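/- For every integer m ≥ 2 there are infinitely many natural numbers r such that the run of consecutive prime gaps δ_j = p_{r+j+1} − p_{r+j} (1 ≤ j ≤ m) is strictly decreasing: δ_1 > δ_2 > ⋯ > δ_m. -/

import Mathlib

/-- `nthPrime n` is the `n`-th smallest prime, so `nthPrime 1 = 2`. -/
noncomputable def nthPrime (n : ℕ) : ℕ := Nat.nth Nat.Prime (n - 1)

/-- The `j`-th prime gap in the run starting at `r`:
`primeGap r j = p_{r+j+1} - p_{r+j}`. -/
noncomputable def primeGap (r j : ℕ) : ℕ := nthPrime (r + j + 1) - nthPrime (r + j)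

section

open Complex Filter Topology MeasureTheory Set

theorem sum_Ico_period {f : ℕ → ℂ} {N : ℕ} (hper : Function.Periodic f N) (a : ℕ) :
    ∑ k ∈ Finset.Ico a (a + N), f k = ∑ k ∈ Finset.range N, f k := by
  induction a with
  | zero => rw [zero_add, Finset.range_eq_Ico]
  | succ a ih =>
    rw [← ih]
    rcases Nat.eq_zero_or_pos N with rfl | hN
    · simp
    · have h1 : ∑ k ∈ Finset.Ico a (a + 1 + N), f k
          = ∑ k ∈ Finset.Ico a (a + N), f k + f (a + N) := by
        rw [show a + 1 + N = a + N + 1 by ring, Finset.sum_Ico_succ_top (by omega)]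
      have h2 := Finset.sum_eq_sum_Ico_succ_bot (f := f) (show a < a + 1 + N by omega)
      have h3 := hper a
      rw [h1, h3] at h2
      linear_combination -h2

theorem norm_sum_Ico_le_of_periodic {f : ℕ → ℂ} {N : ℕ} (hN : 0 < N)
    (hper : Function.Periodic f N) (hsum : ∑ k ∈ Finset.range N, f k = 0)
    (hf : ∀ n, ‖f n‖ ≤ 1) (a n : ℕ) : ‖∑ k ∈ Finset.Ico a (a + n), f k‖ ≤ N := by
  induction n using Nat.strong_induction_on generalizing a with
  | _ n ih =>
    rcases lt_or_ge n N with h | h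
    · refine (norm_sum_le_of_le _ (fun k _ ↦ hf k)).trans ?_
      simp only [Finset.sum_const, Nat.card_Ico, nsmul_eq_mul, mul_one]
      exact_mod_cast (by omega)
    · rw [← Finset.sum_Ico_consecutive _ (show a ≤ a + N by omega) (show a + N ≤ a + n by omega),
        sum_Ico_period hper, hsum, zero_add]
      have := ih (n - N) (by omega) (a + N)
      rwa [show a + N + (n - N) = a + n by omega] at this

theorem norm_sum_Ico_le_of_periodic' {f : ℕ → ℂ} {N : ℕ} (hN : 0 < N)
    (hper : Function.Periodic f N) (hsum : ∑ k ∈ Finset.range N, f k = 0)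
    (hf : ∀ n, ‖f n‖ ≤ 1) (a b : ℕ) : ‖∑ k ∈ Finset.Ico a b, f k‖ ≤ N := by
  rcases le_total a b with h | h
  · obtain ⟨n, rfl⟩ := Nat.exists_eq_add_of_le h
    exact norm_sum_Ico_le_of_periodic hN hper hsum hf a n
  · rw [Finset.Ico_eq_empty_of_le h]; simp

/-- Partial sums of an arithmetic function, as a function of a real variable. -/
noncomputable def partialSum (f : ℕ → ℂ) (t : ℝ) : ℂ := ∑ k ∈ Finset.Icc 1 ⌊t⌋₊, f k

theorem partialSum_of_lt_one (f : ℕ → ℂ) {t : ℝ} (ht : t < 1) : partialSum f t = 0 := by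
  simp [partialSum, Nat.floor_eq_zero.mpr ht]

theorem measurable_partialSum (f : ℕ → ℂ) : Measurable (partialSum f) :=
  (measurable_from_top (f := fun n : ℕ ↦ ∑ k ∈ Finset.Icc 1 n, f k)).comp Nat.measurable_floor

theorem norm_partialSum_le_self {f : ℕ → ℂ} {B : ℝ} (hB : 0 ≤ B) (hf : ∀ n, ‖f n‖ ≤ B) {t : ℝ}
    (ht : 0 ≤ t) : ‖partialSum f t‖ ≤ B * t := by
  refine (norm_sum_le_of_le _ (fun k _ ↦ hf k)).trans ?_
  simp only [Finset.sum_const, Nat.card_Icc, nsmul_eq_mul, add_tsub_cancel_right]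
  rw [mul_comm]
  exact mul_le_mul_of_nonneg_left (Nat.floor_le ht) hB

theorem norm_integral_partialSum_le {S : ℝ → ℂ} {C a : ℝ} {s : ℂ} (hs : a < s.re)
    (hS : ∀ t, 1 < t → ‖S t‖ ≤ C * t ^ a) :
    ‖∫ t in Ioi (1 : ℝ), S t * (t : ℂ) ^ (-(s + 1))‖ ≤ C / (s.re - a) := by
  have hInt : IntegrableOn (fun t : ℝ ↦ C * t ^ (a - s.re - 1)) (Ioi 1) :=
    (integrableOn_Ioi_rpow_of_lt (by linarith) zero_lt_one).const_mul C
  have h := norm_integral_le_of_norm_le (μ := volume.restrict (Ioi (1 : ℝ)))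
    (f := fun t : ℝ ↦ S t * (t : ℂ) ^ (-(s + 1))) hInt ?_
  · refine h.trans_eq ?_
    rw [integral_const_mul, integral_Ioi_rpow_of_lt (by linarith) zero_lt_one]
    simp only [Real.one_rpow, sub_add_cancel]
    rw [← neg_sub s.re a, neg_div_neg_eq, mul_one_div]
  · filter_upwards [ae_restrict_mem measurableSet_Ioi] with t ht
    have ht : 1 < t := ht
    rw [norm_mul, norm_cpow_eq_rpow_re_of_pos (by linarith)]
    calc _ ≤ C * t ^ a * t ^ (-(s + 1)).re := by gcongr; exact hS t ht
      _ = _ := by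
        rw [mul_assoc, ← Real.rpow_add (by linarith)]; congr 2; simp; ring

theorem integrableOn_partialSum {S : ℝ → ℂ} (hm : Measurable S) {C a : ℝ} {s : ℂ} (hs : a < s.re)
    (hS : ∀ t, 1 < t → ‖S t‖ ≤ C * t ^ a) :
    IntegrableOn (fun t : ℝ ↦ S t * (t : ℂ) ^ (-(s + 1))) (Ioi 1) := by
  have hInt : IntegrableOn (fun t : ℝ ↦ C * t ^ (a - s.re - 1)) (Ioi 1) :=
    (integrableOn_Ioi_rpow_of_lt (by linarith) zero_lt_one).const_mul C
  refine hInt.mono' ?_ ?_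
  · refine (hm.mul ?_).aestronglyMeasurable
    exact (measurable_ofReal.pow_const _)
  · filter_upwards [ae_restrict_mem measurableSet_Ioi] with t ht
    have ht : 1 < t := ht
    rw [norm_mul, norm_cpow_eq_rpow_re_of_pos (by linarith)]
    calc _ ≤ C * t ^ a * t ^ (-(s + 1)).re := by gcongr; exact hS t ht
      _ = _ := by
        rw [mul_assoc, ← Real.rpow_add (by linarith)]; congr 2; simp; ring

theorem integral_partialSum_eq_mellin (f : ℕ → ℂ) (s : ℂ) :
    ∫ t in Ioi (1 : ℝ), partialSum f t * (t : ℂ) ^ (-(s + 1)) = mellin (partialSum f) (-s) := by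
  have : Ioi (1 : ℝ) ⊆ Ioi 0 := Ioi_subset_Ioi zero_le_one
  unfold mellin
  rw [← integral_Ici_eq_integral_Ioi]
  rw [setIntegral_eq_of_subset_of_forall_sdiff_eq_zero (s := Ici 1) (t := Ioi (0:ℝ))
    measurableSet_Ioi (fun x (hx : 1 ≤ x) ↦ (show 0 < x by linarith))]
  · refine setIntegral_congr_fun measurableSet_Ici fun t _ ↦ ?_
    simp only [smul_eq_mul]
    rw [mul_comm]; congr 2; ring
  · intro t ht
    have : t < 1 := by simpa using ht.2
    simp [partialSum_of_lt_one f this]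

theorem differentiableAt_integral_partialSum {f : ℕ → ℂ} {B : ℝ}
    (hB : ∀ t, ‖partialSum f t‖ ≤ B) {s : ℂ} (hs : 0 < s.re) :
    DifferentiableAt ℂ
      (fun s ↦ s * ∫ t in Ioi (1 : ℝ), partialSum f t * (t : ℂ) ^ (-(s + 1))) s := by
  simp only [integral_partialSum_eq_mellin]
  refine differentiableAt_id.mul ?_
  have h : DifferentiableAt ℂ (mellin (partialSum f)) (-s) := by
    refine mellin_differentiableAt_of_isBigO_rpow (a := 0) (b := -s.re - 1) ?_ ?_ ?_ ?_ ?_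
    · refine LocallyIntegrableOn.mono (f := fun _ ↦ B) ?_
        (measurable_partialSum f).aestronglyMeasurable ?_
      · exact (locallyIntegrable_const B).locallyIntegrableOn _
      · exact .of_forall fun t ↦ (hB t).trans (Real.le_norm_self _)
    · simp only [neg_zero, Real.rpow_zero]
      exact Asymptotics.IsBigO.of_bound B (.of_forall fun t ↦ by simpa using hB t)
    · simpa using hs
    · refine Asymptotics.IsBigO.of_bound 1 ?_
      have : ∀ᶠ t : ℝ in 𝓝[>] 0, t < 1 := nhdsWithin_le_nhds (eventually_lt_nhds one_pos)
      filter_upwards [this] with t ht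
      rw [partialSum_of_lt_one f ht]; simp
    · simp
  exact DifferentiableAt.comp (g := mellin (partialSum f)) s h differentiableAt_id.neg

theorem LSeries_eq_integral_partialSum {f : ℕ → ℂ} {B : ℝ}
    (hf : ∀ n, ‖f n‖ ≤ B) {s : ℂ} (hs : 1 < s.re) :
    LSeries f s = s * ∫ t in Ioi (1 : ℝ), partialSum f t * (t : ℂ) ^ (-(s + 1)) := by
  have hB : 0 ≤ B := (norm_nonneg _).trans (hf 0)
  refine LSeries_eq_mul_integral' f zero_le_one hs ?_
  refine Asymptotics.IsBigO.of_bound B (.of_forall fun n ↦ ?_)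
  rw [Real.norm_of_nonneg (Finset.sum_nonneg fun _ _ ↦ norm_nonneg _), Real.rpow_one,
    Real.norm_of_nonneg (Nat.cast_nonneg _)]
  refine (Finset.sum_le_sum fun k _ ↦ hf k).trans ?_
  simp [mul_comm]

section Character

variable {N : ℕ} [NeZero N] (χ : DirichletCharacter ℂ N)

omit [NeZero N] in
theorem periodic_char : Function.Periodic (fun n : ℕ ↦ χ n) N := fun n ↦ by simp

theorem sum_range_zmod (g : ZMod N → ℂ) : ∑ k ∈ Finset.range N, g (k : ZMod N) = ∑ x, g x := by
  refine Finset.sum_bij (fun k _ ↦ (k : ZMod N)) (by simp) ?_ ?_ (by simp)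
  · intro a ha b hb h
    have := (ZMod.natCast_eq_natCast_iff' _ _ _).mp h
    rwa [Nat.mod_eq_of_lt (Finset.mem_range.mp ha), Nat.mod_eq_of_lt (Finset.mem_range.mp hb)]
      at this
  · intro x _
    exact ⟨x.val, Finset.mem_range.mpr (ZMod.val_lt x), by simp⟩

variable {χ}

theorem norm_sum_Ico_char_le (hχ : χ ≠ 1) (a b : ℕ) : ‖∑ k ∈ Finset.Ico a b, χ k‖ ≤ N := by
  refine norm_sum_Ico_le_of_periodic' (NeZero.pos N) (periodic_char χ) ?_
    (fun n ↦ χ.norm_le_one _) a b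
  rw [sum_range_zmod (fun x ↦ χ x)]
  exact MulChar.sum_eq_zero_of_ne_one hχ

theorem norm_partialSum_char_le (hχ : χ ≠ 1) (t : ℝ) :
    ‖partialSum (fun n ↦ χ n) t‖ ≤ N := by
  have := norm_sum_Ico_char_le hχ 1 (⌊t⌋₊ + 1)
  exact this

theorem LFunction_eq_integral (hχ : χ ≠ 1) {s : ℂ} (hs : 0 < s.re) :
    χ.LFunction s =
      s * ∫ t in Ioi (1 : ℝ), partialSum (fun n ↦ χ n) t * (t : ℂ) ^ (-(s + 1)) := by
  have hopen : IsOpen {s : ℂ | 0 < s.re} := isOpen_lt continuous_const continuous_re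
  have hf : AnalyticOnNhd ℂ χ.LFunction {s : ℂ | 0 < s.re} :=
    (DirichletCharacter.differentiable_LFunction hχ).differentiableOn.analyticOnNhd hopen
  have hg : AnalyticOnNhd ℂ
      (fun s ↦ s * ∫ t in Ioi (1 : ℝ), partialSum (fun n ↦ χ n) t * (t : ℂ) ^ (-(s + 1)))
      {s : ℂ | 0 < s.re} := by
    refine DifferentiableOn.analyticOnNhd (fun s hs ↦ ?_) hopen
    exact (differentiableAt_integral_partialSum (norm_partialSum_char_le hχ)
      hs).differentiableWithinAt
  refine hf.eqOn_of_preconnected_of_eventuallyEq hg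
    (convex_halfSpace_re_gt 0).isPreconnected (z₀ := 2) (by simp) ?_ hs
  have : ∀ᶠ s : ℂ in 𝓝 2, 1 < s.re :=
    (isOpen_lt continuous_const continuous_re).mem_nhds (by simp)
  filter_upwards [this] with s hs
  rw [DirichletCharacter.LFunction_eq_LSeries χ hs,
    LSeries_eq_integral_partialSum (fun n ↦ χ.norm_le_one n) hs]

theorem min_le_rpow_mul_rpow {t q κ : ℝ} (ht : 0 < t) (hq : 0 < q) (h0 : 0 ≤ κ) (h1 : κ ≤ 1) :
    min t q ≤ t ^ (1 - κ) * q ^ κ := by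
  have hm : 0 < min t q := lt_min ht hq
  calc min t q = (min t q) ^ (1 - κ) * (min t q) ^ κ := by
        rw [← Real.rpow_add hm]; simp
    _ ≤ _ := by
        gcongr
        · exact min_le_left _ _
        · exact min_le_right _ _

theorem norm_LFunction_le (hχ : χ ≠ 1) {κ : ℝ} (hκ : 0 < κ) (hκ' : κ ≤ 1 / 2) {s : ℂ}
    (hs : 1 - κ ≤ s.re) : ‖χ.LFunction s‖ ≤ ‖s‖ * ((N : ℝ) ^ (2 * κ) / κ) := by
  have hN : (0 : ℝ) < N := by exact_mod_cast NeZero.pos N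
  rw [LFunction_eq_integral hχ (by linarith), norm_mul]
  gcongr
  refine (norm_integral_partialSum_le (C := (N : ℝ) ^ (2 * κ)) (a := 1 - 2 * κ) (by linarith)
    ?_).trans ?_
  · intro t ht
    have h1 := norm_partialSum_le_self zero_le_one (fun n ↦ χ.norm_le_one (n : ZMod N))
      (by linarith : 0 ≤ t)
    rw [one_mul] at h1
    have := (le_min h1 (norm_partialSum_char_le hχ t)).trans
      (min_le_rpow_mul_rpow (by linarith) hN (by linarith : 0 ≤ 2 * κ) (by linarith))
    linarith
  · gcongr
    linarith

end Character

end

section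

open scoped ComplexOrder
open Complex Filter Topology MeasureTheory Set

namespace SiegelCoeff

open ArithmeticFunction

/-- Multiplication by the logarithm. -/
noncomputable def logMul (f : ArithmeticFunction ℂ) : ArithmeticFunction ℂ :=
  ⟨fun n ↦ (Real.log n : ℂ) * f n, by simp⟩

theorem logMul_apply (f : ArithmeticFunction ℂ) (n : ℕ) :
    logMul f n = (Real.log n : ℂ) * f n := rfl

theorem logMul_mul (f g : ArithmeticFunction ℂ) :
    logMul (f * g) = logMul f * g + f * logMul g := by
  ext n
  simp only [logMul_apply, ArithmeticFunction.add_apply, ArithmeticFunction.mul_apply]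
  rw [Finset.mul_sum, ← Finset.sum_add_distrib]
  refine Finset.sum_congr rfl fun x hx ↦ ?_
  obtain ⟨h1, h2⟩ := Nat.mem_divisorsAntidiagonal.mp hx
  have hx1 : (x.1 : ℝ) ≠ 0 := by rintro h; simp_all
  have hx2 : (x.2 : ℝ) ≠ 0 := by rintro h; simp_all
  rw [← h1, Nat.cast_mul, Real.log_mul hx1 hx2]
  push_cast; ring

/-- The arithmetic function of a completely multiplicative function. -/
noncomputable def ofMul (f : ℕ → ℂ) : ArithmeticFunction ℂ := ⟨fun n ↦ if n = 0 then 0 else f n, by simp⟩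

/-- The von Mangoldt function twisted by `f`. -/
noncomputable def twist (f : ℕ → ℂ) : ArithmeticFunction ℂ := ⟨fun n ↦ (Λ n : ℂ) * f n, by simp⟩

theorem ofMul_apply (f : ℕ → ℂ) (n : ℕ) : ofMul f n = if n = 0 then 0 else f n := rfl

theorem twist_apply (f : ℕ → ℂ) (n : ℕ) : twist f n = (Λ n : ℂ) * f n := rfl

theorem logMul_ofMul {f : ℕ → ℂ} (hf : ∀ m n, f (m * n) = f m * f n) :
    logMul (ofMul f) = twist f * ofMul f := by
  ext n
  simp only [logMul_apply, ArithmeticFunction.mul_apply, twist_apply, ofMul_apply]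
  rcases eq_or_ne n 0 with rfl | hn
  · simp
  · rw [if_neg hn]
    have h : Real.log n = ∑ x ∈ n.divisorsAntidiagonal, Λ x.1 := by
      have := vonMangoldt_sum (n := n)
      rw [← this, Nat.sum_divisorsAntidiagonal (fun i _ ↦ Λ i)]
    rw [h]; push_cast; rw [Finset.sum_mul]
    refine Finset.sum_congr rfl fun x hx ↦ ?_
    obtain ⟨h1, h2⟩ := Nat.mem_divisorsAntidiagonal.mp hx
    have hx2 : x.2 ≠ 0 := by rintro h; simp_all
    rw [if_neg hx2, ← h1, hf]; ring

/-- The Dirichlet convolution of the four completely multiplicative functions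
`1`, `f`, `g`, `f * g`. -/
noncomputable def conv4 (f g : ℕ → ℂ) : ArithmeticFunction ℂ :=
  ofMul (fun _ ↦ 1) * ofMul f * (ofMul g * ofMul (fun n ↦ f n * g n))

theorem conv4_nonneg {f g : ℕ → ℂ} (hf : ∀ m n, f (m * n) = f m * f n)
    (hg : ∀ m n, g (m * n) = g m * g n) (hf1 : f 1 = 1) (hg1 : g 1 = 1)
    (hf0 : ∀ n, f n = 0 ∨ f n = 1 ∨ f n = -1) (hg0 : ∀ n, g n = 0 ∨ g n = 1 ∨ g n = -1) :
    conv4 f g 1 = 1 ∧ ∀ n, 0 ≤ conv4 f g n := by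
  have h1 : conv4 f g 1 = 1 := by
    simp [conv4, ofMul_apply, ArithmeticFunction.mul_apply, hf1, hg1]
  refine ⟨h1, fun n ↦ ?_⟩
  have hlog : logMul (conv4 f g) =
      twist (fun n ↦ (1 + f n) * (1 + g n)) * conv4 f g := by
    have ht : twist (fun n ↦ (1 + f n) * (1 + g n)) =
        twist (fun _ ↦ 1) + twist f + (twist g + twist (fun n ↦ f n * g n)) := by
      ext n
      simp only [twist_apply, ArithmeticFunction.add_apply]
      ring
    rw [ht]
    unfold conv4
    rw [logMul_mul, logMul_mul, logMul_mul, logMul_ofMul (by simp), logMul_ofMul hf,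
      logMul_ofMul hg, logMul_ofMul (f := fun n ↦ f n * g n) (by intro m n; rw [hf, hg]; ring)]
    ring
  have ht0 : ∀ n, 0 ≤ twist (fun n ↦ (1 + f n) * (1 + g n)) n := by
    intro n
    have h1 : (0 : ℂ) ≤ Λ n := by exact_mod_cast vonMangoldt_nonneg
    have h2 : (0 : ℂ) ≤ 1 + f n := by
      rcases hf0 n with h | h | h <;> rw [h] <;> norm_num
    have h3 : (0 : ℂ) ≤ 1 + g n := by
      rcases hg0 n with h | h | h <;> rw [h] <;> norm_num
    simp only [twist_apply]
    exact mul_nonneg h1 (mul_nonneg h2 h3)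
  induction n using Nat.strong_induction_on with
  | _ n ih =>
    rcases Nat.lt_or_ge n 2 with h | h
    · interval_cases n
      · simp
      · rw [h1]; norm_num
    · have h2 := congrArg (fun f ↦ f n) hlog
      simp only [logMul_apply, ArithmeticFunction.mul_apply] at h2
      have h3 : 0 ≤ (Real.log n : ℂ) * conv4 f g n := by
        rw [h2]
        refine Finset.sum_nonneg fun x hx ↦ ?_
        obtain ⟨e1, e2⟩ := Nat.mem_divisorsAntidiagonal.mp hx
        rcases eq_or_ne x.1 1 with hx1 | hx1
        · simp [twist_apply, hx1]
        · refine mul_nonneg (ht0 _) (ih _ ?_)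
          have : 0 < x.2 := Nat.pos_of_ne_zero (by rintro h; simp_all)
          have : x.1 ≠ 0 := by rintro h; simp_all
          rw [← e1]
          nlinarith [show 2 ≤ x.1 by omega]
      have hl : 0 < Real.log n := Real.log_pos (by exact_mod_cast h)
      have h4 : (0 : ℂ) ≤ ((Real.log n)⁻¹ : ℝ) := by exact_mod_cast (inv_pos.mpr hl).le
      have h5 := mul_nonneg h4 h3
      rwa [← mul_assoc, ← ofReal_mul, inv_mul_cancel₀ hl.ne', ofReal_one, one_mul] at h5

end SiegelCoeff

end

section

open scoped ComplexOrder
open Complex Filter Topology MeasureTheory Set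

theorem ofReal_re_of_nonneg {z : ℂ} (hz : 0 ≤ z) : ((z.re : ℝ) : ℂ) = z := by
  rw [Complex.le_def] at hz
  exact Complex.ext (by simp) (by simpa using hz.2)

theorem one_le_LSeries {a : ℕ → ℂ} (ha : 0 ≤ a) (ha1 : a 1 = 1) {x : ℝ}
    (hx : LSeriesSummable a x) : 1 ≤ (LSeries a x).re := by
  have hs : Summable (fun n ↦ (LSeries.term a x n).re) := (hasSum_re hx.hasSum).summable
  have h1 : (LSeries a x).re = ∑' n, (LSeries.term a x n).re := by
    rw [LSeries, Complex.re_tsum hx]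
  rw [h1]
  have := hs.le_tsum 1 (fun j _ ↦ (Complex.le_def.mp (LSeries.term_nonneg (ha j) x)).1)
  simpa [LSeries.term_def, ha1] using this

section Estermann

variable {a : ℕ → ℂ} {G : ℂ → ℂ} {B : ℝ}

theorem estermann_residue_nonneg (ha : 0 ≤ a) (hG : Differentiable ℂ G)
    (hGa : ∀ s : ℂ, 1 < s.re → G s = (s - 1) * LSeries a s) : 0 ≤ G 1 := by
  have hcl : IsClosed {z : ℂ | 0 ≤ z} := isClosed_Ici
  have ht : Tendsto (fun x : ℝ ↦ G x) (𝓝[>] 1) (𝓝 (G 1)) := by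
    have : Tendsto (fun x : ℝ ↦ G x) (𝓝 1) (𝓝 (G ((1 : ℝ) : ℂ))) :=
      (hG.continuous.comp continuous_ofReal).tendsto 1
    rw [ofReal_one] at this
    exact this.mono_left nhdsWithin_le_nhds
  refine hcl.mem_of_tendsto ht ?_
  filter_upwards [self_mem_nhdsWithin] with x hx
  have hx : 1 < x := hx
  show 0 ≤ G x
  rw [hGa x (by simpa using hx)]
  refine mul_nonneg ?_ (tsum_nonneg fun n ↦ LSeries.term_nonneg (ha n) x)
  exact_mod_cast (by linarith : (0 : ℝ) ≤ x - 1)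

theorem iteratedDeriv_inv_sub_one (n : ℕ) :
    iteratedDeriv n (fun s : ℂ ↦ (s - 1)⁻¹) 2 = (-1) ^ n * n.factorial := by
  have := congrFun (iter_deriv_inv_linear (𝕜 := ℂ) n 1 (-1)) 2
  rw [iteratedDeriv_eq_iterate]
  simp only [one_mul, ← sub_eq_add_neg, one_pow, mul_one] at this
  rw [this]
  norm_num

theorem estermann_coeff (ha : 0 ≤ a) (ha1 : a 1 = 1)
    (hsum : ∀ y : ℝ, 1 < y → LSeriesSummable a y) (hG : Differentiable ℂ G)
    (hGa : ∀ s : ℂ, 1 < s.re → G s = (s - 1) * LSeries a s)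
    (hB : ∀ z ∈ Metric.closedBall (2 : ℂ) (3 / 2), ‖G z‖ ≤ B) :
    ∃ b : ℕ → ℝ, (∀ n, 0 ≤ b n) ∧ 1 ≤ b 0 ∧
      (∀ n, |b n - (G 1).re| ≤ 4 * B * (2 / 3) ^ n) ∧
      ∀ s : ℝ, s ∈ Ioo (1 / 2 : ℝ) 2 → s ≠ 1 →
        HasSum (fun n ↦ (b n - (G 1).re) * (2 - s) ^ n) (((G s).re - (G 1).re) / (s - 1)) ∧
        (G s).im = 0 := by
  have habs : LSeries.abscissaOfAbsConv a ≤ (1 : ℝ) :=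
    LSeries.abscissaOfAbsConv_le_of_forall_lt_LSeriesSummable hsum
  have h2 : LSeries.abscissaOfAbsConv a < ((2 : ℝ) : EReal) :=
    habs.trans_lt (by exact_mod_cast one_lt_two)
  have hlr := ofReal_re_of_nonneg (estermann_residue_nonneg ha hG hGa)
  set l := (G 1).re with hl
  set H := dslope G 1 with hH
  have hHd : Differentiable ℂ H := by
    rw [← differentiableOn_univ, differentiableOn_dslope univ_mem, differentiableOn_univ]
    exact hG
  have hHs (s : ℂ) (hs : s ≠ 1) : H s = (G s - l) / (s - 1) := by
    rw [hH, dslope_of_ne _ hs, slope_def_field, ← hlr]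
  set b : ℕ → ℂ := fun n ↦ (n.factorial : ℂ)⁻¹ * ((-1) ^ n * iteratedDeriv n (LSeries a) 2)
    with hb
  have hbn (n : ℕ) : 0 ≤ b n := by
    refine mul_nonneg ?_ ?_
    · have : (0 : ℂ) ≤ ((n.factorial : ℝ)⁻¹ : ℝ) :=
        zero_le_real.mpr (inv_nonneg.mpr (Nat.cast_nonneg _))
      simpa using this
    · exact_mod_cast LSeries.iteratedDeriv_alternating ha h2 n
  have hLan : AnalyticAt ℂ (LSeries a) 2 := LSeries_analyticOnNhd a 2 (by exact_mod_cast h2)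
  have hcoef (n : ℕ) : iteratedDeriv n H 2 = (-1) ^ n * n.factorial * (b n - l) := by
    have hev : H =ᶠ[𝓝 2] (LSeries a - fun s ↦ (l : ℂ) * (s - 1)⁻¹) := by
      have : ∀ᶠ s : ℂ in 𝓝 2, 1 < s.re :=
        (isOpen_lt continuous_const continuous_re).mem_nhds (by simp)
      filter_upwards [this] with s hs
      have hs1 : s - 1 ≠ 0 := by
        intro h; rw [sub_eq_zero.mp h] at hs; simp at hs
      rw [hHs s (sub_ne_zero.mp hs1), hGa s hs, Pi.sub_apply]
      field_simp
    have hinv : ContDiffAt ℂ n (fun s : ℂ ↦ (s - 1)⁻¹) 2 := by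
      refine ContDiffAt.inv (by fun_prop) (by norm_num)
    rw [hev.iteratedDeriv_eq n, iteratedDeriv_sub hLan.contDiffAt (contDiffAt_const.mul hinv),
      iteratedDeriv_const_mul _ hinv, iteratedDeriv_inv_sub_one, hb]
    have : (n.factorial : ℂ) ≠ 0 := by exact_mod_cast n.factorial_ne_zero
    have h1 : ((-1 : ℂ)) ^ n * (-1) ^ n = 1 := by rw [← mul_pow]; norm_num
    field_simp
    linear_combination (-iteratedDeriv n (LSeries a) 2) * h1
  have hl0 : |l| ≤ B := by
    have := hB 1 (by rw [Metric.mem_closedBall, dist_eq]; norm_num)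
    exact (Complex.abs_re_le_norm _).trans this
  have hcb (n : ℕ) : ‖iteratedDeriv n H 2‖ ≤ n.factorial * (4 * B) / (3 / 2) ^ n := by
    refine norm_iteratedDeriv_le_of_forall_mem_sphere_norm_le n (by norm_num)
      hHd.diffContOnCl fun z hz ↦ ?_
    have hz1 : ‖z - 2‖ = 3 / 2 := by simpa [dist_eq] using hz
    have hz2 : 1 / 2 ≤ ‖z - 1‖ := by
      have := norm_sub_norm_le (z - 2) (-1)
      rw [sub_neg_eq_add, show z - 2 + 1 = z - 1 by ring, hz1] at this
      simp only [norm_neg, norm_one] at this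
      linarith
    have hz3 : z ≠ 1 := by rintro rfl; norm_num at hz2
    rw [hHs z hz3, norm_div, div_le_iff₀ (by linarith)]
    have h1 := hB z (Metric.sphere_subset_closedBall hz)
    have h2 := norm_sub_le (G z) l
    rw [norm_real, Real.norm_eq_abs] at h2
    have hB0 : 0 ≤ B := (abs_nonneg _).trans hl0
    nlinarith
  refine ⟨fun n ↦ (b n).re, fun n ↦ (Complex.le_def.mp (hbn n)).1, ?_, fun n ↦ ?_,
    fun s hs hs1 ↦ ?_⟩
  · simpa [hb] using one_le_LSeries ha ha1 (hsum 2 one_lt_two)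
  · have h3 := hcb n
    rw [hcoef, norm_mul, norm_mul, norm_pow, norm_neg, norm_one, one_pow, one_mul,
      Complex.norm_natCast, mul_div_assoc] at h3
    have hf : (0 : ℝ) < n.factorial := by exact_mod_cast n.factorial_pos
    have h4 := le_of_mul_le_mul_left h3 hf
    rw [← ofReal_re_of_nonneg (hbn n), ← ofReal_sub, norm_real, Real.norm_eq_abs] at h4
    refine h4.trans_eq ?_
    rw [div_eq_mul_inv, ← inv_pow]; norm_num
  · have hmem : (s : ℂ) ∈ Metric.ball (2 : ℂ) (3 / 2) := by
      rw [Metric.mem_ball, dist_eq, show (s : ℂ) - 2 = ((s - 2 : ℝ) : ℂ) by push_cast; ring,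
        norm_real, Real.norm_eq_abs, abs_lt]
      constructor <;> linarith [hs.1, hs.2]
    have hsum := hasSum_taylorSeries_on_ball (r := 3 / 2) hHd.differentiableOn hmem
    have hs1' : (s : ℂ) ≠ 1 := by exact_mod_cast hs1
    have hterm (n : ℕ) : ((n.factorial : ℂ)⁻¹ • ((s : ℂ) - 2) ^ n • iteratedDeriv n H 2) =
        (((b n).re - l) * (2 - s) ^ n : ℝ) := by
      have : (n.factorial : ℂ) ≠ 0 := by exact_mod_cast n.factorial_ne_zero
      rw [hcoef]
      push_cast
      rw [ofReal_re_of_nonneg (hbn n), show (2 - s : ℂ) = (-1) * (s - 2) by ring, mul_pow,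
        smul_eq_mul, smul_eq_mul]
      field_simp
    rw [funext hterm, hHs _ hs1'] at hsum
    have hre := hasSum_re hsum
    have him := hasSum_im hsum
    have hdiv : (G s - l) / ((s : ℂ) - 1) = (G s - l) / ((s - 1 : ℝ) : ℂ) := by push_cast; rfl
    rw [hdiv, div_ofReal_re, sub_re, ofReal_re] at hre
    rw [hdiv, div_ofReal_im, sub_im, ofReal_im, sub_zero] at him
    simp only [ofReal_re] at hre
    simp only [ofReal_im] at him
    refine ⟨hre, ?_⟩
    have := him.unique hasSum_zero
    rcases div_eq_zero_iff.mp this with h | h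
    · exact h
    · exact absurd (sub_eq_zero.mp h) hs1

theorem estermann (ha : 0 ≤ a) (ha1 : a 1 = 1)
    (hsum : ∀ y : ℝ, 1 < y → LSeriesSummable a y) (hG : Differentiable ℂ G)
    (hGa : ∀ s : ℂ, 1 < s.re → G s = (s - 1) * LSeries a s) (hB1 : 1 ≤ B)
    (hB : ∀ z ∈ Metric.closedBall (2 : ℂ) (3 / 2), ‖G z‖ ≤ B) {s : ℝ} (hs : 7 / 8 < s)
    (hs1 : s < 1) :
    (G s).re ≤ 3 * (G 1).re * (32 * B) ^ (4 * (1 - s)) - (1 - s) / 2 := by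
  obtain ⟨b, hb0, hb1, hbl, hbs⟩ := estermann_coeff ha ha1 hsum hG hGa hB
  have hl0 : 0 ≤ (G 1).re := (Complex.le_def.mp (estermann_residue_nonneg ha hG hGa)).1
  set l := (G 1).re with hl
  obtain ⟨hS, -⟩ := hbs s ⟨by linarith, by linarith⟩ hs1.ne
  set t := 2 - s with ht
  have ht1 : 1 < t := by linarith
  have ht2 : t < 9 / 8 := by linarith
  have hlog : 0 < Real.log (32 * B) := Real.log_pos (by linarith)
  set M := ⌈4 * Real.log (32 * B)⌉₊ with hM
  have hM1 : 4 * Real.log (32 * B) ≤ M := Nat.le_ceil _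
  have hM2 : (M : ℝ) < 4 * Real.log (32 * B) + 1 := Nat.ceil_lt_add_one (by positivity)
  have h34 : (3 / 4 : ℝ) ^ M ≤ 1 / (32 * B) := by
    have h1 : (3 / 4 : ℝ) ≤ Real.exp (-(1 / 4)) := by
      have := Real.add_one_le_exp (-(1 / 4) : ℝ); linarith
    calc (3 / 4 : ℝ) ^ M ≤ Real.exp (-(1 / 4)) ^ M := by gcongr
      _ = Real.exp (-(M / 4)) := by rw [← Real.exp_nat_mul]; ring_nf
      _ ≤ Real.exp (-Real.log (32 * B)) := by gcongr; linarith
      _ = _ := by rw [Real.exp_neg, Real.exp_log (by linarith), one_div]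
  have htM : t ^ M ≤ 3 * (32 * B) ^ (4 * (1 - s)) := by
    have h1 : t ≤ Real.exp (1 - s) := by
      have := Real.add_one_le_exp (1 - s); linarith
    calc t ^ M ≤ Real.exp (1 - s) ^ M := by gcongr
      _ = Real.exp (M * (1 - s)) := by rw [← Real.exp_nat_mul]
      _ ≤ Real.exp (1 + Real.log (32 * B) * (4 * (1 - s))) := by
        gcongr; nlinarith
      _ = Real.exp 1 * (32 * B) ^ (4 * (1 - s)) := by
        rw [Real.exp_add, Real.rpow_def_of_pos (by linarith)]
      _ ≤ _ := by
        gcongr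
        exact Real.exp_one_lt_three.le
  have hsplit := hS.summable.sum_add_tsum_nat_add M
  rw [hS.tsum_eq] at hsplit
  have htail : -(1 / 2 : ℝ) ≤ ∑' i, (b (i + M) - l) * t ^ (i + M) := by
    have hb' (i : ℕ) : ‖(b (i + M) - l) * t ^ (i + M)‖ ≤ 4 * B * (3 / 4) ^ M * (3 / 4) ^ i := by
      rw [norm_mul, Real.norm_eq_abs, norm_pow, Real.norm_of_nonneg (by linarith : 0 ≤ t)]
      calc _ ≤ 4 * B * (2 / 3) ^ (i + M) * (9 / 8) ^ (i + M) := by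
            gcongr
            exact hbl _
        _ = _ := by rw [mul_assoc, ← mul_pow, pow_add]; norm_num; ring
    have hg : HasSum (fun i : ℕ ↦ 4 * B * (3 / 4) ^ M * (3 / 4 : ℝ) ^ i)
        (4 * B * (3 / 4) ^ M * (1 - 3 / 4)⁻¹) :=
      (hasSum_geometric_of_lt_one (by norm_num) (by norm_num)).mul_left _
    have h1 := tsum_of_norm_bounded hg hb'
    have h2 : 4 * B * (3 / 4) ^ M * (1 - 3 / 4 : ℝ)⁻¹ ≤ 1 / 2 := by
      have : B * (3 / 4 : ℝ) ^ M ≤ 1 / 32 := by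
        calc B * (3 / 4 : ℝ) ^ M ≤ B * (1 / (32 * B)) := by gcongr
          _ = _ := by field_simp
      norm_num
      linarith
    have := (abs_le.mp (h1.trans h2)).1
    linarith
  have hhead : 1 - l * ((t ^ M - 1) / (t - 1)) ≤
      ∑ i ∈ Finset.range M, (b i - l) * t ^ i := by
    rw [← geom_sum_eq ht1.ne', Finset.mul_sum]
    simp only [sub_mul, Finset.sum_sub_distrib]
    gcongr
    have hMpos : 0 < M := Nat.ceil_pos.mpr (by positivity)
    refine hb1.trans ?_
    have := Finset.single_le_sum (f := fun i ↦ b i * t ^ i) (s := Finset.range M)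
      (fun i _ ↦ mul_nonneg (hb0 i) (by positivity)) (Finset.mem_range.mpr hMpos)
    simpa using this
  have hfin : 1 / 2 - l * ((t ^ M - 1) / (t - 1)) ≤ ((G s).re - l) / (s - 1) := by linarith
  have h1s : 0 < 1 - s := by linarith
  rw [show t - 1 = 1 - s by rw [ht]; ring, show ((G s).re - l) / (s - 1) =
    (l - (G s).re) / (1 - s) by rw [← neg_sub l, ← neg_sub 1 s, neg_div_neg_eq],
    le_div_iff₀ h1s] at hfin
  have : (1 / 2 - l * ((t ^ M - 1) / (1 - s))) * (1 - s) = (1 - s) / 2 - l * (t ^ M - 1) := by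
    field_simp
  rw [this] at hfin
  nlinarith [mul_le_mul_of_nonneg_left htM hl0]

theorem estermann_real_pos (ha : 0 ≤ a) (ha1 : a 1 = 1)
    (hsum : ∀ y : ℝ, 1 < y → LSeriesSummable a y) (hG : Differentiable ℂ G)
    (hGa : ∀ s : ℂ, 1 < s.re → G s = (s - 1) * LSeries a s) {s : ℝ} (hs : 1 / 2 < s)
    (hs1 : s < 1) (hG0 : ∀ x : ℝ, s ≤ x → x ≤ 1 → G x ≠ 0) : 0 ≤ (G s).re := by
  obtain ⟨B, hB⟩ := (isCompact_closedBall (2 : ℂ) (3 / 2)).exists_bound_of_continuousOn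
    hG.continuous.continuousOn
  obtain ⟨b, -, -, -, hbs⟩ := estermann_coeff ha ha1 hsum hG hGa hB
  have hl := estermann_residue_nonneg ha hG hGa
  by_contra! hneg
  have hcont : ContinuousOn (fun x : ℝ ↦ (G x).re) (Icc s 1) :=
    (continuous_re.comp (hG.continuous.comp continuous_ofReal)).continuousOn
  have hmem : (0 : ℝ) ∈ Icc (G s).re (G ((1 : ℝ) : ℂ)).re :=
    ⟨hneg.le, by rw [ofReal_one]; exact (Complex.le_def.mp hl).1⟩
  obtain ⟨x, hx, hx0⟩ := intermediate_value_Icc hs1.le hcont hmem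
  refine hG0 x hx.1 hx.2 (Complex.ext (by simpa using hx0) ?_)
  rcases eq_or_ne x 1 with rfl | hx1
  · have := (Complex.le_def.mp hl).2
    simpa using this.symm
  · exact (hbs x ⟨by linarith [hx.1], by linarith [hx.2]⟩ hx1).2

end Estermann

end

section

open scoped ComplexOrder
open Complex Filter Topology MeasureTheory Set

/-- The product of two Dirichlet characters, at the product of the levels. -/
noncomputable def prodChar {q₁ q₂ : ℕ} (χ₁ : DirichletCharacter ℂ q₁)
    (χ₂ : DirichletCharacter ℂ q₂) : DirichletCharacter ℂ (q₁ * q₂) :=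
  DirichletCharacter.changeLevel (dvd_mul_right q₁ q₂) χ₁ *
    DirichletCharacter.changeLevel (dvd_mul_left q₂ q₁) χ₂

theorem char_eq_zero_of_not_coprime {q : ℕ} (χ : DirichletCharacter ℂ q) {n : ℕ}
    (h : ¬ n.Coprime q) : χ n = 0 :=
  χ.map_nonunit (by rwa [ZMod.isUnit_iff_coprime])

theorem changeLevel_apply_of_coprime {q m : ℕ} (χ : DirichletCharacter ℂ q) (hm : q ∣ m) {n : ℕ}
    (h : n.Coprime m) : DirichletCharacter.changeLevel hm χ n = χ n := by
  have := DirichletCharacter.changeLevel_eq_cast_of_dvd' χ hm (a := n)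
    (Nat.isCoprime_iff_coprime.mpr h)
  simpa using this

theorem prodChar_apply {q₁ q₂ : ℕ} (χ₁ : DirichletCharacter ℂ q₁)
    (χ₂ : DirichletCharacter ℂ q₂) (n : ℕ) : prodChar χ₁ χ₂ n = χ₁ n * χ₂ n := by
  by_cases h : n.Coprime (q₁ * q₂)
  · rw [prodChar, MulChar.mul_apply, changeLevel_apply_of_coprime _ _ h,
      changeLevel_apply_of_coprime _ _ h]
  · rw [char_eq_zero_of_not_coprime _ h]
    rw [Nat.coprime_mul_iff_right, not_and_or] at h
    rcases h with h | h <;> simp [char_eq_zero_of_not_coprime _ h]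

theorem char_values_of_sq_eq_one {q : ℕ} {χ : DirichletCharacter ℂ q} (h : χ ^ 2 = 1) (n : ℕ) :
    χ n = 0 ∨ χ n = 1 ∨ χ n = -1 := by
  by_cases hn : IsUnit (n : ZMod q)
  · right
    have := congrArg (fun f : DirichletCharacter ℂ q ↦ f n) h
    simp only [MulChar.pow_apply' _ two_ne_zero, MulChar.one_apply hn] at this
    exact mul_self_eq_one_iff.mp (by rwa [← pow_two])
  · exact Or.inl (χ.map_nonunit hn)

/-- `(s - 1) ζ(s)` as an entire function. -/
noncomputable def zetaOne : ℂ → ℂ := DirichletCharacter.LFunctionTrivChar₁ 1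

theorem differentiable_zetaOne : Differentiable ℂ zetaOne :=
  DirichletCharacter.differentiable_LFunctionTrivChar₁ 1

theorem zetaOne_one : zetaOne 1 = 1 := by
  simp [zetaOne, DirichletCharacter.LFunctionTrivChar₁]

theorem zetaOne_of_ne {s : ℂ} (hs : s ≠ 1) : zetaOne s = (s - 1) * riemannZeta s := by
  simp [zetaOne, DirichletCharacter.LFunctionTrivChar₁, Function.update_of_ne hs,
    DirichletCharacter.LFunctionTrivChar, DirichletCharacter.LFunction_modOne_eq]

section Pair

variable {q₁ q₂ : ℕ} [NeZero q₁] [NeZero q₂]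

/-- The entire function `(s - 1) ζ(s) L(s, χ₁) L(s, χ₂) L(s, χ₁χ₂)`. -/
noncomputable def siegelFun (χ₁ : DirichletCharacter ℂ q₁) (χ₂ : DirichletCharacter ℂ q₂)
    (s : ℂ) : ℂ :=
  zetaOne s * χ₁.LFunction s * (χ₂.LFunction s * (prodChar χ₁ χ₂).LFunction s)

variable {χ₁ : DirichletCharacter ℂ q₁} {χ₂ : DirichletCharacter ℂ q₂}

theorem differentiable_siegelFun (h₁ : χ₁ ≠ 1) (h₂ : χ₂ ≠ 1) (h₁₂ : prodChar χ₁ χ₂ ≠ 1) :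
    Differentiable ℂ (siegelFun χ₁ χ₂) :=
  (differentiable_zetaOne.mul (DirichletCharacter.differentiable_LFunction h₁)).mul
    ((DirichletCharacter.differentiable_LFunction h₂).mul
      (DirichletCharacter.differentiable_LFunction h₁₂))

open SiegelCoeff in
theorem LSeries_conv4 {s : ℂ} (hs : 1 < s.re) :
    LSeriesSummable (conv4 (fun n ↦ χ₁ n) (fun n ↦ χ₂ n)) s ∧
      siegelFun χ₁ χ₂ s = (s - 1) * LSeries (conv4 (fun n ↦ χ₁ n) (fun n ↦ χ₂ n)) s := by
  have hone : LSeriesSummable (ofMul (fun _ ↦ 1)) s ∧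
      LSeries (ofMul (fun _ ↦ 1)) s = riemannZeta s := by
    have hc : ∀ {n : ℕ}, n ≠ 0 → ofMul (fun _ ↦ 1) n = (1 : ℕ → ℂ) n := fun {n} hn ↦ by
      rw [ofMul_apply, if_neg hn]; rfl
    exact ⟨(LSeriesSummable_congr s hc).mpr (LSeriesSummable_one_iff.mpr hs),
      (LSeries_congr hc s).trans (LSeries_one_eq_riemannZeta hs)⟩
  have hchar {q : ℕ} [NeZero q] (χ : DirichletCharacter ℂ q) (f : ℕ → ℂ) (hf : ∀ n : ℕ, χ n = f n) :
      LSeriesSummable (ofMul f) s ∧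
      LSeries (ofMul f) s = χ.LFunction s := by
    have hc : ∀ {n : ℕ}, n ≠ 0 → ofMul f n = (fun n : ℕ ↦ χ n) n :=
      fun {n} hn ↦ by rw [ofMul_apply, if_neg hn]; exact (hf n).symm
    exact ⟨(LSeriesSummable_congr s hc).mpr (χ.LSeriesSummable_of_one_lt_re hs),
      (LSeries_congr hc s).trans (χ.LFunction_eq_LSeries hs).symm⟩
  have h1 := hchar χ₁ _ (fun _ ↦ rfl)
  have h2 := hchar χ₂ _ (fun _ ↦ rfl)
  have h12 := hchar (prodChar χ₁ χ₂) _ (prodChar_apply χ₁ χ₂)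
  have hA := ArithmeticFunction.LSeriesSummable_mul hone.1 h1.1
  have hB := ArithmeticFunction.LSeriesSummable_mul h2.1 h12.1
  refine ⟨ArithmeticFunction.LSeriesSummable_mul hA hB, ?_⟩
  have hs1 : s ≠ 1 := by rintro rfl; simp at hs
  have := ArithmeticFunction.LSeries_mul' hA hB
  rw [conv4]
  rw [this, ArithmeticFunction.LSeries_mul' hone.1 h1.1, ArithmeticFunction.LSeries_mul' h2.1 h12.1,
    hone.2, h1.2, h2.2, h12.2, siegelFun, zetaOne_of_ne hs1]
  ring

end Pair

theorem siegel_pair : ∃ C s₀ : ℝ, 1 ≤ C ∧ 7 / 8 < s₀ ∧ s₀ < 1 ∧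
    ∀ {q₁ q₂ : ℕ} [NeZero q₁] [NeZero q₂] (χ₁ : DirichletCharacter ℂ q₁)
      (χ₂ : DirichletCharacter ℂ q₂), χ₁ ≠ 1 → χ₂ ≠ 1 → prodChar χ₁ χ₂ ≠ 1 →
      χ₁ ^ 2 = 1 → χ₂ ^ 2 = 1 → ∀ s : ℝ, s₀ < s → s < 1 →
      (χ₁.LFunction s = 0 ∨ ∀ x : ℝ, s ≤ x → x < 1 → χ₁.LFunction x ≠ 0 ∧ χ₂.LFunction x ≠ 0 ∧
        (prodChar χ₁ χ₂).LFunction x ≠ 0) →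
      (1 - s) ^ 3 ≤ C * ‖χ₂.LFunction 1‖ * ((q₁ * q₂ : ℕ) : ℝ) ^ (12 * (1 - s)) := by
  obtain ⟨C₀, hC₀⟩ := (isCompact_closedBall (2 : ℂ) (3 / 2)).exists_bound_of_continuousOn
    differentiable_zetaOne.continuous.continuousOn
  have hC1 : 1 ≤ C₀ := by
    have := hC₀ 1 (by rw [Metric.mem_closedBall, dist_eq]; norm_num)
    rwa [zetaOne_one, norm_one] at this
  obtain ⟨s₀, hs₀, hs₀1, hz⟩ : ∃ s₀ : ℝ, 7 / 8 < s₀ ∧ s₀ < 1 ∧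
      ∀ x : ℝ, s₀ < x → x ≤ 1 → zetaOne x ≠ 0 := by
    have hev : ∀ᶠ x : ℝ in 𝓝 1, zetaOne x ≠ 0 := by
      have hc : ContinuousAt (fun x : ℝ ↦ zetaOne x) 1 :=
        (differentiable_zetaOne.continuous.comp continuous_ofReal).continuousAt
      refine hc.eventually_ne ?_
      rw [ofReal_one, zetaOne_one]; exact one_ne_zero
    obtain ⟨ε, hε, h⟩ := Metric.eventually_nhds_iff.mp hev
    refine ⟨max (1 - ε) (15 / 16), lt_max_of_lt_right (by norm_num),
      max_lt (by linarith) (by norm_num), fun x hx hx1 ↦ h ?_⟩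
    rw [Real.dist_eq, abs_lt]
    have := (le_max_left _ _).trans_lt hx
    constructor <;> linarith
  set C := 32 * (C₀ * 343) with hC
  refine ⟨6 * C, s₀, by linarith, hs₀, hs₀1, ?_⟩
  intro q₁ q₂ _ _ χ₁ χ₂ h₁ h₂ h₁₂ hq₁ hq₂ s hs hs1 hzero
  set N : ℝ := ((q₁ * q₂ : ℕ) : ℝ) with hN
  have hq1 : (1 : ℝ) ≤ q₁ := by exact_mod_cast NeZero.one_le
  have hq2 : (1 : ℝ) ≤ q₂ := by exact_mod_cast NeZero.one_le
  have hN1 : 1 ≤ N := by rw [hN]; exact_mod_cast NeZero.one_le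
  have hNe : N = q₁ * q₂ := by rw [hN]; push_cast; rfl
  set a := SiegelCoeff.conv4 (fun n ↦ χ₁ n) (fun n ↦ χ₂ n) with ha
  obtain ⟨ha1, ha0⟩ := SiegelCoeff.conv4_nonneg (f := fun n ↦ χ₁ n) (g := fun n ↦ χ₂ n)
    (by simp) (by simp) (by simp) (by simp) (char_values_of_sq_eq_one hq₁)
    (char_values_of_sq_eq_one hq₂)
  have hG := differentiable_siegelFun h₁ h₂ h₁₂
  have hGa (s : ℂ) (hs : 1 < s.re) := (LSeries_conv4 (χ₁ := χ₁) (χ₂ := χ₂) hs).2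
  have hsum (y : ℝ) (hy : 1 < y) : LSeriesSummable (a ·) y :=
    (LSeries_conv4 (χ₁ := χ₁) (χ₂ := χ₂) (by simpa using hy)).1
  have hB : ∀ z ∈ Metric.closedBall (2 : ℂ) (3 / 2), ‖siegelFun χ₁ χ₂ z‖ ≤ C₀ * 343 * N ^ 2 := by
    intro z hz
    have hz' : ‖z - 2‖ ≤ 3 / 2 := by simpa [dist_eq] using hz
    have hzre : 1 - 1 / 2 ≤ z.re := by
      have := (abs_le.mp ((Complex.abs_re_le_norm (z - 2)).trans hz')).1
      simp at this; linarith
    have hzn : ‖z‖ ≤ 7 / 2 := by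
      have := norm_add_le (z - 2) 2
      rw [sub_add_cancel] at this
      norm_num at this; linarith
    have hL {q : ℕ} [NeZero q] {χ : DirichletCharacter ℂ q} (hχ : χ ≠ 1) :
        ‖χ.LFunction z‖ ≤ 7 * q := by
      have := norm_LFunction_le hχ one_half_pos le_rfl hzre
      rw [mul_one_div_cancel two_ne_zero, Real.rpow_one] at this
      refine this.trans ?_
      rw [show (7 : ℝ) * q = 7 / 2 * (q / (1 / 2)) by ring]
      gcongr
    have e1 := hC₀ z hz
    have e2 := hL h₁
    have e3 := hL h₂
    have e4 := hL h₁₂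
    rw [siegelFun, norm_mul, norm_mul, norm_mul]
    calc _ ≤ C₀ * (7 * q₁) * (7 * q₂ * (7 * (q₁ * q₂ : ℕ))) := by gcongr
      _ = _ := by rw [← hN, hNe]; ring
  have hκ : 0 < 1 - s := by linarith
  have hs8 : 7 / 8 < s := by linarith
  have hBone : 1 ≤ C₀ * 343 * N ^ 2 := by nlinarith [one_le_pow₀ hN1 (n := 2)]
  have hmain := estermann (a := (a ·)) (fun n ↦ ha0 n) ha1 hsum hG hGa hBone hB hs8 hs1
  have hpos : 0 ≤ (siegelFun χ₁ χ₂ s).re := by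
    rcases hzero with h | h
    · simp [siegelFun, h]
    · refine estermann_real_pos (a := (a ·)) (fun n ↦ ha0 n) ha1 hsum hG hGa (by linarith) hs1 ?_
      intro x hx hx1
      have hz0 := hz x (by linarith) hx1
      rcases hx1.eq_or_lt with rfl | hx1
      · have := DirichletCharacter.LFunction_apply_one_ne_zero h₁
        have := DirichletCharacter.LFunction_apply_one_ne_zero h₂
        have := DirichletCharacter.LFunction_apply_one_ne_zero h₁₂
        simp_all [siegelFun]
      · obtain ⟨e1, e2, e3⟩ := h x hx hx1
        exact mul_ne_zero (mul_ne_zero hz0 e1) (mul_ne_zero e2 e3)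
  have hκ1 : 1 - s ≤ 1 / 2 := by linarith
  have hL {q : ℕ} [NeZero q] {χ : DirichletCharacter ℂ q} (hχ : χ ≠ 1) (hqN : (q : ℝ) ≤ N) :
      ‖χ.LFunction 1‖ ≤ N ^ (2 * (1 - s)) / (1 - s) := by
    have := norm_LFunction_le (s := 1) hχ hκ hκ1 (by simp; linarith)
    rw [norm_one, one_mul] at this
    refine this.trans ?_
    gcongr
  have hG1 : (siegelFun χ₁ χ₂ 1).re ≤ ‖χ₂.LFunction 1‖ * (N ^ (2 * (1 - s)) / (1 - s)) ^ 2 := by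
    refine (Complex.re_le_norm _).trans ?_
    rw [siegelFun, norm_mul, norm_mul, norm_mul, zetaOne_one, norm_one, one_mul]
    have e1 := hL h₁ (by rw [hNe]; nlinarith)
    have e2 := hL h₁₂ le_rfl
    calc _ ≤ N ^ (2 * (1 - s)) / (1 - s) * (‖χ₂.LFunction 1‖ * (N ^ (2 * (1 - s)) / (1 - s))) := by
          gcongr
      _ = _ := by ring
  have hpow : (32 * (C₀ * 343 * N ^ 2)) ^ (4 * (1 - s)) ≤ C * N ^ (8 * (1 - s)) := by
    rw [show 32 * (C₀ * 343 * N ^ 2) = C * N ^ 2 by rw [hC]; ring,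
      Real.mul_rpow (by positivity) (by positivity), ← Real.rpow_natCast_mul (by positivity)]
    have : C ^ (4 * (1 - s)) ≤ C := by
      calc C ^ (4 * (1 - s)) ≤ C ^ (1 : ℝ) := by
            apply Real.rpow_le_rpow_of_exponent_le <;> linarith
        _ = C := Real.rpow_one C
    rw [show ((2 : ℕ) : ℝ) * (4 * (1 - s)) = 8 * (1 - s) by push_cast; ring]
    gcongr
  have h1 : (1 - s) / 2 ≤ 3 * (‖χ₂.LFunction 1‖ * (N ^ (2 * (1 - s)) / (1 - s)) ^ 2) *
      (C * N ^ (8 * (1 - s))) := by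
    calc (1 - s) / 2 ≤ 3 * (siegelFun χ₁ χ₂ 1).re *
          (32 * (C₀ * 343 * N ^ 2)) ^ (4 * (1 - s)) := by linarith
      _ ≤ _ := by gcongr
  have h2 : (N ^ (2 * (1 - s))) ^ 2 * N ^ (8 * (1 - s)) = N ^ (12 * (1 - s)) := by
    rw [← Real.rpow_mul_natCast (by positivity), ← Real.rpow_add (by positivity)]
    congr 1; push_cast; ring
  rw [div_pow] at h1
  have h3 : 3 * (‖χ₂.LFunction 1‖ * ((N ^ (2 * (1 - s))) ^ 2 / (1 - s) ^ 2)) *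
      (C * N ^ (8 * (1 - s))) =
      (3 * C * ‖χ₂.LFunction 1‖ * N ^ (12 * (1 - s))) / (1 - s) ^ 2 := by
    rw [← h2]; ring
  rw [h3, le_div_iff₀ (by positivity)] at h1
  nlinarith

theorem exists_nontrivial_quadratic_char : ∃ χ : DirichletCharacter ℂ 4, χ ≠ 1 ∧ χ ^ 2 = 1 := by
  refine ⟨ZMod.χ₄.ringHomComp (Int.castRingHom ℂ), fun h ↦ ?_, ?_⟩
  · have := congrArg (fun f : DirichletCharacter ℂ 4 ↦ f (3 : ℕ)) h
    have h3 : IsUnit ((3 : ℕ) : ZMod 4) := by rw [ZMod.isUnit_iff_coprime]; norm_num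
    simp only [MulChar.ringHomComp_apply, ZMod.χ₄_nat_three_mod_four (n := 3) rfl,
      MulChar.one_apply h3] at this
    norm_num at this
  · have : ZMod.χ₄ ^ 2 = 1 := ZMod.isQuadratic_χ₄.sq_eq_one
    rw [MulChar.ringHomComp_pow, this, MulChar.ringHomComp_one]

theorem prodChar_ne_one {q₁ q₂ : ℕ} [NeZero q₁] [NeZero q₂] {χ₁ : DirichletCharacter ℂ q₁}
    {χ₂ : DirichletCharacter ℂ q₂} (hprim : χ₂.IsPrimitive) (h : χ₂ ^ 2 = 1) (hlt : q₁ < q₂) :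
    prodChar χ₁ χ₂ ≠ 1 := by
  intro h1
  rw [prodChar] at h1
  have h2 : DirichletCharacter.changeLevel (dvd_mul_left q₂ q₁) χ₂ ^ 2 = 1 := by
    rw [← map_pow, h, map_one]
  have h3 : DirichletCharacter.changeLevel (dvd_mul_right q₁ q₂) χ₁ =
      DirichletCharacter.changeLevel (dvd_mul_left q₂ q₁) χ₂ := by
    calc _ = DirichletCharacter.changeLevel (dvd_mul_right q₁ q₂) χ₁ *
          DirichletCharacter.changeLevel (dvd_mul_left q₂ q₁) χ₂ ^ 2 := by rw [h2, mul_one]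
      _ = _ := by rw [pow_two, ← mul_assoc, h1, one_mul]
  have h4 := congrArg DirichletCharacter.conductor h3
  rw [DirichletCharacter.conductor_changeLevel, DirichletCharacter.conductor_changeLevel,
    (DirichletCharacter.isPrimitive_def _).mp hprim] at h4
  have := Nat.le_of_dvd (NeZero.pos q₁) χ₁.conductor_dvd_level
  omega

/-- **Siegel's theorem**: a lower bound for `L(1, χ)` for quadratic characters. -/
theorem siegel {κ : ℝ} (hκ : 0 < κ) : ∃ c > 0, ∀ (q : ℕ) [NeZero q] (χ : DirichletCharacter ℂ q),
    χ.IsPrimitive → χ ≠ 1 → χ ^ 2 = 1 → c * (q : ℝ) ^ (-κ) ≤ ‖χ.LFunction 1‖ := by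
  obtain ⟨C, s₀, hC, hs₀, hs₀1, hpair⟩ := siegel_pair
  obtain ⟨s₁, hs₁, hs₁1, hs₁κ⟩ : ∃ s₁ : ℝ, s₀ < s₁ ∧ s₁ < 1 ∧ 12 * (1 - s₁) ≤ κ := by
    refine ⟨max ((1 + s₀) / 2) (1 - κ / 12), lt_max_of_lt_left (by linarith),
      max_lt (by linarith) (by linarith), ?_⟩
    have := le_max_right ((1 + s₀) / 2) (1 - κ / 12)
    linarith
  obtain ⟨Q, hQ, χ₁, s, h₁, hq₁, hs, hs1, hor⟩ : ∃ (Q : ℕ) (_ : NeZero Q)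
      (χ₁ : DirichletCharacter ℂ Q) (s : ℝ), χ₁ ≠ 1 ∧ χ₁ ^ 2 = 1 ∧ s₁ ≤ s ∧ s < 1 ∧
      (χ₁.LFunction s = 0 ∨ ∀ (q : ℕ) [NeZero q] (χ : DirichletCharacter ℂ q), χ ≠ 1 → χ ^ 2 = 1 →
        ∀ x : ℝ, s ≤ x → x < 1 → χ.LFunction x ≠ 0) := by
    by_cases h : ∀ (q : ℕ) [NeZero q] (χ : DirichletCharacter ℂ q), χ ≠ 1 → χ ^ 2 = 1 →
        ∀ x : ℝ, s₁ ≤ x → x < 1 → χ.LFunction x ≠ 0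
    · obtain ⟨χ, h1, h2⟩ := exists_nontrivial_quadratic_char
      exact ⟨4, inferInstance, χ, s₁, h1, h2, le_rfl, hs₁1, Or.inr h⟩
    · push Not at h
      obtain ⟨q, hq, χ, h1, h2, x, hx, hx1, h0⟩ := h
      exact ⟨q, hq, χ, x, h1, h2, hx, hx1, Or.inl h0⟩
  -- finitely many characters of small modulus
  have hsmall : ∃ c > 0, ∀ (q : ℕ) [NeZero q] (χ : DirichletCharacter ℂ q), q ≤ Q → χ ≠ 1 →
      c ≤ ‖χ.LFunction 1‖ := by
    have : ∀ q : ℕ, ∃ c > 0, ∀ [NeZero q] (χ : DirichletCharacter ℂ q), χ ≠ 1 →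
        c ≤ ‖χ.LFunction 1‖ := by
      intro q
      rcases Nat.eq_zero_or_pos q with rfl | hq
      · exact ⟨1, one_pos, fun {h} ↦ absurd rfl h.out⟩
      have : NeZero q := ⟨hq.ne'⟩
      have hfin : Finite {χ : DirichletCharacter ℂ q // χ ≠ 1} := inferInstance
      rcases isEmpty_or_nonempty {χ : DirichletCharacter ℂ q // χ ≠ 1} with he | hne
      · exact ⟨1, one_pos, fun χ h ↦ (he.false ⟨χ, h⟩).elim⟩
      · obtain ⟨χ, hχ⟩ := Finite.exists_min
          (fun χ : {χ : DirichletCharacter ℂ q // χ ≠ 1} ↦ ‖χ.1.LFunction 1‖)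
        exact ⟨_, norm_pos_iff.mpr (DirichletCharacter.LFunction_apply_one_ne_zero χ.2),
          fun χ' h ↦ hχ ⟨χ', h⟩⟩
    choose c hc hcl using this
    obtain ⟨q₀, -, hq₀⟩ := (Finset.range (Q + 1)).exists_min_image c ⟨0, by simp⟩
    exact ⟨c q₀, hc q₀, fun q _ χ hq hχ ↦
      (hq₀ q (Finset.mem_range.mpr (by omega))).trans (hcl q χ hχ)⟩
  obtain ⟨c₁, hc₁, hsm⟩ := hsmall
  have hQ1 : (1 : ℝ) ≤ Q := by exact_mod_cast NeZero.one_le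
  set c₂ := (1 - s) ^ 3 / (C * (Q : ℝ) ^ (12 * (1 - s))) with hc₂
  have hs0 : 0 < 1 - s := by linarith
  have hc₂0 : 0 < c₂ := by positivity
  refine ⟨min c₁ c₂, lt_min hc₁ hc₂0, fun q _ χ hprim hχ hq ↦ ?_⟩
  have hq1 : (1 : ℝ) ≤ q := by exact_mod_cast NeZero.one_le
  rcases le_or_gt q Q with hle | hlt
  · calc min c₁ c₂ * (q : ℝ) ^ (-κ) ≤ c₁ * 1 := by
          gcongr
          · exact min_le_left _ _
          · exact Real.rpow_le_one_of_one_le_of_nonpos hq1 (by linarith)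
      _ ≤ _ := by rw [mul_one]; exact hsm q χ hle hχ
  · have hne := prodChar_ne_one (χ₁ := χ₁) hprim hq hlt
    have hsq : prodChar χ₁ χ ^ 2 = 1 := by
      rw [prodChar, mul_pow, ← map_pow, ← map_pow, hq₁, hq, map_one, map_one, one_mul]
    have := hpair χ₁ χ h₁ hχ hne hq₁ hq s (by linarith) hs1
      (hor.imp id fun h x hx hx1 ↦ ⟨h _ _ h₁ hq₁ x hx hx1, h _ _ hχ hq x hx hx1,
        h _ _ hne hsq x hx hx1⟩)
    rw [Nat.cast_mul, Real.mul_rpow (by positivity) (by positivity)] at this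
    have hqpos : (0 : ℝ) < (q : ℝ) ^ κ := by positivity
    have h2 : (q : ℝ) ^ (12 * (1 - s)) ≤ (q : ℝ) ^ κ := by
      apply Real.rpow_le_rpow_of_exponent_le hq1; linarith
    have h3 : c₂ ≤ ‖χ.LFunction 1‖ * (q : ℝ) ^ κ := by
      rw [hc₂, div_le_iff₀ (by positivity)]
      calc (1 - s) ^ 3 ≤ _ := this
        _ = ‖χ.LFunction 1‖ * (q : ℝ) ^ (12 * (1 - s)) * (C * (Q : ℝ) ^ (12 * (1 - s))) := by ring
        _ ≤ _ := by gcongr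
    rw [Real.rpow_neg (by positivity), ← div_eq_mul_inv, div_le_iff₀ hqpos]
    exact (min_le_right _ _).trans h3

end

section

open Complex Filter Topology MeasureTheory Set

section TrivialCharacter

variable {N : ℕ} [NeZero N]

theorem norm_one_apply_sub_le {δ : ℝ} (h0 : 0 ≤ δ) (h1 : δ ≤ 1) (a : ZMod N) :
    ‖(1 : DirichletCharacter ℂ N) a - δ‖ ≤ 1 := by
  by_cases ha : IsUnit a
  · rw [MulChar.one_apply ha, ← ofReal_one, ← ofReal_sub, norm_real,
      Real.norm_of_nonneg (by linarith)]
    linarith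
  · rw [MulChar.map_nonunit _ ha, zero_sub, norm_neg, norm_real, Real.norm_of_nonneg h0]
    exact h1

theorem norm_partialSum_one_sub_le (t : ℝ) (ht : 1 < t) :
    ‖partialSum (fun n ↦ (1 : DirichletCharacter ℂ N) n) t
      - ((N.totient / N : ℝ) : ℂ) * t‖ ≤ 2 * min t N := by
  have hN : (0 : ℝ) < N := by exact_mod_cast NeZero.pos N
  have hN1 : (1 : ℝ) ≤ N := by exact_mod_cast NeZero.pos N
  set δ : ℝ := N.totient / N with hδ
  have h0 : 0 ≤ δ := by positivity
  have h1 : δ ≤ 1 := by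
    rw [hδ, div_le_one hN]; exact_mod_cast Nat.totient_le N
  have hfl : |(t - ⌊t⌋₊ : ℝ)| ≤ 1 := by
    rw [abs_le]; constructor <;> linarith [Nat.floor_le (by linarith : 0 ≤ t), Nat.lt_floor_add_one t]
  have ha := norm_partialSum_le_self zero_le_one
    (fun n ↦ (1 : DirichletCharacter ℂ N).norm_le_one (n : ZMod N)) (by linarith : 0 ≤ t)
  have hδt : ‖((δ : ℝ) : ℂ) * t‖ ≤ t := by
    rw [norm_mul, norm_real, norm_real, Real.norm_of_nonneg h0, Real.norm_of_nonneg (by linarith)]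
    nlinarith
  have hb : ‖partialSum (fun n ↦ (1 : DirichletCharacter ℂ N) n) t - (δ : ℂ) * t‖ ≤ 2 * t := by
    refine (norm_sub_le _ _).trans ?_
    linarith
  have hc : ‖partialSum (fun n ↦ (1 : DirichletCharacter ℂ N) n) t - (δ : ℂ) * t‖ ≤ 2 * N := by
    have key : ‖∑ k ∈ Finset.Ico 1 (⌊t⌋₊ + 1), ((1 : DirichletCharacter ℂ N) k - (δ : ℂ))‖ ≤ N := by
      refine norm_sum_Ico_le_of_periodic' (f := fun k : ℕ ↦ (1 : DirichletCharacter ℂ N) k - (δ : ℂ))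
        (NeZero.pos N) (fun n ↦ by simp) ?_ (fun n ↦ norm_one_apply_sub_le h0 h1 _) _ _
      rw [Finset.sum_sub_distrib, sum_range_zmod (fun x ↦ (1 : DirichletCharacter ℂ N) x),
        MulChar.sum_one_eq_card_units, ZMod.card_units_eq_totient]
      simp only [Finset.sum_const, Finset.card_range, nsmul_eq_mul, hδ]
      push_cast
      have : (N : ℂ) ≠ 0 := by exact_mod_cast NeZero.ne N
      field_simp
      ring
    rw [Finset.sum_sub_distrib] at key
    simp only [Finset.sum_const, Nat.card_Ico, nsmul_eq_mul, add_tsub_cancel_right] at key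
    have e : partialSum (fun n ↦ (1 : DirichletCharacter ℂ N) n) t - (δ : ℂ) * t =
        (∑ k ∈ Finset.Ico 1 (⌊t⌋₊ + 1), (1 : DirichletCharacter ℂ N) k - ⌊t⌋₊ * (δ : ℂ))
          - δ * ((t - ⌊t⌋₊ : ℝ) : ℂ) := by
      have : partialSum (fun n ↦ (1 : DirichletCharacter ℂ N) n) t =
        ∑ k ∈ Finset.Ico 1 (⌊t⌋₊ + 1), (1 : DirichletCharacter ℂ N) k := rfl
      rw [this]; push_cast; ring
    rw [e]
    refine (norm_sub_le _ _).trans ?_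
    have : ‖(δ : ℂ) * ((t - ⌊t⌋₊ : ℝ) : ℂ)‖ ≤ 1 := by
      rw [norm_mul, norm_real, norm_real, Real.norm_of_nonneg h0, Real.norm_eq_abs]
      nlinarith [abs_nonneg (t - ⌊t⌋₊ : ℝ)]
    linarith
  rw [mul_min_of_nonneg _ _ zero_le_two]
  exact le_min hb hc

theorem norm_LFunction_one_le {κ : ℝ} (hκ : 0 < κ) (hκ' : κ ≤ 1 / 2) {s : ℂ} (hs : 1 < s.re) :
    ‖(1 : DirichletCharacter ℂ N).LFunction s‖ ≤
      ‖s‖ / ‖s - 1‖ + ‖s‖ * ((N : ℝ) ^ (2 * κ) / κ) := by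
  have hN : (0 : ℝ) < N := by exact_mod_cast NeZero.pos N
  set δ : ℝ := N.totient / N with hδ
  have h0 : 0 ≤ δ := by positivity
  have h1 : δ ≤ 1 := by
    rw [hδ, div_le_one hN]; exact_mod_cast Nat.totient_le N
  set f : ℕ → ℂ := fun n ↦ (1 : DirichletCharacter ℂ N) n with hf
  have hE : ∀ t, 1 < t → ‖partialSum f t - (δ : ℂ) * t‖ ≤ 2 * (N : ℝ) ^ (2 * κ) * t ^ (1 - 2 * κ) := by
    intro t ht
    refine (norm_partialSum_one_sub_le t ht).trans ?_
    have := min_le_rpow_mul_rpow (by linarith : 0 < t) hN (by linarith : 0 ≤ 2 * κ) (by linarith)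
    linarith
  have hL : ∀ t : ℝ, 1 < t → ‖(δ : ℂ) * t‖ ≤ 1 * t ^ (1 : ℝ) := by
    intro t ht
    rw [norm_mul, norm_real, norm_real, Real.norm_of_nonneg h0, Real.norm_of_nonneg (by linarith),
      Real.rpow_one]
    gcongr
  have hs1 : s - 1 ≠ 0 := by
    intro h; rw [sub_eq_zero.mp h] at hs; simp at hs
  have i1 := integrableOn_partialSum (S := fun t ↦ partialSum f t - (δ : ℂ) * t)
    ((measurable_partialSum f).sub (measurable_const.mul measurable_ofReal)) (a := 1 - 2 * κ)
    (s := s) (by linarith) hE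
  have i2 := integrableOn_partialSum (S := fun t ↦ (δ : ℂ) * t)
    (measurable_const.mul measurable_ofReal) (a := 1) (s := s) (by linarith) hL
  have e2 : ∫ t in Ioi (1 : ℝ), (δ : ℂ) * t * (t : ℂ) ^ (-(s + 1)) = δ / (s - 1) := by
    have : ∀ t ∈ Ioi (1 : ℝ), (δ : ℂ) * t * (t : ℂ) ^ (-(s + 1)) = δ * (t : ℂ) ^ (-s) := by
      intro t ht
      have ht0 : (t : ℂ) ≠ 0 := by
        exact_mod_cast (zero_lt_one.trans (show (1 : ℝ) < t from ht)).ne'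
      rw [mul_assoc, neg_add, cpow_add _ _ ht0, cpow_neg_one]
      field_simp
    rw [setIntegral_congr_fun measurableSet_Ioi this, integral_const_mul,
      integral_Ioi_cpow_of_lt (by simpa using hs) zero_lt_one, ofReal_one, one_cpow]
    have : -s + 1 ≠ 0 := by rw [← neg_ne_zero]; ring_nf; rwa [← sub_eq_neg_add]
    field_simp
    ring
  rw [DirichletCharacter.LFunction_eq_LSeries _ hs,
    LSeries_eq_integral_partialSum (fun n ↦ (1 : DirichletCharacter ℂ N).norm_le_one n) hs]
  have e : ∫ t in Ioi (1 : ℝ), partialSum f t * (t : ℂ) ^ (-(s + 1)) =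
      (∫ t in Ioi (1 : ℝ), (partialSum f t - (δ : ℂ) * t) * (t : ℂ) ^ (-(s + 1))) + δ / (s - 1) := by
    rw [← e2, ← integral_add i1 i2]
    congr 1; ext t; ring
  rw [e, mul_add]
  refine (norm_add_le _ _).trans ?_
  rw [add_comm]
  gcongr
  · rw [norm_mul, norm_div, norm_real, Real.norm_of_nonneg h0, ← mul_div_assoc]
    gcongr
    nlinarith [norm_nonneg s]
  · rw [norm_mul]
    gcongr
    refine (norm_integral_partialSum_le (a := 1 - 2 * κ) (by linarith) hE).trans ?_
    rw [div_le_div_iff₀ (by linarith) hκ]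
    have : 0 < (N : ℝ) ^ (2 * κ) := by positivity
    nlinarith

theorem norm_LFunctionTrivChar_le {x : ℝ} (hx : 0 < x) :
    ‖DirichletCharacter.LFunctionTrivChar N (1 + x)‖ ≤ (1 + x) / x := by
  have hs : 1 < (1 + x : ℂ).re := by simpa using hx
  have := LSeries_eq_integral_partialSum (s := 1 + x)
    (fun n ↦ (1 : DirichletCharacter ℂ N).norm_le_one n) hs
  rw [DirichletCharacter.LFunctionTrivChar, DirichletCharacter.LFunction_eq_LSeries _ hs, this,
    norm_mul]
  have h1 : ‖(1 + x : ℂ)‖ = 1 + x := by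
    rw [← ofReal_one, ← ofReal_add, norm_real, Real.norm_of_nonneg (by linarith)]
  rw [h1, div_eq_mul_inv]
  gcongr
  refine (norm_integral_partialSum_le (C := 1) (a := 1) hs ?_).trans ?_
  · intro t ht
    simpa using norm_partialSum_le_self zero_le_one
      (fun n ↦ (1 : DirichletCharacter ℂ N).norm_le_one (n : ZMod N)) (by linarith : 0 ≤ t)
  · simp

end TrivialCharacter

end

section

open Complex Filter Topology MeasureTheory Set

section LowerBound

variable {N : ℕ} [NeZero N] {χ : DirichletCharacter ℂ N}

theorem norm_deriv_LFunction_le (hχ : χ ≠ 1) {κ : ℝ} (hκ : 0 < κ) (hκ' : κ ≤ 1 / 2) {s : ℂ}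
    (hs : 1 - κ / 2 ≤ s.re) :
    ‖deriv χ.LFunction s‖ ≤ (‖s‖ + 1) * (2 * (N : ℝ) ^ (2 * κ) / κ ^ 2) := by
  have h := norm_deriv_le_of_forall_mem_sphere_norm_le (c := s) (R := κ / 2)
    (f := χ.LFunction) (C := (‖s‖ + 1) * ((N : ℝ) ^ (2 * κ) / κ)) (by linarith)
    (DirichletCharacter.differentiable_LFunction hχ).diffContOnCl ?_
  · refine h.trans_eq ?_
    field_simp
  · intro z hz
    have hz' : ‖z - s‖ = κ / 2 := by simpa using hz
    have h1 : |(z - s).re| ≤ κ / 2 := hz' ▸ abs_re_le_norm _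
    rw [sub_re, abs_le] at h1
    refine (norm_LFunction_le hχ hκ hκ' (by linarith)).trans ?_
    gcongr
    have := norm_add_le (z - s) s
    rw [sub_add_cancel] at this
    linarith

theorem norm_LFunction_sub_le (hχ : χ ≠ 1) {x y M : ℝ}
    (hder : ∀ z : ℂ, |z.re - 1| ≤ x → z.im = y → ‖deriv χ.LFunction z‖ ≤ M) {σ σ' : ℝ}
    (h : |σ - 1| ≤ x) (h' : |σ' - 1| ≤ x) :
    ‖χ.LFunction (σ' + y * I) - χ.LFunction (σ + y * I)‖ ≤ M * |σ' - σ| := by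
  have hconv : Convex ℝ {z : ℂ | |z.re - 1| ≤ x ∧ z.im = y} := by
    have : {z : ℂ | |z.re - 1| ≤ x ∧ z.im = y} =
        reLm ⁻¹' Set.Icc (1 - x) (1 + x) ∩ imLm ⁻¹' {y} := by
      ext z
      simp only [mem_ofPred_eq, mem_inter_iff, mem_preimage, mem_Icc, mem_singleton_iff, abs_le,
        reLm_coe, imLm_coe]
      constructor <;> rintro ⟨⟨h1, h2⟩, h3⟩ <;> exact ⟨⟨by linarith, by linarith⟩, h3⟩
    rw [this]
    exact ((convex_Icc _ _).linear_preimage _).inter ((convex_singleton _).linear_preimage _)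
  have := hconv.norm_image_sub_le_of_norm_deriv_le (f := χ.LFunction) (C := M)
    (x := σ + y * I) (y := σ' + y * I)
    (fun z _ ↦ DirichletCharacter.differentiable_LFunction hχ z) (fun z hz ↦ hder z hz.1 hz.2)
    (by simpa using h) (by simpa using h')
  refine this.trans_eq ?_
  congr 1
  rw [add_sub_add_right_eq_sub, ← ofReal_sub, norm_real, Real.norm_eq_abs]

theorem le_norm_LFunction_of_bounds (hχ : χ ≠ 1) {x y M : ℝ} (hM : 1 ≤ M)
    (hx : x = 1 / (1000 * M ^ 5))
    (hL2 : ‖(χ ^ 2).LFunction (1 + x + 2 * I * y)‖ ≤ M)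
    (hder : ∀ z : ℂ, |z.re - 1| ≤ x → z.im = y → ‖deriv χ.LFunction z‖ ≤ M)
    {σ : ℝ} (hσ : |σ - 1| ≤ x) : x ≤ ‖χ.LFunction (σ + y * I)‖ := by
  have hM5 : 1 ≤ M ^ 5 := one_le_pow₀ hM
  have hx0 : 0 < x := by rw [hx]; positivity
  have hx1 : x ≤ 1 := by
    rw [hx, div_le_one (by positivity)]; linarith
  by_contra! hlt
  have h1 : ‖χ.LFunction (1 + x + I * y)‖ ≤ 3 * x * M := by
    have := norm_LFunction_sub_le hχ hder hσ (σ' := 1 + x) (by simp [abs_of_pos hx0])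
    have e : (1 + x + I * y : ℂ) = ((1 + x : ℝ) : ℂ) + y * I := by push_cast; ring
    rw [e]
    have hd : |1 + x - σ| ≤ 2 * x := by
      rw [abs_le] at hσ ⊢; constructor <;> linarith
    have h2 := norm_add_le (χ.LFunction (((1 + x : ℝ) : ℂ) + y * I) - χ.LFunction (σ + y * I))
      (χ.LFunction (σ + y * I))
    rw [sub_add_cancel] at h2
    have : M * |1 + x - σ| ≤ M * (2 * x) := by gcongr
    nlinarith
  have h0 : ‖DirichletCharacter.LFunctionTrivChar N (1 + x)‖ ≤ 2 / x := by
    refine (norm_LFunctionTrivChar_le hx0).trans ?_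
    gcongr
    linarith
  have key := χ.norm_LFunction_product_ge_one hx0 y
  rw [norm_mul, norm_mul, norm_pow, norm_pow] at key
  have : ‖DirichletCharacter.LFunctionTrivChar N (1 + x)‖ ^ 3 * ‖χ.LFunction (1 + x + I * y)‖ ^ 4
      * ‖(χ ^ 2).LFunction (1 + x + 2 * I * y)‖ ≤ (2 / x) ^ 3 * (3 * x * M) ^ 4 * M := by
    gcongr
  have e : (2 / x) ^ 3 * (3 * x * M) ^ 4 * M = 648 * (x * M ^ 5) := by
    field_simp; ring
  have e2 : x * M ^ 5 = 1 / 1000 := by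
    rw [hx]; field_simp
  rw [e, e2] at this
  norm_num at this
  linarith

theorem le_norm_LFunction_near_one (hχ : χ ≠ 1) {κ c : ℝ} (hκ : 0 < κ) (hκ' : κ ≤ 1 / 2)
    (hc : c ≤ ‖χ.LFunction 1‖) {s : ℂ} (hs : ‖s - 1‖ ≤ κ / 2) :
    c - 6 * (N : ℝ) ^ (2 * κ) / κ ^ 2 * ‖s - 1‖ ≤ ‖χ.LFunction s‖ := by
  have := (convex_closedBall (1 : ℂ) (κ / 2)).norm_image_sub_le_of_norm_deriv_le
    (f := χ.LFunction) (C := 6 * (N : ℝ) ^ (2 * κ) / κ ^ 2) (x := s) (y := 1)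
    (fun z _ ↦ DirichletCharacter.differentiable_LFunction hχ z) ?_ (by simpa [dist_eq] using hs)
    (by simp; linarith)
  · rw [norm_sub_rev 1 s] at this
    have h2 := norm_add_le (χ.LFunction 1 - χ.LFunction s) (χ.LFunction s)
    rw [sub_add_cancel] at h2
    linarith
  · intro z hz
    have hz' : ‖z - 1‖ ≤ κ / 2 := by simpa [dist_eq] using hz
    have h1 := (abs_re_le_norm _).trans hz'
    rw [sub_re, one_re, abs_le] at h1
    refine (norm_deriv_LFunction_le hχ hκ hκ' (by linarith)).trans ?_
    have h2 : ‖z‖ ≤ 2 := by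
      have := norm_add_le (z - 1) 1
      rw [sub_add_cancel, norm_one] at this
      linarith
    calc _ ≤ (2 + 1) * (2 * (N : ℝ) ^ (2 * κ) / κ ^ 2) := by gcongr
      _ = _ := by ring

end LowerBound

set_option maxHeartbeats 1000000 in
theorem exists_le_norm_LFunction {κ : ℝ} (hκ : 0 < κ) (hκ' : κ ≤ 1 / 2) :
    ∃ C : ℝ, 1 ≤ C ∧ ∀ (q : ℕ) [NeZero q] (χ : DirichletCharacter ℂ q), χ.IsPrimitive → χ ≠ 1 →
      ∀ y σ : ℝ, |σ - 1| ≤ 1 / (C * ((|y| + 2) * (q : ℝ) ^ (3 * κ)) ^ 5) →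
        1 / (C * ((|y| + 2) * (q : ℝ) ^ (3 * κ)) ^ 5) ≤ ‖χ.LFunction (σ + y * I)‖ := by
  obtain ⟨c, hc, hS⟩ := siegel hκ
  obtain ⟨c1, hc1pos, hc1a, hc1b⟩ : ∃ c1 : ℝ, 0 < c1 ∧ c1 ≤ κ / 4 ∧ c1 ≤ c * κ ^ 2 / 24 :=
    ⟨min (κ / 4) (c * κ ^ 2 / 24), lt_min (by positivity) (by positivity), min_le_left _ _,
      min_le_right _ _⟩
  have h8 : c1 ≤ c / 2 := by
    have : κ ^ 2 ≤ 1 := pow_le_one₀ hκ.le (by linarith)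
    have : c * κ ^ 2 ≤ c := mul_le_of_le_one_right hc.le this
    linarith
  obtain ⟨C1, hC1⟩ : ∃ C1 : ℝ, C1 = 3 / κ ^ 2 + 2 / κ + 1 + 1 / c1 := ⟨_, rfl⟩
  have hC1_1 : 1 ≤ C1 := by
    have : 0 ≤ 3 / κ ^ 2 + 2 / κ + 1 / c1 := by positivity
    linarith
  refine ⟨1000 * C1 ^ 5, ?_, ?_⟩
  · have : 1 ≤ C1 ^ 5 := one_le_pow₀ hC1_1
    linarith
  intro q _ χ hprim hχ y σ hσ
  have hq1 : (1 : ℝ) ≤ q := by exact_mod_cast NeZero.pos q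
  obtain ⟨Q, hQ⟩ : ∃ Q : ℝ, Q = (q : ℝ) ^ κ := ⟨_, rfl⟩
  have hQ1 : 1 ≤ Q := hQ ▸ Real.one_le_rpow hq1 hκ.le
  have hQ2 : (q : ℝ) ^ (2 * κ) = Q ^ 2 := by
    rw [hQ, mul_comm, Real.rpow_mul (by linarith)]; norm_cast
  have hQ3 : (q : ℝ) ^ (3 * κ) = Q ^ 3 := by
    rw [hQ, mul_comm, Real.rpow_mul (by linarith)]; norm_cast
  have hQn : (q : ℝ) ^ (-κ) = Q⁻¹ := by
    rw [hQ, Real.rpow_neg (by linarith)]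
  rw [hQ3] at hσ ⊢
  obtain ⟨T, hT⟩ : ∃ T : ℝ, T = |y| + 2 := ⟨_, rfl⟩
  rw [← hT] at hσ ⊢
  have hT2 : 2 ≤ T := by have := abs_nonneg y; linarith
  obtain ⟨M, hM⟩ : ∃ M : ℝ, M = C1 * (T * Q ^ 3) := ⟨_, rfl⟩
  have hQ3_1 : 1 ≤ Q ^ 3 := one_le_pow₀ hQ1
  have hQ23 : Q ^ 2 ≤ Q ^ 3 := pow_le_pow_right₀ hQ1 (by norm_num)
  have hTQ : 1 ≤ T * Q ^ 3 := one_le_mul_of_one_le_of_one_le (by linarith) hQ3_1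
  have hM1 : 1 ≤ M := hM ▸ one_le_mul_of_one_le_of_one_le hC1_1 hTQ
  have hM5 : M ≤ M ^ 5 := le_self_pow₀ hM1 (by norm_num)
  obtain ⟨x, hx⟩ : ∃ x : ℝ, x = 1 / (1000 * M ^ 5) := ⟨_, rfl⟩
  have hxe : 1 / (1000 * C1 ^ 5 * (T * Q ^ 3) ^ 5) = x := by rw [hx, hM]; ring
  rw [hxe] at hσ ⊢
  have hx0 : 0 < x := by rw [hx]; positivity
  have hxM : x ≤ 1 / M := by
    rw [hx]; apply one_div_le_one_div_of_le (by linarith); linarith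
  have hxc : x ≤ c1 * (Q ^ 3)⁻¹ := by
    refine hxM.trans ?_
    have : 1 / c1 ≤ C1 := by
      have : 0 ≤ 3 / κ ^ 2 + 2 / κ := by positivity
      linarith
    have h2 : 1 / c1 * Q ^ 3 ≤ M := by
      rw [hM]
      exact mul_le_mul this (le_mul_of_one_le_left (by linarith) (by linarith)) (by linarith)
        (by linarith)
    calc 1 / M ≤ 1 / (1 / c1 * Q ^ 3) := one_div_le_one_div_of_le (by positivity) h2
      _ = _ := by field_simp
  have hinv1 : (Q ^ 3)⁻¹ ≤ 1 := inv_le_one_of_one_le₀ hQ3_1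
  have hci : c1 * (Q ^ 3)⁻¹ ≤ c1 := mul_le_of_le_one_right hc1pos.le hinv1
  have hxκ : x ≤ κ / 4 := by linarith
  have hder : ∀ z : ℂ, |z.re - 1| ≤ x → z.im = y → ‖deriv χ.LFunction z‖ ≤ M := by
    intro z hz hzy
    have hz' := abs_le.mp hz
    refine (norm_deriv_LFunction_le hχ hκ hκ' (by linarith)).trans ?_
    have h1 : ‖z‖ ≤ 3 / 2 * T - 1 := by
      refine (norm_le_abs_re_add_abs_im z).trans ?_
      rw [hzy, abs_of_nonneg (show 0 ≤ z.re by linarith)]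
      linarith
    rw [hQ2]
    calc (‖z‖ + 1) * (2 * Q ^ 2 / κ ^ 2) ≤ (3 / 2 * T) * (2 * Q ^ 3 / κ ^ 2) := by
          gcongr; linarith
      _ = 3 / κ ^ 2 * (T * Q ^ 3) := by ring
      _ ≤ M := by
          rw [hM]
          gcongr
          have : 0 ≤ 2 / κ + 1 + 1 / c1 := by positivity
          linarith
  have hs_re : 1 < (1 + x + 2 * I * y : ℂ).re := by simp; exact hx0
  have hs_norm : ‖(1 + x + 2 * I * y : ℂ)‖ ≤ 2 * T := by
    refine (norm_le_abs_re_add_abs_im _).trans ?_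
    simp only [add_re, one_re, ofReal_re, mul_re, re_ofNat, I_re, mul_zero, im_ofNat, I_im,
      mul_one, sub_self, zero_mul, mul_im, zero_add, ofReal_im, add_zero, add_im, one_im]
    rw [abs_of_pos (by linarith), abs_mul, abs_two]
    linarith
  have hmain : 2 * T * (Q ^ 2 / κ) ≤ 2 / κ * (T * Q ^ 3) := by
    calc 2 * T * (Q ^ 2 / κ) ≤ 2 * T * (Q ^ 3 / κ) := by gcongr
      _ = _ := by ring
  by_cases h2 : χ ^ 2 = 1
  · by_cases hy : c1 * (Q ^ 3)⁻¹ ≤ |y|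
    · refine le_norm_LFunction_of_bounds hχ hM1 hx ?_ hder hσ
      rw [h2]
      refine (norm_LFunction_one_le hκ hκ' hs_re).trans ?_
      rw [hQ2]
      have hb : ‖(1 + x + 2 * I * y : ℂ)‖ / ‖(1 + x + 2 * I * y : ℂ) - 1‖ ≤ 1 + Q ^ 3 / c1 := by
        have hy0 : 0 < c1 * (Q ^ 3)⁻¹ := by positivity
        have hle : c1 * (Q ^ 3)⁻¹ ≤ ‖(1 + x + 2 * I * y : ℂ) - 1‖ := by
          refine le_trans ?_ (abs_im_le_norm _)
          simp only [sub_im, add_im, one_im, ofReal_im, mul_im, mul_re, re_ofNat, I_im, mul_one,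
            im_ofNat, I_re, mul_zero, add_zero, zero_add, ofReal_re, sub_self, zero_mul, sub_zero]
          rw [abs_mul, abs_two]
          linarith
        have hpos := hy0.trans_le hle
        have htri := norm_add_le ((1 + x + 2 * I * y : ℂ) - 1) 1
        rw [sub_add_cancel, norm_one] at htri
        rw [div_le_iff₀ hpos, add_mul, one_mul]
        refine htri.trans ?_
        gcongr
        calc (1 : ℝ) = Q ^ 3 / c1 * (c1 * (Q ^ 3)⁻¹) := by field_simp
          _ ≤ _ := by gcongr
      have : ‖(1 + x + 2 * I * y : ℂ)‖ * (Q ^ 2 / κ) ≤ 2 * T * (Q ^ 2 / κ) := by gcongr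
      have h3 : 1 + Q ^ 3 / c1 ≤ (1 + 1 / c1) * (T * Q ^ 3) := by
        have : Q ^ 3 / c1 ≤ 1 / c1 * (T * Q ^ 3) := by
          rw [div_eq_mul_one_div, mul_comm]
          exact mul_le_mul_of_nonneg_left (le_mul_of_one_le_left (by linarith) (by linarith))
            (by positivity)
        rw [add_mul, one_mul]
        linarith
      have h4 : 0 ≤ 3 / κ ^ 2 * (T * Q ^ 3) := by positivity
      rw [hM, hC1, add_mul, add_mul, add_mul]
      rw [add_mul] at h3
      linarith
    · push Not at hy
      have hn : ‖(σ + y * I : ℂ) - 1‖ ≤ 2 * (c1 * (Q ^ 3)⁻¹) := by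
        refine (norm_le_abs_re_add_abs_im _).trans ?_
        simp only [sub_re, add_re, ofReal_re, mul_re, I_re, mul_zero, ofReal_im, I_im, mul_one,
          sub_self, add_zero, one_re, sub_im, add_im, mul_im, zero_add, one_im, sub_zero]
        linarith
      have := le_norm_LFunction_near_one hχ hκ hκ' (hS q χ hprim hχ h2) (s := σ + y * I)
        (hn.trans (by linarith))
      refine le_trans ?_ this
      rw [hQn, hQ2]
      have h5 : 6 * Q ^ 2 / κ ^ 2 * ‖(σ + y * I : ℂ) - 1‖ ≤
          6 * Q ^ 2 / κ ^ 2 * (2 * (c * κ ^ 2 / 24 * (Q ^ 3)⁻¹)) := by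
        gcongr
        refine hn.trans ?_
        gcongr
      have e5 : 6 * Q ^ 2 / κ ^ 2 * (2 * (c * κ ^ 2 / 24 * (Q ^ 3)⁻¹)) = c * Q⁻¹ / 2 := by
        field_simp; ring
      have h6 : x ≤ c * Q⁻¹ / 2 := by
        refine hxc.trans ?_
        have h7 : (Q ^ 3)⁻¹ ≤ Q⁻¹ := inv_anti₀ (by linarith) (le_self_pow₀ hQ1 (by norm_num))
        calc _ ≤ c / 2 * Q⁻¹ := by gcongr
          _ = _ := by ring
      linarith
  · refine le_norm_LFunction_of_bounds hχ hM1 hx ?_ hder hσ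
    refine (norm_LFunction_le h2 hκ hκ' (by linarith)).trans ?_
    rw [hQ2]
    calc _ ≤ 2 * T * (Q ^ 2 / κ) := by gcongr
      _ ≤ 2 / κ * (T * Q ^ 3) := hmain
      _ ≤ M := by
        rw [hM]
        gcongr
        have : 0 ≤ 3 / κ ^ 2 + 1 + 1 / c1 := by positivity
        linarith

end

section

open Complex Filter Topology MeasureTheory Set

section LogDeriv

variable {N : ℕ} [NeZero N] {χ : DirichletCharacter ℂ N}

theorem norm_LSeries_le_of_norm_le_one {f : ℕ → ℂ} (hf : ∀ n, ‖f n‖ ≤ 1) {s : ℂ} (hs : 1 < s.re) :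
    ‖LSeries f s‖ ≤ ‖s‖ / (s.re - 1) := by
  rw [LSeries_eq_integral_partialSum hf hs, norm_mul, div_eq_mul_one_div]
  gcongr
  refine norm_integral_partialSum_le (C := 1) (a := 1) hs fun t ht ↦ ?_
  simpa using norm_partialSum_le_self zero_le_one hf (by linarith : 0 ≤ t)

theorem norm_char_mul_moebius_le (n : ℕ) :
    ‖((fun n ↦ χ n : ℕ → ℂ) * (fun n ↦ (ArithmeticFunction.moebius n : ℂ))) n‖ ≤ 1 := by
  rw [Pi.mul_apply, norm_mul]
  have h1 := χ.norm_le_one (n : ZMod N)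
  have h2 : ‖(ArithmeticFunction.moebius n : ℂ)‖ ≤ 1 := by
    rw [norm_intCast]
    exact_mod_cast ArithmeticFunction.abs_moebius_le_one
  exact mul_le_one₀ h1 (norm_nonneg _) h2

theorem le_norm_LFunction_of_one_lt_re {s : ℂ} (hs : 1 < s.re) :
    (s.re - 1) / ‖s‖ ≤ ‖χ.LFunction s‖ := by
  have h := DirichletCharacter.LSeries.mul_mu_eq_one χ hs
  have hs0 : 0 < ‖s‖ := norm_pos_iff.mpr (fun h ↦ by simp [h] at hs; linarith)
  have h1 := norm_LSeries_le_of_norm_le_one (norm_char_mul_moebius_le (χ := χ)) hs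
  rw [DirichletCharacter.LFunction_eq_LSeries _ hs, div_le_iff₀ hs0]
  have h2 := congrArg norm h
  rw [norm_mul, norm_one] at h2
  have h3 : 1 ≤ ‖LSeries (fun n ↦ χ n) s‖ * (‖s‖ / (s.re - 1)) :=
    h2.symm.le.trans (mul_le_mul_of_nonneg_left h1 (norm_nonneg _))
  rw [← mul_div_assoc, le_div_iff₀ (by linarith)] at h3
  linarith

end LogDeriv

theorem exists_le_norm_LFunction' {κ : ℝ} (hκ : 0 < κ) (hκ' : κ ≤ 1 / 2) :
    ∃ C : ℝ, 1 ≤ C ∧ ∀ (q : ℕ) [NeZero q] (χ : DirichletCharacter ℂ q), χ.IsPrimitive → χ ≠ 1 →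
      ∀ y σ : ℝ, 1 - 1 / (C * ((|y| + 2) * (q : ℝ) ^ (3 * κ)) ^ 6) ≤ σ → σ ≤ 2 →
        1 / (C * ((|y| + 2) * (q : ℝ) ^ (3 * κ)) ^ 6) ≤ ‖χ.LFunction (σ + y * I)‖ := by
  obtain ⟨C, hC, h⟩ := exists_le_norm_LFunction hκ hκ'
  refine ⟨C, hC, fun q _ χ hprim hχ y σ hσ hσ2 ↦ ?_⟩
  have hq1 : (1 : ℝ) ≤ q := by exact_mod_cast NeZero.pos q
  have hQ1 : 1 ≤ (q : ℝ) ^ (3 * κ) := Real.one_le_rpow hq1 (by positivity)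
  obtain ⟨P, hP⟩ : ∃ P : ℝ, P = (|y| + 2) * (q : ℝ) ^ (3 * κ) := ⟨_, rfl⟩
  have hyP : |y| + 2 ≤ P := by
    rw [hP]; exact le_mul_of_one_le_right (by positivity) hQ1
  have hP1 : 1 ≤ P := by linarith [abs_nonneg y]
  have h := h q χ hprim hχ y σ
  rw [← hP] at h hσ ⊢
  have h65 : 1 / (C * P ^ 6) ≤ 1 / (C * P ^ 5) := by
    gcongr <;> first | assumption | norm_num
  by_cases hlt : |σ - 1| ≤ 1 / (C * P ^ 5)
  · exact h65.trans (h hlt)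
  · push Not at hlt
    have hpos : 0 < 1 / (C * P ^ 5) := by positivity
    have hσ1 : 1 / (C * P ^ 5) < σ - 1 := by
      rcases lt_abs.mp hlt with h | h
      · exact h
      · linarith
    have hre : 1 < (σ + y * I : ℂ).re := by simp; linarith
    refine le_trans ?_ (le_norm_LFunction_of_one_lt_re hre)
    have hn : ‖(σ + y * I : ℂ)‖ ≤ P := by
      refine (norm_le_abs_re_add_abs_im _).trans ?_
      simp only [add_re, ofReal_re, mul_re, I_re, mul_zero, ofReal_im, I_im, mul_one, sub_self,
        add_zero, add_im, mul_im, zero_add]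
      rw [abs_of_pos (by linarith)]
      linarith
    have hn0 : 0 < ‖(σ + y * I : ℂ)‖ := norm_pos_iff.mpr (fun h ↦ by simp [h] at hre; linarith)
    have e : 1 / (C * P ^ 6) = 1 / (C * P ^ 5) / P := by field_simp
    rw [e]
    have : (σ + y * I : ℂ).re - 1 = σ - 1 := by simp
    rw [this]
    gcongr
    linarith

theorem logMul_iterate_apply (f : ℕ → ℂ) (k n : ℕ) :
    (LSeries.logMul^[k] f) n = Complex.log n ^ k * f n := by
  induction k with
  | zero => simp
  | succ k ih =>
    rw [Function.iterate_succ_apply', LSeries.logMul, ih]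
    ring

/-- The coefficients `χ(n) Λ(n) (log n) ^ k`. -/
noncomputable def logCoeff {q : ℕ} (χ : DirichletCharacter ℂ q) (k n : ℕ) : ℂ :=
  Complex.log n ^ k * (χ n * ArithmeticFunction.vonMangoldt n)

theorem abscissaOfAbsConv_twist_le {q : ℕ} (χ : DirichletCharacter ℂ q) :
    LSeries.abscissaOfAbsConv ((fun n ↦ χ n : ℕ → ℂ) *
      (fun n ↦ (ArithmeticFunction.vonMangoldt n : ℂ))) ≤ 1 :=
  LSeries.abscissaOfAbsConv_le_of_forall_lt_LSeriesSummable fun y hy ↦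
    DirichletCharacter.LSeriesSummable_twist_vonMangoldt χ (by simpa using hy)

theorem LSeriesSummable_logCoeff {q : ℕ} (χ : DirichletCharacter ℂ q) (k : ℕ) {s : ℂ}
    (hs : 1 < s.re) : LSeriesSummable (logCoeff χ k) s := by
  have : logCoeff χ k = LSeries.logMul^[k] ((fun n ↦ χ n : ℕ → ℂ) *
      (fun n ↦ (ArithmeticFunction.vonMangoldt n : ℂ))) := by
    ext n; rw [logMul_iterate_apply]; rfl
  rw [this]
  refine LSeriesSummable_of_abscissaOfAbsConv_lt_re ?_
  rw [LSeries.absicssaOfAbsConv_logPowMul]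
  exact (abscissaOfAbsConv_twist_le χ).trans_lt (by exact_mod_cast hs)

theorem norm_LSeries_logCoeff {q : ℕ} [NeZero q] (χ : DirichletCharacter ℂ q) (k : ℕ) {s : ℂ}
    (hs : 1 < s.re) : ‖LSeries (logCoeff χ k) s‖ =
      ‖iteratedDeriv k (fun z ↦ -deriv χ.LFunction z / χ.LFunction z) s‖ := by
  have e1 : logCoeff χ k = LSeries.logMul^[k] ((fun n ↦ χ n : ℕ → ℂ) *
      (fun n ↦ (ArithmeticFunction.vonMangoldt n : ℂ))) := by
    ext n; rw [logMul_iterate_apply]; rfl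
  have h := LSeries_iteratedDeriv (f := (fun n ↦ χ n : ℕ → ℂ) *
      (fun n ↦ (ArithmeticFunction.vonMangoldt n : ℂ))) k (s := s)
      ((abscissaOfAbsConv_twist_le χ).trans_lt (by exact_mod_cast hs))
  have h' := congrArg norm h
  rw [norm_mul, norm_pow, norm_neg, norm_one, one_pow, one_mul, ← e1] at h'
  rw [← h']
  congr 1
  refine Filter.EventuallyEq.iteratedDeriv_eq k ?_
  have : ∀ᶠ z : ℂ in 𝓝 s, 1 < z.re := (isOpen_lt continuous_const continuous_re).mem_nhds hs
  filter_upwards [this] with z hz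
  rw [DirichletCharacter.LSeries_twist_vonMangoldt_eq χ hz,
    DirichletCharacter.deriv_LFunction_eq_deriv_LSeries χ hz,
    DirichletCharacter.LFunction_eq_LSeries χ hz]

theorem exists_norm_LSeries_logCoeff_le {κ : ℝ} (hκ : 0 < κ) (hκ' : κ ≤ 1 / 2) (k : ℕ) :
    ∃ C : ℝ, 0 ≤ C ∧ ∀ (q : ℕ) [NeZero q] (χ : DirichletCharacter ℂ q), χ.IsPrimitive → χ ≠ 1 →
      ∀ y σ : ℝ, 1 < σ → σ ≤ 3 / 2 →
        ‖LSeries (logCoeff χ k) (σ + y * I)‖ ≤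
          C * ((|y| + 2) * (q : ℝ) ^ (3 * κ)) ^ (7 + 6 * k) := by
  obtain ⟨C, hC, h⟩ := exists_le_norm_LFunction' hκ hκ'
  obtain ⟨D, hD⟩ : ∃ D : ℝ, D = max C (64 / κ) := ⟨_, rfl⟩
  have hDC : C ≤ D := hD ▸ le_max_left _ _
  have hDκ : 64 / κ ≤ D := hD ▸ le_max_right _ _
  have hD1 : 1 ≤ D := hC.trans hDC
  refine ⟨k.factorial * (6 / κ ^ 2 * (D * 2 ^ 6)) * (D * 2 ^ 6) ^ k, by positivity,
    fun q _ χ hprim hχ y σ hσ hσ2 ↦ ?_⟩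
  have hq1 : (1 : ℝ) ≤ q := by exact_mod_cast NeZero.pos q
  obtain ⟨Q, hQ⟩ : ∃ Q : ℝ, Q = (q : ℝ) ^ (3 * κ) := ⟨_, rfl⟩
  have hQ1 : 1 ≤ Q := hQ ▸ Real.one_le_rpow hq1 (by positivity)
  obtain ⟨P, hP⟩ : ∃ P : ℝ, P = (|y| + 2) * Q := ⟨_, rfl⟩
  have hyP : |y| + 2 ≤ P := by
    rw [hP]; exact le_mul_of_one_le_right (by positivity) hQ1
  have hP1 : 1 ≤ P := by linarith [abs_nonneg y]
  rw [← hQ, ← hP]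
  have hq2 : (q : ℝ) ^ (2 * κ) ≤ Q := by
    rw [hQ]; exact Real.rpow_le_rpow_of_exponent_le hq1 (by linarith)
  obtain ⟨r, hr⟩ : ∃ r : ℝ, r = 1 / (D * (2 * P) ^ 6) := ⟨_, rfl⟩
  have hP6 : 1 ≤ (2 * P) ^ 6 := one_le_pow₀ (by linarith)
  have hr0 : 0 < r := by rw [hr]; positivity
  have hrκ : r ≤ κ / 2 := by
    have h1 : r ≤ 1 / D := by
      rw [hr]; exact one_div_le_one_div_of_le (by linarith) (le_mul_of_one_le_right (by linarith) hP6)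
    refine h1.trans ?_
    rw [div_le_iff₀ (by linarith)]
    have : κ / 2 * (64 / κ) ≤ κ / 2 * D := by gcongr
    have e : κ / 2 * (64 / κ) = 32 := by field_simp; norm_num
    linarith
  have hre : 1 < (σ + y * I : ℂ).re := by simpa using hσ
  rw [norm_LSeries_logCoeff χ k hre]
  have hdisc : ∀ z ∈ Metric.closedBall (σ + y * I : ℂ) r, r ≤ ‖χ.LFunction z‖ ∧
      ‖deriv χ.LFunction z‖ ≤ 6 / κ ^ 2 * P := by
    intro z hz
    have hz' : ‖z - (σ + y * I)‖ ≤ r := by simpa [dist_eq] using hz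
    have h1 := abs_le.mp ((abs_re_le_norm _).trans hz')
    have h2 := abs_le.mp ((abs_im_le_norm _).trans hz')
    simp only [sub_re, add_re, ofReal_re, mul_re, I_re, mul_zero, ofReal_im, I_im, mul_one,
      sub_self, add_zero, sub_im, add_im, mul_im, zero_add] at h1 h2
    have hzim : |z.im| ≤ |y| + 1 / 4 := by
      have := abs_le.mp (le_refl |y|)
      rw [abs_le]; constructor <;> linarith
    constructor
    · have e : ((z.re : ℝ) : ℂ) + (z.im : ℝ) * I = z := re_add_im z
      have hle : r ≤ 1 / (C * ((|z.im| + 2) * (q : ℝ) ^ (3 * κ)) ^ 6) := by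
        rw [hr, ← hQ, hP]
        refine one_div_le_one_div_of_le (by positivity) ?_
        have h4 : (|z.im| + 2) * Q ≤ 2 * ((|y| + 2) * Q) := by
          rw [← mul_assoc]
          gcongr
          linarith [abs_nonneg y]
        gcongr
      have := h q χ hprim hχ z.im z.re (by linarith) (by linarith)
      rw [e] at this
      exact hle.trans this
    · refine (norm_deriv_LFunction_le hχ hκ hκ' (by linarith)).trans ?_
      have h3 : ‖z‖ + 1 ≤ 3 * (|y| + 2) := by
        have := norm_le_abs_re_add_abs_im z
        rw [abs_of_pos (by linarith : 0 < z.re)] at this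
        linarith [abs_nonneg y]
      calc (‖z‖ + 1) * (2 * (q : ℝ) ^ (2 * κ) / κ ^ 2)
          ≤ (3 * (|y| + 2)) * (2 * Q / κ ^ 2) := by gcongr
        _ = 6 / κ ^ 2 * P := by rw [hP]; ring
  have hdiff := DirichletCharacter.differentiable_LFunction hχ
  have hdc : DiffContOnCl ℂ (fun z ↦ -deriv χ.LFunction z / χ.LFunction z)
      (Metric.ball (σ + y * I : ℂ) r) := by
    refine DifferentiableOn.diffContOnCl ?_
    intro z hz
    rw [closure_ball _ hr0.ne'] at hz
    have : χ.LFunction z ≠ 0 := fun h0 ↦ by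
      have := (hdisc z hz).1
      rw [h0, norm_zero] at this
      linarith
    have hd2 : DifferentiableAt ℂ (deriv χ.LFunction) z :=
      (hdiff.contDiff (n := 2)).differentiable_deriv_two z
    exact ((hd2.neg).div (hdiff z) this).differentiableWithinAt
  have := norm_iteratedDeriv_le_of_forall_mem_sphere_norm_le k hr0 hdc
    (C := 6 / κ ^ 2 * P / r) (fun z hz ↦ by
      obtain ⟨h1, h2⟩ := hdisc z (Metric.sphere_subset_closedBall hz)
      rw [norm_div, norm_neg]
      gcongr)
  refine this.trans_eq ?_
  have hrinv : r⁻¹ = D * 2 ^ 6 * P ^ 6 := by rw [hr, one_div, inv_inv]; ring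
  rw [div_eq_mul_inv _ (r ^ k), div_eq_mul_inv _ r, ← inv_pow, hrinv]
  ring

end

section

open Complex Filter Topology MeasureTheory Set
open scoped FourierTransform ContDiff

theorem integrable_norm_mul_pow (g : SchwartzMap ℝ ℂ) (a : ℕ) :
    Integrable (fun ξ : ℝ ↦ ‖g ξ‖ * (2 * Real.pi * |ξ| + 2) ^ a) := by
  have h1 := (g.integrable_pow_mul volume a).const_mul (2 ^ (a - 1) * (2 * Real.pi) ^ a)
  have h2 := (g.integrable (μ := volume)).norm.const_mul (2 ^ (a - 1) * 2 ^ a)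
  refine (h1.add h2).mono' ?_ (.of_forall fun ξ ↦ ?_)
  · exact (g.continuous.norm.mul (by fun_prop)).aestronglyMeasurable
  · have hpi := Real.pi_pos
    have := add_pow_le (by positivity : 0 ≤ 2 * Real.pi * |ξ|) zero_le_two a
    rw [Real.norm_of_nonneg (by positivity)]
    calc _ ≤ ‖g ξ‖ * (2 ^ (a - 1) * ((2 * Real.pi * |ξ|) ^ a + 2 ^ a)) := by gcongr
      _ = _ := by
        simp only [Pi.add_apply, Real.norm_eq_abs]
        rw [mul_pow]; ring

theorem norm_term_add_mul_I (f : ℕ → ℂ) (σ y : ℝ) (n : ℕ) :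
    ‖LSeries.term f (σ + y * I) n‖ = ‖LSeries.term f σ n‖ := by
  rw [LSeries.norm_term_eq, LSeries.norm_term_eq]
  simp

theorem continuous_term (f : ℕ → ℂ) (n : ℕ) : Continuous (fun s : ℂ ↦ LSeries.term f s n) := by
  rcases Nat.eq_zero_or_pos n with rfl | hn
  · simp [continuous_const]
  · have h0 : (n : ℂ) ≠ 0 := by exact_mod_cast hn.ne'
    have : (fun s : ℂ ↦ LSeries.term f s n) = fun s ↦ f n / (n : ℂ) ^ s := by
      ext s; rw [LSeries.term_of_ne_zero hn.ne']
    rw [this]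
    refine continuous_const.div (continuous_const.cpow continuous_id ?_) ?_
    · intro s; left; exact_mod_cast hn
    · intro s; rw [cpow_ne_zero_iff]; exact Or.inl h0

theorem norm_tsum_term_mul_le {f : ℕ → ℂ} {σ K : ℝ} {a : ℕ} (hf : LSeriesSummable f σ)
    (hK : ∀ y : ℝ, ‖LSeries f (σ + y * I)‖ ≤ K * (|y| + 2) ^ a) (g : SchwartzMap ℝ ℂ) (v : ℝ) :
    ‖∑' n, LSeries.term f σ n * g (Real.log n - v)‖ ≤
      K * ∫ ξ : ℝ, ‖(𝓕 g) ξ‖ * (2 * Real.pi * |ξ| + 2) ^ a := by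
  set h : SchwartzMap ℝ ℂ := 𝓕 g with hh
  have hinv : ∀ u, g u = ∫ ξ : ℝ, Complex.exp ((2 * Real.pi * ξ * u : ℝ) * I) * h ξ := by
    intro u
    have : g = 𝓕⁻ h := by rw [hh, FourierTransform.fourierInv_fourier_eq]
    rw [this, SchwartzMap.fourierInv_coe, Real.fourierInv_eq']
    refine integral_congr_ae (.of_forall fun ξ ↦ ?_)
    simp only [smul_eq_mul]
    rw [show (inner ℝ ξ u : ℝ) = ξ * u by
      rw [RCLike.inner_apply, conj_trivial, mul_comm], mul_assoc (2 * Real.pi)]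
  set F : ℕ → ℝ → ℂ := fun n ξ ↦
    Complex.exp ((-(2 * Real.pi * ξ * v) : ℝ) * I) * h ξ *
      LSeries.term f (σ + (-(2 * Real.pi * ξ) : ℝ) * I) n with hF
  have hFn : ∀ n ξ, ‖F n ξ‖ = ‖LSeries.term f σ n‖ * ‖h ξ‖ := by
    intro n ξ
    rw [hF]; simp only
    rw [norm_mul, norm_mul, norm_exp_ofReal_mul_I, one_mul, norm_term_add_mul_I, mul_comm]
  have hFc : ∀ n, Continuous (F n) := by
    intro n
    rw [hF]
    refine Continuous.mul (Continuous.mul (by fun_prop) h.continuous) ?_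
    exact (continuous_term f n).comp (by fun_prop)
  have hhi : Integrable (fun ξ ↦ ‖h ξ‖) := h.integrable.norm
  have hFint : ∀ n, Integrable (F n) := fun n ↦
    (hhi.const_mul ‖LSeries.term f σ n‖).mono' (hFc n).aestronglyMeasurable
      (.of_forall fun ξ ↦ (hFn n ξ).le)
  have hsum : Summable fun n ↦ ∫ ξ, ‖F n ξ‖ := by
    simp only [hFn, integral_const_mul]
    exact hf.norm.mul_right _
  have hmain := integral_tsum_of_summable_integral_norm hFint hsum
  have hterm : ∀ n, ∫ ξ, F n ξ = LSeries.term f σ n * g (Real.log n - v) := by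
    intro n
    rcases Nat.eq_zero_or_pos n with rfl | hn
    · simp [hF]
    · rw [hinv, ← integral_const_mul]
      congr 1
      ext ξ
      have h0 : (n : ℂ) ≠ 0 := by exact_mod_cast hn.ne'
      rw [hF]; simp only
      rw [LSeries.term_of_ne_zero hn.ne', LSeries.term_of_ne_zero hn.ne', cpow_add _ _ h0,
        cpow_def_of_ne_zero h0 ((-(2 * Real.pi * ξ) : ℝ) * I), ← natCast_log,
        div_mul_eq_div_div, div_eq_mul_inv _ (Complex.exp _), ← Complex.exp_neg]
      have : Complex.exp ((2 * Real.pi * ξ * (Real.log n - v) : ℝ) * I) =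
          Complex.exp ((-(2 * Real.pi * ξ * v) : ℝ) * I) *
            Complex.exp (-((Real.log n : ℂ) * ((-(2 * Real.pi * ξ) : ℝ) * I))) := by
        rw [← Complex.exp_add]; congr 1; push_cast; ring
      rw [this]; ring
  simp only [hterm] at hmain
  rw [hmain, ← integral_const_mul]
  refine norm_integral_le_of_norm_le ((integrable_norm_mul_pow h a).const_mul K)
    (.of_forall fun ξ ↦ ?_)
  have : ∑' n, F n ξ = Complex.exp ((-(2 * Real.pi * ξ * v) : ℝ) * I) * h ξ *
      LSeries f (σ + (-(2 * Real.pi * ξ) : ℝ) * I) := by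
    rw [hF]; simp only; rw [tsum_mul_left]; rfl
  rw [this, norm_mul, norm_mul, norm_exp_ofReal_mul_I, one_mul]
  have h3 := hK (-(2 * Real.pi * ξ))
  rw [abs_neg, abs_mul, abs_of_pos (by positivity : 0 < 2 * Real.pi)] at h3
  calc _ ≤ ‖h ξ‖ * (K * (2 * Real.pi * |ξ| + 2) ^ a) := by gcongr
    _ = _ := by ring

theorem exists_forall_ge_eq_zero {ψ : ℝ → ℂ} (hψ : HasCompactSupport ψ) (v : ℝ) :
    ∃ M : ℕ, 1 ≤ M ∧ ∀ n : ℕ, M ≤ n → ψ (Real.log n - v) = 0 := by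
  obtain ⟨R, hR⟩ := hψ.isCompact.isBounded.subset_closedBall 0
  refine ⟨⌈Real.exp (R + v + 1)⌉₊, Nat.ceil_pos.mpr (Real.exp_pos _), fun n hn ↦ ?_⟩
  by_contra h
  have h1 := hR (subset_tsupport _ (Function.mem_support.mpr h))
  have h2 : Real.exp (R + v + 1) ≤ n := (Nat.le_ceil _).trans (by exact_mod_cast hn)
  have h3 := (Real.le_log_iff_exp_le ((Real.exp_pos _).trans_le h2)).mpr h2
  simp only [Metric.mem_closedBall, dist_zero_right, Real.norm_eq_abs, abs_le] at h1
  linarith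

theorem exists_norm_tsum_logCoeff_le {ψ : ℝ → ℂ} (hψ : ContDiff ℝ ∞ ψ) (hψ' : HasCompactSupport ψ)
    {κ : ℝ} (hκ : 0 < κ) (hκ' : κ ≤ 1 / 2) (k : ℕ) :
    ∃ C : ℝ, 0 ≤ C ∧ ∀ (q : ℕ) [NeZero q] (χ : DirichletCharacter ℂ q), χ.IsPrimitive → χ ≠ 1 →
      ∀ X : ℝ, 0 < X → ‖∑' n, logCoeff χ k n * ψ (Real.log n - Real.log X)‖ ≤
        C * X * ((q : ℝ) ^ (3 * κ)) ^ (7 + 6 * k) := by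
  obtain ⟨C, hC, h⟩ := exists_norm_LSeries_logCoeff_le hκ hκ' k
  have hWs : ContDiff ℝ ∞ (fun u : ℝ ↦ Complex.exp u * ψ u) := by
    refine ContDiff.mul ?_ hψ
    exact (ofRealCLM.contDiff.cexp)
  have hWc : HasCompactSupport (fun u : ℝ ↦ Complex.exp u * ψ u) := hψ'.mul_left
  obtain ⟨g, hg⟩ : ∃ g : SchwartzMap ℝ ℂ, ∀ u, g u = Complex.exp u * ψ u :=
    ⟨hWc.toSchwartzMap hWs, fun u ↦ rfl⟩
  refine ⟨C * ∫ ξ : ℝ, ‖(𝓕 g) ξ‖ * (2 * Real.pi * |ξ| + 2) ^ (7 + 6 * k), ?_, ?_⟩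
  · refine mul_nonneg hC (integral_nonneg fun ξ ↦ ?_)
    have := Real.pi_pos
    positivity
  intro q _ χ hprim hχ X hX
  set J : ℝ := ∫ ξ : ℝ, ‖(𝓕 g) ξ‖ * (2 * Real.pi * |ξ| + 2) ^ (7 + 6 * k)
  obtain ⟨M, hM1, hM⟩ := exists_forall_ge_eq_zero hψ' (Real.log X)
  have hfin : ∀ c : ℕ → ℂ, (∑' n, c n * ψ (Real.log n - Real.log X)) =
      ∑ n ∈ Finset.range M, c n * ψ (Real.log n - Real.log X) := fun c ↦
    tsum_eq_sum fun n hn ↦ by rw [hM n (by simpa using hn), mul_zero]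
  have hfing : ∀ c : ℕ → ℂ, (∑' n, c n * g (Real.log n - Real.log X)) =
      ∑ n ∈ Finset.range M, c n * g (Real.log n - Real.log X) := fun c ↦
    tsum_eq_sum fun n hn ↦ by rw [hg, hM n (by simpa using hn), mul_zero, mul_zero]
  have hbound : ∀ σ : ℝ, 1 < σ → σ ≤ 3 / 2 →
      ‖∑ n ∈ Finset.range M, LSeries.term (logCoeff χ k) σ n * g (Real.log n - Real.log X)‖ ≤
        C * ((q : ℝ) ^ (3 * κ)) ^ (7 + 6 * k) * J := by
    intro σ h1 h2
    have := norm_tsum_term_mul_le (LSeriesSummable_logCoeff χ k (s := σ) (by simpa using h1))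
      (K := C * ((q : ℝ) ^ (3 * κ)) ^ (7 + 6 * k)) (a := 7 + 6 * k) (fun y ↦ ?_) g (Real.log X)
    · rwa [hfing] at this
    · refine (h q χ hprim hχ y σ h1 h2).trans_eq ?_
      rw [mul_pow]; ring
  have hlim : Tendsto (fun σ : ℝ ↦ ‖∑ n ∈ Finset.range M, LSeries.term (logCoeff χ k) σ n *
      g (Real.log n - Real.log X)‖) (𝓝[>] 1)
      (𝓝 ‖∑ n ∈ Finset.range M, LSeries.term (logCoeff χ k) (1 : ℝ) n *
        g (Real.log n - Real.log X)‖) := by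
    refine tendsto_nhdsWithin_of_tendsto_nhds (Continuous.tendsto ?_ 1)
    refine continuous_norm.comp (continuous_finsetSum _ fun n _ ↦ ?_)
    exact ((continuous_term _ n).comp continuous_ofReal).mul continuous_const
  have hle := le_of_tendsto hlim (b := C * ((q : ℝ) ^ (3 * κ)) ^ (7 + 6 * k) * J) (by
    have : ∀ᶠ σ : ℝ in 𝓝[>] 1, σ ≤ 3 / 2 :=
      nhdsWithin_le_nhds (eventually_le_nhds (by norm_num))
    filter_upwards [this, self_mem_nhdsWithin] with σ h2 h1 using hbound σ h1 h2)
  rw [hfin]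
  have e : ∑ n ∈ Finset.range M, LSeries.term (logCoeff χ k) (1 : ℝ) n *
        g (Real.log n - Real.log X) =
      (X : ℂ)⁻¹ * ∑ n ∈ Finset.range M, logCoeff χ k n * ψ (Real.log n - Real.log X) := by
    rw [Finset.mul_sum]
    refine Finset.sum_congr rfl fun n _ ↦ ?_
    rcases Nat.eq_zero_or_pos n with rfl | hn
    · simp [logCoeff]
    · have hn' : (0 : ℝ) < n := by exact_mod_cast hn
      have h0 : (n : ℂ) ≠ 0 := by exact_mod_cast hn.ne'
      have hX0 : (X : ℂ) ≠ 0 := by exact_mod_cast hX.ne'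
      rw [LSeries.term_of_ne_zero hn.ne', hg, ← ofReal_exp, Real.exp_sub, Real.exp_log hn',
        Real.exp_log hX]
      push_cast
      rw [cpow_one]
      field_simp
  rw [e, norm_mul, norm_inv, norm_real, Real.norm_of_nonneg hX.le, inv_mul_le_iff₀ hX] at hle
  refine hle.trans_eq ?_
  ring

end

section

open Complex Filter Topology MeasureTheory Set
open scoped FourierTransform ContDiff

theorem logCoeff_eq {q : ℕ} (χ : DirichletCharacter ℂ q) (k n : ℕ) :
    logCoeff χ k n = ((Real.log n : ℝ) : ℂ) ^ k * logCoeff χ 0 n := by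
  simp [logCoeff]

theorem tsum_logCoeff_eq_sum {q : ℕ} (χ : DirichletCharacter ℂ q) {ψ : ℝ → ℂ}
    (hψ' : HasCompactSupport ψ) (k : ℕ) (v : ℝ) :
    ∑' n, logCoeff χ k n * ψ (Real.log n - v) = ∑ j ∈ Finset.range (k + 1),
      (v : ℂ) ^ j * (k.choose j) *
        ∑' n, logCoeff χ 0 n * ((fun u : ℝ ↦ (u : ℂ) ^ (k - j) * ψ u) (Real.log n - v)) := by
  obtain ⟨M, -, hM⟩ := exists_forall_ge_eq_zero hψ' v
  have hfin : ∀ c : ℕ → ℂ, (∑' n, c n * ψ (Real.log n - v)) =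
      ∑ n ∈ Finset.range M, c n * ψ (Real.log n - v) := fun c ↦
    tsum_eq_sum fun n hn ↦ by rw [hM n (by simpa using hn), mul_zero]
  have hfin2 : ∀ i, (∑' n, logCoeff χ 0 n * ((fun u : ℝ ↦ (u : ℂ) ^ i * ψ u) (Real.log n - v))) =
      ∑ n ∈ Finset.range M, logCoeff χ 0 n * (((Real.log n - v : ℝ) : ℂ) ^ i * ψ (Real.log n - v)) :=
    fun i ↦ tsum_eq_sum fun n hn ↦ by simp only; rw [hM n (by simpa using hn), mul_zero, mul_zero]
  rw [hfin]
  simp only [hfin2, Finset.mul_sum]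
  rw [Finset.sum_comm]
  refine Finset.sum_congr rfl fun n _ ↦ ?_
  rw [logCoeff_eq χ k]
  have : ((Real.log n : ℝ) : ℂ) = (v : ℂ) + ((Real.log n - v : ℝ) : ℂ) := by push_cast; ring
  rw [this, add_pow, Finset.sum_mul, Finset.sum_mul]
  refine Finset.sum_congr rfl fun j _ ↦ ?_
  ring

theorem rpow_pow_le_log {q A k : ℕ} {L : ℝ} (hL : 1 ≤ L) (hq : (q : ℝ) ≤ L ^ A) :
    ((q : ℝ) ^ (3 * (1 / (3 * (7 + 6 * k) * (A + 1)) : ℝ))) ^ (7 + 6 * k) ≤ L := by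
  have h1 : ((q : ℝ) ^ (3 * (1 / (3 * (7 + 6 * k) * (A + 1)) : ℝ))) ^ (7 + 6 * k)
      = (q : ℝ) ^ (1 / (A + 1) : ℝ) := by
    rw [← Real.rpow_mul_natCast (Nat.cast_nonneg _)]
    congr 1
    push_cast
    field_simp
  rw [h1]
  calc (q : ℝ) ^ (1 / (A + 1) : ℝ) ≤ (L ^ A) ^ (1 / (A + 1) : ℝ) := by gcongr
    _ = L ^ ((A : ℝ) * (1 / (A + 1) : ℝ)) := by rw [Real.rpow_natCast_mul (by linarith)]
    _ ≤ L ^ (1 : ℝ) := by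
        refine Real.rpow_le_rpow_of_exponent_le hL ?_
        rw [mul_one_div, div_le_one (by positivity)]
        linarith
    _ = L := Real.rpow_one L

theorem one_le_log_of_three_le {X : ℝ} (hX : 3 ≤ X) : 1 ≤ Real.log X := by
  rw [Real.le_log_iff_exp_le (by linarith)]
  exact Real.exp_one_lt_three.le.trans hX

theorem norm_tsum_logCoeff_le (A k : ℕ) {ψ : ℝ → ℂ} (hψ : ContDiff ℝ ∞ ψ)
    (hψ' : HasCompactSupport ψ) :
    ∃ C : ℝ, 0 ≤ C ∧ ∀ (q : ℕ) [NeZero q] (χ : DirichletCharacter ℂ q), χ.IsPrimitive → χ ≠ 1 →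
      ∀ X : ℝ, 3 ≤ X → (q : ℝ) ≤ Real.log X ^ A →
        ‖∑' n, logCoeff χ k n * ψ (Real.log n - Real.log X)‖ ≤ C * X * Real.log X := by
  obtain ⟨C, hC, h⟩ := exists_norm_tsum_logCoeff_le hψ hψ'
    (κ := (1 / (3 * (7 + 6 * k) * (A + 1)) : ℝ)) (by positivity)
    (by
      apply one_div_le_one_div_of_le (by norm_num)
      have h1 : (2 : ℝ) ≤ 3 * (7 + 6 * k) := by
        have : (0 : ℝ) ≤ k := Nat.cast_nonneg k
        linarith
      have h2 : (1 : ℝ) ≤ A + 1 := by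
        have : (0 : ℝ) ≤ A := Nat.cast_nonneg A
        linarith
      nlinarith) k
  refine ⟨C, hC, fun q _ χ hprim hχ X hX hq ↦ ?_⟩
  refine (h q χ hprim hχ X (by linarith)).trans ?_
  have := rpow_pow_le_log (k := k) (one_le_log_of_three_le hX) hq
  gcongr

/-- The Siegel-Walfisz theorem, for smoothly weighted character sums over prime powers. -/
theorem siegel_walfisz (A a : ℕ) : ∀ {ψ : ℝ → ℂ}, ContDiff ℝ ∞ ψ → HasCompactSupport ψ →
    ∃ C : ℝ, 0 ≤ C ∧ ∀ (q : ℕ) [NeZero q] (χ : DirichletCharacter ℂ q), χ.IsPrimitive → χ ≠ 1 →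
      ∀ X : ℝ, 3 ≤ X → (q : ℝ) ≤ Real.log X ^ A →
        Real.log X ^ a * ‖∑' n, logCoeff χ 0 n * ψ (Real.log n - Real.log X)‖ ≤
          C * X * Real.log X := by
  induction a with
  | zero =>
    intro ψ hψ hψ'
    simpa using norm_tsum_logCoeff_le A 0 hψ hψ'
  | succ a ih =>
    intro ψ hψ hψ'
    obtain ⟨C, hC, h⟩ := norm_tsum_logCoeff_le A (a + 1) hψ hψ'
    have hs : ∀ i : ℕ, ContDiff ℝ ∞ (fun u : ℝ ↦ (u : ℂ) ^ i * ψ u) := fun i ↦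
      (ofRealCLM.contDiff.pow i).mul hψ
    have hc : ∀ i : ℕ, HasCompactSupport (fun u : ℝ ↦ (u : ℂ) ^ i * ψ u) := fun i ↦ hψ'.mul_left
    choose D hD hD' using fun i ↦ ih (hs i) (hc i)
    refine ⟨C + ∑ j ∈ Finset.range (a + 1), ((a + 1).choose j) * D (a + 1 - j),
      add_nonneg hC (Finset.sum_nonneg fun j _ ↦ mul_nonneg (Nat.cast_nonneg _) (hD _)),
      fun q _ χ hprim hχ X hX hq ↦ ?_⟩
    have hL := one_le_log_of_three_le hX
    have key := tsum_logCoeff_eq_sum χ hψ' (a + 1) (Real.log X)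
    rw [Finset.sum_range_succ] at key
    simp only [Nat.choose_self, Nat.cast_one, mul_one, Nat.sub_self, pow_zero, one_mul] at key
    have e : Real.log X ^ (a + 1) * ‖∑' n, logCoeff χ 0 n * ψ (Real.log n - Real.log X)‖ =
        ‖((Real.log X : ℝ) : ℂ) ^ (a + 1) *
          ∑' n, logCoeff χ 0 n * ψ (Real.log n - Real.log X)‖ := by
      rw [norm_mul, norm_pow, norm_real, Real.norm_of_nonneg (by linarith)]
    rw [e, eq_sub_iff_add_eq'.mpr key.symm, add_mul, add_mul]
    refine (norm_sub_le _ _).trans ?_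
    gcongr
    · exact h q χ hprim hχ X hX hq
    · rw [Finset.sum_mul, Finset.sum_mul]
      refine norm_sum_le_of_le _ fun j hj ↦ ?_
      have hj : j ≤ a := by simpa [Nat.lt_succ_iff] using hj
      rw [norm_mul, norm_mul, norm_pow, norm_real, Real.norm_of_nonneg (by linarith),
        norm_natCast]
      have h1 := hD' (a + 1 - j) q χ hprim hχ X hX hq
      have h2 : Real.log X ^ j ≤ Real.log X ^ a := pow_le_pow_right₀ hL hj
      calc _ ≤ Real.log X ^ a * ((a + 1).choose j) * ‖∑' n, logCoeff χ 0 n *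
            ((fun u : ℝ ↦ (u : ℂ) ^ (a + 1 - j) * ψ u) (Real.log n - Real.log X))‖ := by
            gcongr
        _ = ((a + 1).choose j) * (Real.log X ^ a * ‖∑' n, logCoeff χ 0 n *
            ((fun u : ℝ ↦ (u : ℂ) ^ (a + 1 - j) * ψ u) (Real.log n - Real.log X))‖) := by ring
        _ ≤ ((a + 1).choose j) * (D (a + 1 - j) * X * Real.log X) := by gcongr
        _ = _ := by ring

end

section

open Complex Filter Topology MeasureTheory Set

/-- The trivial large sieve inequality, for almost orthogonal families of bounded functions. -/
theorem sum_norm_sq_le_of_almost_orthogonal {ι : Type*} (T : Finset ι) (f : ι → ℕ → ℂ)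
    (I : Finset ℕ) {M : ℝ} (hM : 0 ≤ M) (hf : ∀ i ∈ T, ∀ n ∈ I, ‖f i n‖ ≤ 1)
    (hoff : ∀ i ∈ T, ∀ j ∈ T, i ≠ j → ‖∑ n ∈ I, star (f i n) * f j n‖ ≤ M) (a : ℕ → ℂ) :
    ∑ i ∈ T, ‖∑ n ∈ I, a n * f i n‖ ^ 2 ≤ (I.card + T.card * M) * ∑ n ∈ I, ‖a n‖ ^ 2 := by
  classical
  obtain ⟨b, hb⟩ : ∃ b : ι → ℂ, ∀ i, b i = ∑ n ∈ I, a n * f i n := ⟨_, fun _ ↦ rfl⟩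
  simp_rw [← hb]
  obtain ⟨S, hS⟩ : ∃ S : ℝ, S = ∑ i ∈ T, ‖b i‖ ^ 2 := ⟨_, rfl⟩
  have hS0 : 0 ≤ S := hS ▸ Finset.sum_nonneg fun _ _ ↦ sq_nonneg _
  have hdual : ∑ n ∈ I, ‖∑ i ∈ T, star (b i) * f i n‖ ^ 2 ≤ (I.card + T.card * M) * S := by
    have h1 : ((∑ n ∈ I, ‖∑ i ∈ T, star (b i) * f i n‖ ^ 2 : ℝ) : ℂ) =
        ∑ i ∈ T, ∑ j ∈ T, b i * star (b j) * ∑ n ∈ I, star (f i n) * f j n := by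
      push_cast
      have : ∀ n, (‖∑ i ∈ T, star (b i) * f i n‖ : ℂ) ^ 2 =
          ∑ i ∈ T, ∑ j ∈ T, b i * star (b j) * (star (f i n) * f j n) := fun n ↦ by
        rw [← conj_mul', map_sum, Finset.sum_mul_sum]
        refine Finset.sum_congr rfl fun i _ ↦ Finset.sum_congr rfl fun j _ ↦ ?_
        simp
        ring
      simp_rw [this]
      rw [Finset.sum_comm]
      refine Finset.sum_congr rfl fun i _ ↦ ?_
      rw [Finset.sum_comm]
      exact Finset.sum_congr rfl fun j _ ↦ by rw [Finset.mul_sum]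
    have h2 : ∑ n ∈ I, ‖∑ i ∈ T, star (b i) * f i n‖ ^ 2 =
        ‖((∑ n ∈ I, ‖∑ i ∈ T, star (b i) * f i n‖ ^ 2 : ℝ) : ℂ)‖ := by
      rw [norm_real, Real.norm_of_nonneg (Finset.sum_nonneg fun _ _ ↦ sq_nonneg _)]
    rw [h2, h1]
    have h3 : ∀ i ∈ T, ∀ j ∈ T, ‖b i * star (b j) * ∑ n ∈ I, star (f i n) * f j n‖ ≤
        (if i = j then ‖b i‖ ^ 2 * I.card else 0) + ‖b i‖ * ‖b j‖ * M := by
      intro i hi j hj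
      rw [norm_mul, norm_mul, norm_star]
      by_cases hij : i = j
      · subst hij
        rw [if_pos rfl, ← pow_two]
        have : ‖∑ n ∈ I, star (f i n) * f i n‖ ≤ I.card := by
          refine (norm_sum_le_of_le (f := fun n ↦ star (f i n) * f i n) I (n := fun _ ↦ 1)
            fun n hn ↦ ?_).trans (by simp)
          rw [norm_mul, norm_star]
          exact mul_le_one₀ (hf i hi n hn) (norm_nonneg _) (hf i hi n hn)
        have h4 : ‖b i‖ ^ 2 * ‖∑ n ∈ I, star (f i n) * f i n‖ ≤ ‖b i‖ ^ 2 * I.card := by gcongr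
        have h5 : 0 ≤ ‖b i‖ ^ 2 * M := by positivity
        linarith
      · rw [if_neg hij, zero_add]
        have := hoff i hi j hj hij
        gcongr
    refine (norm_sum_le_of_le _ fun i hi ↦ norm_sum_le_of_le _ (h3 i hi)).trans ?_
    simp_rw [Finset.sum_add_distrib, Finset.sum_ite_eq]
    have h6 : ∑ i ∈ T, (if i ∈ T then ‖b i‖ ^ 2 * (I.card : ℝ) else 0) = S * I.card := by
      rw [hS, Finset.sum_mul]
      exact Finset.sum_congr rfl fun i hi ↦ by rw [if_pos hi]
    have h7 : ∑ i ∈ T, ∑ j ∈ T, ‖b i‖ * ‖b j‖ * M = (∑ i ∈ T, ‖b i‖) ^ 2 * M := by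
      rw [pow_two, Finset.sum_mul_sum, Finset.sum_mul]
      exact Finset.sum_congr rfl fun i _ ↦ by rw [Finset.sum_mul]
    have h8 : (∑ i ∈ T, ‖b i‖) ^ 2 ≤ T.card * S := by
      rw [hS]
      exact sq_sum_le_card_mul_sum_sq
    rw [h6, h7]
    have := mul_le_mul_of_nonneg_right h8 hM
    linarith
  have hSeq : (S : ℂ) = ∑ n ∈ I, a n * ∑ i ∈ T, star (b i) * f i n := by
    rw [hS]
    push_cast
    simp_rw [← conj_mul', Finset.mul_sum]
    rw [Finset.sum_comm]
    refine Finset.sum_congr rfl fun i _ ↦ ?_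
    nth_rewrite 2 [hb i]
    rw [Finset.mul_sum]
    exact Finset.sum_congr rfl fun n _ ↦ by simp; ring
  have hS2 : S ^ 2 ≤ (∑ n ∈ I, ‖a n‖ ^ 2) * ((I.card + T.card * M) * S) := by
    have h1 : S ≤ ∑ n ∈ I, ‖a n‖ * ‖∑ i ∈ T, star (b i) * f i n‖ := by
      calc S = ‖(S : ℂ)‖ := by rw [norm_real, Real.norm_of_nonneg hS0]
        _ ≤ _ := by
          rw [hSeq]
          exact norm_sum_le_of_le _ fun n _ ↦ (norm_mul _ _).le
    calc S ^ 2 ≤ (∑ n ∈ I, ‖a n‖ * ‖∑ i ∈ T, star (b i) * f i n‖) ^ 2 := by gcongr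
      _ ≤ (∑ n ∈ I, ‖a n‖ ^ 2) * ∑ n ∈ I, ‖∑ i ∈ T, star (b i) * f i n‖ ^ 2 :=
        Finset.sum_mul_sq_le_sq_mul_sq _ _ _
      _ ≤ _ := by gcongr
  rw [← hS]
  rcases hS0.eq_or_lt with h | h
  · rw [← h]
    positivity
  · refine le_of_mul_le_mul_right ?_ h
    calc S * S = S ^ 2 := (pow_two S).symm
      _ ≤ _ := hS2
      _ = _ := by ring

/-- The type of all Dirichlet characters of all moduli. -/
abbrev DChar : Type := Σ q : ℕ, DirichletCharacter ℂ q

/-- The value of a Dirichlet character at a natural number. -/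
noncomputable def DChar.ev (x : DChar) (n : ℕ) : ℂ := x.2 n

theorem DChar.norm_ev_le (x : DChar) (n : ℕ) : ‖x.ev n‖ ≤ 1 := x.2.norm_le_one _

/-- Finite families of nontrivial primitive characters with conductor at most `Q`. -/
structure DChar.Family (Q : ℕ) (T : Finset DChar) : Prop where
  pos : ∀ x ∈ T, 0 < x.1
  le : ∀ x ∈ T, x.1 ≤ Q
  prim : ∀ x ∈ T, x.2.IsPrimitive
  ne : ∀ x ∈ T, x.2 ≠ 1

theorem DChar.prodChar_inv_ne_one {x y : DChar} (hx : 0 < x.1) (hy : 0 < y.1)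
    (hx' : x.2.IsPrimitive) (hy' : y.2.IsPrimitive) (hxy : x ≠ y) : prodChar x.2⁻¹ y.2 ≠ 1 := by
  obtain ⟨q, χ⟩ := x
  obtain ⟨r, ξ⟩ := y
  simp only at hx hy hx' hy' ⊢
  have : NeZero q := ⟨hx.ne'⟩
  have : NeZero r := ⟨hy.ne'⟩
  intro h
  rw [prodChar, map_inv, inv_mul_eq_one] at h
  have h4 := congrArg DirichletCharacter.conductor h
  rw [DirichletCharacter.conductor_changeLevel, DirichletCharacter.conductor_changeLevel,
    (DirichletCharacter.isPrimitive_def _).mp hx', (DirichletCharacter.isPrimitive_def _).mp hy']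
    at h4
  subst h4
  exact hxy (by rw [DirichletCharacter.changeLevel_injective _ h])

theorem DChar.norm_sum_star_mul_le {Q : ℕ} {T : Finset DChar} (hT : DChar.Family Q T) {x y : DChar}
    (hx : x ∈ T) (hy : y ∈ T) (hxy : x ≠ y) (a b : ℕ) :
    ‖∑ n ∈ Finset.Ico a b, star (x.ev n) * y.ev n‖ ≤ (Q : ℝ) ^ 2 := by
  have hx0 := hT.pos x hx
  have hy0 := hT.pos y hy
  have : NeZero (x.1 * y.1) := ⟨(Nat.mul_pos hx0 hy0).ne'⟩
  have h := norm_sum_Ico_char_le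
    (DChar.prodChar_inv_ne_one hx0 hy0 (hT.prim x hx) (hT.prim y hy) hxy) a b
  simp_rw [prodChar_apply] at h
  simp_rw [DChar.ev, MulChar.star_apply']
  refine h.trans ?_
  rw [pow_two, ← Nat.cast_mul]
  exact_mod_cast Nat.mul_le_mul (hT.le x hx) (hT.le y hy)

theorem DChar.card_le {Q : ℕ} {T : Finset DChar} (hT : DChar.Family Q T) : T.card ≤ Q ^ 2 := by
  classical
  have hsub : T ⊆ (Finset.Icc 1 Q).sigma (fun _ ↦ Finset.univ) := fun x hx ↦ by
    simp only [Finset.mem_sigma, Finset.mem_Icc, Finset.mem_univ, and_true]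
    exact ⟨hT.pos x hx, hT.le x hx⟩
  refine (Finset.card_le_card hsub).trans ?_
  rw [Finset.card_sigma]
  calc ∑ q ∈ Finset.Icc 1 Q, (Finset.univ : Finset (DirichletCharacter ℂ q)).card
      ≤ ∑ q ∈ Finset.Icc 1 Q, Q := by
        refine Finset.sum_le_sum fun q hq ↦ ?_
        rw [Finset.mem_Icc] at hq
        have : NeZero q := ⟨by omega⟩
        rw [Finset.card_univ, ← Nat.card_eq_fintype_card,
          DirichletCharacter.card_eq_totient_of_hasEnoughRootsOfUnity]
        exact (Nat.totient_le q).trans hq.2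
    _ = Q ^ 2 := by simp [pow_two]

theorem DChar.large_sieve {Q : ℕ} {T : Finset DChar} (hT : DChar.Family Q T) (a b : ℕ)
    (c : ℕ → ℂ) : ∑ x ∈ T, ‖∑ n ∈ Finset.Ico a b, c n * x.ev n‖ ^ 2 ≤
      ((b - a : ℕ) + (Q : ℝ) ^ 4) * ∑ n ∈ Finset.Ico a b, ‖c n‖ ^ 2 := by
  refine (sum_norm_sq_le_of_almost_orthogonal T DChar.ev _ (sq_nonneg (Q : ℝ))
    (fun x _ n _ ↦ x.norm_ev_le n)
    (fun x hx y hy hxy ↦ DChar.norm_sum_star_mul_le hT hx hy hxy a b) c).trans ?_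
  rw [Nat.card_Ico]
  have : (T.card : ℝ) ≤ (Q : ℝ) ^ 2 := by exact_mod_cast DChar.card_le hT
  have h2 : (T.card : ℝ) * (Q : ℝ) ^ 2 ≤ (Q : ℝ) ^ 4 := by
    calc _ ≤ (Q : ℝ) ^ 2 * (Q : ℝ) ^ 2 := by gcongr
      _ = _ := by ring
  gcongr

/-- The bilinear form of the large sieve inequality. -/
theorem DChar.bilinear_large_sieve {Q : ℕ} {T : Finset DChar} (hT : DChar.Family Q T)
    (a b a' b' : ℕ) {A B : ℝ} (hA : 0 ≤ A) (hB : 0 ≤ B) (c d : ℕ → ℂ) (hc : ∀ n, ‖c n‖ ≤ A)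
    (hd : ∀ n ∈ Finset.Ico a' b', ‖d n‖ ≤ B) {N N' : ℝ} (hN : ((b - a : ℕ) : ℝ) + (Q : ℝ) ^ 4 ≤ N)
    (hN' : ((b' - a' : ℕ) : ℝ) + (Q : ℝ) ^ 4 ≤ N') :
    ∑ x ∈ T, ‖∑ n ∈ Finset.Ico a b, c n * x.ev n‖ * ‖∑ n ∈ Finset.Ico a' b', d n * x.ev n‖ ≤
      N * N' * (A * B) := by
  have hN0 : 0 ≤ N := le_trans (by positivity) hN
  have hN0' : 0 ≤ N' := le_trans (by positivity) hN'
  have key : ∀ (a b : ℕ) (A N : ℝ) (c : ℕ → ℂ), 0 ≤ A → (∀ n ∈ Finset.Ico a b, ‖c n‖ ≤ A) →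
      ((b - a : ℕ) : ℝ) + (Q : ℝ) ^ 4 ≤ N →
      ∑ x ∈ T, ‖∑ n ∈ Finset.Ico a b, c n * x.ev n‖ ^ 2 ≤ (N * A) ^ 2 := by
    intro a b A N c hA hc hN
    have hN0 : 0 ≤ N := le_trans (by positivity) hN
    refine (DChar.large_sieve hT a b c).trans ?_
    have h1 : ∑ n ∈ Finset.Ico a b, ‖c n‖ ^ 2 ≤ N * A ^ 2 := by
      calc ∑ n ∈ Finset.Ico a b, ‖c n‖ ^ 2 ≤ ∑ n ∈ Finset.Ico a b, A ^ 2 :=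
            Finset.sum_le_sum fun n hn ↦ pow_le_pow_left₀ (norm_nonneg _) (hc n hn) 2
        _ = (b - a : ℕ) * A ^ 2 := by simp
        _ ≤ N * A ^ 2 := by
          have : (0 : ℝ) ≤ (Q : ℝ) ^ 4 := by positivity
          gcongr
          linarith
    calc _ ≤ N * (N * A ^ 2) := by gcongr
      _ = _ := by ring
  have h1 := key a b A N c hA (fun n _ ↦ hc n) hN
  have h2 := key a' b' B N' d hB hd hN'
  have h3 := Finset.sum_mul_sq_le_sq_mul_sq T (fun x ↦ ‖∑ n ∈ Finset.Ico a b, c n * x.ev n‖)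
    (fun x ↦ ‖∑ n ∈ Finset.Ico a' b', d n * x.ev n‖)
  refine le_of_sq_le_sq ?_ (by positivity)
  calc _ ≤ _ := h3
    _ ≤ (N * A) ^ 2 * (N' * B) ^ 2 := by gcongr
    _ = _ := by ring

end

section

open Complex Filter Topology MeasureTheory Set

/-- A bounded Lipschitz weight supported in `[0, κ]`. -/
structure IsWeight (ψ : ℝ → ℂ) (P κ : ℝ) : Prop where
  nonneg : 0 ≤ κ
  bound : ∀ u, ‖ψ u‖ ≤ P
  lip : ∀ u v, ‖ψ u - ψ v‖ ≤ P * |u - v|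
  left : ∀ u ≤ 0, ψ u = 0
  right : ∀ u, κ ≤ u → ψ u = 0

theorem IsWeight.P_nonneg {ψ : ℝ → ℂ} {P κ : ℝ} (h : IsWeight ψ P κ) : 0 ≤ P :=
  (norm_nonneg _).trans (h.bound 0)

theorem sum_conv_eq (f g : ArithmeticFunction ℂ) (h : ℕ → ℂ) (N : ℕ) (hh : ∀ n ≥ N, h n = 0) :
    ∑ n ∈ Finset.Ico 1 N, (f * g) n * h n =
      ∑ m ∈ Finset.Ico 1 N, ∑ l ∈ Finset.Ico 1 N, f m * g l * h (m * l) := by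
  classical
  rw [← Finset.sum_product']
  have h1 : ∑ p ∈ Finset.Ico 1 N ×ˢ Finset.Ico 1 N, f p.1 * g p.2 * h (p.1 * p.2) =
      ∑ p ∈ (Finset.Ico 1 N ×ˢ Finset.Ico 1 N).filter (fun p ↦ p.1 * p.2 < N),
        f p.1 * g p.2 * h (p.1 * p.2) := by
    rw [Finset.sum_filter]
    refine Finset.sum_congr rfl fun p _ ↦ ?_
    split_ifs with hp
    · rfl
    · rw [hh _ (not_lt.mp hp), mul_zero]
  rw [h1, ← Finset.sum_fiberwise_of_maps_to (t := Finset.Ico 1 N) (g := fun p : ℕ × ℕ ↦ p.1 * p.2)]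
  · refine Finset.sum_congr rfl fun n hn ↦ ?_
    rw [Finset.mem_Ico] at hn
    rw [ArithmeticFunction.mul_apply, Finset.sum_mul]
    refine Finset.sum_congr ?_ fun p hp ↦ ?_
    · ext ⟨a, b⟩
      simp only [Nat.mem_divisorsAntidiagonal, Finset.mem_filter, Finset.mem_product,
        Finset.mem_Ico]
      constructor
      · rintro ⟨rfl, h0⟩
        have ha : 0 < a := Nat.pos_of_ne_zero fun h ↦ by simp [h] at h0
        have hb : 0 < b := Nat.pos_of_ne_zero fun h ↦ by simp [h] at h0
        have h2 := Nat.le_mul_of_pos_right a hb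
        have h3 := Nat.le_mul_of_pos_left b ha
        exact ⟨⟨⟨⟨ha, by omega⟩, hb, by omega⟩, hn.2⟩, rfl⟩
      · rintro ⟨-, rfl⟩
        exact ⟨rfl, by omega⟩
    · rw [(Finset.mem_filter.mp hp).2]
  · rintro ⟨a, b⟩ hp
    simp only [Finset.mem_filter, Finset.mem_product, Finset.mem_Ico] at hp ⊢
    exact ⟨Nat.mul_pos hp.1.1.1 hp.1.2.1, hp.2⟩

theorem norm_sum_char_mul_le {q : ℕ} [NeZero q] {χ : DirichletCharacter ℂ q} (hχ : χ ≠ 1)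
    (g : ℕ → ℂ) (N : ℕ) (hN : g N = 0) :
    ‖∑ l ∈ Finset.Ico 1 N, χ l * g l‖ ≤ q * ∑ l ∈ Finset.Ico 1 N, ‖g l - g (l + 1)‖ := by
  have h1 : ∀ l ∈ Finset.Ico 1 N, g l = ∑ j ∈ Finset.Ico l N, (g j - g (j + 1)) := fun l hl ↦ by
    rw [Finset.sum_Ico_eq_sum_range, Finset.sum_congr rfl (g := fun i ↦ g (l + i) - g (l + (i + 1)))
      (fun _ _ ↦ by rw [add_assoc]), Finset.sum_range_sub' (fun i ↦ g (l + i))]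
    rw [Finset.mem_Ico] at hl
    rw [Nat.add_sub_cancel' hl.2.le, hN]
    simp
  have h2 : ∑ l ∈ Finset.Ico 1 N, χ l * g l =
      ∑ j ∈ Finset.Ico 1 N, (∑ l ∈ Finset.Ico 1 (j + 1), χ l) * (g j - g (j + 1)) := by
    rw [Finset.sum_congr rfl (fun l hl ↦ by rw [h1 l hl, Finset.mul_sum])]
    simp_rw [Finset.sum_mul]
    refine Finset.sum_comm' fun l j ↦ ?_
    simp only [Finset.mem_Ico]
    omega
  rw [h2, Finset.mul_sum]
  refine norm_sum_le_of_le _ fun j _ ↦ ?_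
  rw [norm_mul]
  gcongr
  exact norm_sum_Ico_char_le hχ _ _

theorem sum_Ico_one_div_le (N : ℕ) :
    ∑ l ∈ Finset.Ico 1 N, (1 / l : ℝ) ≤ 1 + Real.log N := by
  rcases Nat.eq_zero_or_pos N with rfl | hN
  · simp
  have h := harmonic_le_one_add_log (N - 1)
  have h2 : (harmonic (N - 1) : ℝ) = ∑ l ∈ Finset.Ico 1 N, (1 / l : ℝ) := by
    rw [harmonic, Finset.sum_Ico_eq_sum_range]
    push_cast
    refine Finset.sum_congr rfl fun i _ ↦ ?_
    rw [add_comm, one_div]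
  rw [← h2]
  refine h.trans ?_
  have : Real.log (N - 1 : ℕ) ≤ Real.log N := by
    rcases Nat.eq_zero_or_pos (N - 1) with h0 | h0
    · rw [h0]
      simpa using Real.log_natCast_nonneg N
    · exact Real.log_le_log (by exact_mod_cast h0) (by exact_mod_cast Nat.sub_le _ _)
  linarith

theorem log_succ_sub_log_le {l : ℕ} (hl : 1 ≤ l) :
    |Real.log (l : ℝ) - Real.log ((l + 1 : ℕ) : ℝ)| ≤ 1 / l := by
  have hl' : (0 : ℝ) < l := by exact_mod_cast hl
  rw [abs_sub_comm, abs_of_nonneg (sub_nonneg.mpr (Real.log_le_log hl' (by push_cast; linarith))),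
    ← Real.log_div (by positivity) hl'.ne']
  refine (Real.log_le_sub_one_of_pos (by positivity)).trans (le_of_eq ?_)
  push_cast
  field_simp
  ring

theorem log_natCast_mul {m l : ℕ} (hm : 1 ≤ m) (hl : 1 ≤ l) :
    Real.log ((m * l : ℕ) : ℝ) = Real.log m + Real.log l := by
  push_cast
  rw [Real.log_mul (by positivity) (by positivity)]

section TypeOne

variable {ψ : ℝ → ℂ} {P κ : ℝ} (hw : IsWeight ψ P κ) {X : ℝ} {N : ℕ}

include hw in
/-- The inner sum of type I. -/
theorem IsWeight.norm_sum_char_le {q : ℕ} [NeZero q] {χ : DirichletCharacter ℂ q} (hχ : χ ≠ 1)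
    (hN : ∀ n ≥ N, ψ (Real.log n - Real.log X) = 0) {m : ℕ} (hm : 1 ≤ m) :
    ‖∑ l ∈ Finset.Ico 1 N, χ l * ψ (Real.log (m * l : ℕ) - Real.log X)‖ ≤
      q * (P * (1 + Real.log N)) := by
  refine (norm_sum_char_mul_le hχ (fun l ↦ ψ (Real.log (m * l : ℕ) - Real.log X)) N ?_).trans ?_
  · exact hN _ (Nat.le_mul_of_pos_left N hm)
  · gcongr
    calc _ ≤ ∑ l ∈ Finset.Ico 1 N, P * (1 / l : ℝ) := by
          refine Finset.sum_le_sum fun l hl ↦ ?_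
          have hl := (Finset.mem_Ico.mp hl).1
          refine (hw.lip _ _).trans ?_
          have := hw.P_nonneg
          gcongr
          rw [log_natCast_mul hm hl, log_natCast_mul hm (by omega)]
          exact (le_of_eq (congrArg _ (by ring))).trans (log_succ_sub_log_le hl)
      _ = P * ∑ l ∈ Finset.Ico 1 N, (1 / l : ℝ) := by rw [Finset.mul_sum]
      _ ≤ _ := by
        have := hw.P_nonneg
        gcongr
        exact sum_Ico_one_div_le N

include hw in
/-- The inner sum of type I, with a logarithmic factor. -/
theorem IsWeight.norm_sum_char_log_le {q : ℕ} [NeZero q] {χ : DirichletCharacter ℂ q} (hχ : χ ≠ 1)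
    (hN : ∀ n ≥ N, ψ (Real.log n - Real.log X) = 0) {m : ℕ} (hm : 1 ≤ m) :
    ‖∑ l ∈ Finset.Ico 1 N, χ l * (Real.log l * ψ (Real.log (m * l : ℕ) - Real.log X))‖ ≤
      q * (P * (1 + Real.log N) ^ 2) := by
  have hP := hw.P_nonneg
  refine (norm_sum_char_mul_le hχ
    (fun l ↦ (Real.log l * ψ (Real.log (m * l : ℕ) - Real.log X))) N ?_).trans ?_
  · rw [hN _ (Nat.le_mul_of_pos_left N hm), mul_zero]
  · gcongr
    calc _ ≤ ∑ l ∈ Finset.Ico 1 N, P * (1 + Real.log N) * (1 / l : ℝ) := by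
          refine Finset.sum_le_sum fun l hl ↦ ?_
          have hlN := (Finset.mem_Ico.mp hl).2
          have hl := (Finset.mem_Ico.mp hl).1
          have h1 := log_succ_sub_log_le hl
          have h2 : ‖ψ (Real.log (m * l : ℕ) - Real.log X) -
              ψ (Real.log (m * (l + 1) : ℕ) - Real.log X)‖ ≤ P * (1 / l) := by
            refine (hw.lip _ _).trans ?_
            gcongr
            rw [log_natCast_mul hm hl, log_natCast_mul hm (by omega)]
            exact (le_of_eq (congrArg _ (by ring))).trans (log_succ_sub_log_le hl)
          have h3 := hw.bound (Real.log (m * (l + 1) : ℕ) - Real.log X)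
          generalize ψ (Real.log (m * l : ℕ) - Real.log X) = y at *
          generalize ψ (Real.log (m * (l + 1) : ℕ) - Real.log X) = z at *
          have h4 : Real.log l * y - Real.log (l + 1 : ℕ) * z =
              Real.log l * (y - z) + ((Real.log l - Real.log (l + 1 : ℕ) : ℝ) : ℂ) * z := by
            push_cast
            ring
          rw [h4]
          have h5 : Real.log l ≤ Real.log N :=
            Real.log_le_log (by exact_mod_cast hl) (by exact_mod_cast hlN.le)
          have h6 : 0 ≤ Real.log l := Real.log_natCast_nonneg l
          calc _ ≤ ‖(Real.log l : ℂ) * (y - z)‖ +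
                ‖((Real.log l - Real.log (l + 1 : ℕ) : ℝ) : ℂ) * z‖ := norm_add_le _ _
            _ ≤ Real.log N * (P * (1 / l)) + (1 / l) * P := by
              rw [norm_mul, norm_mul, norm_real, norm_real, Real.norm_of_nonneg h6, Real.norm_eq_abs]
              gcongr
            _ = _ := by ring
      _ = P * (1 + Real.log N) * ∑ l ∈ Finset.Ico 1 N, (1 / l : ℝ) := by rw [Finset.mul_sum]
      _ ≤ P * (1 + Real.log N) * (1 + Real.log N) := by
        have := Real.log_natCast_nonneg N
        gcongr
        exact sum_Ico_one_div_le N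
      _ = _ := by ring

end TypeOne

/-- The restriction of an arithmetic function to arguments at most `U`. -/
noncomputable def truncLe (f : ArithmeticFunction ℂ) (U : ℕ) : ArithmeticFunction ℂ :=
  ⟨fun n ↦ if n ≤ U then f n else 0, by simp⟩

/-- The restriction of an arithmetic function to arguments larger than `U`. -/
noncomputable def truncGt (f : ArithmeticFunction ℂ) (U : ℕ) : ArithmeticFunction ℂ :=
  ⟨fun n ↦ if n ≤ U then 0 else f n, by simp⟩

theorem truncLe_apply (f : ArithmeticFunction ℂ) (U n : ℕ) :
    truncLe f U n = if n ≤ U then f n else 0 := rfl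

theorem truncGt_apply (f : ArithmeticFunction ℂ) (U n : ℕ) :
    truncGt f U n = if n ≤ U then 0 else f n := rfl

theorem truncLe_add_truncGt (f : ArithmeticFunction ℂ) (U : ℕ) :
    truncLe f U + truncGt f U = f := by
  ext n
  rw [ArithmeticFunction.add_apply, truncLe_apply, truncGt_apply]
  split_ifs <;> simp

/-- The von Mangoldt function with complex values. -/
noncomputable def cLambda : ArithmeticFunction ℂ := ⟨fun n ↦ (ArithmeticFunction.vonMangoldt n : ℂ), by simp⟩

/-- The logarithm as a complex valued arithmetic function. -/
noncomputable def cLog : ArithmeticFunction ℂ := ⟨fun n ↦ (Real.log n : ℂ), by simp⟩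

/-- The Möbius function with complex values. -/
noncomputable def cMu : ArithmeticFunction ℂ := (ArithmeticFunction.moebius : ArithmeticFunction ℂ)

/-- The constant function one as a complex valued arithmetic function. -/
noncomputable def cZeta : ArithmeticFunction ℂ := (ArithmeticFunction.zeta : ArithmeticFunction ℂ)

theorem cZeta_mul_cMu : cZeta * cMu = 1 := ArithmeticFunction.coe_zeta_mul_coe_moebius

theorem cLambda_mul_cZeta : cLambda * cZeta = cLog := by
  ext n
  rw [cZeta, ArithmeticFunction.coe_mul_zeta_apply]
  show ∑ i ∈ n.divisors, ((ArithmeticFunction.vonMangoldt i : ℝ) : ℂ) = ((Real.log n : ℝ) : ℂ)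
  rw [← ArithmeticFunction.vonMangoldt_sum]
  push_cast
  rfl

/-- Vaughan's identity. -/
theorem vaughan_identity (U : ℕ) :
    cLambda + (truncLe cLambda U * truncLe cMu U) * cZeta =
      truncLe cLambda U + truncLe cMu U * cLog +
      truncGt cMu U * (truncGt cLambda U * cZeta) := by
  have h1 := truncLe_add_truncGt cLambda U
  have h2 := truncLe_add_truncGt cMu U
  have h3 := cZeta_mul_cMu
  rw [← cLambda_mul_cZeta]
  generalize truncLe cLambda U = a at *
  generalize truncGt cLambda U = b at *
  generalize truncLe cMu U = c at *
  generalize truncGt cMu U = d at *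
  rw [← h1]
  rw [← h2] at h3
  linear_combination b * (-h3)

theorem norm_cMu_le (n : ℕ) : ‖cMu n‖ ≤ 1 := by
  have := ArithmeticFunction.abs_moebius_le_one (n := n)
  show ‖((ArithmeticFunction.moebius n : ℤ) : ℂ)‖ ≤ 1
  rw [norm_intCast]
  exact_mod_cast this

theorem norm_truncGt_cLambda_mul_cZeta_le {U n : ℕ} :
    ‖(truncGt cLambda U * cZeta) n‖ ≤ Real.log n := by
  rw [cZeta, ArithmeticFunction.coe_mul_zeta_apply, ← ArithmeticFunction.vonMangoldt_sum]
  refine norm_sum_le_of_le _ fun d _ ↦ ?_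
  rw [truncGt_apply]
  split_ifs
  · simpa using ArithmeticFunction.vonMangoldt_nonneg
  · show ‖((ArithmeticFunction.vonMangoldt d : ℝ) : ℂ)‖ ≤ _
    rw [norm_real, Real.norm_of_nonneg ArithmeticFunction.vonMangoldt_nonneg]

theorem truncGt_cLambda_mul_cZeta_eq_zero {U n : ℕ} (h : n ≤ U) :
    (truncGt cLambda U * cZeta) n = 0 := by
  rw [cZeta, ArithmeticFunction.coe_mul_zeta_apply]
  refine Finset.sum_eq_zero fun d hd ↦ ?_
  rw [truncGt_apply, if_pos ((Nat.divisor_le hd).trans h)]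

theorem norm_truncLe_cLambda_mul_truncLe_cMu_le {U n : ℕ} :
    ‖(truncLe cLambda U * truncLe cMu U) n‖ ≤ Real.log n := by
  have h0 := Nat.sum_divisorsAntidiagonal (n := n) (fun d _ ↦ ArithmeticFunction.vonMangoldt d)
  rw [ArithmeticFunction.mul_apply, ← ArithmeticFunction.vonMangoldt_sum, ← h0]
  refine norm_sum_le_of_le _ fun d _ ↦ ?_
  rw [truncLe_apply, truncLe_apply, norm_mul]
  have h1 : ‖if d.1 ≤ U then cLambda d.1 else 0‖ ≤ ArithmeticFunction.vonMangoldt d.1 := by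
    split_ifs
    · show ‖((ArithmeticFunction.vonMangoldt d.1 : ℝ) : ℂ)‖ ≤ _
      rw [norm_real, Real.norm_of_nonneg ArithmeticFunction.vonMangoldt_nonneg]
    · simpa using ArithmeticFunction.vonMangoldt_nonneg
  have h2 : ‖if d.2 ≤ U then cMu d.2 else 0‖ ≤ 1 := by
    split_ifs
    · exact norm_cMu_le _
    · simp
  calc _ ≤ ArithmeticFunction.vonMangoldt d.1 * 1 := by
        gcongr
    _ = _ := mul_one _

theorem truncLe_cLambda_mul_truncLe_cMu_eq_zero {U n : ℕ} (h : U ^ 2 < n) :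
    (truncLe cLambda U * truncLe cMu U) n = 0 := by
  rw [ArithmeticFunction.mul_apply]
  refine Finset.sum_eq_zero fun d hd ↦ ?_
  rw [Nat.mem_divisorsAntidiagonal] at hd
  rw [truncLe_apply, truncLe_apply]
  by_cases h1 : d.1 ≤ U
  · by_cases h2 : d.2 ≤ U
    · have := Nat.mul_le_mul h1 h2
      rw [hd.1, ← pow_two] at this
      omega
    · rw [if_neg h2, mul_zero]
  · rw [if_neg h1, zero_mul]

end

section

open Complex Filter Topology MeasureTheory Set

theorem sum_range_mul_eq_sum_blocks (f : ℕ → ℂ) (B J : ℕ) :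
    ∑ m ∈ Finset.range (J * B), f m =
      ∑ j ∈ Finset.range J, ∑ m ∈ Finset.Ico (j * B) ((j + 1) * B), f m := by
  induction J with
  | zero => simp
  | succ J ih =>
    rw [Finset.sum_range_succ, ← ih, Finset.range_eq_Ico, Finset.range_eq_Ico,
      Finset.sum_Ico_consecutive _ (Nat.zero_le _) (Nat.mul_le_mul_right _ (Nat.le_succ _))]

section TypeTwo

variable {ψ : ℝ → ℂ} {P κ : ℝ} (hw : IsWeight ψ P κ) {X : ℝ} {N : ℕ}

include hw in
theorem IsWeight.eq_zero_of_le (hX : 0 < X) {n : ℕ} (hn : Real.exp κ * X ≤ n) :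
    ψ (Real.log n - Real.log X) = 0 := by
  apply hw.right
  have := Real.log_le_log (by positivity) hn
  rw [Real.log_mul (by positivity) hX.ne', Real.log_exp] at this
  linarith

include hw in
theorem IsWeight.eq_zero_of_ge (hX : 1 ≤ X) {n : ℕ} (hn : n ≤ X) :
    ψ (Real.log n - Real.log X) = 0 := by
  apply hw.left
  rcases Nat.eq_zero_or_pos n with rfl | h
  · simpa using Real.log_nonneg hX
  · exact sub_nonpos.mpr (Real.log_le_log (by exact_mod_cast h) hn)

include hw in
theorem IsWeight.norm_sub_block_le (hX : 0 < X) {B j m l : ℕ} (hj : 1 ≤ j) (hB : 1 ≤ B)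
    (hm : m ∈ Finset.Ico (j * B) ((j + 1) * B)) (hl : 1 ≤ l) :
    ‖ψ (Real.log (m * l : ℕ) - Real.log X) - ψ (Real.log (j * B * l : ℕ) - Real.log X)‖ ≤
      if l < ⌊Real.exp κ * X / (j * B)⌋₊ + 1 then P * (1 / j) else 0 := by
  have hP := hw.P_nonneg
  rw [Finset.mem_Ico] at hm
  have hjB : 0 < j * B := Nat.mul_pos hj hB
  have hj0 : (0 : ℝ) < j := by exact_mod_cast hj
  have hB0 : (0 : ℝ) < B := by exact_mod_cast hB
  have hm0 : (0 : ℝ) < m := by exact_mod_cast hjB.trans_le hm.1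
  split_ifs with h
  · refine (hw.lip _ _).trans ?_
    gcongr
    rw [log_natCast_mul (by omega) hl, log_natCast_mul hjB hl]
    have e : Real.log m + Real.log l - Real.log X -
        (Real.log (j * B : ℕ) + Real.log l - Real.log X) = Real.log (m / (j * B : ℕ)) := by
      rw [Real.log_div (by positivity) (by positivity)]
      ring
    have h1 : (1 : ℝ) ≤ m / (j * B : ℕ) := by
      rw [le_div_iff₀ (by exact_mod_cast hjB), one_mul]
      exact_mod_cast hm.1
    rw [e, abs_of_nonneg (Real.log_nonneg h1)]
    refine (Real.log_le_sub_one_of_pos (by linarith)).trans ?_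
    rw [sub_le_iff_le_add, div_le_iff₀ (by exact_mod_cast hjB)]
    push_cast
    have : (m : ℝ) ≤ (j + 1) * B := by exact_mod_cast hm.2.le
    calc (m : ℝ) ≤ (j + 1) * B := this
      _ = _ := by field_simp; ring
  · push Not at h
    have h1 : Real.exp κ * X ≤ (j * B * l : ℕ) := by
      have := (Nat.lt_floor_add_one (Real.exp κ * X / (j * B))).le.trans
        (b := ((⌊Real.exp κ * X / (j * B)⌋₊ : ℝ) + 1)) (c := (l : ℝ)) (by exact_mod_cast h)
      rw [div_le_iff₀ (by positivity)] at this
      push_cast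
      linarith
    have h2 : Real.exp κ * X ≤ (m * l : ℕ) :=
      h1.trans (by exact_mod_cast Nat.mul_le_mul_right l hm.1)
    rw [hw.eq_zero_of_le hX h1, hw.eq_zero_of_le hX h2, sub_zero, norm_zero]

include hw in
theorem IsWeight.norm_block_le (hX : 0 < X) {B j : ℕ} (hj : 1 ≤ j) (hB : 1 ≤ B) (x : DChar)
    {a b : ℕ → ℂ} {L : ℝ} (hL : 0 ≤ L) (ha : ∀ m, ‖a m‖ ≤ 1) (hb : ∀ l ∈ Finset.Ico 1 N, ‖b l‖ ≤ L) :
    ‖∑ m ∈ Finset.Ico (j * B) ((j + 1) * B), ∑ l ∈ Finset.Ico 1 N,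
        a m * b l * (x.ev (m * l) * ψ (Real.log (m * l : ℕ) - Real.log X))‖ ≤
      ‖∑ m ∈ Finset.Ico (j * B) ((j + 1) * B), a m * x.ev m‖ *
        ‖∑ l ∈ Finset.Ico 1 (min N (⌊Real.exp κ * X / (j * B)⌋₊ + 1)),
          (b l * ψ (Real.log (j * B * l : ℕ) - Real.log X)) * x.ev l‖ +
      Real.exp κ * X * P * L * ((j : ℝ) ^ 2)⁻¹ := by
  have hP := hw.P_nonneg
  have hj0 : (0 : ℝ) < j := by exact_mod_cast hj
  have hB0 : (0 : ℝ) < B := by exact_mod_cast hB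
  have hev : ∀ m l : ℕ, x.ev (m * l) = x.ev m * x.ev l := fun m l ↦ by
    simp [DChar.ev]
  have h1 : ∑ m ∈ Finset.Ico (j * B) ((j + 1) * B), ∑ l ∈ Finset.Ico 1 N,
        a m * b l * (x.ev (m * l) * ψ (Real.log (m * l : ℕ) - Real.log X)) =
      (∑ m ∈ Finset.Ico (j * B) ((j + 1) * B), a m * x.ev m) *
        (∑ l ∈ Finset.Ico 1 N, (b l * ψ (Real.log (j * B * l : ℕ) - Real.log X)) * x.ev l) +
      ∑ m ∈ Finset.Ico (j * B) ((j + 1) * B), ∑ l ∈ Finset.Ico 1 N,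
        a m * b l * x.ev (m * l) * (ψ (Real.log (m * l : ℕ) - Real.log X) -
          ψ (Real.log (j * B * l : ℕ) - Real.log X)) := by
    rw [Finset.sum_mul_sum, ← Finset.sum_add_distrib]
    refine Finset.sum_congr rfl fun m _ ↦ ?_
    rw [← Finset.sum_add_distrib]
    refine Finset.sum_congr rfl fun l _ ↦ ?_
    rw [hev]
    ring
  have h2 : ∑ l ∈ Finset.Ico 1 N, (b l * ψ (Real.log (j * B * l : ℕ) - Real.log X)) * x.ev l =
      ∑ l ∈ Finset.Ico 1 (min N (⌊Real.exp κ * X / (j * B)⌋₊ + 1)),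
          (b l * ψ (Real.log (j * B * l : ℕ) - Real.log X)) * x.ev l := by
    symm
    refine Finset.sum_subset (Finset.Ico_subset_Ico_right (min_le_left _ _)) fun l hl hl' ↦ ?_
    rw [Finset.mem_Ico] at hl
    rw [Finset.mem_Ico, lt_min_iff, not_and, not_and] at hl'
    have h := not_lt.mp (hl' hl.1 hl.2)
    have h3 : Real.exp κ * X ≤ (j * B * l : ℕ) := by
      have := (Nat.lt_floor_add_one (Real.exp κ * X / (j * B))).le.trans
        (b := ((⌊Real.exp κ * X / (j * B)⌋₊ : ℝ) + 1)) (c := (l : ℝ)) (by exact_mod_cast h)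
      rw [div_le_iff₀ (by positivity)] at this
      push_cast
      linarith
    rw [hw.eq_zero_of_le hX h3, mul_zero, zero_mul]
  rw [h1, h2]
  refine (norm_add_le _ _).trans ?_
  rw [norm_mul]
  gcongr
  obtain ⟨M, hM⟩ : ∃ M, M = ⌊Real.exp κ * X / (j * B)⌋₊ := ⟨_, rfl⟩
  have hM' : (M : ℝ) ≤ Real.exp κ * X / (j * B) := by
    rw [hM]
    exact Nat.floor_le (by positivity)
  calc _ ≤ ∑ m ∈ Finset.Ico (j * B) ((j + 1) * B), ∑ l ∈ Finset.Ico 1 N,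
        L * (if l < M + 1 then P * (1 / j : ℝ) else 0) := by
        refine norm_sum_le_of_le _ fun m hm ↦ norm_sum_le_of_le _ fun l hl ↦ ?_
        rw [norm_mul, norm_mul, norm_mul]
        have h4 : ‖a m‖ * ‖b l‖ * ‖x.ev (m * l)‖ ≤ 1 * L * 1 := by
          gcongr
          · exact ha m
          · exact hb l hl
          · exact x.norm_ev_le _
        rw [one_mul, mul_one] at h4
        have := hw.norm_sub_block_le hX hj hB hm (Finset.mem_Ico.mp hl).1
        rw [← hM] at this
        gcongr
    _ ≤ ∑ m ∈ Finset.Ico (j * B) ((j + 1) * B), L * (M * (P * (1 / j : ℝ))) := by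
        refine Finset.sum_le_sum fun m _ ↦ ?_
        rw [← Finset.mul_sum, ← Finset.sum_filter]
        gcongr
        rw [Finset.sum_const, nsmul_eq_mul]
        gcongr
        calc _ ≤ (Finset.Ico 1 (M + 1)).card := by
              refine Finset.card_le_card fun l hl ↦ ?_
              simp only [Finset.mem_filter, Finset.mem_Ico] at hl ⊢
              omega
          _ = M := by simp
    _ = B * (L * (M * (P * (1 / j : ℝ)))) := by
        rw [Finset.sum_const, Nat.card_Ico, nsmul_eq_mul, add_mul, one_mul, Nat.add_sub_cancel_left]
    _ ≤ B * (L * (Real.exp κ * X / (j * B) * (P * (1 / j : ℝ)))) := by gcongr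
    _ = _ := by field_simp

include hw in
theorem IsWeight.norm_typeII_le (hX : 0 < X) {B : ℕ} (hB : 1 ≤ B) (x : DChar)
    (hN : ∀ n ≥ N, ψ (Real.log n - Real.log X) = 0)
    {a b : ℕ → ℂ} {L : ℝ} (hL : 0 ≤ L) (ha : ∀ m, ‖a m‖ ≤ 1) (ha' : ∀ m ≤ B ^ 2, a m = 0)
    (hb : ∀ l ∈ Finset.Ico 1 N, ‖b l‖ ≤ L) :
    ‖∑ m ∈ Finset.Ico 1 N, ∑ l ∈ Finset.Ico 1 N,
        a m * b l * (x.ev (m * l) * ψ (Real.log (m * l : ℕ) - Real.log X))‖ ≤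
      ∑ j ∈ Finset.Ico B N, ‖∑ m ∈ Finset.Ico (j * B) ((j + 1) * B), a m * x.ev m‖ *
        ‖∑ l ∈ Finset.Ico 1 (min N (⌊Real.exp κ * X / (j * B)⌋₊ + 1)),
          (b l * ψ (Real.log (j * B * l : ℕ) - Real.log X)) * x.ev l‖ +
      Real.exp κ * X * P * L * (2 / B) := by
  have hP := hw.P_nonneg
  obtain ⟨F, hF⟩ : ∃ F : ℕ → ℂ, ∀ m, F m = ∑ l ∈ Finset.Ico 1 N,
      a m * b l * (x.ev (m * l) * ψ (Real.log (m * l : ℕ) - Real.log X)) := ⟨_, fun _ ↦ rfl⟩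
  have h1 : ∑ m ∈ Finset.Ico 1 N, F m = ∑ m ∈ Finset.range (N * B), F m := by
    refine Finset.sum_subset (fun m hm ↦ ?_) fun m _ hm' ↦ ?_
    · rw [Finset.mem_Ico] at hm
      rw [Finset.mem_range]
      exact hm.2.trans_le (Nat.le_mul_of_pos_right N hB)
    · rw [hF]
      refine Finset.sum_eq_zero fun l hl ↦ ?_
      rw [Finset.mem_Ico] at hl hm'
      rcases Nat.eq_zero_or_pos m with rfl | h
      · rw [ha' 0 (Nat.zero_le _), zero_mul, zero_mul]
      · have : N ≤ m * l := by
          have := Nat.le_mul_of_pos_right m hl.1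
          omega
        rw [hN _ this, mul_zero, mul_zero]
  have h2 : ∑ j ∈ Finset.range N, ∑ m ∈ Finset.Ico (j * B) ((j + 1) * B), F m =
      ∑ j ∈ Finset.Ico B N, ∑ m ∈ Finset.Ico (j * B) ((j + 1) * B), F m := by
    symm
    refine Finset.sum_subset (fun j hj ↦ by simp at hj ⊢; omega) fun j hj hj' ↦ ?_
    refine Finset.sum_eq_zero fun m hm ↦ ?_
    rw [Finset.mem_range] at hj
    rw [Finset.mem_Ico] at hm hj'
    have h3 : (j + 1) * B ≤ B ^ 2 := by
      rw [pow_two]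
      exact Nat.mul_le_mul_right B (by omega)
    rw [hF]
    exact Finset.sum_eq_zero fun l _ ↦ by rw [ha' m (by omega), zero_mul, zero_mul]
  simp_rw [← hF]
  rw [h1, sum_range_mul_eq_sum_blocks, h2]
  refine (norm_sum_le_of_le _ fun j hj ↦ ?_).trans (b := ∑ j ∈ Finset.Ico B N,
    (‖∑ m ∈ Finset.Ico (j * B) ((j + 1) * B), a m * x.ev m‖ *
        ‖∑ l ∈ Finset.Ico 1 (min N (⌊Real.exp κ * X / (j * B)⌋₊ + 1)),
          (b l * ψ (Real.log (j * B * l : ℕ) - Real.log X)) * x.ev l‖ +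
      Real.exp κ * X * P * L * ((j : ℝ) ^ 2)⁻¹)) ?_
  · simp_rw [hF]
    exact hw.norm_block_le hX (hB.trans (Finset.mem_Ico.mp hj).1) hB x hL ha hb
  · rw [Finset.sum_add_distrib, ← Finset.mul_sum]
    gcongr
    have h4 : Finset.Ico B N = Finset.Ioo (B - 1) N := by
      ext j
      simp only [Finset.mem_Ico, Finset.mem_Ioo]
      omega
    have h5 := sum_Ioo_inv_sq_le (α := ℝ) (B - 1) N
    rw [← h4] at h5
    refine h5.trans (le_of_eq ?_)
    rw [Nat.cast_sub hB]
    simp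

end TypeTwo

end

section

open Complex Filter Topology MeasureTheory Set

section Vaughan

variable {ψ : ℝ → ℂ} {P κ : ℝ} (hw : IsWeight ψ P κ) {X : ℝ} {N : ℕ}

include hw in
theorem IsWeight.sum_block_le (hX : 0 < X) {B Q j : ℕ} (hB : 1 ≤ B) (hQB : Q ^ 4 ≤ B)
    {T : Finset DChar} (hT : DChar.Family Q T) (hj : 1 ≤ j)
    {a b : ℕ → ℂ} {L : ℝ} (hL : 0 ≤ L) (ha : ∀ m, ‖a m‖ ≤ 1) (hb' : ∀ m ≤ B, b m = 0)
    (hb : ∀ l ∈ Finset.Ico 1 N, ‖b l‖ ≤ L) :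
    ∑ x ∈ T, ‖∑ m ∈ Finset.Ico (j * B) ((j + 1) * B), a m * x.ev m‖ *
        ‖∑ l ∈ Finset.Ico 1 (min N (⌊Real.exp κ * X / (j * B)⌋₊ + 1)),
          (b l * ψ (Real.log (j * B * l : ℕ) - Real.log X)) * x.ev l‖ ≤
      4 * Real.exp κ * X * (L * P) * (1 / j) := by
  have hP := hw.P_nonneg
  have hj0 : (0 : ℝ) < j := by exact_mod_cast hj
  have hB0 : (0 : ℝ) < B := by exact_mod_cast hB
  have hQB' : (Q : ℝ) ^ 4 ≤ B := by exact_mod_cast hQB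
  obtain ⟨Y, hY⟩ : ∃ Y, Y = Real.exp κ * X / (j * B) := ⟨_, rfl⟩
  rw [← hY]
  have hY0 : 0 ≤ Y := hY ▸ by positivity
  rcases le_or_gt Y B with h | h
  · have : ∀ x : DChar, ∑ l ∈ Finset.Ico 1 (min N (⌊Y⌋₊ + 1)),
          (b l * ψ (Real.log (j * B * l : ℕ) - Real.log X)) * x.ev l = 0 := fun x ↦ by
      refine Finset.sum_eq_zero fun l hl ↦ ?_
      rw [Finset.mem_Ico, lt_min_iff] at hl
      have h2 : l ≤ B := by
        have := Nat.floor_le_of_le h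
        omega
      rw [hb' l h2, zero_mul, zero_mul]
    simp_rw [this, norm_zero, mul_zero, Finset.sum_const_zero]
    positivity
  · have h1 := DChar.bilinear_large_sieve hT (j * B) ((j + 1) * B) 1 (min N (⌊Y⌋₊ + 1))
      zero_le_one (mul_nonneg hL hP) a (fun l ↦ b l * ψ (Real.log (j * B * l : ℕ) - Real.log X))
      ha (fun l hl ↦ ?_) (N := 2 * B) (N' := 2 * Y) ?_ ?_
    · refine h1.trans (le_of_eq ?_)
      rw [hY]
      field_simp
      ring
    · rw [norm_mul]
      have h2 := hb l (by
        rw [Finset.mem_Ico, lt_min_iff] at hl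
        exact Finset.mem_Ico.mpr ⟨hl.1, hl.2.1⟩)
      have h3 := hw.bound (Real.log (j * B * l : ℕ) - Real.log X)
      gcongr
    · rw [add_mul, one_mul, Nat.add_sub_cancel_left]
      linarith
    · have h2 : ((min N (⌊Y⌋₊ + 1) - 1 : ℕ) : ℝ) ≤ Y := by
        refine le_trans ?_ (Nat.floor_le hY0)
        have : min N (⌊Y⌋₊ + 1) - 1 ≤ ⌊Y⌋₊ := by omega
        exact_mod_cast this
      linarith

include hw in
theorem IsWeight.sum_typeII_le (hX : 0 < X) {B Q : ℕ} (hB : 1 ≤ B) (hQB : Q ^ 4 ≤ B)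
    {T : Finset DChar} (hT : DChar.Family Q T)
    (hN : ∀ n ≥ N, ψ (Real.log n - Real.log X) = 0)
    {a b : ℕ → ℂ} {L : ℝ} (hL : 0 ≤ L) (ha : ∀ m, ‖a m‖ ≤ 1) (ha' : ∀ m ≤ B ^ 2, a m = 0)
    (hb' : ∀ m ≤ B, b m = 0) (hb : ∀ l ∈ Finset.Ico 1 N, ‖b l‖ ≤ L) :
    ∑ x ∈ T, ‖∑ m ∈ Finset.Ico 1 N, ∑ l ∈ Finset.Ico 1 N,
        a m * b l * (x.ev (m * l) * ψ (Real.log (m * l : ℕ) - Real.log X))‖ ≤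
      4 * Real.exp κ * X * (L * P) * (1 + Real.log N) + 2 * Real.exp κ * X * (L * P) := by
  have hP := hw.P_nonneg
  refine (Finset.sum_le_sum fun x _ ↦ hw.norm_typeII_le hX hB x hN hL ha ha' hb).trans ?_
  rw [Finset.sum_add_distrib, Finset.sum_comm]
  refine add_le_add ?_ ?_
  · refine (Finset.sum_le_sum fun j hj ↦ hw.sum_block_le hX hB hQB hT
      (hB.trans (Finset.mem_Ico.mp hj).1) hL ha hb' hb).trans ?_
    rw [← Finset.mul_sum]
    gcongr
    refine le_trans ?_ (sum_Ico_one_div_le N)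
    exact Finset.sum_le_sum_of_subset_of_nonneg (Finset.Ico_subset_Ico_left hB)
      fun _ _ _ ↦ by positivity
  · rw [Finset.sum_const, nsmul_eq_mul]
    have h1 : (T.card : ℝ) ≤ B := by
      have h2 := DChar.card_le hT
      have h3 : Q ^ 2 ≤ Q ^ 4 := by
        rcases Nat.eq_zero_or_pos Q with rfl | h
        · simp
        · exact Nat.pow_le_pow_right h (by norm_num)
      exact_mod_cast h2.trans (h3.trans hQB)
    have hB0 : (0 : ℝ) < B := by exact_mod_cast hB
    calc _ ≤ (B : ℝ) * (Real.exp κ * X * P * L * (2 / B)) := by gcongr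
      _ = _ := by field_simp

include hw in
theorem IsWeight.norm_typeI_le {q : ℕ} [NeZero q] {χ : DirichletCharacter ℂ q} (hχ : χ ≠ 1)
    (hN : ∀ n ≥ N, ψ (Real.log n - Real.log X) = 0) {V : ℕ} {f g : ℕ → ℂ} {A G : ℝ}
    (hf : ∀ m ∈ Finset.Ico 1 N, ‖f m‖ ≤ A) (hA : 0 ≤ A) (hf' : ∀ m > V, f m = 0) (hG : 0 ≤ G)
    (hg : ∀ m, 1 ≤ m → ‖∑ l ∈ Finset.Ico 1 N, χ l * (g l *
      ψ (Real.log (m * l : ℕ) - Real.log X))‖ ≤ G) :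
    ‖∑ m ∈ Finset.Ico 1 N, ∑ l ∈ Finset.Ico 1 N,
        f m * g l * (χ (m * l : ℕ) * ψ (Real.log (m * l : ℕ) - Real.log X))‖ ≤ V * (A * G) := by
  have h1 : ∀ m, ∑ l ∈ Finset.Ico 1 N,
        f m * g l * (χ (m * l : ℕ) * ψ (Real.log (m * l : ℕ) - Real.log X)) =
      f m * χ m * ∑ l ∈ Finset.Ico 1 N, χ l * (g l *
        ψ (Real.log (m * l : ℕ) - Real.log X)) := fun m ↦ by
    rw [Finset.mul_sum]
    refine Finset.sum_congr rfl fun l _ ↦ ?_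
    rw [Nat.cast_mul m l, map_mul]
    ring
  simp_rw [h1]
  have h2 : ∀ m ∈ Finset.Ico 1 N, ‖f m * χ m * ∑ l ∈ Finset.Ico 1 N, χ l * (g l *
        ψ (Real.log (m * l : ℕ) - Real.log X))‖ ≤ if m ≤ V then A * G else 0 := fun m hm ↦ by
    split_ifs with h
    · rw [norm_mul, norm_mul]
      have h3 := hf m hm
      have h4 := χ.norm_le_one m
      have h5 := hg m (Finset.mem_Ico.mp hm).1
      calc _ ≤ A * 1 * G := by gcongr
        _ = _ := by ring
    · rw [hf' m (not_le.mp h), zero_mul, zero_mul, norm_zero]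
  refine (norm_sum_le_of_le _ h2).trans ?_
  rw [← Finset.sum_filter, Finset.sum_const, nsmul_eq_mul]
  gcongr
  calc _ ≤ (Finset.Ico 1 (V + 1)).card := by
        refine Finset.card_le_card fun l hl ↦ ?_
        simp only [Finset.mem_filter, Finset.mem_Ico] at hl ⊢
        omega
    _ = V := by simp

set_option maxHeartbeats 1000000 in
include hw in
/-- A weak form of the mean value theorem of Barban, Davenport and Halberstam type, obtained from
Vaughan's identity and the trivial large sieve. -/
theorem IsWeight.sum_cLambda_le (hX : 1 ≤ X) {B Q : ℕ} (hQ : 1 ≤ Q) (hQB : Q ^ 4 ≤ B)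
    (hBX : (B : ℝ) ^ 8 ≤ X) {T : Finset DChar} (hT : DChar.Family Q T)
    (hN1 : 1 ≤ N) (hN : ∀ n ≥ N, ψ (Real.log n - Real.log X) = 0) :
    ∑ x ∈ T, ‖∑ n ∈ Finset.Ico 1 N, cLambda n * (x.ev n * ψ (Real.log n - Real.log X))‖ ≤
      8 * P * Real.exp κ * X * (1 + Real.log N) ^ 2 := by
  have hP := hw.P_nonneg
  have hB : 1 ≤ B := (Nat.one_le_pow _ _ hQ).trans hQB
  have hB1 : (1 : ℝ) ≤ B := by exact_mod_cast hB
  have hX0 : 0 < X := by linarith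
  obtain ⟨ℓ, hℓ⟩ : ∃ ℓ, ℓ = Real.log N := ⟨_, rfl⟩
  rw [← hℓ]
  have hℓ0 : 0 ≤ ℓ := hℓ ▸ Real.log_natCast_nonneg N
  have hlog : ∀ l ∈ Finset.Ico 1 N, Real.log l ≤ ℓ := fun l hl ↦ by
    rw [Finset.mem_Ico] at hl
    rw [hℓ]
    exact Real.log_le_log (by exact_mod_cast hl.1) (by exact_mod_cast hl.2.le)
  have hII := hw.sum_typeII_le hX0 hB hQB hT hN hℓ0 (a := truncGt cMu (B ^ 2))
    (b := (truncGt cLambda (B ^ 2) * cZeta : ArithmeticFunction ℂ))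
    (fun m ↦ by
      rw [truncGt_apply]
      split_ifs
      · simp
      · exact norm_cMu_le m)
    (fun m hm ↦ by rw [truncGt_apply, if_pos hm])
    (fun m hm ↦ truncGt_cLambda_mul_cZeta_eq_zero (hm.trans (Nat.le_self_pow two_ne_zero B)))
    (fun l hl ↦ norm_truncGt_cLambda_mul_cZeta_le.trans (hlog l hl))
  have hI : ∀ x ∈ T, ‖∑ m ∈ Finset.Ico 1 N, ∑ l ∈ Finset.Ico 1 N,
      truncLe cMu (B ^ 2) m * cLog l *
        (x.ev (m * l) * ψ (Real.log (m * l : ℕ) - Real.log X))‖ ≤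
      B ^ 4 * (Q * (P * (1 + ℓ) ^ 2)) := fun x hx ↦ by
    have : NeZero x.1 := ⟨(hT.pos x hx).ne'⟩
    refine (hw.norm_typeI_le (χ := x.2) (hT.ne x hx) hN (V := B ^ 2) (f := truncLe cMu (B ^ 2))
      (g := cLog) (A := 1) (G := Q * (P * (1 + ℓ) ^ 2)) (fun m _ ↦ ?_) zero_le_one
      (fun m hm ↦ by rw [truncLe_apply, if_neg (by omega)]) (by positivity)
      (fun m hm ↦ ?_)).trans ?_
    · rw [truncLe_apply]
      split_ifs
      · exact norm_cMu_le m
      · simp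
    · refine (hw.norm_sum_char_log_le (hT.ne x hx) hN hm).trans ?_
      rw [hℓ]
      gcongr
      exact_mod_cast hT.le x hx
    · rw [one_mul]
      push_cast
      gcongr ?_ * _
      exact pow_le_pow_right₀ hB1 (by norm_num)
  have hI' : ∀ x ∈ T, ‖∑ m ∈ Finset.Ico 1 N, ∑ l ∈ Finset.Ico 1 N,
      (truncLe cLambda (B ^ 2) * truncLe cMu (B ^ 2)) m * cZeta l *
        (x.ev (m * l) * ψ (Real.log (m * l : ℕ) - Real.log X))‖ ≤
      B ^ 4 * (Q * (P * (1 + ℓ) ^ 2)) := fun x hx ↦ by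
    have : NeZero x.1 := ⟨(hT.pos x hx).ne'⟩
    refine (hw.norm_typeI_le (χ := x.2) (hT.ne x hx) hN (V := (B ^ 2) ^ 2)
      (f := (truncLe cLambda (B ^ 2) * truncLe cMu (B ^ 2) : ArithmeticFunction ℂ))
      (g := cZeta) (A := ℓ) (G := Q * (P * (1 + ℓ)))
      (fun m hm ↦ norm_truncLe_cLambda_mul_truncLe_cMu_le.trans (hlog m hm)) hℓ0
      (fun m hm ↦ truncLe_cLambda_mul_truncLe_cMu_eq_zero hm) (by positivity)
      (fun m hm ↦ ?_)).trans ?_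
    · refine (le_of_eq (congrArg _ (Finset.sum_congr rfl fun l hl ↦ ?_))).trans
        ((hw.norm_sum_char_le (hT.ne x hx) hN hm).trans ?_)
      · have : cZeta l = 1 := by
          rw [cZeta, ArithmeticFunction.natCoe_apply, ArithmeticFunction.zeta_apply_ne
            (by rw [Finset.mem_Ico] at hl; omega)]
          simp
        rw [this, one_mul]
      · rw [hℓ]
        gcongr
        exact_mod_cast hT.le x hx
    · push_cast
      rw [← pow_mul]
      have : ℓ * (Q * (P * (1 + ℓ))) ≤ (1 + ℓ) * (Q * (P * (1 + ℓ))) := by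
        gcongr
        linarith
      calc _ ≤ (B : ℝ) ^ (2 * 2) * ((1 + ℓ) * (Q * (P * (1 + ℓ)))) := by gcongr
        _ = _ := by ring
  have hB2X : ((B ^ 2 : ℕ) : ℝ) ≤ X := by
    refine le_trans ?_ hBX
    push_cast
    exact pow_le_pow_right₀ hB1 (by norm_num)
  have hdec : ∀ x : DChar, ∑ n ∈ Finset.Ico 1 N, cLambda n *
      (x.ev n * ψ (Real.log n - Real.log X)) =
      ∑ m ∈ Finset.Ico 1 N, ∑ l ∈ Finset.Ico 1 N, truncLe cMu (B ^ 2) m * cLog l *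
        (x.ev (m * l) * ψ (Real.log (m * l : ℕ) - Real.log X)) -
      ∑ m ∈ Finset.Ico 1 N, ∑ l ∈ Finset.Ico 1 N,
        (truncLe cLambda (B ^ 2) * truncLe cMu (B ^ 2)) m * cZeta l *
        (x.ev (m * l) * ψ (Real.log (m * l : ℕ) - Real.log X)) +
      ∑ m ∈ Finset.Ico 1 N, ∑ l ∈ Finset.Ico 1 N,
        truncGt cMu (B ^ 2) m * (truncGt cLambda (B ^ 2) * cZeta) l *
        (x.ev (m * l) * ψ (Real.log (m * l : ℕ) - Real.log X)) := fun x ↦ by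
    have hh : ∀ n ≥ N, x.ev n * ψ (Real.log n - Real.log X) = 0 := fun n hn ↦ by
      rw [hN n hn, mul_zero]
    have hconv := fun f g ↦ (sum_conv_eq f g (fun n ↦ x.ev n * ψ (Real.log n - Real.log X)) N
      hh).symm
    rw [hconv, hconv, hconv, ← Finset.sum_sub_distrib, ← Finset.sum_add_distrib]
    refine Finset.sum_congr rfl fun n _ ↦ ?_
    have h1 := congrArg (fun F : ArithmeticFunction ℂ ↦ F n) (vaughan_identity (B ^ 2))
    simp only [ArithmeticFunction.add_apply] at h1
    have h2 : truncLe cLambda (B ^ 2) n * (x.ev n * ψ (Real.log n - Real.log X)) = 0 := by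
      rw [truncLe_apply]
      split_ifs with h
      · rw [hw.eq_zero_of_ge hX (le_trans (by exact_mod_cast h) hB2X), mul_zero, mul_zero]
      · rw [zero_mul]
    linear_combination (x.ev n * ψ (Real.log n - Real.log X)) * h1 + h2
  calc _ ≤ ∑ x ∈ T, (B ^ 4 * (Q * (P * (1 + ℓ) ^ 2)) + B ^ 4 * (Q * (P * (1 + ℓ) ^ 2)) +
        ‖∑ m ∈ Finset.Ico 1 N, ∑ l ∈ Finset.Ico 1 N,
        truncGt cMu (B ^ 2) m * (truncGt cLambda (B ^ 2) * cZeta) l *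
        (x.ev (m * l) * ψ (Real.log (m * l : ℕ) - Real.log X))‖) := by
        refine Finset.sum_le_sum fun x hx ↦ ?_
        rw [hdec]
        refine (norm_add_le _ _).trans (add_le_add ((norm_sub_le _ _).trans ?_) le_rfl)
        exact add_le_add (hI x hx) (hI' x hx)
    _ ≤ T.card * (2 * (B ^ 4 * (Q * (P * (1 + ℓ) ^ 2)))) +
        (4 * Real.exp κ * X * (ℓ * P) * (1 + ℓ) + 2 * Real.exp κ * X * (ℓ * P)) := by
        rw [Finset.sum_add_distrib, Finset.sum_const, nsmul_eq_mul, two_mul, hℓ]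
        gcongr
        rw [← hℓ]
        simpa only [hℓ] using hII
    _ ≤ 2 * P * Real.exp κ * X * (1 + ℓ) ^ 2 +
        (4 * Real.exp κ * X * ((1 + ℓ) * P) * (1 + ℓ) +
          2 * Real.exp κ * X * ((1 + ℓ) * (1 + ℓ) * P)) := by
        have h1 : (T.card : ℝ) * (B ^ 4 * Q) ≤ Real.exp κ * X := by
          have h2 : (T.card : ℝ) ≤ (Q : ℝ) ^ 2 := by exact_mod_cast DChar.card_le hT
          have h3 : (Q : ℝ) ^ 3 ≤ B := by
            have : Q ^ 3 ≤ Q ^ 4 := Nat.pow_le_pow_right hQ (by norm_num)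
            exact_mod_cast this.trans hQB
          calc (T.card : ℝ) * (B ^ 4 * Q) ≤ (Q : ℝ) ^ 2 * (B ^ 4 * Q) := by gcongr
            _ = (Q : ℝ) ^ 3 * B ^ 4 := by ring
            _ ≤ B * B ^ 4 := by gcongr
            _ = (B : ℝ) ^ 5 := by ring
            _ ≤ (B : ℝ) ^ 8 := pow_le_pow_right₀ hB1 (by norm_num)
            _ ≤ 1 * X := by linarith
            _ ≤ _ := by
              gcongr
              exact Real.one_le_exp hw.nonneg
        have h5 : ℓ ≤ (1 + ℓ) * (1 + ℓ) := by nlinarith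
        refine add_le_add ?_ ?_
        · calc _ = 2 * P * ((T.card : ℝ) * (B ^ 4 * Q)) * (1 + ℓ) ^ 2 := by ring
            _ ≤ 2 * P * (Real.exp κ * X) * (1 + ℓ) ^ 2 := by gcongr
            _ = _ := by ring
        · gcongr
          linarith
    _ = _ := by ring

end Vaughan

end

section

open Complex Filter Topology MeasureTheory Set
open scoped ContDiff

/-- The end point of the summation range for a weight supported in `[X, exp κ * X]`. -/
noncomputable def windowEnd (κ X : ℝ) : ℕ := ⌊Real.exp κ * X⌋₊ + 1

/-- Smoothly weighted sums over primes. -/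
noncomputable def primeSum (ψ : ℝ → ℂ) (κ X : ℝ) (f : ℕ → ℂ) : ℂ :=
  ∑ p ∈ (Finset.Ico 1 (windowEnd κ X)).filter Nat.Prime,
    Real.log p * (f p * ψ (Real.log p - Real.log X))

theorem log_pow_le {n : ℕ} {X : ℝ} (hX : 1 ≤ X) :
    Real.log X ^ n ≤ (4 * (n + 1 : ℝ)) ^ n * X ^ (1 / 4 : ℝ) := by
  have h1 := Real.log_le_rpow_div (x := X) (by linarith) (ε := 1 / (4 * (n + 1 : ℝ)))
    (by positivity)
  have h2 : X ^ (1 / (4 * (n + 1 : ℝ))) / (1 / (4 * (n + 1 : ℝ))) =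
      4 * (n + 1 : ℝ) * X ^ (1 / (4 * (n + 1 : ℝ))) := by
    field_simp
  rw [h2] at h1
  calc Real.log X ^ n ≤ (4 * (n + 1 : ℝ) * X ^ (1 / (4 * (n + 1 : ℝ)))) ^ n :=
        pow_le_pow_left₀ (Real.log_nonneg hX) h1 n
    _ = (4 * (n + 1 : ℝ)) ^ n * X ^ (1 / (4 * (n + 1 : ℝ)) * n) := by
        rw [mul_pow, Real.rpow_mul_natCast (by linarith)]
    _ ≤ _ := by
        gcongr
        rw [one_div, one_div, inv_mul_le_iff₀ (by positivity)]
        linarith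

section Window

variable {ψ : ℝ → ℂ} {P κ : ℝ} (hw : IsWeight ψ P κ) {X : ℝ}

include hw in
theorem IsWeight.eq_zero_of_windowEnd_le (hX : 0 < X) {n : ℕ} (hn : windowEnd κ X ≤ n) :
    ψ (Real.log n - Real.log X) = 0 :=
  hw.eq_zero_of_le hX ((Nat.lt_floor_add_one _).le.trans (by exact_mod_cast hn))

include hw in
theorem IsWeight.log_windowEnd_le (hX : 3 ≤ X) :
    Real.log (windowEnd κ X) ≤ (κ + 1) * Real.log X + 1 := by
  have hL := one_le_log_of_three_le hX
  have hK := Real.one_le_exp hw.nonneg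
  have h1 : (windowEnd κ X : ℝ) ≤ Real.exp κ * X * Real.exp 1 := by
    rw [windowEnd]
    push_cast
    have h2 := Nat.floor_le (a := Real.exp κ * X) (by positivity)
    have h3 := Real.add_one_le_exp (1 : ℝ)
    have h4 : (1 : ℝ) ≤ Real.exp κ * X := one_le_mul_of_one_le_of_one_le hK (by linarith)
    calc _ ≤ Real.exp κ * X + Real.exp κ * X := by linarith
      _ = Real.exp κ * X * 2 := by ring
      _ ≤ _ := by
        gcongr
        linarith
  have h5 := Real.log_le_log (by rw [windowEnd]; positivity) h1
  rw [Real.log_mul (by positivity) (by positivity), Real.log_mul (by positivity) (by linarith),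
    Real.log_exp, Real.log_exp] at h5
  have := mul_le_mul_of_nonneg_left hL hw.nonneg
  linarith

include hw in
theorem IsWeight.norm_primeSum_sub_le (hX : 3 ≤ X) (x : DChar) :
    ‖∑ n ∈ Finset.Ico 1 (windowEnd κ X), cLambda n * (x.ev n * ψ (Real.log n - Real.log X)) -
      primeSum ψ κ X x.ev‖ ≤
      P * (2 * √(Real.exp κ * X) * ((κ + 1) * Real.log X)) := by
  have hP := hw.P_nonneg
  have hK := Real.one_le_exp hw.nonneg
  have h4 : (1 : ℝ) ≤ Real.exp κ * X := one_le_mul_of_one_le_of_one_le hK (by linarith)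
  have h1 := Chebyshev.psi_sub_theta_le h4
  rw [Chebyshev.psi_sub_theta_eq_sum_not_prime] at h1
  have h2 : Real.log (Real.exp κ * X) ≤ (κ + 1) * Real.log X := by
    rw [Real.log_mul (by positivity) (by linarith), Real.log_exp]
    have := mul_le_mul_of_nonneg_left (one_le_log_of_three_le hX) hw.nonneg
    linarith
  have h3 : ∑ n ∈ Finset.Ico 1 (windowEnd κ X), cLambda n *
      (x.ev n * ψ (Real.log n - Real.log X)) - primeSum ψ κ X x.ev =
      ∑ n ∈ (Finset.Ico 1 (windowEnd κ X)).filter (fun n ↦ ¬ n.Prime), cLambda n *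
        (x.ev n * ψ (Real.log n - Real.log X)) := by
    rw [primeSum, sub_eq_iff_eq_add', ← Finset.sum_filter_add_sum_filter_not _ Nat.Prime]
    congr 1
    refine Finset.sum_congr rfl fun p hp ↦ ?_
    congr 1
    show ((ArithmeticFunction.vonMangoldt p : ℝ) : ℂ) = _
    rw [ArithmeticFunction.vonMangoldt_apply_prime (Finset.mem_filter.mp hp).2]
  rw [h3]
  calc _ ≤ ∑ n ∈ (Finset.Ico 1 (windowEnd κ X)).filter (fun n ↦ ¬ n.Prime),
        ArithmeticFunction.vonMangoldt n * P := by
        refine norm_sum_le_of_le _ fun n _ ↦ ?_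
        rw [norm_mul, norm_mul]
        have h5 : ‖cLambda n‖ = ArithmeticFunction.vonMangoldt n := by
          show ‖((ArithmeticFunction.vonMangoldt n : ℝ) : ℂ)‖ = _
          rw [norm_real, Real.norm_of_nonneg ArithmeticFunction.vonMangoldt_nonneg]
        rw [h5]
        have h6 := hw.bound (Real.log n - Real.log X)
        have h7 := x.norm_ev_le n
        have h8 : 0 ≤ ArithmeticFunction.vonMangoldt n := ArithmeticFunction.vonMangoldt_nonneg
        calc _ ≤ ArithmeticFunction.vonMangoldt n * (1 * P) := by gcongr
          _ = _ := by ring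
    _ = P * ∑ n ∈ Finset.Ioc 0 ⌊Real.exp κ * X⌋₊ with ¬ n.Prime, ArithmeticFunction.vonMangoldt n := by
        rw [mul_comm, Finset.sum_mul]
        refine Finset.sum_congr ?_ fun _ _ ↦ rfl
        ext n
        simp only [windowEnd, Finset.mem_filter, Finset.mem_Ico, Finset.mem_Ioc]
        constructor <;> rintro ⟨⟨h5, h6⟩, h7⟩ <;> exact ⟨⟨by omega, by omega⟩, h7⟩
    _ ≤ _ := by
        gcongr
        exact h1.trans (by gcongr)

include hw in
theorem IsWeight.tsum_logCoeff_eq (hX : 0 < X) (x : DChar) :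
    ∑' n, logCoeff x.2 0 n * ψ (Real.log n - Real.log X) =
      ∑ n ∈ Finset.Ico 1 (windowEnd κ X), cLambda n *
        (x.ev n * ψ (Real.log n - Real.log X)) := by
  rw [tsum_eq_sum (s := Finset.Ico 1 (windowEnd κ X))]
  · refine Finset.sum_congr rfl fun n _ ↦ ?_
    rw [logCoeff, pow_zero, one_mul, DChar.ev]
    show _ = ((ArithmeticFunction.vonMangoldt n : ℝ) : ℂ) * _
    ring
  · intro n hn
    rw [Finset.mem_Ico, not_and_or, not_le, not_lt] at hn
    rcases hn with hn | hn
    · have : n = 0 := by omega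
      simp [this, logCoeff]
    · rw [hw.eq_zero_of_windowEnd_le hX hn, mul_zero]

include hw in
/-- The error terms coming from proper prime powers. -/
theorem IsWeight.sum_primePow_le (A : ℕ) : ∃ C : ℝ, 0 ≤ C ∧ ∀ X : ℝ, 3 ≤ X → ∀ Q : ℕ,
    (Q : ℝ) ^ 32 ≤ X → 
    Real.log X ^ A * (Q ^ 2 * (P * (2 * √(Real.exp κ * X) * ((κ + 1) * Real.log X)))) ≤ C * X := by
  have hP := hw.P_nonneg
  have hκ := hw.nonneg
  refine ⟨(4 * ((A + 1 : ℕ) + 1 : ℝ)) ^ (A + 1) * (P * (2 * √(Real.exp κ) * (κ + 1))),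
    by positivity, fun X hX Q hQ ↦ ?_⟩
  have h1 := log_pow_le (n := A + 1) (X := X) (by linarith)
  have hX0 : 0 < X := by linarith
  have h2 : (Q : ℝ) ^ 2 ≤ X ^ (1 / 16 : ℝ) := by
    calc (Q : ℝ) ^ 2 = ((Q : ℝ) ^ 32) ^ (1 / 16 : ℝ) := by
          rw [← Real.rpow_natCast_mul (Nat.cast_nonneg _), ← Real.rpow_natCast]
          norm_num
      _ ≤ _ := by gcongr
  have h3 : √(Real.exp κ * X) = √(Real.exp κ) * X ^ (1 / 2 : ℝ) := by
    rw [Real.sqrt_mul (Real.exp_pos _).le, Real.sqrt_eq_rpow X]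
  calc _ = Real.log X ^ (A + 1) * (Q : ℝ) ^ 2 * √(Real.exp κ * X) * (P * (2 * (κ + 1))) := by ring
    _ ≤ ((4 * ((A + 1 : ℕ) + 1 : ℝ)) ^ (A + 1) * X ^ (1 / 4 : ℝ)) * X ^ (1 / 16 : ℝ) *
        (√(Real.exp κ) * X ^ (1 / 2 : ℝ)) * (P * (2 * (κ + 1))) := by
        rw [h3]
        gcongr
    _ = (4 * ((A + 1 : ℕ) + 1 : ℝ)) ^ (A + 1) * (P * (2 * √(Real.exp κ) * (κ + 1))) *
        (X ^ (1 / 4 : ℝ) * X ^ (1 / 16 : ℝ) * X ^ (1 / 2 : ℝ)) := by ring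
    _ ≤ (4 * ((A + 1 : ℕ) + 1 : ℝ)) ^ (A + 1) * (P * (2 * √(Real.exp κ) * (κ + 1))) *
        X ^ (1 : ℝ) := by
        rw [← Real.rpow_add hX0, ← Real.rpow_add hX0]
        gcongr
        · linarith
        · norm_num
    _ = _ := by rw [Real.rpow_one]

include hw in
/-- A weak form of the Bombieri-Vinogradov theorem: prime sums over primitive characters. -/
theorem IsWeight.sum_primeSum_le (hψ : ContDiff ℝ ∞ ψ) (hψ' : HasCompactSupport ψ) (A : ℕ) :
    ∃ C : ℝ, 0 ≤ C ∧ ∀ X : ℝ, 3 ≤ X → ∀ Q : ℕ, 1 ≤ Q → (Q : ℝ) ^ 32 ≤ X →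
      ∀ T : Finset DChar, DChar.Family Q T →
        Real.log X ^ A * ∑ x ∈ T, ‖primeSum ψ κ X x.ev‖ * (√x.1)⁻¹ ≤ C * X := by
  have hP := hw.P_nonneg
  have hκ := hw.nonneg
  obtain ⟨D, hD⟩ : ∃ D, D = A + 2 := ⟨_, rfl⟩
  obtain ⟨C₁, hC₁, h₁⟩ := siegel_walfisz (2 * D) (A + 4 * D + 1) hψ hψ'
  obtain ⟨C₂, hC₂, h₂⟩ := hw.sum_primePow_le A
  refine ⟨C₁ + 8 * P * Real.exp κ * (κ + 3) ^ 2 + C₂, by positivity, fun X hX Q hQ hQX T hT ↦ ?_⟩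
  have hL := one_le_log_of_three_le hX
  obtain ⟨ℓ, hℓ⟩ : ∃ ℓ, ℓ = Real.log X := ⟨_, rfl⟩
  obtain ⟨S, hS⟩ : ∃ S : DChar → ℂ, ∀ x, S x = ∑ n ∈ Finset.Ico 1 (windowEnd κ X),
    cLambda n * (x.ev n * ψ (Real.log n - Real.log X)) := ⟨_, fun _ ↦ rfl⟩
  obtain ⟨G, hG⟩ : ∃ G, G = P * (2 * √(Real.exp κ * X) * ((κ + 1) * Real.log X)) := ⟨_, rfl⟩
  have hG0 : 0 ≤ G := by
    rw [hG]
    have : 0 ≤ Real.log X := by linarith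
    positivity
  have hsub : ∀ x : DChar, ‖primeSum ψ κ X x.ev‖ ≤ ‖S x‖ + G := fun x ↦ by
    have := hw.norm_primeSum_sub_le hX x
    rw [← hS, ← hG] at this
    have h3 := norm_sub_norm_le (primeSum ψ κ X x.ev) (S x)
    rw [norm_sub_rev] at h3
    linarith
  have hsq : ∀ x ∈ T, (√x.1)⁻¹ ≤ 1 := fun x hx ↦ by
    refine inv_le_one_of_one_le₀ (Real.one_le_sqrt.mpr ?_)
    exact_mod_cast hT.pos x hx
  have hXpos : 0 < X := by linarith
  have hbig : ℓ ^ A * ∑ x ∈ T with ℓ ^ (2 * D) < x.1, ‖S x‖ * (√x.1)⁻¹ ≤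
      8 * P * Real.exp κ * (κ + 3) ^ 2 * X := by
    have hT' : DChar.Family Q (T.filter fun x ↦ ℓ ^ (2 * D) < x.1) :=
      ⟨fun x hx ↦ hT.pos x (Finset.mem_filter.mp hx).1,
        fun x hx ↦ hT.le x (Finset.mem_filter.mp hx).1,
        fun x hx ↦ hT.prim x (Finset.mem_filter.mp hx).1,
        fun x hx ↦ hT.ne x (Finset.mem_filter.mp hx).1⟩
    have h3 := hw.sum_cLambda_le (by linarith) hQ (le_refl (Q ^ 4)) (X := X)
      (by push_cast; rwa [← pow_mul]) hT' (N := windowEnd κ X) (Nat.le_add_left _ _)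
      (fun n hn ↦ hw.eq_zero_of_windowEnd_le hXpos hn)
    simp_rw [← hS] at h3
    have h4 := hw.log_windowEnd_le hX
    have h5 : ∀ x ∈ T.filter (fun x ↦ ℓ ^ (2 * D) < x.1), ‖S x‖ * (√x.1)⁻¹ ≤ ‖S x‖ * (ℓ ^ D)⁻¹ := by
      intro x hx
      gcongr
      · exact pow_pos (by linarith) _
      · apply Real.le_sqrt_of_sq_le
        rw [← pow_mul, mul_comm]
        exact (Finset.mem_filter.mp hx).2.le
    have hℓ0 : 0 < ℓ := by linarith
    have h6 : 1 + Real.log (windowEnd κ X) ≤ (κ + 3) * ℓ := by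
      rw [hℓ]
      linarith
    calc _ ≤ ℓ ^ A * ((8 * P * Real.exp κ * X * (1 + Real.log (windowEnd κ X)) ^ 2) * (ℓ ^ D)⁻¹) := by
          gcongr
          refine (Finset.sum_le_sum h5).trans ?_
          rw [← Finset.sum_mul]
          gcongr
      _ ≤ ℓ ^ A * ((8 * P * Real.exp κ * X * ((κ + 3) * ℓ) ^ 2) * (ℓ ^ D)⁻¹) := by
          gcongr
      _ = _ := by
          rw [hD]
          field_simp
          ring
  have hsmall : ℓ ^ A * ∑ x ∈ T with ¬ ℓ ^ (2 * D) < x.1, ‖S x‖ * (√x.1)⁻¹ ≤ C₁ * X := by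
    obtain ⟨Q', hQ'⟩ : ∃ Q', Q' = ⌊ℓ ^ (2 * D)⌋₊ := ⟨_, rfl⟩
    have hℓ0 : 0 < ℓ := by linarith
    have hT' : DChar.Family Q' (T.filter fun x ↦ ¬ ℓ ^ (2 * D) < x.1) :=
      ⟨fun x hx ↦ hT.pos x (Finset.mem_filter.mp hx).1,
        fun x hx ↦ hQ' ▸ Nat.le_floor (not_lt.mp (Finset.mem_filter.mp hx).2),
        fun x hx ↦ hT.prim x (Finset.mem_filter.mp hx).1,
        fun x hx ↦ hT.ne x (Finset.mem_filter.mp hx).1⟩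
    have hcard : (((T.filter fun x ↦ ¬ ℓ ^ (2 * D) < x.1).card : ℕ) : ℝ) ≤ ℓ ^ (4 * D) := by
      have h3 : (((T.filter fun x ↦ ¬ ℓ ^ (2 * D) < x.1).card : ℕ) : ℝ) ≤ (Q' : ℝ) ^ 2 := by
        exact_mod_cast DChar.card_le hT'
      have h4 : (Q' : ℝ) ≤ ℓ ^ (2 * D) := hQ' ▸ Nat.floor_le (by positivity)
      calc _ ≤ _ := h3
        _ ≤ (ℓ ^ (2 * D)) ^ 2 := by gcongr
        _ = _ := by rw [← pow_mul]; congr 1; ring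
    have h5 : ∀ x ∈ T.filter (fun x ↦ ¬ ℓ ^ (2 * D) < x.1), ‖S x‖ * (√x.1)⁻¹ ≤
        C₁ * X * ℓ * (ℓ ^ (A + 4 * D + 1))⁻¹ := by
      intro x hx
      obtain ⟨hxT, hxl⟩ := Finset.mem_filter.mp hx
      have : NeZero x.1 := ⟨(hT.pos x hxT).ne'⟩
      have h6 := h₁ x.1 x.2 (hT.prim x hxT) (hT.ne x hxT) X hX (by rw [← hℓ]; exact not_lt.mp hxl)
      rw [hw.tsum_logCoeff_eq hXpos, ← hS, ← hℓ] at h6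
      rw [le_mul_inv_iff₀ (by positivity)]
      calc _ ≤ ‖S x‖ * 1 * ℓ ^ (A + 4 * D + 1) := by
            gcongr
            exact hsq x hxT
        _ ≤ _ := by linarith
    calc _ ≤ ℓ ^ A * (ℓ ^ (4 * D) * (C₁ * X * ℓ * (ℓ ^ (A + 4 * D + 1))⁻¹)) := by
          gcongr
          refine (Finset.sum_le_sum h5).trans ?_
          rw [Finset.sum_const, nsmul_eq_mul]
          gcongr
      _ = _ := by
          rw [pow_add, pow_add, pow_one]
          field_simp
  rw [← hℓ]
  have hℓ0 : 0 < ℓ := by linarith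
  calc _ ≤ ℓ ^ A * ∑ x ∈ T, (‖S x‖ * (√x.1)⁻¹ + G) := by
        gcongr with x hx
        calc _ ≤ (‖S x‖ + G) * (√x.1)⁻¹ := by
              gcongr
              exact hsub x
          _ = ‖S x‖ * (√x.1)⁻¹ + G * (√x.1)⁻¹ := by ring
          _ ≤ ‖S x‖ * (√x.1)⁻¹ + G * 1 := by
              gcongr
              exact hsq x hx
          _ = _ := by rw [mul_one]
    _ = ℓ ^ A * (∑ x ∈ T with ℓ ^ (2 * D) < x.1, ‖S x‖ * (√x.1)⁻¹) +
        ℓ ^ A * (∑ x ∈ T with ¬ ℓ ^ (2 * D) < x.1, ‖S x‖ * (√x.1)⁻¹) + ℓ ^ A * (T.card * G) := by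
        rw [Finset.sum_add_distrib, Finset.sum_const, nsmul_eq_mul,
          ← Finset.sum_filter_add_sum_filter_not T (fun x ↦ ℓ ^ (2 * D) < x.1)]
        ring
    _ ≤ 8 * P * Real.exp κ * (κ + 3) ^ 2 * X + C₁ * X + C₂ * X := by
        refine add_le_add (add_le_add hbig hsmall) ?_
        have h7 := h₂ X hX Q hQX
        rw [← hG, ← hℓ] at h7
        refine le_trans ?_ h7
        gcongr
        exact_mod_cast DChar.card_le hT
    _ = _ := by ring

end Window

end

section

open Finset

section Tensor

variable {S Z C : Type*} [Fintype S] [Fintype Z] [Fintype C]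

theorem sum_fin_succ_pi {α M : Type*} [Fintype α] [AddCommMonoid M] {n : ℕ}
    (f : (Fin (n + 1) → α) → M) :
    ∑ r, f r = ∑ a, ∑ r : Fin n → α, f (Fin.cons a r) := by
  rw [← Fintype.sum_prod_type']
  exact (Fintype.sum_equiv (Fin.consEquiv fun _ ↦ α) _ _ fun _ ↦ rfl).symm

/-- Inequalities between sums of squares of linear forms tensorize. -/
theorem sum_prod_sq_le_of_forall {n : ℕ} (P : Fin n → S → ℝ) (A : Fin n → S → Z → ℝ)
    (Q : Fin n → C → ℝ) (B : Fin n → C → Z → ℝ) (hP : ∀ j s, 0 ≤ P j s) (hQ : ∀ j c, 0 ≤ Q j c)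
    (h : ∀ j, ∀ z : Z → ℝ, ∑ s, P j s * (∑ a, A j s a * z a) ^ 2 ≤
      ∑ c, Q j c * (∑ a, B j c a * z a) ^ 2) (y : (Fin n → Z) → ℝ) :
    ∑ s : Fin n → S, (∏ j, P j (s j)) * (∑ r, (∏ j, A j (s j) (r j)) * y r) ^ 2 ≤
      ∑ c : Fin n → C, (∏ j, Q j (c j)) * (∑ r, (∏ j, B j (c j) (r j)) * y r) ^ 2 := by
  induction n with
  | zero => simp
  | succ n ih =>
    simp_rw [sum_fin_succ_pi, Fin.prod_univ_succ, Fin.cons_zero, Fin.cons_succ]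
    calc _ = ∑ s₀, P 0 s₀ * ∑ s : Fin n → S, (∏ j, P (Fin.succ j) (s j)) *
          (∑ r, (∏ j, A (Fin.succ j) (s j) (r j)) * ∑ a, A 0 s₀ a * y (Fin.cons a r)) ^ 2 := by
          refine sum_congr rfl fun s₀ _ ↦ ?_
          rw [mul_sum]
          refine sum_congr rfl fun s _ ↦ ?_
          rw [sum_comm, mul_assoc]
          simp_rw [mul_sum]
          congr 4
          ext r
          exact sum_congr rfl fun a _ ↦ by ring
      _ ≤ ∑ s₀, P 0 s₀ * ∑ c : Fin n → C, (∏ j, Q (Fin.succ j) (c j)) *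
          (∑ r, (∏ j, B (Fin.succ j) (c j) (r j)) * ∑ a, A 0 s₀ a * y (Fin.cons a r)) ^ 2 := by
          refine sum_le_sum fun s₀ _ ↦ mul_le_mul_of_nonneg_left ?_ (hP 0 s₀)
          exact ih (fun j ↦ P (Fin.succ j)) (fun j ↦ A (Fin.succ j)) (fun j ↦ Q (Fin.succ j))
            (fun j ↦ B (Fin.succ j)) (fun j ↦ hP _) (fun j ↦ hQ _) (fun j ↦ h _) _
      _ = ∑ c : Fin n → C, (∏ j, Q (Fin.succ j) (c j)) * ∑ s₀, P 0 s₀ *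
          (∑ a, A 0 s₀ a * ∑ r, (∏ j, B (Fin.succ j) (c j) (r j)) * y (Fin.cons a r)) ^ 2 := by
          simp_rw [mul_sum]
          rw [sum_comm]
          refine sum_congr rfl fun c _ ↦ sum_congr rfl fun s₀ _ ↦ ?_
          rw [sum_comm, mul_left_comm]
          congr 4
          ext a
          exact sum_congr rfl fun r _ ↦ by ring
      _ ≤ ∑ c : Fin n → C, (∏ j, Q (Fin.succ j) (c j)) * ∑ c₀, Q 0 c₀ *
          (∑ a, B 0 c₀ a * ∑ r, (∏ j, B (Fin.succ j) (c j) (r j)) * y (Fin.cons a r)) ^ 2 :=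
          sum_le_sum fun c _ ↦ mul_le_mul_of_nonneg_left (h 0 _) (prod_nonneg fun j _ ↦ hQ _ _)
      _ = _ := by
          simp_rw [mul_sum]
          rw [sum_comm]
          refine sum_congr rfl fun c _ ↦ sum_congr rfl fun s₀ _ ↦ ?_
          rw [mul_assoc, mul_left_comm]
          congr 4
          ext a
          exact sum_congr rfl fun r _ ↦ by ring

end Tensor

section Local

variable {k : ℕ}

/-- The local factor of the sieve weight at a prime of size `P`. -/
noncomputable def locWeight (P : ℝ) (a s : Option (Fin k)) : ℝ :=
  match a with
  | none => 1
  | some i => 1 - (P - 1) * if s = some i then 1 else 0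

/-- The distribution of the divisibility state for a random integer. -/
noncomputable def locProb (P : ℝ) : Option (Fin k) → ℝ
  | none => 1 - k / P
  | some _ => 1 / P

/-- The distribution of the divisibility state for a random prime in position `l`. -/
noncomputable def locProb' (l : Fin k) (P : ℝ) : Option (Fin k) → ℝ
  | none => 1 - (k - 1) / (P - 1)
  | some i => if i = l then 0 else 1 / (P - 1)

/-- The size of a local component. -/
noncomputable def locNorm (P : ℝ) : Option (Fin k) → ℝ
  | none => 1
  | some _ => P

theorem sum_locWeight_none (P : ℝ) (z : Option (Fin k) → ℝ) :
    ∑ a, locWeight P a none * z a = z none + ∑ i, z (some i) := by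
  rw [Fintype.sum_option]
  simp [locWeight]

theorem sum_locWeight_some (P : ℝ) (z : Option (Fin k) → ℝ) (i : Fin k) :
    ∑ a, locWeight P a (some i) * z a = z none + ∑ i, z (some i) - (P - 1) * z (some i) := by
  rw [Fintype.sum_option]
  simp only [locWeight, sub_mul, sum_sub_distrib, one_mul, Option.some_inj, mul_ite, ite_mul,
    mul_one, mul_zero, zero_mul, sum_ite_eq, mem_univ, if_true]
  ring

theorem sum_locProb_mul_sq_le {P : ℝ} (hP : 2 ≤ P) (z : Option (Fin k) → ℝ) :
    ∑ s, locProb P s * (∑ a, locWeight P a s * z a) ^ 2 ≤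
      ∑ c, ((1 + k / P ^ 2) * locNorm P c) * (∑ a, (if a = c then 1 else 0) * z a) ^ 2 := by
  simp_rw [ite_mul, one_mul, zero_mul, sum_ite_eq', mem_univ, if_true]
  rw [Fintype.sum_option (fun s ↦ locProb P s * _),
    Fintype.sum_option (fun c ↦ _ * locNorm P c * _), sum_locWeight_none]
  simp_rw [sum_locWeight_some, locProb, locNorm, mul_assoc, ← mul_sum]
  obtain ⟨u, hu⟩ : ∃ u, u = z none := ⟨_, rfl⟩
  obtain ⟨S, hS⟩ : ∃ S, S = ∑ i, z (some i) := ⟨_, rfl⟩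
  obtain ⟨q, hq⟩ : ∃ q, q = ∑ i, z (some i) ^ 2 := ⟨_, rfl⟩
  have h1 : ∑ i, (u + S - (P - 1) * z (some i)) ^ 2 =
      k * (u + S) ^ 2 - 2 * (P - 1) * (u + S) * S + (P - 1) ^ 2 * q := by
    rw [hS, hq, mul_sum, mul_sum, ← hS]
    have h2 : (k : ℝ) * (u + S) ^ 2 = ∑ _i : Fin k, (u + S) ^ 2 := by simp
    rw [h2, ← sum_sub_distrib, ← sum_add_distrib]
    exact sum_congr rfl fun i _ ↦ by ring
  rw [← hu, ← hS, ← hq, h1]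
  have h3 : 2 * (u / P) * S ≤ k * (u / P) ^ 2 + q := by
    have h2 : (k : ℝ) * (u / P) ^ 2 = ∑ _i : Fin k, (u / P) ^ 2 := by simp
    rw [hS, hq, h2, mul_sum, ← sum_add_distrib]
    exact sum_le_sum fun i _ ↦ by nlinarith [sq_nonneg (u / P - z (some i))]
  have hq0 : 0 ≤ q := hq ▸ sum_nonneg fun i _ ↦ sq_nonneg _
  have hP0 : 0 < P := by linarith
  have h4 : (1 - k / P) * (u + S) ^ 2 +
      1 / P * (k * (u + S) ^ 2 - 2 * (P - 1) * (u + S) * S + (P - 1) ^ 2 * q) =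
      u ^ 2 + 2 * (u / P) * S - (1 - 2 / P) * S ^ 2 + (P - 2 + 1 / P) * q := by
    field_simp
    ring
  have h5 : 1 / P ≤ 1 := by rw [div_le_one hP0]; linarith
  have h6 : 0 ≤ (1 - 2 / P) * S ^ 2 := by
    have : 2 / P ≤ 1 := by rw [div_le_one hP0]; linarith
    exact mul_nonneg (by linarith) (sq_nonneg _)
  have h7 : (P - 2 + 1 / P) * q ≤ (P - 1) * q := mul_le_mul_of_nonneg_right (by linarith) hq0
  have h8 : 0 ≤ k / P ^ 2 * P * q := by positivity
  have h9 : k * (u / P) ^ 2 = k / P ^ 2 * u ^ 2 := by ring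
  rw [h4]
  calc _ ≤ u ^ 2 + k / P ^ 2 * u ^ 2 + P * q + k / P ^ 2 * P * q := by linarith
    _ = _ := by ring

theorem le_sum_locProb'_mul_sq (l : Fin k) {P : ℝ} (hP : 1 < P) (z : Option (Fin k) → ℝ) :
    ∑ c : Option (Fin k), (if c = some l then 0 else 1) * (locNorm (P - k) c) *
      (∑ a, (if a = c ∨ (c = none ∧ a = some l) then 1 else 0) * z a) ^ 2 ≤
    ∑ s, locProb' l P s * (∑ a, locWeight P a s * z a) ^ 2 := by
  rw [Fintype.sum_option (fun s ↦ locProb' l P s * _), sum_locWeight_none]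
  simp_rw [sum_locWeight_some, locProb', Fintype.sum_option, locNorm]
  obtain ⟨u, hu⟩ : ∃ u, u = z none := ⟨_, rfl⟩
  obtain ⟨w, hw⟩ : ∃ w, w = z (some l) := ⟨_, rfl⟩
  obtain ⟨S, hS⟩ : ∃ S, S = ∑ i ∈ univ.erase l, z (some i) := ⟨_, rfl⟩
  obtain ⟨q, hq⟩ : ∃ q, q = ∑ i ∈ univ.erase l, z (some i) ^ 2 := ⟨_, rfl⟩
  have hS' : ∑ i, z (some i) = w + S := by
    rw [hw, hS, add_sum_erase _ (fun i ↦ z (some i)) (mem_univ l)]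
  have hk : ((univ.erase l).card : ℝ) = k - 1 := by
    rw [card_erase_of_mem (mem_univ l), card_univ, Fintype.card_fin, Nat.cast_sub (by
      have := l.2; omega), Nat.cast_one]
  have h1 : ∑ x, (if x = l then 0 else 1 / (P - 1)) *
      (z none + ∑ i, z (some i) - (P - 1) * z (some x)) ^ 2 = 
      1 / (P - 1) * ((k - 1) * (u + w + S) ^ 2 - 2 * (P - 1) * (u + w + S) * S + (P - 1) ^ 2 * q) := by
    rw [← add_sum_erase _ _ (mem_univ l), if_pos rfl, zero_mul, zero_add]
    rw [← hk, hS, hq, hS', mul_sum, mul_sum, ← hS, ← hu, mul_add, mul_sub, mul_sum, mul_sum]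
    have h2 : (1 / (P - 1)) * (((univ.erase l).card : ℝ) * (u + w + S) ^ 2) =
      ∑ _i ∈ univ.erase l, (1 / (P - 1)) * (u + w + S) ^ 2 := by simp; ring
    rw [h2, ← sum_sub_distrib, ← sum_add_distrib]
    refine sum_congr rfl fun i hi ↦ ?_
    rw [if_neg (ne_of_mem_erase hi)]
    ring
  have h3 : S ^ 2 ≤ (k - 1) * q := by
    rw [← hk, hS, hq]
    exact sq_sum_le_card_mul_sum_sq
  have h5 : ∑ x, (if some x = some l then 0 else 1) * (P - k) *
      ((if none = some x ∨ some x = none ∧ none = some l then 1 else 0) * z none +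
        ∑ i, (if some i = some x ∨ some x = none ∧ some i = some l then 1 else 0) *
          z (some i)) ^ 2 = (P - k) * q := by
    rw [← add_sum_erase _ _ (mem_univ l), if_pos rfl, zero_mul, zero_mul, zero_add, hq, mul_sum]
    refine sum_congr rfl fun i hi ↦ ?_
    simp [ne_of_mem_erase hi]
  rw [h1, h5, hS']
  simp only [reduceCtorEq, Option.some_inj, if_true, true_and, or_false, false_or, if_false, one_mul,
    mul_one, true_or, ite_mul, zero_mul, sum_ite_eq', mem_univ, ← hu, ← hw, zero_add]
  have hP0 : P - 1 ≠ 0 := by linarith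
  have h4 : (1 - (k - 1) / (P - 1)) * (u + (w + S)) ^ 2 + 1 / (P - 1) *
      ((k - 1) * (u + w + S) ^ 2 - 2 * (P - 1) * (u + w + S) * S + (P - 1) ^ 2 * q) =
      (u + w) ^ 2 - S ^ 2 + (P - 1) * q := by
    field_simp
    ring
  rw [h4]
  linarith

end Local

end

section

open Finset

/-- An assignment to each of `n` primes of at most one of `k` positions. -/
abbrev Config (n k : ℕ) := Fin n → Option (Fin k)

section Sieve

variable {n k : ℕ} (P : Fin n → ℝ)

/-- The product of the primes in a configuration. -/
noncomputable def configNorm (r : Config n k) : ℝ := ∏ j, locNorm (P j) (r j)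

/-- The multidimensional sieve weight with parameters `y`. -/
noncomputable def sieveSum (y : Config n k → ℝ) (s : Config n k) : ℝ :=
  ∑ r, (∏ j, locWeight (P j) (r j) (s j)) * y r

/-- The indicator that a local component is contained in another one. -/
noncomputable def locInd (b s : Option (Fin k)) : ℝ := if b = none ∨ b = s then 1 else 0

/-- Coefficients of local weights in terms of indicators. -/
noncomputable def locCoeff (P : ℝ) (a b : Option (Fin k)) : ℝ :=
  if b = none then 1 else if b = a then -(P - 1) else 0

/-- Coefficients of the sieve weight in terms of indicators. -/
noncomputable def sieveCoeff (y : Config n k → ℝ) (d : Config n k) : ℝ :=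
  ∑ r, (∏ j, locCoeff (P j) (r j) (d j)) * y r

/-- The indicator that a configuration is contained in another one. -/
noncomputable def configInd (d s : Config n k) : ℝ := ∏ j, locInd (d j) (s j)

variable {P}

theorem locNorm_pos {p : ℝ} (hp : 0 < p) (a : Option (Fin k)) : 0 < locNorm p a := by
  cases a <;> simp [locNorm, hp]

theorem one_le_locNorm {p : ℝ} (hp : 1 ≤ p) (a : Option (Fin k)) : 1 ≤ locNorm p a := by
  cases a <;> simp [locNorm, hp]

theorem configNorm_pos (hP : ∀ j, 0 < P j) (r : Config n k) : 0 < configNorm P r :=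
  prod_pos fun j _ ↦ locNorm_pos (hP j) _

theorem locProb_nonneg {p : ℝ} (hp : 0 < p) (hk : k ≤ p) (s : Option (Fin k)) :
    0 ≤ locProb p s := by
  cases s with
  | none =>
    simp only [locProb]
    rw [sub_nonneg, div_le_one hp]
    exact hk
  | some i => simp only [locProb]; positivity

theorem locProb'_nonneg (l : Fin k) {p : ℝ} (hp : 1 < p) (hk : k ≤ p) (s : Option (Fin k)) :
    0 ≤ locProb' l p s := by
  cases s with
  | none =>
    simp only [locProb']
    rw [sub_nonneg, div_le_one (by linarith)]
    linarith
  | some i =>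
    simp only [locProb']
    split_ifs
    · exact le_rfl
    · have : 0 < p - 1 := by linarith
      positivity

theorem prod_ite_eq_ite_forall {α : Type*} [DecidableEq α] (r c : Fin n → α) :
    ∏ j, (if r j = c j then (1 : ℝ) else 0) = if r = c then 1 else 0 := by
  rw [prod_boole]
  simp [funext_iff]

theorem sum_prob_mul_sieveSum_sq_le (hP : ∀ j, 2 ≤ P j) (hk : ∀ j, k ≤ P j)
    (y : Config n k → ℝ) :
    ∑ s, (∏ j, locProb (P j) (s j)) * sieveSum P y s ^ 2 ≤
      (∏ j, (1 + k / P j ^ 2)) * ∑ c, configNorm P c * y c ^ 2 := by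
  refine (sum_prod_sq_le_of_forall (fun j ↦ locProb (P j)) (fun j s a ↦ locWeight (P j) a s)
    (fun j c ↦ (1 + k / P j ^ 2) * locNorm (P j) c) (fun j c a ↦ if a = c then 1 else 0)
    (fun j s ↦ locProb_nonneg (by linarith [hP j]) (hk j) s)
    (fun j c ↦ mul_nonneg (by positivity) (locNorm_pos (by linarith [hP j]) c).le)
    (fun j z ↦ sum_locProb_mul_sq_le (hP j) z) y).trans_eq ?_
  simp_rw [prod_ite_eq_ite_forall, ite_mul, one_mul, zero_mul, sum_ite_eq', mem_univ, if_true,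
    prod_mul_distrib, mul_sum, configNorm, mul_assoc]

theorem le_sum_prob'_mul_sieveSum_sq (l : Fin k) (hP : ∀ j, 2 ≤ P j) (hk : ∀ j, k ≤ P j)
    (y : Config n k → ℝ) :
    ∑ c : Config n k, (∏ j, (if c j = some l then 0 else 1) * locNorm (P j - k) (c j)) *
      (∑ r : Config n k,
        (∏ j, (if r j = c j ∨ (c j = none ∧ r j = some l) then 1 else 0)) * y r) ^ 2 ≤
    ∑ s, (∏ j, locProb' l (P j) (s j)) * sieveSum P y s ^ 2 := by
  refine sum_prod_sq_le_of_forall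
    (fun j c ↦ (if c = some l then 0 else 1) * locNorm (P j - k) c)
    (fun j c a ↦ if a = c ∨ (c = none ∧ a = some l) then 1 else 0)
    (fun j ↦ locProb' l (P j)) (fun j s a ↦ locWeight (P j) a s) (fun j c ↦ ?_)
    (fun j s ↦ locProb'_nonneg l (by linarith [hP j]) (hk j) s)
    (fun j z ↦ le_sum_locProb'_mul_sq l (by linarith [hP j]) z) y
  have : 0 ≤ locNorm (P j - k) c := by
    cases c <;> simp [locNorm, hk j]
  split_ifs <;> simp [this]

theorem locWeight_eq_sum (p : ℝ) (a s : Option (Fin k)) :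
    locWeight p a s = ∑ b, locCoeff p a b * locInd b s := by
  rw [Fintype.sum_option]
  cases a with
  | none => simp [locWeight, locCoeff, locInd]
  | some i =>
    simp only [locWeight, locCoeff, locInd, if_true, true_or, reduceCtorEq, if_false, false_or,
      mul_one, Option.some_inj, ite_mul, zero_mul, sum_ite_eq', mem_univ, eq_comm (a := s)]
    ring

theorem sieveSum_eq (y : Config n k → ℝ) (s : Config n k) :
    sieveSum P y s = ∑ d, sieveCoeff P y d * configInd d s := by
  simp_rw [sieveSum, locWeight_eq_sum, prod_univ_sum, Fintype.piFinset_univ, sieveCoeff, sum_mul,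
    configInd]
  rw [sum_comm]
  refine sum_congr rfl fun d _ ↦ sum_congr rfl fun r _ ↦ ?_
  rw [prod_mul_distrib]
  ring

theorem sum_mul_sieveSum_sq {ι : Type*} (T : Finset ι) (a : ι → ℝ) (s : ι → Config n k)
    (y : Config n k → ℝ) :
    ∑ x ∈ T, a x * sieveSum P y (s x) ^ 2 = ∑ d, ∑ e, sieveCoeff P y d * sieveCoeff P y e *
      ∑ x ∈ T, a x * (configInd d (s x) * configInd e (s x)) := by
  simp_rw [sieveSum_eq, sq, sum_mul_sum, mul_sum]
  rw [sum_comm]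
  refine sum_congr rfl fun d _ ↦ ?_
  rw [sum_comm]
  exact sum_congr rfl fun e _ ↦ sum_congr rfl fun x _ ↦ by ring

theorem sum_prod_mul_configInd (w : Fin n → Option (Fin k) → ℝ) (d e : Config n k) :
    ∑ s : Config n k, (∏ j, w j (s j)) * (configInd d s * configInd e s) =
      ∏ j, ∑ a, w j a * (locInd (d j) a * locInd (e j) a) := by
  simp_rw [prod_univ_sum, Fintype.piFinset_univ, configInd, prod_mul_distrib]

theorem abs_sieveCoeff_le (hP : ∀ j, 2 ≤ P j) {y : Config n k → ℝ} {F : ℝ} (hF : 0 ≤ F)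
    (hy : ∀ r, |y r| ≤ F * (configNorm P r)⁻¹) (d : Config n k) :
    |sieveCoeff P y d| ≤ F * ∏ j, (1 + k / P j) := by
  calc |sieveCoeff P y d| ≤ ∑ r : Config n k, (∏ j, |locCoeff (P j) (r j) (d j)|) *
        (F * (configNorm P r)⁻¹) := by
        refine (abs_sum_le_sum_abs _ _).trans (sum_le_sum fun r _ ↦ ?_)
        rw [abs_mul, abs_prod]
        exact mul_le_mul_of_nonneg_left (hy r) (prod_nonneg fun _ _ ↦ abs_nonneg _)
    _ = F * ∏ j, ∑ a, |locCoeff (P j) a (d j)| * (locNorm (P j) a)⁻¹ := by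
        simp_rw [prod_univ_sum, Fintype.piFinset_univ, mul_sum, configNorm, prod_mul_distrib,
          prod_inv_distrib]
        exact sum_congr rfl fun r _ ↦ by ring
    _ ≤ _ := by
        refine mul_le_mul_of_nonneg_left (prod_le_prod (fun j _ ↦ sum_nonneg fun a _ ↦ ?_)
          fun j _ ↦ ?_) hF
        · exact mul_nonneg (abs_nonneg _) (inv_nonneg.mpr (locNorm_pos (by linarith [hP j]) a).le)
        · have h2 := hP j
          have h0 : 0 < P j := by linarith
          rw [Fintype.sum_option]
          rcases d j with _ | i
          · simp [locCoeff, locNorm, div_eq_mul_inv]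
          · simp only [locCoeff, locNorm, reduceCtorEq, if_false, abs_zero, zero_mul, zero_add,
              Option.some_inj, apply_ite abs, ite_mul, sum_ite_eq, mem_univ, if_true, abs_neg]
            rw [abs_of_nonneg (by linarith)]
            have h3 : (P j - 1) * (P j)⁻¹ ≤ 1 := by
              rw [mul_inv_le_iff₀ h0]
              linarith
            have : (0 : ℝ) ≤ k / P j := by positivity
            linarith

theorem sieveCoeff_eq_zero (hP : ∀ j, 1 ≤ P j) {y : Config n k → ℝ} {R : ℝ}
    (hy : ∀ r, R < configNorm P r → y r = 0) {d : Config n k} (hd : R < configNorm P d) :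
    sieveCoeff P y d = 0 := by
  refine sum_eq_zero fun r _ ↦ ?_
  by_cases h : ∀ j, d j = none ∨ d j = r j
  · rw [hy r, mul_zero]
    refine hd.trans_le (prod_le_prod (fun j _ ↦ (locNorm_pos (by linarith [hP j]) _).le)
      fun j _ ↦ ?_)
    rcases h j with h | h
    · rw [h]
      exact one_le_locNorm (hP j) _
    · rw [h]
  · push Not at h
    obtain ⟨j, h1, h2⟩ := h
    rw [prod_eq_zero (mem_univ j), zero_mul]
    simp [locCoeff, h1, h2]

/-- Comparison of second moments of the sieve weight with those for independent states. -/
theorem abs_sum_mul_sieveSum_sq_sub_le (hP : ∀ j, 2 ≤ P j) {y : Config n k → ℝ} {F R : ℝ}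
    (hF : 0 ≤ F) (hy : ∀ r, |y r| ≤ F * (configNorm P r)⁻¹)
    (hy' : ∀ r, R < configNorm P r → y r = 0) {ι : Type*} (T : Finset ι) (a : ι → ℝ)
    (s : ι → Config n k) (w : Fin n → Option (Fin k) → ℝ) (M : ℝ)
    (E : Config n k → Config n k → ℝ)
    (hE : ∀ d e, configNorm P d ≤ R → configNorm P e ≤ R →
      |∑ x ∈ T, a x * (configInd d (s x) * configInd e (s x)) -
        M * ∏ j, ∑ b, w j b * (locInd (d j) b * locInd (e j) b)| ≤ E d e) :
    |∑ x ∈ T, a x * sieveSum P y (s x) ^ 2 -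
      M * ∑ c : Config n k, (∏ j, w j (c j)) * sieveSum P y c ^ 2| ≤
    (F * ∏ j, (1 + k / P j)) ^ 2 *
      ∑ x : Config n k × Config n k with configNorm P x.1 ≤ R ∧ configNorm P x.2 ≤ R,
        E x.1 x.2 := by
  have hV : 0 ≤ F * ∏ j, (1 + k / P j) :=
    mul_nonneg hF (prod_nonneg fun j _ ↦ by have := hP j; positivity)
  have h0 : ∑ x ∈ T, a x * sieveSum P y (s x) ^ 2 -
      M * ∑ c : Config n k, (∏ j, w j (c j)) * sieveSum P y c ^ 2 =
      ∑ d, ∑ e, sieveCoeff P y d * sieveCoeff P y e *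
        (∑ x ∈ T, a x * (configInd d (s x) * configInd e (s x)) -
          M * ∏ j, ∑ b, w j b * (locInd (d j) b * locInd (e j) b)) := by
    rw [sum_mul_sieveSum_sq, sum_mul_sieveSum_sq, mul_sum, ← sum_sub_distrib]
    refine sum_congr rfl fun d _ ↦ ?_
    rw [mul_sum, ← sum_sub_distrib]
    refine sum_congr rfl fun e _ ↦ ?_
    rw [sum_prod_mul_configInd]
    ring
  rw [h0, ← Fintype.sum_prod_type', sum_filter, mul_sum]
  refine (abs_sum_le_sum_abs _ _).trans (sum_le_sum fun x _ ↦ ?_)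
  split_ifs with h
  · rw [abs_mul, abs_mul, sq]
    exact mul_le_mul (mul_le_mul (abs_sieveCoeff_le hP hF hy _) (abs_sieveCoeff_le hP hF hy _)
      (abs_nonneg _) hV) (hE x.1 x.2 h.1 h.2) (abs_nonneg _) (mul_nonneg hV hV)
  · rcases not_and_or.mp h with h | h
    · simp [sieveCoeff_eq_zero (fun j ↦ by linarith [hP j]) hy' (not_le.mp h)]
    · simp [sieveCoeff_eq_zero (fun j ↦ by linarith [hP j]) hy' (not_le.mp h)]

end Sieve

end

section

open Finset

section Optimize

variable {n k : ℕ} (P : Fin n → ℝ)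

/-- The product of the primes indexed by a set. -/
noncomputable def setNorm (t : Finset (Fin n)) : ℝ := ∏ j ∈ t, P j

/-- The set of primes in position `i`. -/
def parts (r : Config n k) (i : Fin k) : Finset (Fin n) := univ.filter fun j ↦ r j = some i

/-- The parameters of the sieve weight. -/
noncomputable def sieveParam (g : Finset (Fin n) → ℝ) (R : ℝ) (r : Config n k) : ℝ :=
  if configNorm P r ≤ R then (configNorm P r)⁻¹ * ∏ i, g (parts r i) else 0

variable {P}

theorem mem_parts {r : Config n k} {i : Fin k} {j : Fin n} : j ∈ parts r i ↔ r j = some i := by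
  simp [parts]

theorem configNorm_eq_prod_setNorm (r : Config n k) :
    configNorm P r = ∏ i, setNorm P (parts r i) := by
  simp_rw [setNorm, parts, prod_filter]
  rw [prod_comm, configNorm]
  refine prod_congr rfl fun j _ ↦ ?_
  rcases r j with _ | i
  · simp [locNorm]
  · simp [locNorm]

theorem setNorm_pos (hP : ∀ j, 0 < P j) (t : Finset (Fin n)) : 0 < setNorm P t :=
  prod_pos fun j _ ↦ hP j

theorem parts_injective : Function.Injective (parts : Config n k → Fin k → Finset (Fin n)) := by
  intro r s h
  ext1 j
  ext i
  rw [← mem_parts (r := r), ← mem_parts (r := s), h]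

theorem sum_configNorm_mul_sieveParam_sq_le (hP : ∀ j, 0 < P j) (g : Finset (Fin n) → ℝ) (R : ℝ) :
    ∑ r : Config n k, configNorm P r * sieveParam P g R r ^ 2 ≤
      (∑ t, g t ^ 2 * (setNorm P t)⁻¹) ^ k := by
  calc _ ≤ ∑ r : Config n k, ∏ i, (g (parts r i) ^ 2 * (setNorm P (parts r i))⁻¹) := by
        refine sum_le_sum fun r _ ↦ ?_
        have h1 := configNorm_pos hP r
        rw [prod_mul_distrib, prod_pow, prod_inv_distrib, ← configNorm_eq_prod_setNorm, sieveParam]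
        split_ifs
        · apply le_of_eq
          field_simp
        · have : 0 ≤ (∏ i, g (parts r i)) ^ 2 := sq_nonneg _
          simp only [ne_eq, OfNat.ofNat_ne_zero, not_false_eq_true, zero_pow, mul_zero]
          positivity
    _ = ∑ t ∈ univ.image (parts : Config n k → Fin k → Finset (Fin n)),
        ∏ i, (g (t i) ^ 2 * (setNorm P (t i))⁻¹) := by
        rw [sum_image parts_injective.injOn]
    _ ≤ ∑ t : Fin k → Finset (Fin n), ∏ i, (g (t i) ^ 2 * (setNorm P (t i))⁻¹) :=
        sum_le_sum_of_subset_of_nonneg (subset_univ _) fun t _ _ ↦ prod_nonneg fun i _ ↦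
          mul_nonneg (sq_nonneg _) (inv_nonneg.mpr (setNorm_pos hP _).le)
    _ = ∏ _i : Fin k, ∑ t, g t ^ 2 * (setNorm P t)⁻¹ := by
        rw [prod_univ_sum, Fintype.piFinset_univ]
    _ = _ := by simp

theorem sum_mem_mul_inv_setNorm_le (hP : ∀ j, 0 < P j) {f : Finset (Fin n) → ℝ}
    (hf : ∀ t, 0 ≤ f t) (hf' : ∀ s t, s ⊆ t → f t ≤ f s) (j : Fin n) :
    ∑ t with j ∈ t, f t * (setNorm P t)⁻¹ ≤ (P j)⁻¹ * ∑ t, f t * (setNorm P t)⁻¹ := by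
  have h0 : ∀ t, 0 ≤ f t * (setNorm P t)⁻¹ := fun t ↦
    mul_nonneg (hf t) (inv_nonneg.mpr (setNorm_pos hP _).le)
  calc _ ≤ ∑ t : Finset (Fin n) with j ∈ t, (P j)⁻¹ * (f (t.erase j) * (setNorm P (t.erase j))⁻¹) := by
        refine sum_le_sum fun t ht ↦ ?_
        have h1 : setNorm P t = P j * setNorm P (t.erase j) :=
          (mul_prod_erase t P (mem_filter.mp ht).2).symm
        rw [h1, mul_inv, mul_left_comm]
        have := hf' _ _ (erase_subset j t)
        have h2 := setNorm_pos hP (t.erase j)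
        have h3 := hP j
        gcongr
    _ = (P j)⁻¹ * ∑ t ∈ (univ.filter fun t : Finset (Fin n) ↦ j ∈ t).image (fun t ↦ t.erase j),
        f t * (setNorm P t)⁻¹ := by
        rw [sum_image, mul_sum]
        intro s hs t ht hst
        simp only [coe_filter, mem_univ, true_and, Set.mem_ofPred_eq] at hs ht
        rw [← insert_erase hs, ← insert_erase ht]
        exact congrArg _ hst
    _ ≤ _ := mul_le_mul_of_nonneg_left
        (sum_le_sum_of_subset_of_nonneg (subset_univ _) fun t _ _ ↦ h0 t) (inv_nonneg.mpr (hP j).le)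

theorem le_sum_disjoint_mul_inv_setNorm (hP : ∀ j, 0 < P j) {f : Finset (Fin n) → ℝ}
    (hf : ∀ t, 0 ≤ f t) (hf' : ∀ s t, s ⊆ t → f t ≤ f s) (u : Finset (Fin n)) :
    (1 - ∑ j ∈ u, (P j)⁻¹) * ∑ t, f t * (setNorm P t)⁻¹ ≤
      ∑ t with Disjoint t u, f t * (setNorm P t)⁻¹ := by
  have h0 : ∀ t, 0 ≤ f t * (setNorm P t)⁻¹ := fun t ↦
    mul_nonneg (hf t) (inv_nonneg.mpr (setNorm_pos hP _).le)
  have h1 : ∑ t with ¬ Disjoint t u, f t * (setNorm P t)⁻¹ ≤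
      ∑ j ∈ u, ∑ t with j ∈ t, f t * (setNorm P t)⁻¹ := by
    simp_rw [sum_filter]
    rw [sum_comm]
    refine sum_le_sum fun t _ ↦ ?_
    split_ifs with h
    · exact sum_nonneg fun i _ ↦ by
        split_ifs
        exacts [h0 t, le_rfl]
    · obtain ⟨j, hj, hj'⟩ := not_disjoint_iff.mp h
      refine le_trans ?_ (single_le_sum (f := fun j ↦ if j ∈ t then f t * (setNorm P t)⁻¹ else 0)
        (fun i _ ↦ ?_) hj')
      · simp [hj]
      · split_ifs
        exacts [h0 t, le_rfl]
  have h2 := h1.trans (sum_le_sum fun j _ ↦ sum_mem_mul_inv_setNorm_le hP hf hf' j)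
  rw [← sum_mul] at h2
  have h3 := sum_filter_add_sum_filter_not univ (fun t ↦ Disjoint t u)
    fun t ↦ f t * (setNorm P t)⁻¹
  linarith

end Optimize

end

section

open Finset

section Lower

theorem one_sub_sum_le_prod_one_sub {ι : Type*} (s : Finset ι) (a : ι → ℝ) (h0 : ∀ i ∈ s, 0 ≤ a i)
    (h1 : ∀ i ∈ s, a i ≤ 1) : 1 - ∑ i ∈ s, a i ≤ ∏ i ∈ s, (1 - a i) := by
  classical
  induction s using Finset.induction_on with
  | empty => simp
  | insert i s hi ih =>
    rw [sum_insert hi, prod_insert hi]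
    have h2 := ih (fun j hj ↦ h0 j (mem_insert_of_mem hj)) fun j hj ↦ h1 j (mem_insert_of_mem hj)
    have h3 : ∏ j ∈ s, (1 - a j) ≤ 1 := prod_le_one
      (fun j hj ↦ sub_nonneg.mpr (h1 j (mem_insert_of_mem hj)))
      fun j hj ↦ by linarith [h0 j (mem_insert_of_mem hj)]
    have h4 := h0 i (mem_insert_self i s)
    have h5 := mul_le_mul_of_nonneg_left h3 h4
    linarith

section Tuples

variable {k : ℕ} {T : Type*} [Fintype T]

theorem sum_prod_mul_prod_le (w u : Fin k → T → ℝ) (ρ : Fin k → ℝ) (hw : ∀ i t, 0 ≤ w i t)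
    (hu : ∀ i t, 0 ≤ u i t) (h : ∀ i, ∑ t, w i t * u i t ≤ ρ i * ∑ t, w i t) :
    ∑ t : Fin k → T, (∏ i, w i (t i)) * ∏ i, u i (t i) ≤ (∏ i, ρ i) * ∏ i, ∑ t, w i t := by
  simp_rw [← prod_mul_distrib]
  have h1 : ∑ t : Fin k → T, ∏ i, w i (t i) * u i (t i) = ∏ i, ∑ t, w i t * u i t := by
    rw [prod_univ_sum, Fintype.piFinset_univ]
  rw [h1]
  exact prod_le_prod (fun i _ ↦ sum_nonneg fun t _ ↦ mul_nonneg (hw i t) (hu i t)) fun i _ ↦ h i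

variable {w : Fin k → T → ℝ} {f : T → ℝ} {ρ : ℝ}

theorem sum_prod_mul_apply_le (hw : ∀ i t, 0 ≤ w i t)
    (hf : ∀ t, 0 ≤ f t) (h : ∀ i, ∑ t, w i t * f t ≤ ρ * ∑ t, w i t) (a : Fin k) :
    ∑ t : Fin k → T, (∏ i, w i (t i)) * f (t a) ≤ ρ * ∏ i, ∑ t, w i t := by
  have h1 := sum_prod_mul_prod_le w (fun i t ↦ if i = a then f t else 1)
    (fun i ↦ if i = a then ρ else 1) hw (fun i t ↦ by
      split_ifs
      exacts [hf t, zero_le_one]) fun i ↦ by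
        split_ifs
        · exact h i
        · simp
  simpa [prod_ite_eq'] using h1

theorem sum_prod_mul_apply_mul_apply_le (hw : ∀ i t, 0 ≤ w i t)
    (hf : ∀ t, 0 ≤ f t) (h : ∀ i, ∑ t, w i t * f t ≤ ρ * ∑ t, w i t) {a b : Fin k} (hab : a ≠ b) :
    ∑ t : Fin k → T, (∏ i, w i (t i)) * (f (t a) * f (t b)) ≤ ρ ^ 2 * ∏ i, ∑ t, w i t := by
  have h1 := sum_prod_mul_prod_le w
    (fun i t ↦ (if i = a then f t else 1) * (if i = b then f t else 1))
    (fun i ↦ (if i = a then ρ else 1) * (if i = b then ρ else 1)) hw (fun i t ↦ by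
      split_ifs <;> simp [hf t, mul_nonneg]) fun i ↦ by
        split_ifs with h1 h2 h2
        · exact absurd (h1.symm.trans h2) hab
        · simpa using h i
        · simpa using h i
        · simp
  simp only [prod_mul_distrib, prod_ite_eq', mem_univ, if_true] at h1
  rwa [sq]

end Tuples

variable {n k : ℕ}

open Classical in
/-- The configuration with given disjoint parts. -/
noncomputable def ofParts (t : Fin k → Finset (Fin n)) : Config n k :=
  fun j ↦ if h : ∃ i, j ∈ t i then some h.choose else none

theorem parts_ofParts {t : Fin k → Finset (Fin n)} (ht : ∀ a b, a ≠ b → Disjoint (t a) (t b)) :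
    parts (ofParts t) = t := by
  ext i j
  rw [mem_parts, ofParts]
  split_ifs with h
  · rw [Option.some_inj]
    have h1 := h.choose_spec
    constructor
    · intro h2
      rwa [h2] at h1
    · intro h2
      by_contra h3
      exact disjoint_left.mp (ht _ _ h3) h1 h2
  · simp only [reduceCtorEq, false_iff]
    exact fun h2 ↦ h ⟨i, h2⟩

/-- Put the primes indexed by `t` in position `l`. -/
def Config.merge (c : Config n k) (l : Fin k) (t : Finset (Fin n)) : Config n k :=
  fun j ↦ if j ∈ t then some l else c j

/-- The set of primes occurring in a configuration. -/
def Config.supp (c : Config n k) : Finset (Fin n) := univ.filter fun j ↦ c j ≠ none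

variable {P : Fin n → ℝ} {c : Config n k} {l : Fin k}

theorem Config.eq_none_of_disjoint {t : Finset (Fin n)} (ht : Disjoint t c.supp) {j : Fin n}
    (hj : j ∈ t) : c j = none := by
  have h := disjoint_left.mp ht hj
  simpa [Config.supp] using h

theorem Config.parts_merge (hc : ∀ j, c j ≠ some l) {t : Finset (Fin n)}
    (ht : Disjoint t c.supp) (i : Fin k) :
    parts (c.merge l t) i = if i = l then t else parts c i := by
  ext j
  rw [mem_parts, Config.merge]
  split_ifs with h1 h2 h2
  · simp [h1, h2]
  · simp only [Option.some_inj, mem_parts]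
    rw [Config.eq_none_of_disjoint ht h1]
    simpa using fun h ↦ h2 h.symm
  · simp only [h2, h1, iff_false]
    exact hc j
  · rw [mem_parts]

theorem Config.configNorm_merge {t : Finset (Fin n)} (ht : Disjoint t c.supp) :
    configNorm P (c.merge l t) = configNorm P c * setNorm P t := by
  rw [configNorm, configNorm, setNorm, ← prod_filter_mul_prod_filter_not univ (fun j ↦ j ∈ t),
    ← prod_filter_mul_prod_filter_not univ (fun j ↦ j ∈ t) (fun j ↦ locNorm (P j) (c j))]
  have h1 : ∏ j with j ∈ t, locNorm (P j) (c.merge l t j) = ∏ j ∈ t, P j := by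
    rw [filter_mem_eq_inter, univ_inter]
    exact prod_congr rfl fun j hj ↦ by simp [Config.merge, hj, locNorm]
  have h2 : ∏ j with j ∈ t, locNorm (P j) (c j) = 1 := by
    rw [filter_mem_eq_inter, univ_inter]
    exact prod_eq_one fun j hj ↦ by simp [Config.eq_none_of_disjoint ht hj, locNorm]
  have h3 : ∏ j with j ∉ t, locNorm (P j) (c.merge l t j) = ∏ j with j ∉ t, locNorm (P j) (c j) :=
    prod_congr rfl fun j hj ↦ by simp [Config.merge, (mem_filter.mp hj).2]
  rw [h1, h2, h3]
  ring

variable {g : Finset (Fin n) → ℝ} {R S : ℝ}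

theorem sieveParam_nonneg (hP : ∀ j, 0 < P j) (hg : ∀ t, 0 ≤ g t) (r : Config n k) :
    0 ≤ sieveParam P g R r := by
  rw [sieveParam]
  split_ifs
  · exact mul_nonneg (inv_nonneg.mpr (configNorm_pos hP r).le) (prod_nonneg fun i _ ↦ hg _)
  · exact le_rfl

theorem le_sum_merge (hP : ∀ j, 0 < P j) (hg : ∀ t, 0 ≤ g t) (hg' : ∀ s t, s ⊆ t → g t ≤ g s)
    (hgS : ∀ t, S < setNorm P t → g t = 0) (hR : S * S ≤ R)
    (hc : ∀ j, c j ≠ some l) (hcS : configNorm P c ≤ S) :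
    (configNorm P c)⁻¹ * (∏ i, if i = l then 1 else g (parts c i)) *
      ((1 - ∑ j ∈ c.supp, (P j)⁻¹) * ∑ t, g t * (setNorm P t)⁻¹) ≤
    ∑ r : Config n k, (∏ j, (if r j = c j ∨ (c j = none ∧ r j = some l) then 1 else 0)) *
      sieveParam P g R r := by
  have hN := configNorm_pos hP c
  have hprod : 0 ≤ ∏ i, if i = l then 1 else g (parts c i) := prod_nonneg fun i _ ↦ by
    split_ifs
    exacts [zero_le_one, hg _]
  calc _ ≤ (configNorm P c)⁻¹ * (∏ i, if i = l then 1 else g (parts c i)) *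
        ∑ t with Disjoint t c.supp, g t * (setNorm P t)⁻¹ := by
        refine mul_le_mul_of_nonneg_left (le_sum_disjoint_mul_inv_setNorm hP hg hg' _) ?_
        exact mul_nonneg (inv_nonneg.mpr hN.le) hprod
    _ ≤ ∑ t with Disjoint t c.supp, sieveParam P g R (c.merge l t) := by
        rw [mul_sum]
        refine sum_le_sum fun t ht ↦ ?_
        rw [mem_filter] at ht
        by_cases h : g t = 0
        · rw [h, zero_mul, mul_zero]
          exact sieveParam_nonneg hP hg _
        · have h1 : setNorm P t ≤ S := not_lt.mp fun h2 ↦ h (hgS t h2)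
          have h2 := setNorm_pos hP t
          have h3 : configNorm P (c.merge l t) ≤ R := by
            rw [Config.configNorm_merge ht.2]
            exact (mul_le_mul hcS h1 h2.le (hN.le.trans hcS)).trans hR
          have h4 : ∏ i, g (parts (c.merge l t) i) =
              g t * ∏ i, if i = l then 1 else g (parts c i) := by
            rw [← mul_prod_erase univ _ (mem_univ l), ← mul_prod_erase univ (fun i ↦ ite _ _ _) (mem_univ l),
              if_pos rfl, one_mul, Config.parts_merge hc ht.2, if_pos rfl]
            congr 1
            refine prod_congr rfl fun i hi ↦ ?_
            rw [Config.parts_merge hc ht.2, if_neg (ne_of_mem_erase hi),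
              if_neg (ne_of_mem_erase hi)]
          rw [sieveParam, if_pos h3, h4, Config.configNorm_merge ht.2, mul_inv]
          apply le_of_eq
          ring
    _ = ∑ r ∈ (univ.filter fun t ↦ Disjoint t c.supp).image (c.merge l), sieveParam P g R r := by
        rw [sum_image]
        intro s hs t ht hst
        rw [mem_coe, mem_filter] at hs ht
        have h1 := Config.parts_merge hc hs.2 l
        rw [hst, Config.parts_merge hc ht.2, if_pos rfl, if_pos rfl] at h1
        exact h1.symm
    _ ≤ ∑ r ∈ (univ.filter fun t ↦ Disjoint t c.supp).image (c.merge l),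
        (∏ j, (if r j = c j ∨ (c j = none ∧ r j = some l) then 1 else 0)) *
          sieveParam P g R r := by
        refine sum_le_sum fun r hr ↦ ?_
        obtain ⟨t, ht, rfl⟩ := mem_image.mp hr
        rw [mem_filter] at ht
        rw [prod_eq_one, one_mul]
        intro j _
        rw [if_pos]
        by_cases hj : j ∈ t
        · exact Or.inr ⟨Config.eq_none_of_disjoint ht.2 hj, by simp [Config.merge, hj]⟩
        · exact Or.inl (by simp [Config.merge, hj])
    _ ≤ _ := sum_le_sum_of_subset_of_nonneg (subset_univ _) fun r _ _ ↦
        mul_nonneg (prod_nonneg fun j _ ↦ by positivity) (sieveParam_nonneg hP hg r)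

theorem one_sub_le_mul_sq {A x κ : ℝ} {B : ℝ} (hA : 0 ≤ A) (hA' : 1 - κ * x ≤ A) (hx : 0 ≤ x) (hκ : 0 ≤ κ)
    (hB : 1 - x ≤ B) : 1 - (κ + 2) * x ≤ A * B ^ 2 := by
  have h0 : 0 ≤ A * B ^ 2 := by positivity
  by_cases h : 1 - (κ + 2) * x ≤ 0
  · linarith
  · have h1 : 0 ≤ κ * x := mul_nonneg hκ hx
    have h2 : 1 - 2 * x ≤ B ^ 2 := by nlinarith [sq_nonneg x, sq_nonneg (B - 1 + x)]
    have h3 : (1 - κ * x) * (1 - 2 * x) ≤ A * B ^ 2 :=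
      mul_le_mul hA' h2 (by linarith) hA
    have h4 : 0 ≤ κ * x * x := mul_nonneg h1 hx
    linarith

/-- The summand of the lower bound for second moments over primes. -/
noncomputable def primeTerm (P : Fin n → ℝ) (l : Fin k) (y : Config n k → ℝ) (c : Config n k) : ℝ :=
  (∏ j, (if c j = some l then 0 else 1) * locNorm (P j - k) (c j)) *
    (∑ r : Config n k, (∏ j, (if r j = c j ∨ (c j = none ∧ r j = some l) then 1 else 0)) * y r) ^ 2

theorem primeTerm_nonneg (hk : ∀ j, k ≤ P j) (l : Fin k) (y : Config n k → ℝ) (c : Config n k) :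
    0 ≤ primeTerm P l y c := by
  refine mul_nonneg (prod_nonneg fun j _ ↦ mul_nonneg (by positivity) ?_) (sq_nonneg _)
  rcases c j with _ | i
  · simp [locNorm]
  · simpa [locNorm] using hk j

theorem le_primeTerm (hP : ∀ j, 0 < P j) (hk : ∀ j, k ≤ P j) (hg : ∀ t, 0 ≤ g t)
    (hg' : ∀ s t, s ⊆ t → g t ≤ g s) (hgS : ∀ t, S < setNorm P t → g t = 0) (hR : S * S ≤ R)
    (hc : ∀ j, c j ≠ some l) (hcS : configNorm P c ≤ S) :
    (∏ i, if i = l then 1 else g (parts c i) ^ 2) * (configNorm P c)⁻¹ *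
      (∑ t, g t * (setNorm P t)⁻¹) ^ 2 * (1 - (k + 2) * ∑ j ∈ c.supp, (P j)⁻¹) ≤
      primeTerm P l (sieveParam P g R) c := by
  have hN := configNorm_pos hP c
  have h1 := le_sum_merge hP hg hg' hgS hR hc hcS
  obtain ⟨x, hx⟩ : ∃ x, x = ∑ j ∈ c.supp, (P j)⁻¹ := ⟨_, rfl⟩
  obtain ⟨G, hG⟩ : ∃ G, G = ∑ t, g t * (setNorm P t)⁻¹ := ⟨_, rfl⟩
  obtain ⟨I, hI⟩ : ∃ I, I = ∑ r : Config n k, (∏ j, (if r j = c j ∨ (c j = none ∧ r j = some l)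
    then (1 : ℝ) else 0)) * sieveParam P g R r := ⟨_, rfl⟩
  obtain ⟨γ, hγ⟩ : ∃ γ, γ = ∏ i, if i = l then 1 else g (parts c i) := ⟨_, rfl⟩
  have h2 : ∏ i, (if i = l then 1 else g (parts c i) ^ 2) = γ ^ 2 := by
    rw [hγ, ← prod_pow]
    exact prod_congr rfl fun i _ ↦ by split_ifs <;> simp
  rw [← hx, ← hG, ← hγ, ← hI] at h1
  rw [primeTerm, ← hx, ← hG, ← hI, h2]
  obtain ⟨A, hA⟩ : ∃ A, A = ∏ j ∈ c.supp, (1 - k * (P j)⁻¹) := ⟨_, rfl⟩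
  have hkP : ∀ j, k * (P j)⁻¹ ≤ 1 := fun j ↦ by
    rw [mul_inv_le_iff₀ (hP j), one_mul]
    exact hk j
  have hPi : ∀ j, 0 ≤ (P j)⁻¹ := fun j ↦ inv_nonneg.mpr (hP j).le
  have h3 : ∏ j, (if c j = some l then 0 else 1) * locNorm (P j - k) (c j) =
      configNorm P c * A := by
    rw [configNorm, hA, Config.supp, prod_filter, ← prod_mul_distrib]
    refine prod_congr rfl fun j _ ↦ ?_
    rw [if_neg (hc j), one_mul]
    have := hP j
    rcases c j with _ | i
    · simp [locNorm]
    · simp only [locNorm, ne_eq, reduceCtorEq, not_false_eq_true, if_true]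
      field_simp
  rw [h3]
  have hx0 : 0 ≤ x := hx ▸ sum_nonneg fun j _ ↦ hPi j
  have hA0 : 0 ≤ A := hA ▸ prod_nonneg fun j _ ↦ sub_nonneg.mpr (hkP j)
  have hA1 : 1 - k * x ≤ A := by
    rw [hA, hx, mul_sum]
    exact one_sub_sum_le_prod_one_sub _ _ (fun j _ ↦ mul_nonneg (Nat.cast_nonneg _) (hPi j))
      fun j _ ↦ hkP j
  have hγ0 : 0 ≤ γ := hγ ▸ prod_nonneg fun i _ ↦ by
    split_ifs
    exacts [zero_le_one, hg _]
  have hG0 : 0 ≤ G := hG ▸ sum_nonneg fun t _ ↦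
    mul_nonneg (hg t) (inv_nonneg.mpr (setNorm_pos hP t).le)
  rcases (mul_nonneg hγ0 hG0).eq_or_lt with h | h
  · have h4 : γ ^ 2 * (configNorm P c)⁻¹ * G ^ 2 = (γ * G) ^ 2 * (configNorm P c)⁻¹ := by ring
    rw [h4, ← h]
    have : 0 ≤ configNorm P c * A * I ^ 2 := by positivity
    simpa using this
  · have hD : 0 < (configNorm P c)⁻¹ * (γ * G) := mul_pos (inv_pos.mpr hN) h
    have h5 : 1 - x ≤ I / ((configNorm P c)⁻¹ * (γ * G)) := by
      rw [le_div_iff₀ hD]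
      linarith
    have h6 := one_sub_le_mul_sq hA0 hA1 hx0 (Nat.cast_nonneg k) h5
    have h7 := mul_le_mul_of_nonneg_left h6
      (show 0 ≤ γ ^ 2 * (configNorm P c)⁻¹ * G ^ 2 by positivity)
    refine h7.trans_eq ?_
    have h8 : γ ≠ 0 := fun h8 ↦ by simp [h8] at h
    have h9 : G ≠ 0 := fun h9 ↦ by simp [h9] at h
    field_simp

end Lower

end

section

open Finset

section LowerSum

variable {n k : ℕ} {P : Fin n → ℝ} {l : Fin k} {g : Finset (Fin n) → ℝ} {R S : ℝ}

/-- The weight attached to the `i`-th part of a configuration avoiding position `l`. -/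
noncomputable def partWeight (P : Fin n → ℝ) (l : Fin k) (g : Finset (Fin n) → ℝ) (i : Fin k)
    (t : Finset (Fin n)) : ℝ :=
  if i = l then (if t = ∅ then 1 else 0) else g t ^ 2 * (setNorm P t)⁻¹

theorem partWeight_nonneg (hP : ∀ j, 0 < P j) (i : Fin k) (t : Finset (Fin n)) :
    0 ≤ partWeight P l g i t := by
  have := setNorm_pos hP t
  rw [partWeight]
  split_ifs <;> positivity

theorem prod_sum_partWeight :
    ∏ i, ∑ t, partWeight P l g i t = (∑ t, g t ^ 2 * (setNorm P t)⁻¹) ^ (k - 1) := by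
  rw [← mul_prod_erase univ _ (mem_univ l), prod_congr rfl (g := fun _ ↦ ∑ t, g t ^ 2 * (setNorm P t)⁻¹)]
  · simp [partWeight]
  · intro i hi
    simp [partWeight, ne_of_mem_erase hi]

/-- The correction factor for overlapping, non-generic or large tuples of parts. -/
noncomputable def tupleBracket (P : Fin n → ℝ) (S : ℝ) (t : Fin k → Finset (Fin n)) : ℝ :=
  1 - (∑ j, ∑ a, ∑ b ∈ univ.erase a, (if j ∈ t a then 1 else 0) * (if j ∈ t b then 1 else 0)) -
    (k + 2) * (∑ j, ∑ a, (P j)⁻¹ * (if j ∈ t a then 1 else 0)) -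
    (Real.log S)⁻¹ * ∑ a, Real.log (setNorm P (t a))

theorem prod_partWeight_mul_tupleBracket_le (hP : ∀ j, 1 ≤ P j) (hk : ∀ j, k ≤ P j)
    (hg : ∀ t, 0 ≤ g t) (hg' : ∀ s t, s ⊆ t → g t ≤ g s)
    (hgS : ∀ t, S < setNorm P t → g t = 0) (hS : 1 < S) (hR : S * S ≤ R)
    (t : Fin k → Finset (Fin n)) :
    (∏ i, partWeight P l g i (t i)) * tupleBracket P S t *
      (∑ t, g t * (setNorm P t)⁻¹) ^ 2 ≤
    if ∀ a b, a ≠ b → Disjoint (t a) (t b) then primeTerm P l (sieveParam P g R) (ofParts t)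
      else 0 := by
  have hP' : ∀ j, 0 < P j := fun j ↦ zero_lt_one.trans_le (hP j)
  obtain ⟨A, hA⟩ : ∃ A, A = ∑ j, ∑ a, ∑ b ∈ univ.erase a,
    (if j ∈ t a then (1 : ℝ) else 0) * (if j ∈ t b then 1 else 0) := ⟨_, rfl⟩
  obtain ⟨B, hB⟩ : ∃ B, B = ∑ j, ∑ a, (P j)⁻¹ * (if j ∈ t a then 1 else 0) := ⟨_, rfl⟩
  obtain ⟨C, hC⟩ : ∃ C, C = ∑ a, Real.log (setNorm P (t a)) := ⟨_, rfl⟩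
  have hAterm : ∀ j a b, 0 ≤ (if j ∈ t a then (1 : ℝ) else 0) * (if j ∈ t b then 1 else 0) :=
    fun j a b ↦ by split_ifs <;> simp
  have hBterm : ∀ j a, 0 ≤ (P j)⁻¹ * (if j ∈ t a then (1 : ℝ) else 0) :=
    fun j a ↦ mul_nonneg (inv_nonneg.mpr (hP' j).le) (by split_ifs <;> simp)
  have hA0 : 0 ≤ A := hA ▸ sum_nonneg fun j _ ↦ sum_nonneg fun a _ ↦ sum_nonneg fun b _ ↦
    hAterm j a b
  have hB0 : 0 ≤ B := hB ▸ sum_nonneg fun j _ ↦ sum_nonneg fun a _ ↦ hBterm j a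
  have hN1 : ∀ t, 1 ≤ setNorm P t := fun t ↦ by
    rw [setNorm, ← prod_const_one (s := t)]
    exact prod_le_prod (fun _ _ ↦ zero_le_one) fun j _ ↦ hP j
  have hC0 : 0 ≤ C := hC ▸ sum_nonneg fun a _ ↦ Real.log_nonneg (hN1 _)
  have hlS := Real.log_pos hS
  have hk2 : (0 : ℝ) ≤ k + 2 := by positivity
  have hW := prod_nonneg fun i (_ : i ∈ univ) ↦ partWeight_nonneg (l := l) (g := g) hP' i (t i)
  obtain ⟨G, hG⟩ : ∃ G, G = ∑ t, g t * (setNorm P t)⁻¹ := ⟨_, rfl⟩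
  have hbr : tupleBracket P S t = 1 - A - (k + 2) * B - (Real.log S)⁻¹ * C := by
    rw [tupleBracket, hA, hB, hC]
  have hneg : tupleBracket P S t ≤ 0 → (∏ i, partWeight P l g i (t i)) * tupleBracket P S t *
      G ^ 2 ≤ 0 := fun h ↦ mul_nonpos_of_nonpos_of_nonneg
    (mul_nonpos_of_nonneg_of_nonpos hW h) (sq_nonneg _)
  have h1 : 0 ≤ (k + 2) * B := mul_nonneg hk2 hB0
  have h2 : 0 ≤ (Real.log S)⁻¹ * C := mul_nonneg (inv_nonneg.mpr hlS.le) hC0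
  rw [← hG]
  split_ifs with hd
  swap
  · apply hneg
    push Not at hd
    obtain ⟨a, b, hab, hd⟩ := hd
    obtain ⟨j, hja, hjb⟩ := not_disjoint_iff.mp hd
    have h3 : 1 ≤ A := by
      rw [hA]
      refine le_trans ?_ (single_le_sum (fun j _ ↦ sum_nonneg fun a _ ↦ sum_nonneg fun b _ ↦
        hAterm j a b) (mem_univ j))
      refine le_trans ?_ (single_le_sum (fun a _ ↦ sum_nonneg fun b _ ↦
        hAterm j a b) (mem_univ a))
      refine le_trans ?_ (single_le_sum (fun b _ ↦
        hAterm j a b) (mem_erase.mpr ⟨hab.symm, mem_univ b⟩))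
      simp [hja, hjb]
    rw [hbr]
    linarith
  have hpt := primeTerm_nonneg hk l (sieveParam P g R) (ofParts t)
  by_cases hl : t l = ∅
  swap
  · have : ∏ i, partWeight P l g i (t i) = 0 :=
      prod_eq_zero (mem_univ l) (by simp [partWeight, hl])
    rw [this, zero_mul, zero_mul]
    exact hpt
  by_cases hCS : Real.log S < C
  · refine (hneg ?_).trans hpt
    have : 1 ≤ (Real.log S)⁻¹ * C := by
      rw [inv_mul_eq_div, one_le_div hlS]
      exact hCS.le
    rw [hbr]
    linarith
  have hparts := parts_ofParts hd
  obtain ⟨c, hc⟩ : ∃ c : Config n k, c = ofParts t := ⟨_, rfl⟩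
  rw [← hc] at hparts ⊢
  have hc1 : ∀ j, c j ≠ some l := fun j hj ↦ by
    rw [← mem_parts, hparts, hl] at hj
    exact notMem_empty _ hj
  have hc2 : configNorm P c ≤ S := by
    rw [configNorm_eq_prod_setNorm, hparts,
      ← Real.log_le_log_iff (prod_pos fun i _ ↦ setNorm_pos hP' _) (by linarith),
      Real.log_prod fun i _ ↦ (setNorm_pos hP' _).ne', ← hC]
    exact not_lt.mp hCS
  have h3 := le_primeTerm hP' hk hg hg' hgS hR hc1 hc2
  rw [← hG] at h3
  refine le_trans ?_ h3
  have h4 : ∏ i, partWeight P l g i (t i) =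
      (∏ i, if i = l then 1 else g (parts c i) ^ 2) * (configNorm P c)⁻¹ := by
    rw [configNorm_eq_prod_setNorm, hparts, ← prod_inv_distrib, ← prod_mul_distrib]
    refine prod_congr rfl fun i _ ↦ ?_
    rw [partWeight]
    split_ifs with h5 h6 h6
    · rw [h6]
      simp [setNorm]
    · exact absurd (h5 ▸ hl) h6
    · rfl
  have h5 : ∑ j ∈ c.supp, (P j)⁻¹ ≤ B := by
    rw [hB, Config.supp, sum_filter]
    refine sum_le_sum fun j _ ↦ ?_
    split_ifs with h6
    · obtain ⟨a, ha⟩ := Option.ne_none_iff_exists'.mp h6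
      refine le_trans ?_ (single_le_sum (fun a _ ↦ hBterm j a) (mem_univ a))
      rw [← mem_parts, hparts] at ha
      simp [ha]
    · exact sum_nonneg fun a _ ↦ hBterm j a
  rw [h4] at hW ⊢
  have h6 : tupleBracket P S t ≤ 1 - (k + 2) * ∑ j ∈ c.supp, (P j)⁻¹ := by
    have := mul_le_mul_of_nonneg_left h5 hk2
    rw [hbr]
    linarith
  have h7 := mul_le_mul_of_nonneg_left h6 (mul_nonneg hW (sq_nonneg G))
  linarith

theorem le_sum_primeTerm (hP : ∀ j, 1 ≤ P j) (hk : ∀ j, k ≤ P j)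
    (hg : ∀ t, 0 ≤ g t) (hg' : ∀ s t, s ⊆ t → g t ≤ g s)
    (hgS : ∀ t, S < setNorm P t → g t = 0) (hS : 1 < S) (hR : S * S ≤ R) {μ : ℝ} (hμ : 0 ≤ μ)
    (hμS : 4 * k * μ ≤ Real.log S)
    (hgμ : ∑ t, g t ^ 2 * (setNorm P t)⁻¹ * Real.log (setNorm P t) ≤
      μ * ∑ t, g t ^ 2 * (setNorm P t)⁻¹)
    (hPsq : (2 * k ^ 2 + 2 * k) * ∑ j, (P j)⁻¹ ^ 2 ≤ 1 / 4) (l : Fin k) :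
    1 / 2 * (∑ t, g t * (setNorm P t)⁻¹) ^ 2 * (∑ t, g t ^ 2 * (setNorm P t)⁻¹) ^ (k - 1) ≤
      ∑ c, primeTerm P l (sieveParam P g R) c := by
  classical
  have hP' : ∀ j, 0 < P j := fun j ↦ zero_lt_one.trans_le (hP j)
  have hN1 : ∀ t, 1 ≤ setNorm P t := fun t ↦ by
    rw [setNorm, ← prod_const_one (s := t)]
    exact prod_le_prod (fun _ _ ↦ zero_le_one) fun j _ ↦ hP j
  have hlS := Real.log_pos hS
  have hw := fun i t ↦ partWeight_nonneg (l := l) (g := g) hP' i t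
  obtain ⟨V, hV⟩ : ∃ V, V = ∏ i, ∑ t, partWeight P l g i t := ⟨_, rfl⟩
  have hV0 : 0 ≤ V := hV ▸ prod_nonneg fun i _ ↦ sum_nonneg fun t _ ↦ hw i t
  obtain ⟨G, hG⟩ : ∃ G, G = ∑ t, g t * (setNorm P t)⁻¹ := ⟨_, rfl⟩
  have hone : ∀ j i, ∑ t, partWeight P l g i t * (if j ∈ t then 1 else 0) ≤
      (P j)⁻¹ * ∑ t, partWeight P l g i t := fun j i ↦ by
    by_cases hi : i = l
    · rw [sum_eq_zero]
      · exact mul_nonneg (inv_nonneg.mpr (hP' j).le) (sum_nonneg fun t _ ↦ hw i t)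
      · intro t _
        by_cases ht : t = ∅ <;> simp [partWeight, hi, ht]
    · simp only [partWeight, if_neg hi]
      have := sum_mem_mul_inv_setNorm_le hP' (f := fun t ↦ g t ^ 2) (fun t ↦ sq_nonneg _)
        (fun s t hst ↦ pow_le_pow_left₀ (hg t) (hg' s t hst) 2) j
      rw [sum_filter] at this
      simpa using this
  have hlog : ∀ i, ∑ t, partWeight P l g i t * Real.log (setNorm P t) ≤
      μ * ∑ t, partWeight P l g i t := fun i ↦ by
    by_cases hi : i = l
    · simp [partWeight, hi, setNorm, hμ]
    · simpa only [partWeight, if_neg hi] using hgμ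
  have e1 : ∀ j a b, a ≠ b → ∑ t : Fin k → Finset (Fin n), (∏ i, partWeight P l g i (t i)) *
      ((if j ∈ t a then 1 else 0) * (if j ∈ t b then 1 else 0)) ≤ (P j)⁻¹ ^ 2 * V :=
    fun j a b hab ↦ by
      rw [hV]
      exact sum_prod_mul_apply_mul_apply_le (f := fun t ↦ if j ∈ t then 1 else 0) hw
        (fun t ↦ by split_ifs <;> simp) (hone j) hab
  have e2 : ∀ j a, ∑ t : Fin k → Finset (Fin n), (∏ i, partWeight P l g i (t i)) *
      (if j ∈ t a then 1 else 0) ≤ (P j)⁻¹ * V := fun j a ↦ by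
    rw [hV]
    exact sum_prod_mul_apply_le (f := fun t ↦ if j ∈ t then 1 else 0) hw
        (fun t ↦ by split_ifs <;> simp) (hone j) a
  have e3 : ∀ a, ∑ t : Fin k → Finset (Fin n), (∏ i, partWeight P l g i (t i)) *
      Real.log (setNorm P (t a)) ≤ μ * V := fun a ↦ by
    rw [hV]
    exact sum_prod_mul_apply_le (f := fun t ↦ Real.log (setNorm P t)) hw
        (fun t ↦ Real.log_nonneg (hN1 t)) hlog a
  obtain ⟨σ, hσ⟩ : ∃ σ, σ = ∑ j, (P j)⁻¹ ^ 2 := ⟨_, rfl⟩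
  have hσ0 : 0 ≤ σ := hσ ▸ sum_nonneg fun j _ ↦ sq_nonneg _
  have f0 : ∑ t : Fin k → Finset (Fin n), ∏ i, partWeight P l g i (t i) = V := by
    rw [hV, prod_univ_sum, Fintype.piFinset_univ]
  have f1 : ∑ t : Fin k → Finset (Fin n), (∏ i, partWeight P l g i (t i)) *
      (∑ j, ∑ a, ∑ b ∈ univ.erase a, (if j ∈ t a then 1 else 0) * (if j ∈ t b then 1 else 0)) ≤
      k ^ 2 * σ * V := by
    simp_rw [mul_sum]
    rw [sum_comm]
    have : ∀ j, ∑ t : Fin k → Finset (Fin n), ∑ a, ∑ b ∈ univ.erase a,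
        (∏ i, partWeight P l g i (t i)) * ((if j ∈ t a then 1 else 0) * (if j ∈ t b then 1 else 0))
        ≤ k ^ 2 * ((P j)⁻¹ ^ 2 * V) := fun j ↦ by
      have h0 : 0 ≤ (P j)⁻¹ ^ 2 * V := mul_nonneg (sq_nonneg _) hV0
      rw [sum_comm]
      calc _ ≤ ∑ _a : Fin k, (k : ℝ) * ((P j)⁻¹ ^ 2 * V) := by
            refine sum_le_sum fun a _ ↦ ?_
            rw [sum_comm]
            calc _ ≤ ∑ _b ∈ univ.erase a, (P j)⁻¹ ^ 2 * V :=
                  sum_le_sum fun b hb ↦ e1 j a b (ne_of_mem_erase hb).symm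
              _ ≤ ∑ _b : Fin k, (P j)⁻¹ ^ 2 * V :=
                  sum_le_sum_of_subset_of_nonneg (erase_subset _ _) fun _ _ _ ↦ h0
              _ = _ := by simp
        _ = _ := by
            simp only [sum_const, card_univ, Fintype.card_fin, nsmul_eq_mul]
            ring
    calc _ ≤ _ := sum_le_sum fun j _ ↦ this j
      _ = _ := by
        rw [hσ, ← mul_sum, ← sum_mul, mul_assoc]
  have f2 : ∑ t : Fin k → Finset (Fin n), (∏ i, partWeight P l g i (t i)) *
      (∑ j, ∑ a, (P j)⁻¹ * (if j ∈ t a then 1 else 0)) ≤ k * σ * V := by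
    simp_rw [mul_sum]
    rw [sum_comm]
    calc _ ≤ ∑ j, k * ((P j)⁻¹ ^ 2 * V) := by
          refine sum_le_sum fun j _ ↦ ?_
          rw [sum_comm]
          calc _ ≤ ∑ _a : Fin k, (P j)⁻¹ ^ 2 * V := by
                refine sum_le_sum fun a _ ↦ ?_
                have := mul_le_mul_of_nonneg_left (e2 j a) (inv_nonneg.mpr (hP' j).le)
                rw [mul_sum] at this
                calc _ = _ := sum_congr rfl fun t _ ↦ by ring
                  _ ≤ _ := this
                  _ = _ := by ring
            _ = _ := by simp
      _ = _ := by
        rw [hσ, ← mul_sum, ← sum_mul, mul_assoc]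
  have f3 : ∑ t : Fin k → Finset (Fin n), (∏ i, partWeight P l g i (t i)) *
      ∑ a, Real.log (setNorm P (t a)) ≤ k * μ * V := by
    simp_rw [mul_sum]
    rw [sum_comm]
    calc _ ≤ ∑ _a : Fin k, μ * V := sum_le_sum fun a _ ↦ e3 a
      _ = _ := by
        simp only [sum_const, card_univ, Fintype.card_fin, nsmul_eq_mul]
        ring
  have f4 : 1 / 2 * V ≤ ∑ t : Fin k → Finset (Fin n), (∏ i, partWeight P l g i (t i)) *
      tupleBracket P S t := by
    have : ∀ t : Fin k → Finset (Fin n), (∏ i, partWeight P l g i (t i)) * tupleBracket P S t =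
      (∏ i, partWeight P l g i (t i)) - (∏ i, partWeight P l g i (t i)) *
      (∑ j, ∑ a, ∑ b ∈ univ.erase a, (if j ∈ t a then 1 else 0) * (if j ∈ t b then 1 else 0)) -
      (k + 2) * ((∏ i, partWeight P l g i (t i)) *
      (∑ j, ∑ a, (P j)⁻¹ * (if j ∈ t a then 1 else 0))) -
      (Real.log S)⁻¹ * ((∏ i, partWeight P l g i (t i)) *
      ∑ a, Real.log (setNorm P (t a))) := fun t ↦ by rw [tupleBracket]; ring
    rw [sum_congr rfl fun t _ ↦ this t, sum_sub_distrib, sum_sub_distrib, sum_sub_distrib,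
      ← mul_sum, ← mul_sum, f0]
    have g2 := mul_le_mul_of_nonneg_left f2 (show (0 : ℝ) ≤ k + 2 by positivity)
    have g3 := mul_le_mul_of_nonneg_left f3 (inv_nonneg.mpr hlS.le)
    have g4 : (Real.log S)⁻¹ * (k * μ) ≤ 1 / 4 := by
      rw [inv_mul_eq_div, div_le_iff₀ hlS]
      linarith
    have g5 := mul_le_mul_of_nonneg_right g4 hV0
    have g6 := mul_le_mul_of_nonneg_right (hσ ▸ hPsq) hV0
    linarith
  have hinj : Set.InjOn (fun t : Fin k → Finset (Fin n) ↦ (ofParts t : Config n k))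
      (univ.filter fun t : Fin k → Finset (Fin n) ↦ ∀ a b, a ≠ b → Disjoint (t a) (t b)) := by
    intro s hs t ht hst
    rw [mem_coe, mem_filter] at hs ht
    rw [← parts_ofParts hs.2, ← parts_ofParts ht.2]
    exact congrArg _ hst
  calc _ = 1 / 2 * V * G ^ 2 := by
        rw [hV, prod_sum_partWeight, hG]
        ring
    _ ≤ (∑ t : Fin k → Finset (Fin n), (∏ i, partWeight P l g i (t i)) *
      tupleBracket P S t) * G ^ 2 := mul_le_mul_of_nonneg_right f4 (sq_nonneg _)
    _ ≤ ∑ t : Fin k → Finset (Fin n), if ∀ a b, a ≠ b → Disjoint (t a) (t b) then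
        primeTerm P l (sieveParam P g R) (ofParts t) else 0 := by
        rw [sum_mul, hG]
        exact sum_le_sum fun t _ ↦
          prod_partWeight_mul_tupleBracket_le hP hk hg hg' hgS hS hR t
    _ = ∑ c ∈ (univ.filter fun t : Fin k → Finset (Fin n) ↦
        ∀ a b, a ≠ b → Disjoint (t a) (t b)).image ofParts,
        primeTerm P l (sieveParam P g R) c := by
        rw [sum_image hinj, sum_filter]
    _ ≤ _ := sum_le_sum_of_subset_of_nonneg (subset_univ _) fun c _ _ ↦
        primeTerm_nonneg hk l _ c

end LowerSum

end

section

open Finset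

section CoprimeSums

variable {W : ℕ}

theorem card_filter_coprime_Ico_mul (W u : ℕ) :
    #{n ∈ Ico (u * W + 1) ((u + 1) * W + 1) | W.Coprime n} = W.totient := by
  rw [← Nat.filter_coprime_Ico_eq_totient W (u * W + 1)]
  congr 3
  ring

theorem sum_coprime_Ico_succ (W N : ℕ) :
    ∑ n ∈ Ico 1 ((N + 1) * W + 1) with W.Coprime n, (n : ℝ)⁻¹ =
      ∑ n ∈ Ico 1 (N * W + 1) with W.Coprime n, (n : ℝ)⁻¹ +
        ∑ n ∈ Ico (N * W + 1) ((N + 1) * W + 1) with W.Coprime n, (n : ℝ)⁻¹ := by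
  simp_rw [sum_filter]
  exact (sum_Ico_consecutive _ (by omega) (by gcongr; omega)).symm

theorem le_sum_coprime_inv (N : ℕ) :
    (W.totient / W : ℝ) * harmonic N ≤ ∑ n ∈ Ico 1 (N * W + 1) with W.Coprime n, (n : ℝ)⁻¹ := by
  induction N with
  | zero => simp
  | succ N ih =>
    rw [sum_coprime_Ico_succ]
    have h1 : (W.totient : ℝ) * (((N + 1) * W : ℕ) : ℝ)⁻¹ ≤
        ∑ n ∈ Ico (N * W + 1) ((N + 1) * W + 1) with W.Coprime n, (n : ℝ)⁻¹ := by
      rw [← card_filter_coprime_Ico_mul W N, ← nsmul_eq_mul]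
      refine card_nsmul_le_sum _ _ _ fun n hn ↦ ?_
      rw [mem_filter, mem_Ico] at hn
      have h2 : 0 < n := by omega
      have h3 : n ≤ (N + 1) * W := by omega
      gcongr
    rw [harmonic_succ]
    push_cast at h1 ⊢
    rw [mul_inv] at h1
    have h4 : (W.totient / W : ℝ) * (harmonic N + ((N : ℝ) + 1)⁻¹) =
      W.totient / W * harmonic N + W.totient * (((N : ℝ) + 1)⁻¹ * (W : ℝ)⁻¹) := by ring
    rw [h4]
    linarith

theorem sum_coprime_inv_le (hW : 0 < W) (N : ℕ) :
    ∑ n ∈ Ico 1 ((N + 1) * W + 1) with W.Coprime n, (n : ℝ)⁻¹ ≤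
      W + (W.totient / W : ℝ) * harmonic N := by
  induction N with
  | zero =>
    have h1 : ∑ n ∈ Ico 1 ((0 + 1) * W + 1) with W.Coprime n, (n : ℝ)⁻¹ ≤
        #{n ∈ Ico 1 ((0 + 1) * W + 1) | W.Coprime n} • (1 : ℝ) := by
      refine sum_le_card_nsmul _ _ _ fun n hn ↦ ?_
      rw [mem_filter, mem_Ico] at hn
      exact inv_le_one_of_one_le₀ (by exact_mod_cast hn.1.1)
    have h2 : #{n ∈ Ico 1 ((0 + 1) * W + 1) | W.Coprime n} ≤ W :=
      (card_filter_le _ _).trans (by simp)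
    refine h1.trans ?_
    simpa using h2
  | succ N ih =>
    rw [sum_coprime_Ico_succ]
    have h1 : ∑ n ∈ Ico ((N + 1) * W + 1) ((N + 1 + 1) * W + 1) with W.Coprime n, (n : ℝ)⁻¹ ≤
        (W.totient : ℝ) * (((N + 1) * W : ℕ) : ℝ)⁻¹ := by
      rw [← card_filter_coprime_Ico_mul W (N + 1), ← nsmul_eq_mul]
      refine sum_le_card_nsmul _ _ _ fun n hn ↦ ?_
      rw [mem_filter, mem_Ico] at hn
      have h2 : 0 < (N + 1) * W := by positivity
      have h3 : (N + 1) * W ≤ n := by omega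
      gcongr
    rw [harmonic_succ]
    push_cast at h1 ⊢
    rw [mul_inv] at h1
    have h4 : (W.totient / W : ℝ) * (harmonic N + ((N : ℝ) + 1)⁻¹) =
      W.totient / W * harmonic N + W.totient * (((N : ℝ) + 1)⁻¹ * (W : ℝ)⁻¹) := by ring
    rw [h4]
    linarith

end CoprimeSums

section PrimeEnum

/-- The family `pr` enumerates the primes up to `R` not dividing `W`. -/
structure PrimeEnum (W R : ℕ) {n : ℕ} (pr : Fin n → ℕ) : Prop where
  prime : ∀ j, (pr j).Prime
  inj : Function.Injective pr
  le : ∀ j, pr j ≤ R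
  not_dvd : ∀ j, ¬ pr j ∣ W
  surj : ∀ p, p.Prime → p ≤ R → ¬ p ∣ W → ∃ j, pr j = p

theorem PrimeEnum.exists (W R : ℕ) : ∃ (n : ℕ) (pr : Fin n → ℕ), PrimeEnum W R pr := by
  let s := (range (R + 1)).filter fun p ↦ p.Prime ∧ ¬ p ∣ W
  have hs : ∀ p, p ∈ s ↔ p ≤ R ∧ p.Prime ∧ ¬ p ∣ W := fun p ↦ by simp [s, Nat.lt_succ_iff]
  have hm : ∀ j, ((s.equivFin.symm j : ℕ)) ∈ s := fun j ↦ (s.equivFin.symm j).2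
  refine ⟨#s, fun j ↦ s.equivFin.symm j, fun j ↦ ((hs _).mp (hm j)).2.1, fun i j h ↦ ?_,
    fun j ↦ ((hs _).mp (hm j)).1, fun j ↦ ((hs _).mp (hm j)).2.2, fun p h1 h2 h3 ↦ ?_⟩
  · exact s.equivFin.symm.injective (Subtype.ext h)
  · exact ⟨s.equivFin ⟨p, (hs p).mpr ⟨h2, h1, h3⟩⟩, by simp⟩

variable {W R n : ℕ} {pr : Fin n → ℕ}

theorem setNorm_natCast (t : Finset (Fin n)) :
    setNorm (fun j ↦ (pr j : ℝ)) t = ((∏ j ∈ t, pr j : ℕ) : ℝ) := by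
  rw [setNorm]
  push_cast
  rfl

namespace PrimeEnum

variable (hpr : PrimeEnum W R pr)

include hpr

theorem coprime (j : Fin n) : W.Coprime (pr j) :=
  ((Nat.Prime.coprime_iff_not_dvd (hpr.prime j)).mpr (hpr.not_dvd j)).symm

theorem coprime_prod (t : Finset (Fin n)) : W.Coprime (∏ j ∈ t, pr j) :=
  Nat.Coprime.prod_right fun j _ ↦ hpr.coprime j

theorem prod_pos (t : Finset (Fin n)) : 0 < ∏ j ∈ t, pr j :=
  Finset.prod_pos fun j _ ↦ (hpr.prime j).pos

theorem dvd_prod_iff (t : Finset (Fin n)) (i : Fin n) : pr i ∣ ∏ j ∈ t, pr j ↔ i ∈ t := by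
  rw [(hpr.prime i).prime.dvd_finsetProd_iff]
  constructor
  · rintro ⟨j, hj, hij⟩
    rwa [hpr.inj ((Nat.prime_dvd_prime_iff_eq (hpr.prime i) (hpr.prime j)).mp hij)]
  · exact fun h ↦ ⟨i, h, dvd_rfl⟩

theorem prod_injective : Function.Injective fun t : Finset (Fin n) ↦ ∏ j ∈ t, pr j := by
  intro s t h
  ext i
  rw [← hpr.dvd_prod_iff s i, ← hpr.dvd_prod_iff t i]
  exact iff_of_eq (congrArg _ h)

theorem exists_prod_eq {s : ℕ} (hs : Squarefree s) (hsR : s ≤ R) (hsW : W.Coprime s) :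
    ∃ t : Finset (Fin n), ∏ j ∈ t, pr j = s := by
  classical
  refine ⟨univ.filter fun j ↦ pr j ∈ s.primeFactors, ?_⟩
  rw [← prod_image (f := fun p ↦ p) (g := pr) (hpr.inj.injOn)]
  conv_rhs => rw [← Nat.prod_primeFactors_of_squarefree hs]
  refine prod_congr ?_ fun _ _ ↦ rfl
  ext p
  simp only [mem_image, mem_filter, mem_univ, true_and]
  constructor
  · rintro ⟨j, hj, rfl⟩
    exact hj
  · intro hp
    have h1 := Nat.prime_of_mem_primeFactors hp
    have h2 := Nat.dvd_of_mem_primeFactors hp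
    obtain ⟨j, rfl⟩ := hpr.surj p h1
      ((Nat.le_of_dvd (Nat.pos_of_ne_zero hs.ne_zero) h2).trans hsR)
      fun h3 ↦ h1.one_lt.ne' (Nat.eq_one_of_dvd_coprimes hsW h3 h2)
    exact ⟨j, hp, rfl⟩

theorem sum_inv_setNorm_le (hW : 0 < W) {z : ℝ} (hz : 0 ≤ z) :
    ∑ t with Real.log (setNorm (fun j ↦ (pr j : ℝ)) t) ≤ z, (setNorm (fun j ↦ (pr j : ℝ)) t)⁻¹ ≤
      W + (W.totient / W : ℝ) * (1 + z) := by
  obtain ⟨Y, hY⟩ : ∃ Y, Y = ⌊Real.exp z⌋₊ := ⟨_, rfl⟩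
  have hYz : (Y : ℝ) ≤ Real.exp z := hY ▸ Nat.floor_le (Real.exp_pos z).le
  have hY1 : 1 ≤ Y := by
    rw [hY, Nat.one_le_floor_iff]
    exact Real.one_le_exp hz
  have hH : (harmonic (Y / W) : ℝ) ≤ 1 + z := by
    refine (harmonic_le_one_add_log _).trans ?_
    rcases Nat.eq_zero_or_pos (Y / W) with h | h
    · rw [h]
      simpa using hz
    · have h1 : ((Y / W : ℕ) : ℝ) ≤ Real.exp z :=
        (Nat.cast_le.mpr (Nat.div_le_self Y W)).trans hYz
      have h2 := Real.log_le_log (by exact_mod_cast h) h1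
      rw [Real.log_exp] at h2
      linarith
  refine le_trans ?_ ((sum_coprime_inv_le hW (Y / W)).trans (by gcongr))
  simp_rw [setNorm_natCast]
  rw [← sum_image (f := fun m : ℕ ↦ (m : ℝ)⁻¹) (g := fun t : Finset (Fin n) ↦ ∏ j ∈ t, pr j)
    hpr.prod_injective.injOn]
  refine sum_le_sum_of_subset_of_nonneg ?_ fun _ _ _ ↦ by positivity
  intro m hm
  simp only [mem_image, mem_filter, mem_univ, true_and] at hm
  obtain ⟨t, ht, rfl⟩ := hm
  rw [mem_filter, mem_Ico]
  refine ⟨⟨hpr.prod_pos t, ?_⟩, hpr.coprime_prod t⟩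
  have h1 := hpr.prod_pos t
  rw [Real.log_le_iff_le_exp (by exact_mod_cast h1)] at ht
  have h2 : ∏ j ∈ t, pr j ≤ Y := hY ▸ Nat.le_floor ht
  have h3 := Nat.lt_div_mul_add hW (a := Y)
  rw [add_mul, one_mul]
  omega

theorem le_sum_inv_setNorm (hW : 0 < W) {z : ℝ} (hzR : Real.exp z ≤ R) :
    (W.totient / W : ℝ) * (z - Real.log W) ≤
      2 * ∑ t with Real.log (setNorm (fun j ↦ (pr j : ℝ)) t) ≤ z,
        (setNorm (fun j ↦ (pr j : ℝ)) t)⁻¹ := by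
  obtain ⟨Y, hY⟩ : ∃ Y, Y = ⌊Real.exp z⌋₊ := ⟨_, rfl⟩
  have hYz : (Y : ℝ) ≤ Real.exp z := hY ▸ Nat.floor_le (Real.exp_pos z).le
  have hYR : Y ≤ R := by exact_mod_cast hYz.trans hzR
  have hWpos : (0 : ℝ) < W := by exact_mod_cast hW
  have hH : z - Real.log W ≤ harmonic (Y / W) := by
    refine le_trans ?_ (log_add_one_le_harmonic _)
    have h1 : Real.exp z < Y + 1 := hY ▸ Nat.lt_floor_add_one _
    have h2 : Y + 1 ≤ (Y / W + 1) * W := by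
      have h3 := Nat.lt_div_mul_add hW (a := Y)
      rw [add_mul, one_mul]
      omega
    have h3 : (Y + 1 : ℝ) ≤ ((Y / W + 1 : ℕ) : ℝ) * W := by exact_mod_cast h2
    have h4 : z ≤ Real.log (((Y / W + 1 : ℕ) : ℝ) * W) := by
      rw [Real.le_log_iff_exp_le (by positivity)]
      linarith
    rw [Real.log_mul (by positivity) hWpos.ne'] at h4
    linarith
  have h1 := le_sum_coprime_inv (W := W) (Y / W)
  have hρ : (0 : ℝ) ≤ W.totient / W := by positivity
  refine (mul_le_mul_of_nonneg_left hH hρ).trans (h1.trans ?_)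
  calc _ ≤ ∑ n ∈ Ico 1 (Y + 1) with W.Coprime n, (n : ℝ)⁻¹ := by
        refine sum_le_sum_of_subset_of_nonneg (filter_subset_filter _ (Ico_subset_Ico_right ?_))
          fun _ _ _ ↦ by positivity
        have := Nat.div_mul_le_self Y W
        omega
    _ ≤ ∑ m ∈ (Ioo 0 (Y + 1) ×ˢ univ.filter fun t : Finset (Fin n) ↦
          Real.log (setNorm (fun j ↦ (pr j : ℝ)) t) ≤ z).image
          (fun x : ℕ × Finset (Fin n) ↦ (x.1 ^ 2 * ∏ j ∈ x.2, pr j : ℕ)), (m : ℝ)⁻¹ := by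
        refine sum_le_sum_of_subset_of_nonneg ?_ fun _ _ _ ↦ by positivity
        intro m hm
        rw [mem_filter, mem_Ico] at hm
        obtain ⟨s, b, hbs, hs⟩ := Nat.sq_mul_squarefree m
        have hb : 0 < b := Nat.pos_of_ne_zero fun h ↦ by simp [h] at hbs; omega
        have hsm : s ≤ m := hbs ▸ Nat.le_mul_of_pos_left s (by positivity)
        have hbm : b ≤ m := by
          rw [← hbs, sq, mul_assoc]
          exact Nat.le_mul_of_pos_right b (Nat.mul_pos hb (Nat.pos_of_ne_zero hs.ne_zero))
        obtain ⟨t, ht⟩ := hpr.exists_prod_eq hs (by omega)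
          (Nat.Coprime.coprime_dvd_right ⟨b ^ 2, by rw [← hbs, mul_comm]⟩ hm.2)
        rw [mem_image]
        refine ⟨(b, t), ?_, by rw [ht, hbs]⟩
        rw [mem_product, mem_Ioo, mem_filter, setNorm_natCast, ht,
          Real.log_le_iff_le_exp (by exact_mod_cast Nat.pos_of_ne_zero hs.ne_zero)]
        refine ⟨⟨hb, by omega⟩, mem_univ _, le_trans ?_ hYz⟩
        exact_mod_cast (by omega : s ≤ Y)
    _ ≤ ∑ x ∈ Ioo 0 (Y + 1) ×ˢ univ.filter fun t : Finset (Fin n) ↦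
          Real.log (setNorm (fun j ↦ (pr j : ℝ)) t) ≤ z,
          ((x.1 ^ 2 * ∏ j ∈ x.2, pr j : ℕ) : ℝ)⁻¹ :=
        sum_image_le_of_nonneg fun _ _ ↦ by positivity
    _ = (∑ b ∈ Ioo 0 (Y + 1), ((b : ℝ) ^ 2)⁻¹) *
          ∑ t with Real.log (setNorm (fun j ↦ (pr j : ℝ)) t) ≤ z,
            (setNorm (fun j ↦ (pr j : ℝ)) t)⁻¹ := by
        rw [sum_product, sum_mul_sum]
        refine sum_congr rfl fun b _ ↦ sum_congr rfl fun t _ ↦ ?_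
        rw [setNorm_natCast]
        push_cast
        rw [mul_inv]
    _ ≤ _ := by
        have h2 := sum_Ioo_inv_sq_le (α := ℝ) 0 (Y + 1)
        refine mul_le_mul_of_nonneg_right (h2.trans (by norm_num)) (sum_nonneg fun t _ ↦ ?_)
        rw [setNorm_natCast]
        positivity

end PrimeEnum

end PrimeEnum

end

section

open Finset

section StepWeight

/-- A decreasing step function approximating `1 / x`. -/
noncomputable def stepFun (L : ℝ) (J : ℕ) (x : ℝ) : ℝ :=
  ∑ j ∈ range J, (1 / 2) ^ j * (if x ≤ 2 ^ j * L then 1 else 0)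

variable {L : ℝ} {J : ℕ} {x : ℝ}

theorem stepFun_succ (L : ℝ) (J : ℕ) (x : ℝ) :
    stepFun L (J + 1) x = (if x ≤ L then 1 else 0) + 1 / 2 * stepFun L J (x / 2) := by
  rw [stepFun, sum_range_succ', stepFun, mul_sum, add_comm]
  congr 1
  · simp
  · refine sum_congr rfl fun j _ ↦ ?_
    have : x ≤ 2 ^ (j + 1) * L ↔ x / 2 ≤ 2 ^ j * L := by
      rw [div_le_iff₀ two_pos, pow_succ]
      ring_nf
    simp_rw [this]
    ring

theorem stepFun_nonneg : 0 ≤ stepFun L J x :=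
  sum_nonneg fun j _ ↦ by positivity

theorem stepFun_le_two : stepFun L J x ≤ 2 := by
  induction J generalizing x with
  | zero => simp [stepFun]
  | succ J ih =>
    rw [stepFun_succ]
    have := @ih (x / 2)
    split_ifs <;> linarith

theorem one_le_stepFun (hx : x ≤ L) : 1 ≤ stepFun L (J + 1) x := by
  rw [stepFun_succ, if_pos hx]
  linarith [stepFun_nonneg (L := L) (J := J) (x := x / 2)]

theorem stepFun_antitone : Antitone (stepFun L J) := fun x y hxy ↦ by
  refine sum_le_sum fun j _ ↦ mul_le_mul_of_nonneg_left ?_ (by positivity)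
  split_ifs with h1 h2
  exacts [le_rfl, absurd (hxy.trans h1) h2, zero_le_one, le_rfl]

theorem stepFun_eq_zero (hL : 0 ≤ L) (hx : 2 ^ J * L < x) : stepFun L (J + 1) x = 0 := by
  refine sum_eq_zero fun j hj ↦ ?_
  have h1 : (2 : ℝ) ^ j ≤ 2 ^ J :=
    pow_le_pow_right₀ one_le_two (Nat.lt_succ_iff.mp (mem_range.mp hj))
  have h2 := mul_le_mul_of_nonneg_right h1 hL
  rw [if_neg (by linarith), mul_zero]

theorem mul_stepFun_le (hL : 0 ≤ L) (hx : 0 ≤ x) : x * stepFun L J x ≤ 2 * L := by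
  induction J generalizing x with
  | zero => simp [stepFun, hL]
  | succ J ih =>
    by_cases h : x ≤ L
    · have := mul_le_mul h (stepFun_le_two (L := L) (J := J + 1) (x := x)) stepFun_nonneg hL
      linarith
    · rw [stepFun_succ, if_neg h]
      have := @ih (x / 2) (by positivity)
      linarith

theorem stepFun_sq_le : stepFun L J x ^ 2 ≤
    4 * ∑ j ∈ range J, (1 / 3) ^ j * (if x ≤ 2 ^ j * L then 1 else 0) := by
  have h1 : ∑ j ∈ range J, (3 / 4 : ℝ) ^ j ≤ 4 := by
    have h2 := geom_sum_eq (show (3 / 4 : ℝ) ≠ 1 by norm_num) J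
    have : (0 : ℝ) ≤ (3 / 4) ^ J := by positivity
    rw [h2, div_le_iff_of_neg (by norm_num)]
    linarith
  refine (sum_sq_le_sum_mul_sum_of_sq_le_mul (range J) (f := fun j ↦ (3 / 4 : ℝ) ^ j)
    (g := fun j ↦ (1 / 3) ^ j * (if x ≤ 2 ^ j * L then 1 else 0)) (fun j _ ↦ by positivity)
    (fun j _ ↦ by positivity) fun j _ ↦ le_of_eq ?_).trans (mul_le_mul_of_nonneg_right h1
      (sum_nonneg fun j _ ↦ by positivity))
  have h2 : ((1 / 2 : ℝ) ^ j) ^ 2 = (3 / 4) ^ j * (1 / 3) ^ j := by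
    rw [← pow_mul, mul_comm j 2, pow_mul, ← mul_pow]
    norm_num
  rw [mul_pow, h2]
  split_ifs <;> simp

end StepWeight

section SieveFunction

variable {W R n : ℕ} {pr : Fin n → ℕ}

theorem sum_stepFun_mul (P : Fin n → ℝ) (L : ℝ) (J : ℕ) (a : ℝ) :
    ∑ t, (∑ j ∈ range J, a ^ j * (if Real.log (setNorm P t) ≤ 2 ^ j * L then 1 else 0)) *
      (setNorm P t)⁻¹ =
    ∑ j ∈ range J, a ^ j * ∑ t with Real.log (setNorm P t) ≤ 2 ^ j * L, (setNorm P t)⁻¹ := by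
  simp_rw [sum_mul, mul_sum, sum_filter]
  rw [sum_comm]
  refine sum_congr rfl fun j _ ↦ sum_congr rfl fun t _ ↦ ?_
  split_ifs <;> simp

theorem PrimeEnum.exists_sieveFun (hW : 0 < W) {J k : ℕ} (hk : 2 ^ J ≤ k) :
    ∃ R₀ : ℕ, ∀ R ≥ R₀, ∀ (n : ℕ) (pr : Fin n → ℕ), PrimeEnum W R pr →
      ∃ g : Finset (Fin n) → ℝ, (∀ t, 0 ≤ g t) ∧ (∀ t, g t ≤ 2) ∧ (∀ s t, s ⊆ t → g t ≤ g s) ∧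
      (∀ t, √R < setNorm (fun j ↦ (pr j : ℝ)) t → g t = 0) ∧
      (∃ μ, 0 ≤ μ ∧ 4 * k * μ ≤ Real.log √R ∧
        ∑ t, g t ^ 2 * (setNorm (fun j ↦ (pr j : ℝ)) t)⁻¹ *
          Real.log (setNorm (fun j ↦ (pr j : ℝ)) t) ≤
        μ * ∑ t, g t ^ 2 * (setNorm (fun j ↦ (pr j : ℝ)) t)⁻¹) ∧
      1 ≤ ∑ t, g t ^ 2 * (setNorm (fun j ↦ (pr j : ℝ)) t)⁻¹ ∧
      (W.totient / W : ℝ) * Real.log R * (J + 1) *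
        ∑ t, g t ^ 2 * (setNorm (fun j ↦ (pr j : ℝ)) t)⁻¹ ≤
        50000 * k * (∑ t, g t * (setNorm (fun j ↦ (pr j : ℝ)) t)⁻¹) ^ 2 := by
  obtain ⟨ρ, hρ⟩ : ∃ ρ : ℝ, ρ = W.totient / W := ⟨_, rfl⟩
  have hρ0 : 0 < ρ := by
    have := Nat.totient_pos.mpr hW
    rw [hρ]
    positivity
  have hk0 : 0 < k := (by positivity : 0 < 2 ^ J).trans_le hk
  have hk1 : (1 : ℝ) ≤ k := by exact_mod_cast hk0
  have hkJ : (2 : ℝ) ^ J ≤ k := by exact_mod_cast hk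
  obtain ⟨z₀, hz₀⟩ : ∃ z₀ : ℝ, z₀ = max (1 + W / ρ) (2 * Real.log W) := ⟨_, rfl⟩
  have hz₀1 : 1 + W / ρ ≤ z₀ := hz₀ ▸ le_max_left _ _
  have hz₀2 : 2 * Real.log W ≤ z₀ := hz₀ ▸ le_max_right _ _
  have hz₀0 : 1 ≤ z₀ := le_trans (by have : 0 ≤ W / ρ := by positivity
                                     linarith) hz₀1
  refine ⟨⌈Real.exp (128 * k * (J + 1) * z₀)⌉₊, fun R hR n pr hpr ↦ ?_⟩
  have hR1 : Real.exp (128 * k * (J + 1) * z₀) ≤ R := Nat.ceil_le.mp hR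
  have hR0 : (0 : ℝ) < R := (Real.exp_pos _).trans_le hR1
  obtain ⟨P, hP⟩ : ∃ P : Fin n → ℝ, P = fun j ↦ (pr j : ℝ) := ⟨_, rfl⟩
  rw [← hP, ← hρ]
  have hP1 : ∀ j, 1 ≤ P j := fun j ↦ by
    simp only [hP]
    exact_mod_cast (hpr.prime j).one_lt.le
  have hN0 : ∀ t, 0 < setNorm P t := setNorm_pos fun j ↦ zero_lt_one.trans_le (hP1 j)
  have hN1 : ∀ t, 1 ≤ setNorm P t := fun t ↦ by
    rw [setNorm, ← prod_const_one (s := t)]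
    exact prod_le_prod (fun _ _ ↦ zero_le_one) fun j _ ↦ hP1 j
  obtain ⟨L, hL⟩ : ∃ L : ℝ, L = Real.log R / (128 * k * (J + 1)) := ⟨_, rfl⟩
  have hLR : Real.log R = 128 * k * (J + 1) * L := by
    rw [hL]
    field_simp
  have hLz : z₀ ≤ L := by
    rw [hL, le_div_iff₀ (by positivity), mul_comm, Real.le_log_iff_exp_le hR0]
    exact hR1
  have hL0 : 0 < L := by linarith
  have hS : ∀ j ∈ range (J + 1), ∑ t with Real.log (setNorm P t) ≤ 2 ^ j * L, (setNorm P t)⁻¹ ≤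
      2 * ρ * (2 ^ j * L) ∧ ρ * (2 ^ j * L) ≤
      4 * ∑ t with Real.log (setNorm P t) ≤ 2 ^ j * L, (setNorm P t)⁻¹ := fun j hj ↦ by
    have hj1 : (1 : ℝ) ≤ 2 ^ j := one_le_pow₀ one_le_two
    have hj2 : (2 : ℝ) ^ j ≤ k := le_trans
      (pow_le_pow_right₀ one_le_two (Nat.lt_succ_iff.mp (mem_range.mp hj))) hkJ
    have hz : z₀ ≤ 2 ^ j * L := hLz.trans (le_mul_of_one_le_left hL0.le hj1)
    have hzR : 2 ^ j * L ≤ Real.log R := by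
      rw [hLR]
      refine mul_le_mul_of_nonneg_right ?_ hL0.le
      have : (0 : ℝ) ≤ k * J := by positivity
      linarith
    rw [Real.le_log_iff_exp_le hR0] at hzR
    have h1 := hpr.sum_inv_setNorm_le hW (z := 2 ^ j * L) (by linarith)
    have h2 := hpr.le_sum_inv_setNorm hW (z := 2 ^ j * L) hzR
    rw [← hP, ← hρ] at h1 h2
    refine ⟨h1.trans ?_, ?_⟩
    · have h3 : ρ * (1 + W / ρ) ≤ ρ * (2 ^ j * L) :=
        mul_le_mul_of_nonneg_left (hz₀1.trans hz) hρ0.le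
      rw [mul_add, mul_div_cancel₀ _ hρ0.ne'] at h3
      linarith
    · have h3 : ρ * (2 * Real.log W) ≤ ρ * (2 ^ j * L) :=
        mul_le_mul_of_nonneg_left (hz₀2.trans hz) hρ0.le
      linarith
  obtain ⟨g, hg⟩ : ∃ g : Finset (Fin n) → ℝ,
    g = fun t ↦ stepFun L (J + 1) (Real.log (setNorm P t)) := ⟨_, rfl⟩
  have hgt : ∀ t, g t = stepFun L (J + 1) (Real.log (setNorm P t)) := fun t ↦ by rw [hg]
  have hg0 : ∀ t, 0 ≤ g t := fun t ↦ hgt t ▸ stepFun_nonneg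
  obtain ⟨G, hG⟩ : ∃ G, G = ∑ t, g t * (setNorm P t)⁻¹ := ⟨_, rfl⟩
  obtain ⟨Z, hZ⟩ : ∃ Z, Z = ∑ t, g t ^ 2 * (setNorm P t)⁻¹ := ⟨_, rfl⟩
  have hGsum : G = ∑ j ∈ range (J + 1), (1 / 2) ^ j *
      ∑ t with Real.log (setNorm P t) ≤ 2 ^ j * L, (setNorm P t)⁻¹ := by
    rw [hG, ← sum_stepFun_mul]
    simp_rw [hgt, stepFun]
  have hhalf : ∀ j : ℕ, (1 / 2 : ℝ) ^ j * 2 ^ j = 1 := fun j ↦ by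
    rw [← mul_pow]
    norm_num
  have hG1 : ρ * L * (J + 1) ≤ 4 * G := by
    calc ρ * L * (J + 1) = ∑ j ∈ range (J + 1), (1 / 2) ^ j * (ρ * (2 ^ j * L)) := by
          have : ∀ j : ℕ, (1 / 2 : ℝ) ^ j * (ρ * (2 ^ j * L)) = ρ * L := fun j ↦ by
            rw [show (1 / 2 : ℝ) ^ j * (ρ * (2 ^ j * L)) = (1 / 2) ^ j * 2 ^ j * (ρ * L) by ring,
              hhalf, one_mul]
          simp only [this, sum_const, card_range, nsmul_eq_mul]
          push_cast
          ring
      _ ≤ ∑ j ∈ range (J + 1), (1 / 2) ^ j * (4 *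
          ∑ t with Real.log (setNorm P t) ≤ 2 ^ j * L, (setNorm P t)⁻¹) :=
          sum_le_sum fun j hj ↦ mul_le_mul_of_nonneg_left (hS j hj).2 (by positivity)
      _ = _ := by
          rw [hGsum, mul_sum]
          exact sum_congr rfl fun j _ ↦ by ring
  have hG2 : G ≤ 2 * ρ * L * (J + 1) := by
    calc G ≤ ∑ j ∈ range (J + 1), (1 / 2) ^ j * (2 * ρ * (2 ^ j * L)) := by
          rw [hGsum]
          exact sum_le_sum fun j hj ↦ mul_le_mul_of_nonneg_left (hS j hj).1 (by positivity)
      _ = _ := by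
          have : ∀ j : ℕ, (1 / 2 : ℝ) ^ j * (2 * ρ * (2 ^ j * L)) = 2 * ρ * L := fun j ↦ by
            rw [show (1 / 2 : ℝ) ^ j * (2 * ρ * (2 ^ j * L)) =
              (1 / 2) ^ j * 2 ^ j * (2 * ρ * L) by ring, hhalf, one_mul]
          simp only [this, sum_const, card_range, nsmul_eq_mul]
          push_cast
          ring
  have hZ1 : Z ≤ 24 * ρ * L := by
    calc Z ≤ ∑ t, 4 * (∑ j ∈ range (J + 1), (1 / 3) ^ j *
          (if Real.log (setNorm P t) ≤ 2 ^ j * L then 1 else 0)) * (setNorm P t)⁻¹ := by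
          rw [hZ]
          refine sum_le_sum fun t _ ↦ mul_le_mul_of_nonneg_right ?_ (inv_nonneg.mpr (hN0 t).le)
          rw [hgt]
          exact stepFun_sq_le
      _ = 4 * ∑ j ∈ range (J + 1), (1 / 3) ^ j *
          ∑ t with Real.log (setNorm P t) ≤ 2 ^ j * L, (setNorm P t)⁻¹ := by
          rw [← sum_stepFun_mul, mul_sum]
          exact sum_congr rfl fun t _ ↦ by ring
      _ ≤ 4 * ∑ j ∈ range (J + 1), (1 / 3) ^ j * (2 * ρ * (2 ^ j * L)) := by
          gcongr with j hj
          exact (hS j hj).1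
      _ = 8 * ρ * L * ∑ j ∈ range (J + 1), (2 / 3) ^ j := by
          rw [mul_sum, mul_sum]
          refine sum_congr rfl fun j _ ↦ ?_
          have : (2 / 3 : ℝ) ^ j = (1 / 3) ^ j * 2 ^ j := by
            rw [← mul_pow]
            norm_num
          rw [this]
          ring
      _ ≤ 8 * ρ * L * 3 := by
          gcongr
          have : (0 : ℝ) ≤ (2 / 3) ^ (J + 1) := by positivity
          rw [geom_sum_eq (by norm_num), div_le_iff_of_neg (by norm_num)]
          linarith
      _ = _ := by ring
  have hZterm : ∀ t, 0 ≤ g t ^ 2 * (setNorm P t)⁻¹ := fun t ↦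
    mul_nonneg (sq_nonneg _) (inv_nonneg.mpr (hN0 t).le)
  have hZ2 : ρ * L ≤ 4 * Z := by
    have h1 := (hS 0 (by simp)).2
    rw [pow_zero, one_mul] at h1
    refine h1.trans (mul_le_mul_of_nonneg_left ?_ (by norm_num))
    rw [hZ]
    refine (sum_le_sum fun t ht ↦ ?_).trans (sum_le_sum_of_subset_of_nonneg (subset_univ _)
      fun t _ _ ↦ hZterm t)
    refine le_mul_of_one_le_left (inv_nonneg.mpr (hN0 t).le) (one_le_pow₀ ?_)
    rw [hgt]
    exact one_le_stepFun (mem_filter.mp ht).2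
  have hZ0 : 1 ≤ Z := by
    have h1 := single_le_sum (fun t _ ↦ hZterm t) (mem_univ ∅)
    rw [← hZ] at h1
    refine le_trans ?_ h1
    have h2 : 1 ≤ g ∅ := by
      rw [hgt]
      exact one_le_stepFun (by simpa [setNorm] using hL0.le)
    rw [setNorm, prod_empty, inv_one, mul_one]
    exact one_le_pow₀ h2
  refine ⟨g, hg0, fun t ↦ hgt t ▸ stepFun_le_two, fun s t hst ↦ ?_, fun t ht ↦ ?_,
    ⟨16 * L * (J + 1), by positivity, ?_, ?_⟩, hZ ▸ hZ0, ?_⟩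
  · rw [hgt, hgt]
    refine stepFun_antitone (Real.log_le_log (hN0 s) ?_)
    rw [setNorm, setNorm, ← prod_sdiff hst]
    exact le_mul_of_one_le_left (hN0 s).le (hN1 (t \ s))
  · rw [hgt]
    refine stepFun_eq_zero hL0.le ?_
    have h1 := Real.log_lt_log (Real.sqrt_pos.mpr hR0) ht
    rw [Real.log_sqrt hR0.le, hLR] at h1
    refine lt_of_le_of_lt ?_ h1
    have h2 : (2 : ℝ) ^ J * L ≤ k * L := mul_le_mul_of_nonneg_right hkJ hL0.le
    have : 0 ≤ (k : ℝ) * J * L := by positivity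
    have : 0 ≤ (k : ℝ) * L := by positivity
    linarith
  · rw [Real.log_sqrt hR0.le, hLR]
    linarith
  · calc _ ≤ ∑ t, 2 * L * (g t * (setNorm P t)⁻¹) := by
          refine sum_le_sum fun t _ ↦ ?_
          have h1 := mul_stepFun_le (J := J + 1) hL0.le (Real.log_nonneg (hN1 t))
          rw [← hgt] at h1
          have h2 := mul_le_mul_of_nonneg_right h1
            (mul_nonneg (hg0 t) (inv_nonneg.mpr (hN0 t).le))
          refine le_of_eq_of_le ?_ h2
          ring
      _ = 2 * L * G := by rw [hG, mul_sum]
      _ ≤ 2 * L * (2 * ρ * L * (J + 1)) := by gcongr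
      _ = 4 * L * (J + 1) * (ρ * L) := by ring
      _ ≤ 4 * L * (J + 1) * (4 * Z) := by gcongr
      _ = _ := by rw [hZ]; ring
  · rw [← hZ, ← hG, hLR]
    have h1 : (ρ * L * (J + 1)) ^ 2 ≤ (4 * G) ^ 2 := pow_le_pow_left₀ (by positivity) hG1 2
    calc _ = 128 * k * (ρ * L * (J + 1) ^ 2) * Z := by ring
      _ ≤ 128 * k * (ρ * L * (J + 1) ^ 2) * (24 * ρ * L) := by gcongr
      _ = 3072 * k * (ρ * L * (J + 1)) ^ 2 := by ring
      _ ≤ 3072 * k * (4 * G) ^ 2 := by gcongr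
      _ = 49152 * (k * G ^ 2) := by ring
      _ ≤ 50000 * (k * G ^ 2) := by
          refine mul_le_mul_of_nonneg_right (by norm_num) (by positivity)
      _ = _ := by ring

end SieveFunction

end

section

open Finset

section Mertens

theorem sum_primes_Ioc_inv_le {i : ℕ} (hi : 0 < i) :
    ∑ p ∈ Ioc (2 ^ i) (2 ^ (i + 1)) with Nat.Prime p, (p : ℝ)⁻¹ ≤ 4 * (i : ℝ)⁻¹ := by
  have hlog2 := Real.log_pos one_lt_two
  have hi0 : (0 : ℝ) < i := by exact_mod_cast hi
  have h1 : ∑ p ∈ Ioc (2 ^ i) (2 ^ (i + 1)) with Nat.Prime p, Real.log p ≤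
      Real.log 4 * 2 ^ (i + 1) := by
    refine le_trans ?_ (Chebyshev.theta_le_log4_mul_x (x := 2 ^ (i + 1)) (by positivity))
    rw [Chebyshev.theta]
    refine sum_le_sum_of_subset_of_nonneg (filter_subset_filter _ ?_)
      fun p _ _ ↦ Real.log_natCast_nonneg p
    have h2 : ⌊(2 : ℝ) ^ (i + 1)⌋₊ = 2 ^ (i + 1) := by exact_mod_cast Nat.floor_natCast (2 ^ (i + 1))
    rw [h2]
    exact Ioc_subset_Ioc_left (Nat.zero_le _)
  have h2 : ∑ p ∈ Ioc (2 ^ i) (2 ^ (i + 1)) with Nat.Prime p, (p : ℝ)⁻¹ ≤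
      ∑ p ∈ Ioc (2 ^ i) (2 ^ (i + 1)) with Nat.Prime p,
        Real.log p * ((i * Real.log 2)⁻¹ * ((2 : ℝ) ^ i)⁻¹) := by
    refine sum_le_sum fun p hp ↦ ?_
    rw [mem_filter, mem_Ioc] at hp
    have h3 : (2 : ℝ) ^ i ≤ p := by exact_mod_cast hp.1.1.le
    have h4 : i * Real.log 2 ≤ Real.log p := by
      rw [← Real.log_pow]
      exact Real.log_le_log (by positivity) h3
    rw [← mul_assoc]
    have h5 : 1 ≤ Real.log p * (i * Real.log 2)⁻¹ := by
      rw [← div_eq_mul_inv, one_le_div (by positivity)]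
      exact h4
    exact (inv_anti₀ (by positivity) h3).trans (le_mul_of_one_le_left (by positivity) h5)
  rw [← sum_mul] at h2
  refine h2.trans ((mul_le_mul_of_nonneg_right h1 (by positivity)).trans_eq ?_)
  rw [show (4 : ℝ) = 2 ^ 2 by norm_num, Real.log_pow, pow_succ]
  field_simp
  norm_num

theorem sum_primes_inv_le (I : ℕ) :
    ∑ p ∈ Ioc 0 (2 ^ (I + 1)) with Nat.Prime p, (p : ℝ)⁻¹ ≤ 1 + 4 * harmonic I := by
  induction I with
  | zero =>
    have : (Ioc 0 (2 ^ (0 + 1))).filter Nat.Prime = {2} := by decide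
    rw [this]
    norm_num
  | succ I ih =>
    have h1 := sum_primes_Ioc_inv_le (Nat.succ_pos I)
    have h2 : ∑ p ∈ Ioc 0 (2 ^ (I + 1 + 1)) with Nat.Prime p, (p : ℝ)⁻¹ =
        ∑ p ∈ Ioc 0 (2 ^ (I + 1)) with Nat.Prime p, (p : ℝ)⁻¹ +
          ∑ p ∈ Ioc (2 ^ (I + 1)) (2 ^ (I + 1 + 1)) with Nat.Prime p, (p : ℝ)⁻¹ := by
      simp_rw [sum_filter]
      exact (sum_Ioc_consecutive _ (Nat.zero_le _)
        (Nat.pow_le_pow_right two_pos (Nat.le_succ _))).symm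
    rw [harmonic_succ, h2]
    push_cast at h1 ⊢
    linarith

theorem PrimeEnum.exists_prod_le (B : ℕ) : ∃ C : ℝ, 1 ≤ C ∧ ∃ D : ℕ, ∀ W R n : ℕ,
    ∀ pr : Fin n → ℕ, PrimeEnum W R pr → 3 ≤ R →
      ∏ j, (1 + B * (pr j : ℝ)⁻¹) ≤ C * Real.log R ^ D := by
  have hC : 1 ≤ Real.exp (5 * B) * 2 ^ (4 * B) := by
    have h1 := Real.one_le_exp (show (0 : ℝ) ≤ 5 * B by positivity)
    have h2 : (1 : ℝ) ≤ 2 ^ (4 * B) := one_le_pow₀ one_le_two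
    exact one_le_mul_of_one_le_of_one_le h1 h2
  refine ⟨Real.exp (5 * B) * 2 ^ (4 * B), hC, 4 * B, fun W R n pr hpr hR ↦ ?_⟩
  obtain ⟨I, hI⟩ : ∃ I, I = Nat.log 2 R := ⟨_, rfl⟩
  have hR0 : R ≠ 0 := by omega
  have hI1 : 2 ^ I ≤ R := hI ▸ Nat.pow_log_le_self 2 hR0
  have hI2 : R < 2 ^ (I + 1) := hI ▸ Nat.lt_pow_succ_log_self one_lt_two R
  have hI3 : 0 < I := hI ▸ Nat.log_pos one_lt_two (by omega)
  have hI0 : (0 : ℝ) < I := by exact_mod_cast hI3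
  have h1 : (I : ℝ) ≤ 2 * Real.log R := by
    have h2 : I * Real.log 2 ≤ Real.log R := by
      rw [← Real.log_pow]
      exact Real.log_le_log (by positivity) (by exact_mod_cast hI1)
    have := mul_le_mul_of_nonneg_left (show 1 / 2 ≤ Real.log 2 by linarith [Real.log_two_gt_d9])
      hI0.le
    linarith
  have h2 : ∑ j, (pr j : ℝ)⁻¹ ≤ 5 + 4 * Real.log I := by
    have h3 : ∑ j, (pr j : ℝ)⁻¹ ≤ ∑ p ∈ Ioc 0 (2 ^ (I + 1)) with Nat.Prime p, (p : ℝ)⁻¹ := by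
      rw [← sum_image (f := fun p : ℕ ↦ (p : ℝ)⁻¹) hpr.inj.injOn]
      refine sum_le_sum_of_subset_of_nonneg (fun p hp ↦ ?_) fun _ _ _ ↦ by positivity
      obtain ⟨j, _, rfl⟩ := mem_image.mp hp
      rw [mem_filter, mem_Ioc]
      exact ⟨⟨(hpr.prime j).pos, (hpr.le j).trans hI2.le⟩, hpr.prime j⟩
    have h4 := sum_primes_inv_le I
    have h5 := harmonic_le_one_add_log I
    linarith
  calc ∏ j, (1 + B * (pr j : ℝ)⁻¹) ≤ ∏ j, Real.exp (B * (pr j : ℝ)⁻¹) :=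
        prod_le_prod (fun j _ ↦ by positivity) fun j _ ↦ by
          rw [add_comm]
          exact Real.add_one_le_exp _
    _ = Real.exp (B * ∑ j, (pr j : ℝ)⁻¹) := by rw [← Real.exp_sum, mul_sum]
    _ ≤ Real.exp (B * (5 + 4 * Real.log I)) := by gcongr
    _ = Real.exp (5 * B) * (I : ℝ) ^ (4 * B) := by
        rw [show B * (5 + 4 * Real.log I) = 5 * B + ((4 * B : ℕ) : ℝ) * Real.log I by push_cast; ring,
          Real.exp_add, Real.exp_nat_mul, Real.exp_log hI0]
    _ ≤ Real.exp (5 * B) * (2 * Real.log R) ^ (4 * B) := by gcongr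
    _ = _ := by rw [mul_pow, mul_assoc]

theorem PrimeEnum.sum_inv_sq_le {W R n D : ℕ} {pr : Fin n → ℕ} (hpr : PrimeEnum W R pr)
    (hD : ∀ j, D < pr j) : ∑ j, (pr j : ℝ)⁻¹ ^ 2 ≤ 2 / (D + 1) := by
  refine le_trans ?_ (sum_Ioo_inv_sq_le D (R + 1))
  simp_rw [inv_pow]
  rw [← sum_image (f := fun p : ℕ ↦ ((p : ℝ) ^ 2)⁻¹) hpr.inj.injOn]
  refine sum_le_sum_of_subset_of_nonneg (fun p hp ↦ ?_) fun _ _ _ ↦ by positivity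
  obtain ⟨j, _, rfl⟩ := mem_image.mp hp
  rw [mem_Ioo]
  exact ⟨hD j, Nat.lt_succ_iff.mpr (hpr.le j)⟩

end Mertens

end

section

open Finset

section Join

variable {n k : ℕ}

/-- The union of two compatible configurations. -/
def Config.join (d e : Config n k) : Config n k := fun j ↦ (d j).or (e j)

/-- Two configurations are compatible if they agree where both are nontrivial. -/
def Config.Compat (d e : Config n k) : Prop := ∀ j, d j = none ∨ e j = none ∨ d j = e j

instance (d e : Config n k) : Decidable (d.Compat e) :=
  inferInstanceAs (Decidable (∀ j, d j = none ∨ e j = none ∨ d j = e j))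

theorem locInd_mul_locInd {a b : Option (Fin k)} (h : a = none ∨ b = none ∨ a = b)
    (s : Option (Fin k)) : locInd a s * locInd b s = locInd (a.or b) s := by
  cases a <;> cases b <;> simp_all [locInd]

theorem locInd_mul_locInd_eq_zero {a b : Option (Fin k)} (h : ¬ (a = none ∨ b = none ∨ a = b))
    (s : Option (Fin k)) : locInd a s * locInd b s = 0 := by
  cases a <;> cases b <;> simp_all [locInd]
  rintro rfl h2
  exact h (Option.some.inj h2)

theorem configInd_mul_configInd {d e : Config n k} (h : d.Compat e) (s : Config n k) :
    configInd d s * configInd e s = configInd (d.join e) s := by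
  rw [configInd, configInd, ← prod_mul_distrib]
  exact prod_congr rfl fun j _ ↦ locInd_mul_locInd (h j) _

theorem configNorm_join_le {P : Fin n → ℝ} (hP : ∀ j, 1 ≤ P j) (d e : Config n k) :
    configNorm P (d.join e) ≤ configNorm P d * configNorm P e := by
  rw [configNorm, configNorm, configNorm, ← prod_mul_distrib]
  refine prod_le_prod (fun j _ ↦ (locNorm_pos (by linarith [hP j]) _).le) fun j _ ↦ ?_
  have h1 := one_le_locNorm (hP j) (d j)
  have h2 := one_le_locNorm (hP j) (e j)
  rw [Config.join]
  cases h : d j with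
  | none => simp [locNorm]
  | some i =>
    rw [h] at h1
    simp only [Option.some_or]
    nlinarith

theorem sum_compat_join_le {f : Config n k → ℝ} (hf : ∀ u, 0 ≤ f u) {P : Fin n → ℝ}
    (hP : ∀ j, 1 ≤ P j) {R : ℝ} (hR : 0 ≤ R) :
    ∑ x : Config n k × Config n k with (configNorm P x.1 ≤ R ∧ configNorm P x.2 ≤ R) ∧
      x.1.Compat x.2, f (x.1.join x.2) ≤
    ∑ u : Config n k with configNorm P u ≤ R * R, 4 ^ #u.supp * f u := by
  classical
  rw [← sum_fiberwise_of_maps_to (g := fun x ↦ x.1.join x.2)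
    (t := univ.filter fun u : Config n k ↦ configNorm P u ≤ R * R)]
  · refine sum_le_sum fun u _ ↦ ?_
    have h1 : ∀ x ∈ (univ.filter fun x : Config n k × Config n k ↦
        (configNorm P x.1 ≤ R ∧ configNorm P x.2 ≤ R) ∧ x.1.Compat x.2).filter
        fun x ↦ x.1.join x.2 = u, f (x.1.join x.2) = f u := fun x hx ↦ by
      rw [(mem_filter.mp hx).2]
    rw [sum_congr rfl h1, sum_const, nsmul_eq_mul]
    refine mul_le_mul_of_nonneg_right ?_ (hf u)
    have h2 : (univ.filter fun x : Config n k × Config n k ↦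
        (configNorm P x.1 ≤ R ∧ configNorm P x.2 ≤ R) ∧ x.1.Compat x.2).filter
        (fun x ↦ x.1.join x.2 = u) ⊆
        (Fintype.piFinset fun j ↦ {none, u j}) ×ˢ (Fintype.piFinset fun j ↦ {none, u j}) := by
      intro x hx
      simp only [mem_filter, mem_univ, true_and] at hx
      simp only [mem_product, Fintype.mem_piFinset, mem_insert, mem_singleton, ← forall_and]
      intro j
      have h3 := hx.1.2 j
      have h4 := congrFun hx.2 j
      rw [Config.join] at h4
      rw [← h4]
      cases h5 : x.1 j <;> cases h6 : x.2 j <;> simp_all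
    have h3 : #(Fintype.piFinset fun j ↦ ({none, u j} : Finset (Option (Fin k)))) ≤
        2 ^ #u.supp := by
      rw [Fintype.card_piFinset, Config.supp, card_filter, ← prod_pow_eq_pow_sum]
      refine prod_le_prod' fun j _ ↦ ?_
      split_ifs with h
      · exact card_le_two
      · push Not at h
        simp [h]
    have h4 := (card_le_card h2).trans ((card_product _ _).trans_le (Nat.mul_le_mul h3 h3))
    rw [← mul_pow] at h4
    exact_mod_cast h4
  · intro x hx
    simp only [mem_filter, mem_univ, true_and] at hx ⊢
    refine (configNorm_join_le hP _ _).trans ?_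
    have := configNorm_pos (P := P) (fun j ↦ by linarith [hP j]) x.2
    exact mul_le_mul hx.1.1 hx.1.2 this.le hR

/-- A weighted sum of squares of sieve weights is compared with its model, in terms of the
errors in counting the points whose state contains a given configuration. -/
theorem abs_sum_mul_sieveSum_sq_sub_le_of_join {P : Fin n → ℝ} (hP : ∀ j, 2 ≤ P j)
    {y : Config n k → ℝ} {F R : ℝ} (hR : 0 ≤ R)
    (hF : 0 ≤ F) (hy : ∀ r, |y r| ≤ F * (configNorm P r)⁻¹)
    (hy' : ∀ r, R < configNorm P r → y r = 0) {ι : Type*} (T : Finset ι) (a : ι → ℝ)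
    (s : ι → Config n k) (w : Fin n → Option (Fin k) → ℝ) (M : ℝ)
    (E : Config n k → ℝ) (hE0 : ∀ u, 0 ≤ E u)
    (hE : ∀ u, configNorm P u ≤ R * R → |∑ x ∈ T, a x * configInd u (s x) -
        M * ∏ j, ∑ b, w j b * locInd (u j) b| ≤ E u) :
    |∑ x ∈ T, a x * sieveSum P y (s x) ^ 2 -
      M * ∑ c : Config n k, (∏ j, w j (c j)) * sieveSum P y c ^ 2| ≤
    (F * ∏ j, (1 + k / P j)) ^ 2 *
      ∑ u : Config n k with configNorm P u ≤ R * R, 4 ^ #u.supp * E u := by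
  classical
  have hP1 : ∀ j, 1 ≤ P j := fun j ↦ by linarith [hP j]
  refine (abs_sum_mul_sieveSum_sq_sub_le hP hF hy hy' T a s w M
    (fun d e ↦ if d.Compat e then E (d.join e) else 0) fun d e hd he ↦ ?_).trans
    (mul_le_mul_of_nonneg_left ?_ (sq_nonneg _))
  · split_ifs with h
    · simp_rw [configInd_mul_configInd h, locInd_mul_locInd (h _)]
      refine hE _ ((configNorm_join_le hP1 d e).trans ?_)
      exact mul_le_mul hd he (configNorm_pos (fun j ↦ by linarith [hP j]) _).le hR
    · rw [Config.Compat] at h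
      push Not at h
      obtain ⟨j, hj⟩ := h
      have h1 : ∀ s, locInd (d j) s * locInd (e j) s = 0 :=
        locInd_mul_locInd_eq_zero (by tauto)
      have h2 : ∀ s, configInd d s * configInd e s = 0 := fun s ↦ by
        rw [configInd, configInd, ← prod_mul_distrib]
        exact prod_eq_zero (mem_univ j) (h1 _)
      simp_rw [h2]
      rw [prod_eq_zero (mem_univ j) (by simp_rw [h1]; simp)]
      simp
  · refine le_trans (le_of_eq ?_) (sum_compat_join_le hE0 hP1 hR)
    rw [← sum_filter, filter_filter]

theorem sum_locProb_mul_locInd {p : ℝ} (hp : p ≠ 0) (a : Option (Fin k)) :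
    ∑ b, locProb p b * locInd a b = (locNorm p a)⁻¹ := by
  cases a with
  | none =>
    simp [locInd, locProb, locNorm, Fintype.sum_option]
    ring
  | some i => simp [locInd, locProb, locNorm, Fintype.sum_option]

theorem sum_locProb'_mul_locInd_none (l : Fin k) (p : ℝ) :
    ∑ b, locProb' l p b * locInd none b = 1 := by
  simp only [locInd, true_or, if_true, mul_one, Fintype.sum_option, locProb']
  rw [← sum_erase_add _ _ (mem_univ l), sum_congr rfl fun i hi ↦ if_neg (ne_of_mem_erase hi)]
  have : 1 ≤ k := l.pos
  simp [card_erase_of_mem, Nat.cast_sub this]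
  ring

theorem sum_locProb'_mul_locInd_some (l i : Fin k) (p : ℝ) :
    ∑ b, locProb' l p b * locInd (some i) b = if i = l then 0 else 1 / (p - 1) := by
  simp [locInd, locProb', Fintype.sum_option]

/-- The product of the primes in a configuration as a natural number. -/
def configNat (pr : Fin n → ℕ) (u : Config n k) : ℕ := ∏ j ∈ u.supp, pr j

theorem configNat_cast (pr : Fin n → ℕ) (u : Config n k) :
    (configNat pr u : ℝ) = configNorm (fun j ↦ (pr j : ℝ)) u := by
  rw [configNat, configNorm, Config.supp, prod_filter]
  push_cast
  refine prod_congr rfl fun j _ ↦ ?_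
  cases h : u j <;> simp [locNorm]

end Join

end

section

open Finset

section CharacterSums

/-- The primitive characters inducing the nontrivial characters modulo `N`. -/
noncomputable def primitiveFamily (N : ℕ) : Finset DChar :=
  (Set.toFinite ((fun χ : DirichletCharacter ℂ N ↦
    (⟨χ.conductor, χ.primitiveCharacter⟩ : DChar)) '' {χ | χ ≠ 1})).toFinset

theorem mem_primitiveFamily {N : ℕ} {x : DChar} : x ∈ primitiveFamily N ↔
    ∃ χ : DirichletCharacter ℂ N, χ ≠ 1 ∧ (⟨χ.conductor, χ.primitiveCharacter⟩ : DChar) = x := by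
  simp [primitiveFamily]

theorem dvd_of_mem_primitiveFamily {N : ℕ} {x : DChar} (hx : x ∈ primitiveFamily N) : x.1 ∣ N := by
  obtain ⟨χ, -, rfl⟩ := mem_primitiveFamily.mp hx
  exact χ.conductor_dvd_level

theorem sum_primitiveFamily (N : ℕ) [NeZero N] [DecidableEq (DirichletCharacter ℂ N)]
    (F : DChar → ℝ) :
    ∑ χ : DirichletCharacter ℂ N with χ ≠ 1, F ⟨χ.conductor, χ.primitiveCharacter⟩ =
      ∑ x ∈ primitiveFamily N, F x := by
  refine sum_bij (fun χ _ ↦ ⟨χ.conductor, χ.primitiveCharacter⟩)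
    (fun χ hχ ↦ mem_primitiveFamily.mpr ⟨χ, (mem_filter.mp hχ).2, rfl⟩) (fun χ _ ξ _ h ↦ ?_)
    (fun x hx ↦ ?_) fun _ _ ↦ rfl
  · have h1 : Function.LeftInverse (fun x : DChar ↦ if h : x.1 ∣ N then
        DirichletCharacter.changeLevel h x.2 else (1 : DirichletCharacter ℂ N))
        fun χ ↦ ⟨χ.conductor, χ.primitiveCharacter⟩ := fun χ ↦ by
      simp only [χ.conductor_dvd_level, dite_true]
      exact χ.changeLevel_primitiveCharacter
    exact h1.injective h
  · obtain ⟨χ, h1, h2⟩ := mem_primitiveFamily.mp hx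
    exact ⟨χ, mem_filter.mpr ⟨mem_univ _, h1⟩, h2⟩

theorem DChar.family_biUnion {ι : Type*} [DecidableEq DChar] (U : Finset ι) (N : ι → ℕ) {Q : ℕ}
    (hN : ∀ u ∈ U, 0 < N u ∧ N u ≤ Q) :
    DChar.Family Q (U.biUnion fun u ↦ primitiveFamily (N u)) := by
  have h : ∀ x ∈ U.biUnion fun u ↦ primitiveFamily (N u), (0 < x.1 ∧ x.1 ≤ Q) ∧
      x.2.IsPrimitive ∧ x.2 ≠ 1 := by
    intro x hx
    obtain ⟨u, hu, hx⟩ := mem_biUnion.mp hx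
    have h1 := dvd_of_mem_primitiveFamily hx
    have h2 := Nat.pos_of_dvd_of_pos h1 (hN u hu).1
    refine ⟨⟨h2, (Nat.le_of_dvd (hN u hu).1 h1).trans (hN u hu).2⟩, ?_⟩
    obtain ⟨χ, hχ, rfl⟩ := mem_primitiveFamily.mp hx
    have : NeZero (N u) := ⟨(hN u hu).1.ne'⟩
    refine ⟨χ.primitiveCharacter_isPrimitive, fun h ↦ hχ ?_⟩
    have h3 := χ.changeLevel_primitiveCharacter
    simp only at h
    rw [h, DirichletCharacter.changeLevel_one] at h3
    exact h3.symm
  exact ⟨fun x hx ↦ (h x hx).1.1, fun x hx ↦ (h x hx).1.2, fun x hx ↦ (h x hx).2.1,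
    fun x hx ↦ (h x hx).2.2⟩

variable {W R n k : ℕ} {pr : Fin n → ℕ} (hpr : PrimeEnum W R pr)

include hpr

theorem PrimeEnum.coprime_configNat (u : Config n k) : W.Coprime (configNat pr u) :=
  hpr.coprime_prod _

theorem PrimeEnum.configNat_pos (u : Config n k) : 0 < configNat pr u := hpr.prod_pos _

theorem PrimeEnum.totient_configNat (u : Config n k) :
    (configNat pr u).totient = ∏ j ∈ u.supp, (pr j - 1) := by
  classical
  rw [configNat]
  generalize u.supp = s
  induction s using Finset.induction_on with
  | empty => simp
  | insert i s hi ih =>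
    rw [prod_insert hi, prod_insert hi, Nat.totient_mul, ih, Nat.totient_prime (hpr.prime i)]
    rw [Nat.Prime.coprime_iff_not_dvd (hpr.prime i), hpr.dvd_prod_iff]
    exact hi

theorem PrimeEnum.sqrt_le_of_dvd {c : ℕ} (hc : 0 < c) (hW : 0 < W) {u : Config n k}
    (h : c ∣ W * configNat pr u) : 1 ≤ √W * (√c)⁻¹ *
      ∏ j, (if pr j ∣ c then (if u j = none then 0 else √(pr j)) else 1) := by
  have h1 : ∀ j, pr j ∣ c → u j ≠ none := by
    intro j hj
    have h2 := ((hpr.prime j).dvd_mul.mp (hj.trans h)).resolve_left (hpr.not_dvd j)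
    rw [configNat, hpr.dvd_prod_iff, Config.supp, mem_filter] at h2
    exact h2.2
  have h2 : c ∣ W * ∏ j with pr j ∣ c, pr j := by
    rw [configNat, ← prod_filter_mul_prod_filter_not _ fun j ↦ pr j ∣ c, ← mul_assoc] at h
    have h3 : (∏ j ∈ u.supp with pr j ∣ c, pr j) = ∏ j with pr j ∣ c, pr j := by
      refine prod_congr ?_ fun _ _ ↦ rfl
      ext j
      simp only [Config.supp, mem_filter, mem_univ, true_and]
      exact ⟨fun h ↦ h.2, fun h ↦ ⟨h1 j h, h⟩⟩
    rw [h3] at h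
    refine Nat.Coprime.dvd_of_dvd_mul_right (Nat.Coprime.prod_right fun j hj ↦ ?_) h
    exact ((hpr.prime j).coprime_iff_not_dvd.mpr (mem_filter.mp hj).2).symm
  have h3 : (c : ℝ) ≤ W * ∏ j with pr j ∣ c, (pr j : ℝ) := by
    exact_mod_cast Nat.le_of_dvd (Nat.mul_pos hW (hpr.prod_pos _)) h2
  have h4 : ∏ j, (if pr j ∣ c then (if u j = none then 0 else √(pr j)) else 1) =
      √(∏ j with pr j ∣ c, (pr j : ℝ)) := by
    rw [Real.sqrt_eq_rpow, ← Real.finsetProd_rpow _ _ fun j _ ↦ Nat.cast_nonneg _, prod_filter]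
    refine prod_congr rfl fun j _ ↦ ?_
    split_ifs with h5 h6
    · exact absurd h6 (h1 j h5)
    · rw [Real.sqrt_eq_rpow]
    · rfl
  rw [h4, mul_right_comm, ← Real.sqrt_mul (Nat.cast_nonneg _), ← div_eq_mul_inv,
    one_le_div (Real.sqrt_pos.mpr (Nat.cast_pos.mpr hc))]
  exact Real.sqrt_le_sqrt h3

theorem PrimeEnum.sum_dvd_le (hW : 0 < W) (hD : ∀ j, 64 * k ^ 2 ≤ pr j) {c : ℕ} (hc : 0 < c)
    (U : Finset (Config n k)) :
    ∑ u ∈ U with c ∣ W * configNat pr u,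
      4 ^ #u.supp * ((W * configNat pr u).totient : ℝ)⁻¹ ≤
      √W / W.totient * (∏ j, (1 + 8 * k * (pr j : ℝ)⁻¹)) * (√c)⁻¹ := by
  have hp : ∀ j, (2 : ℝ) ≤ pr j := fun j ↦ by exact_mod_cast (hpr.prime j).two_le
  let β : Fin n → ℝ := fun j ↦ 4 * ((pr j : ℝ) - 1)⁻¹
  have hβ : ∀ j, 0 ≤ β j := fun j ↦ by
    have := inv_nonneg.mpr (by linarith [hp j] : (0 : ℝ) ≤ pr j - 1)
    positivity
  have hβ' : ∀ j, β j ≤ 8 * (pr j : ℝ)⁻¹ := fun j ↦ by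
    have h1 : ((pr j : ℝ) - 1)⁻¹ ≤ ((pr j : ℝ) / 2)⁻¹ := by
      have := hp j
      gcongr
      linarith
    rw [inv_div] at h1
    calc β j = 4 * ((pr j : ℝ) - 1)⁻¹ := rfl
      _ ≤ 4 * (2 / pr j) := by linarith
      _ = _ := by ring
  have hβ'' : ∀ j, k * (β j * √(pr j)) ≤ 1 := fun j ↦ by
    have h1 : (8 * k : ℝ) ≤ √(pr j) := by
      rw [Real.le_sqrt (by positivity) (by positivity), mul_pow]
      have := hD j
      norm_num
      exact_mod_cast this
    have h2 : (pr j : ℝ)⁻¹ * √(pr j) = (√(pr j))⁻¹ := by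
      have h3 : 0 < √(pr j : ℝ) := Real.sqrt_pos.mpr (by linarith [hp j])
      refine eq_inv_of_mul_eq_one_left ?_
      rw [mul_assoc, Real.mul_self_sqrt (by linarith [hp j]),
        inv_mul_cancel₀ (by linarith [hp j])]
    have h3 : 0 < √(pr j : ℝ) := Real.sqrt_pos.mpr (by linarith [hp j])
    calc k * (β j * √(pr j)) ≤ k * (8 * (pr j : ℝ)⁻¹ * √(pr j)) := by
          gcongr
          exact hβ' j
      _ = 8 * k * (√(pr j))⁻¹ := by rw [mul_assoc 8, h2]; ring
      _ ≤ √(pr j) * (√(pr j))⁻¹ := by gcongr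
      _ = 1 := mul_inv_cancel₀ h3.ne'
  let v : Config n k → ℝ := fun u ↦ √W / W.totient * (√c)⁻¹ * ∏ j,
    (if u j = none then 1 else β j) *
      (if pr j ∣ c then (if u j = none then 0 else √(pr j)) else 1)
  have hv : ∀ u, 0 ≤ v u := fun u ↦ by
    refine mul_nonneg (by positivity) (prod_nonneg fun j _ ↦ mul_nonneg ?_ ?_)
    · split_ifs <;> simp [hβ]
    · split_ifs <;> positivity
  calc _ ≤ ∑ u ∈ U with c ∣ W * configNat pr u, v u := by
        refine sum_le_sum fun u hu ↦ ?_
        have h1 := hpr.sqrt_le_of_dvd hc hW (mem_filter.mp hu).2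
        have h2 : 4 ^ #u.supp * ((W * configNat pr u).totient : ℝ)⁻¹ =
            (W.totient : ℝ)⁻¹ * ∏ j, if u j = none then 1 else β j := by
          rw [Nat.totient_mul (hpr.coprime_configNat u), hpr.totient_configNat, Nat.cast_mul,
            mul_inv, mul_left_comm, Nat.cast_prod, ← prod_inv_distrib, ← prod_const,
            ← prod_mul_distrib, Config.supp, prod_filter]
          congr 1
          refine prod_congr rfl fun j _ ↦ ?_
          by_cases h : u j = none
          · simp [h]
          · rw [if_pos h, if_neg h, Nat.cast_sub (hpr.prime j).one_le]
            simp [β]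
        rw [h2]
        have h3 : 0 ≤ (W.totient : ℝ)⁻¹ * ∏ j, if u j = none then 1 else β j :=
          mul_nonneg (by positivity) (prod_nonneg fun j _ ↦ by split_ifs <;> simp [hβ])
        refine (le_mul_of_one_le_right h3 h1).trans_eq ?_
        simp only [v, prod_mul_distrib]
        ring
    _ ≤ ∑ u, v u := sum_le_sum_of_subset_of_nonneg (subset_univ _) fun u _ _ ↦ hv u
    _ = √W / W.totient * (√c)⁻¹ * ∏ j, ∑ a : Option (Fin k), (if a = none then 1 else β j) *
      (if pr j ∣ c then (if a = none then 0 else √(pr j)) else 1) := by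
        simp only [v]
        rw [← mul_sum, prod_univ_sum, Fintype.piFinset_univ]
    _ ≤ √W / W.totient * (√c)⁻¹ * ∏ j, (1 + 8 * k * (pr j : ℝ)⁻¹) := by
        refine mul_le_mul_of_nonneg_left (prod_le_prod (fun j _ ↦ sum_nonneg fun a _ ↦
          mul_nonneg ?_ ?_) fun j _ ↦ ?_) (by positivity)
        · split_ifs <;> simp [hβ]
        · split_ifs <;> positivity
        · rw [Fintype.sum_option]
          have h1 : 0 ≤ 8 * k * (pr j : ℝ)⁻¹ := by positivity
          have h2 := hβ'' j
          have h3 : k * β j ≤ k * (8 * (pr j : ℝ)⁻¹) :=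
            mul_le_mul_of_nonneg_left (hβ' j) (by positivity)
          by_cases h : pr j ∣ c <;> simp [h] <;> linarith
    _ = _ := by ring

/-- The sum over all nontrivial characters to moduli `W * configNat pr u` is bounded by a sum
over a family of primitive characters. -/
theorem PrimeEnum.exists_family (hW : 0 < W) (hD : ∀ j, 64 * k ^ 2 ≤ pr j) {Q : ℕ}
    (U : Finset (Config n k)) (hU : ∀ u ∈ U, W * configNat pr u ≤ Q) :
    ∃ T, DChar.Family Q T ∧ ∀ F : DChar → ℝ, (∀ x, 0 ≤ F x) →
      ∑ u ∈ U, 4 ^ #u.supp * (((W * configNat pr u).totient : ℝ)⁻¹ *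
        ∑ x ∈ primitiveFamily (W * configNat pr u), F x) ≤
      √W / W.totient * (∏ j, (1 + 8 * k * (pr j : ℝ)⁻¹)) * ∑ x ∈ T, F x * (√x.1)⁻¹ := by
  classical
  have hT := DChar.family_biUnion U (fun u ↦ W * configNat pr u) (Q := Q)
    fun u hu ↦ ⟨Nat.mul_pos hW (hpr.configNat_pos u), hU u hu⟩
  refine ⟨_, hT, fun F hF ↦ ?_⟩
  obtain ⟨T, hTe⟩ : ∃ T, T = U.biUnion fun u ↦ primitiveFamily (W * configNat pr u) := ⟨_, rfl⟩
  rw [← hTe] at hT ⊢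
  calc _ ≤ ∑ u ∈ U, ∑ x ∈ T with x.1 ∣ W * configNat pr u,
        F x * (4 ^ #u.supp * ((W * configNat pr u).totient : ℝ)⁻¹) := by
        refine sum_le_sum fun u hu ↦ ?_
        rw [← mul_assoc, mul_comm, sum_mul]
        refine sum_le_sum_of_subset_of_nonneg (fun x hx ↦ ?_)
          fun x _ _ ↦ mul_nonneg (hF x) (by positivity)
        rw [hTe]
        exact mem_filter.mpr ⟨mem_biUnion.mpr ⟨u, hu, hx⟩, dvd_of_mem_primitiveFamily hx⟩
    _ = ∑ x ∈ T, F x * ∑ u ∈ U with x.1 ∣ W * configNat pr u,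
        4 ^ #u.supp * ((W * configNat pr u).totient : ℝ)⁻¹ := by
        simp_rw [sum_filter]
        rw [sum_comm]
        simp_rw [mul_sum, mul_ite, mul_zero]
    _ ≤ ∑ x ∈ T, F x * (√W / W.totient * (∏ j, (1 + 8 * k * (pr j : ℝ)⁻¹)) * (√x.1)⁻¹) :=
        sum_le_sum fun x hx ↦ mul_le_mul_of_nonneg_left
          (hpr.sum_dvd_le hW hD (hT.pos x hx) U) (hF x)
    _ = _ := by
        rw [mul_sum]
        exact sum_congr rfl fun x _ ↦ by ring

end CharacterSums

end

section

open Finset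

section States

variable {W R n k : ℕ} {pr : Fin n → ℕ} {h : Fin k → ℕ}

open Classical in
/-- For each prime, the position of a shift of `m` it divides, if there is one. -/
noncomputable def divState (pr : Fin n → ℕ) (h : Fin k → ℕ) (m : ℕ) : Config n k :=
  fun j ↦ if hj : ∃ i, pr j ∣ m + h i then some hj.choose else none

/-- No two of the shifts `h` are congruent modulo one of the primes. -/
def Separated (pr : Fin n → ℕ) (h : Fin k → ℕ) : Prop :=
  ∀ j i i', h i ≡ h i' [MOD pr j] → i = i'

theorem divState_eq_some_iff (hs : Separated pr h) {m : ℕ} {j : Fin n} {i : Fin k} :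
    divState pr h m j = some i ↔ pr j ∣ m + h i := by
  rw [divState]
  constructor
  · intro h1
    split_ifs at h1 with hj
    rw [← Option.some.inj h1]
    exact hj.choose_spec
  · intro h1
    have hj : ∃ i, pr j ∣ m + h i := ⟨i, h1⟩
    rw [dif_pos hj, Option.some_inj]
    refine hs j _ _ ?_
    have h2 : m + h hj.choose ≡ m + h i [MOD pr j] :=
      (Nat.modEq_zero_iff_dvd.mpr hj.choose_spec).trans (Nat.modEq_zero_iff_dvd.mpr h1).symm
    exact Nat.ModEq.add_left_cancel' m h2

theorem configInd_divState (hs : Separated pr h) (u : Config n k) (m : ℕ) :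
    configInd u (divState pr h m) = if ∀ j i, u j = some i → pr j ∣ m + h i then 1 else 0 := by
  simp_rw [configInd, locInd]
  rw [prod_boole]
  congr 1
  simp only [mem_univ, true_imp_iff, eq_iff_iff]
  refine forall_congr' fun j ↦ ?_
  cases hj : u j with
  | none => simp
  | some i =>
    simp only [reduceCtorEq, false_or, Option.some.injEq, forall_eq']
    rw [eq_comm, divState_eq_some_iff hs]

theorem PrimeEnum.modEq_configNat_iff (hpr : PrimeEnum W R pr) (u : Config n k) {a b : ℕ} :
    a ≡ b [MOD W * configNat pr u] ↔ a ≡ b [MOD W] ∧ ∀ j ∈ u.supp, a ≡ b [MOD pr j] := by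
  rw [← Nat.modEq_and_modEq_iff_modEq_mul (hpr.coprime_configNat u)]
  refine and_congr_right fun _ ↦ ⟨fun h1 j hj ↦ h1.of_dvd (dvd_prod_of_mem _ hj), fun h1 ↦ ?_⟩
  rw [Nat.modEq_iff_dvd, configNat, Nat.cast_prod]
  refine Finset.prod_dvd_of_coprime (fun i _ j _ hij ↦ ?_) fun j hj ↦ (h1 j hj).dvd
  exact Nat.isCoprime_iff_coprime.mpr
    ((Nat.coprime_primes (hpr.prime i) (hpr.prime j)).mpr fun h2 ↦ hij (hpr.inj h2))

theorem PrimeEnum.exists_residue (hpr : PrimeEnum W R pr) (b : ℕ)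
    (u : Config n k) : ∃ v, v ≡ b [MOD W] ∧ (∀ j i, u j = some i → pr j ∣ v + h i) ∧
      ∀ m, (m ≡ b [MOD W] ∧ ∀ j i, u j = some i → pr j ∣ m + h i) ↔
        m ≡ v [MOD W * configNat pr u] := by
  obtain ⟨z, hz⟩ := Nat.chineseRemainderOfFinset
    (fun j ↦ (pr j - 1) * (u j).elim 0 h) pr u.supp (fun j _ ↦ (hpr.prime j).ne_zero)
    fun i _ j _ hij ↦ (Nat.coprime_primes (hpr.prime i) (hpr.prime j)).mpr
      fun h2 ↦ hij (hpr.inj h2)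
  obtain ⟨v, hv1, hv2⟩ := Nat.chineseRemainder (hpr.coprime_configNat u) b z
  have hv3 : ∀ j i, u j = some i → pr j ∣ v + h i := by
    intro j i hj
    have h1 : j ∈ u.supp := by simp [Config.supp, hj]
    have h2 := (hv2.of_dvd (dvd_prod_of_mem _ h1)).trans (hz j h1)
    rw [hj] at h2
    have h3 : (pr j - 1) * h i + h i = pr j * h i := by
      rw [← Nat.succ_mul, Nat.succ_eq_add_one, Nat.sub_add_cancel (hpr.prime j).one_le]
    rw [← Nat.modEq_zero_iff_dvd]
    refine (h2.add_right (h i)).trans ?_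
    rw [Option.elim_some, h3]
    exact Nat.modEq_zero_iff_dvd.mpr (dvd_mul_right _ _)
  refine ⟨v, hv1, hv3, fun m ↦ ?_⟩
  rw [hpr.modEq_configNat_iff]
  refine and_congr ⟨fun h1 ↦ h1.trans hv1.symm, fun h1 ↦ h1.trans hv1⟩ ?_
  constructor
  · intro h1 j hj
    obtain ⟨i, hi⟩ := Option.ne_none_iff_exists'.mp (mem_filter.mp hj).2
    refine Nat.ModEq.add_right_cancel' (h i) ?_
    exact (Nat.modEq_zero_iff_dvd.mpr (h1 j i hi)).trans
      (Nat.modEq_zero_iff_dvd.mpr (hv3 j i hi)).symm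
  · intro h1 j i hi
    have h2 : j ∈ u.supp := by simp [Config.supp, hi]
    rw [← Nat.modEq_zero_iff_dvd]
    exact ((h1 j h2).add_right _).trans (Nat.modEq_zero_iff_dvd.mpr (hv3 j i hi))

theorem abs_card_modEq_sub_le {q : ℕ} (hq : 0 < q) (N v : ℕ) :
    |(#((range N).filter fun m ↦ m ≡ v [MOD q]) : ℝ) - N / q| ≤ 1 := by
  rw [← Nat.count_eq_card_filter_range, Nat.count_modEq_card _ hq]
  have h1 : (q : ℝ) * (N / q : ℕ) + (N % q : ℕ) = N := by exact_mod_cast Nat.div_add_mod N q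
  have h2 : ((N % q : ℕ) : ℝ) ≤ q := by exact_mod_cast (Nat.mod_lt N hq).le
  have h3 : (0 : ℝ) < q := by exact_mod_cast hq
  have h4 : (N : ℝ) / q = (N / q : ℕ) + (N % q : ℕ) / q := by
    rw [← h1]
    push_cast
    field_simp
  have h5 : ((N % q : ℕ) : ℝ) / q ≤ 1 := (div_le_one h3).mpr h2
  have h6 : 0 ≤ ((N % q : ℕ) : ℝ) / q := by positivity
  rw [h4, abs_le]
  push_cast
  split_ifs <;> constructor <;> push_cast <;> linarith

theorem sum_pow_card_supp_le (hpr : PrimeEnum W R pr) {S : ℝ} (hS : 0 ≤ S) :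
    ∑ u : Config n k with configNorm (fun j ↦ (pr j : ℝ)) u ≤ S, (4 : ℝ) ^ #u.supp ≤
      S * ∏ j, (1 + 4 * k * (pr j : ℝ)⁻¹) := by
  have hp : ∀ j, (0 : ℝ) < pr j := fun j ↦ by exact_mod_cast (hpr.prime j).pos
  have h0 : ∀ u : Config n k, (0 : ℝ) < (configNorm (fun j ↦ (pr j : ℝ)) u)⁻¹ := fun u ↦
    inv_pos.mpr (configNorm_pos hp u)
  calc ∑ u : Config n k with configNorm (fun j ↦ (pr j : ℝ)) u ≤ S, (4 : ℝ) ^ #u.supp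
      ≤ ∑ u : Config n k with configNorm (fun j ↦ (pr j : ℝ)) u ≤ S,
        S * (4 ^ #u.supp * (configNorm (fun j ↦ (pr j : ℝ)) u)⁻¹) := by
        refine sum_le_sum fun u hu ↦ ?_
        have h1 := (one_le_div (configNorm_pos hp u)).mpr (mem_filter.mp hu).2
        rw [div_eq_mul_inv] at h1
        calc (4 : ℝ) ^ #u.supp ≤ 4 ^ #u.supp *
              (S * (configNorm (fun j ↦ (pr j : ℝ)) u)⁻¹) :=
              le_mul_of_one_le_right (by positivity) h1
          _ = _ := by ring
    _ = S * ∑ u : Config n k with configNorm (fun j ↦ (pr j : ℝ)) u ≤ S,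
        (4 ^ #u.supp * (configNorm (fun j ↦ (pr j : ℝ)) u)⁻¹) := by rw [mul_sum]
    _ ≤ S * ∑ u : Config n k, (4 ^ #u.supp * (configNorm (fun j ↦ (pr j : ℝ)) u)⁻¹) := by
        refine mul_le_mul_of_nonneg_left (sum_le_sum_of_subset_of_nonneg (filter_subset _ _)
          fun u _ _ ↦ mul_nonneg (by positivity) (h0 u).le) hS
    _ = _ := by
        congr 1
        have h1 : ∀ u : Config n k, (4 : ℝ) ^ #u.supp * (configNorm (fun j ↦ (pr j : ℝ)) u)⁻¹ =
            ∏ j, if u j = none then 1 else 4 * (pr j : ℝ)⁻¹ := fun u ↦ by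
          rw [← configNat_cast, configNat, Nat.cast_prod, ← prod_const, ← prod_inv_distrib,
            ← prod_mul_distrib, Config.supp, prod_filter]
          exact prod_congr rfl fun j _ ↦ by by_cases h : u j = none <;> simp [h]
        simp_rw [h1]
        have h2 := prod_univ_sum (fun _ : Fin n ↦ (univ : Finset (Option (Fin k))))
          fun j a ↦ if a = none then (1 : ℝ) else 4 * (pr j : ℝ)⁻¹
        rw [Fintype.piFinset_univ] at h2
        rw [← h2]
        refine prod_congr rfl fun j _ ↦ ?_
        rw [Fintype.sum_option]
        simp
        ring

theorem PrimeEnum.sum_modEq_mul_sieveSum_sq_le (hpr : PrimeEnum W R pr) (hW : 0 < W)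
    (hs : Separated pr h) (hk : ∀ j, k ≤ pr j) {y : Config n k → ℝ} {F S : ℝ} (hS : 0 ≤ S)
    (hF : 0 ≤ F) (hy : ∀ r, |y r| ≤ F * (configNorm (fun j ↦ (pr j : ℝ)) r)⁻¹)
    (hy' : ∀ r, S < configNorm (fun j ↦ (pr j : ℝ)) r → y r = 0) (b N : ℕ) :
    ∑ m ∈ range N, (if m ≡ b [MOD W] then 1 else 0) *
      sieveSum (fun j ↦ (pr j : ℝ)) y (divState pr h m) ^ 2 ≤
    N / W * ((∏ j, (1 + k / (pr j : ℝ) ^ 2)) *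
      ∑ c, configNorm (fun j ↦ (pr j : ℝ)) c * y c ^ 2) +
    (F * ∏ j, (1 + k / (pr j : ℝ))) ^ 2 * (S * S * ∏ j, (1 + 4 * k * (pr j : ℝ)⁻¹)) := by
  have hp : ∀ j, (2 : ℝ) ≤ pr j := fun j ↦ by exact_mod_cast (hpr.prime j).two_le
  have hp0 : ∀ j, (pr j : ℝ) ≠ 0 := fun j ↦ by linarith [hp j]
  have h1 := abs_sum_mul_sieveSum_sq_sub_le_of_join hp hS hF hy hy' (range N)
    (fun m ↦ if m ≡ b [MOD W] then 1 else 0) (divState pr h) (fun j ↦ locProb (pr j)) (N / W)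
    (fun _ ↦ 1) (fun _ ↦ zero_le_one) fun u _ ↦ ?_
  · simp_rw [mul_one] at h1
    have h2 := (abs_le.mp h1).2
    have h3 := mul_le_mul_of_nonneg_left (sum_prob_mul_sieveSum_sq_le (k := k) hp
      (fun j ↦ by exact_mod_cast hk j) y) (by positivity : (0 : ℝ) ≤ N / W)
    have h4 := mul_le_mul_of_nonneg_left (sum_pow_card_supp_le (k := k) hpr (mul_nonneg hS hS))
      (sq_nonneg (F * ∏ j, (1 + k / (pr j : ℝ))))
    linarith
  · obtain ⟨v, -, -, hv⟩ := hpr.exists_residue (h := h) b u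
    have h2 : ∑ m ∈ range N, (if m ≡ b [MOD W] then (1 : ℝ) else 0) *
        configInd u (divState pr h m) =
        #((range N).filter fun m ↦ m ≡ v [MOD W * configNat pr u]) := by
      rw [card_filter, Nat.cast_sum]
      refine sum_congr rfl fun m _ ↦ ?_
      rw [configInd_divState hs]
      have h3 := hv m
      by_cases h4 : m ≡ b [MOD W] <;>
        by_cases h5 : ∀ j i, u j = some i → pr j ∣ m + h i <;> simp_all
    have h3 : (N / W : ℝ) * ∏ j, ∑ c, locProb (pr j : ℝ) c * locInd (u j) c =
        N / ((W * configNat pr u : ℕ) : ℝ) := by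
      simp_rw [sum_locProb_mul_locInd (hp0 _)]
      rw [prod_inv_distrib, Nat.cast_mul, configNat_cast, configNorm]
      field_simp
    rw [h2, h3]
    exact abs_card_modEq_sub_le (Nat.mul_pos hW (hpr.configNat_pos u)) N v

end States

end

section

open Finset

section Progressions

/-- The weight of a prime in the smoothed prime counting sums. -/
noncomputable def primeWeight (ψ : ℝ → ℝ) (X : ℝ) (p : ℕ) : ℝ :=
  Real.log p * ψ (Real.log p - Real.log X)

/-- The primes in the window of summation. -/
noncomputable def windowPrimes (κ X : ℝ) : Finset ℕ :=
  (Ico 1 (windowEnd κ X)).filter Nat.Prime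

variable {ψ : ℝ → ℝ} {κ X : ℝ}

theorem primeSum_ofReal (f : ℕ → ℂ) : primeSum (fun u ↦ (ψ u : ℂ)) κ X f =
    ∑ p ∈ windowPrimes κ X, f p * (primeWeight ψ X p : ℂ) := by
  rw [primeSum, windowPrimes]
  refine sum_congr rfl fun p _ ↦ ?_
  rw [primeWeight]
  push_cast
  ring

theorem primeWeight_eq_zero (hψ : ∀ u ≤ 0, ψ u = 0) {p : ℕ} (hp : 0 < p) (h : (p : ℝ) ≤ X) :
    primeWeight ψ X p = 0 := by
  rw [primeWeight, hψ, mul_zero]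
  exact sub_nonpos.mpr (Real.log_le_log (by exact_mod_cast hp) h)

theorem sum_char_mul_primeWeight_eq (hψ : ∀ u ≤ 0, ψ u = 0) {N : ℕ} (hN : 0 < N)
    (hNX : (N : ℝ) ≤ X) {f g : ℕ → ℂ} (hfg : ∀ p : ℕ, p.Coprime N → f p = g p) :
    ∑ p ∈ windowPrimes κ X, f p * (primeWeight ψ X p : ℂ) =
      ∑ p ∈ windowPrimes κ X, g p * (primeWeight ψ X p : ℂ) := by
  refine sum_congr rfl fun p hp ↦ ?_
  have hpp := (mem_filter.mp hp).2
  by_cases h : (p : ℝ) ≤ X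
  · rw [primeWeight_eq_zero hψ hpp.pos h, Complex.ofReal_zero, mul_zero, mul_zero]
  · rw [hfg p (hpp.coprime_iff_not_dvd.mpr fun h1 ↦ h ?_)]
    exact (by exact_mod_cast Nat.le_of_dvd hN h1 : (p : ℝ) ≤ N).trans hNX

theorem abs_sum_modEq_primeWeight_sub_le (hψ : ∀ u ≤ 0, ψ u = 0) {N : ℕ} (hN : 0 < N)
    (hNX : (N : ℝ) ≤ X) {v : ℕ} (hv : v.Coprime N) :
    |∑ p ∈ windowPrimes κ X, (if p ≡ v [MOD N] then primeWeight ψ X p else 0) -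
      (N.totient : ℝ)⁻¹ * ∑ p ∈ windowPrimes κ X, primeWeight ψ X p| ≤
    (N.totient : ℝ)⁻¹ *
      ∑ x ∈ primitiveFamily N, ‖primeSum (fun u ↦ (ψ u : ℂ)) κ X x.ev‖ := by
  classical
  have : NeZero N := ⟨hN.ne'⟩
  have hφ : (N.totient : ℂ) ≠ 0 := by exact_mod_cast (Nat.totient_pos.mpr hN).ne'
  obtain ⟨S, hS⟩ : ∃ S : DirichletCharacter ℂ N → ℂ, ∀ χ, S χ =
    ∑ p ∈ windowPrimes κ X, χ (p : ZMod N) * (primeWeight ψ X p : ℂ) := ⟨_, fun _ ↦ rfl⟩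
  have h1 : (N.totient : ℂ) * ∑ p ∈ windowPrimes κ X,
      ((if p ≡ v [MOD N] then primeWeight ψ X p else 0 : ℝ) : ℂ) =
      ∑ χ : DirichletCharacter ℂ N, χ (v : ZMod N)⁻¹ * S χ := by
    simp_rw [hS, mul_sum]
    rw [sum_comm]
    refine sum_congr rfl fun p _ ↦ ?_
    simp_rw [← mul_assoc]
    rw [← sum_mul,
      DirichletCharacter.sum_char_inv_mul_char_eq ℂ ((ZMod.isUnit_iff_coprime v N).mpr hv)]
    simp only [ZMod.natCast_eq_natCast_iff]
    by_cases h : p ≡ v [MOD N]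
    · rw [if_pos h, if_pos h.symm]
    · rw [if_neg h, if_neg fun h2 ↦ h h2.symm, Complex.ofReal_zero, mul_zero, zero_mul]
  have h2 : S 1 = ∑ p ∈ windowPrimes κ X, (primeWeight ψ X p : ℂ) := by
    rw [hS, sum_char_mul_primeWeight_eq hψ hN hNX (f := fun p ↦ (1 : DirichletCharacter ℂ N) p)
      (g := fun _ ↦ 1) fun p hp ↦ MulChar.one_apply ((ZMod.isUnit_iff_coprime p N).mpr hp)]
    simp_rw [one_mul]
  have h3 : ∀ χ : DirichletCharacter ℂ N, S χ = primeSum (fun u ↦ (ψ u : ℂ)) κ X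
      (DChar.ev ⟨χ.conductor, χ.primitiveCharacter⟩) := fun χ ↦ by
    rw [hS, primeSum_ofReal]
    refine sum_char_mul_primeWeight_eq hψ hN hNX (f := fun p ↦ χ p) fun p hp ↦ ?_
    have := χ.primitiveCharacter_apply_of_isCoprime (a := (p : ℤ))
      (Nat.isCoprime_iff_coprime.mpr hp)
    rw [DChar.ev]
    exact_mod_cast this.symm
  have h5 : ((∑ p ∈ windowPrimes κ X, (if p ≡ v [MOD N] then primeWeight ψ X p else 0) -
      (N.totient : ℝ)⁻¹ * ∑ p ∈ windowPrimes κ X, primeWeight ψ X p : ℝ) : ℂ) =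
      (N.totient : ℂ)⁻¹ * ∑ χ : DirichletCharacter ℂ N with χ ≠ 1, χ (v : ZMod N)⁻¹ * S χ := by
    have h6 : (1 : DirichletCharacter ℂ N) (v : ZMod N)⁻¹ = 1 := by
      refine MulChar.one_apply ?_
      have h7 := (ZMod.isUnit_iff_coprime v N).mpr hv
      obtain ⟨w, hw⟩ := h7
      rw [← hw, ZMod.inv_coe_unit]
      exact w⁻¹.isUnit
    rw [← sum_filter_add_sum_filter_not univ fun χ : DirichletCharacter ℂ N ↦ χ ≠ 1] at h1
    simp only [not_not, filter_eq', mem_univ, if_true, sum_singleton] at h1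
    rw [h6, one_mul, h2] at h1
    rw [eq_inv_mul_iff_mul_eq₀ hφ, ← sub_eq_iff_eq_add.mpr h1]
    push_cast
    field_simp
  rw [← Real.norm_eq_abs, ← Complex.norm_real, h5, norm_mul, norm_inv, Complex.norm_natCast]
  refine mul_le_mul_of_nonneg_left ?_ (by positivity)
  rw [← sum_primitiveFamily]
  refine (norm_sum_le _ _).trans (sum_le_sum fun χ _ ↦ ?_)
  rw [norm_mul, ← h3]
  exact mul_le_of_le_one_left (norm_nonneg _) (χ.norm_le_one _)

variable {W R n k : ℕ} {pr : Fin n → ℕ} {h : Fin k → ℕ}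

theorem PrimeEnum.abs_sum_primeWeight_mul_configInd_sub_le (hpr : PrimeEnum W R pr) (hW : 0 < W)
    (hs : Separated pr h) (hψ : ∀ u ≤ 0, ψ u = 0) (l : Fin k) {b : ℕ}
    (hb : (b + h l).Coprime W) (hRX : (R : ℝ) ≤ X) (hhX : (h l : ℝ) ≤ X) {u : Config n k}
    (hu : ((W * configNat pr u : ℕ) : ℝ) ≤ X) :
    |∑ p ∈ windowPrimes κ X, (if p ≡ b + h l [MOD W] then primeWeight ψ X p else 0) *
        configInd u (divState pr h (p - h l)) -
      (∑ p ∈ windowPrimes κ X, primeWeight ψ X p) / W.totient *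
        ∏ j, ∑ c, locProb' l (pr j : ℝ) c * locInd (u j) c| ≤
    ((W * configNat pr u).totient : ℝ)⁻¹ * ∑ x ∈ primitiveFamily (W * configNat pr u),
      ‖primeSum (fun u ↦ (ψ u : ℂ)) κ X x.ev‖ := by
  obtain ⟨v, hv1, hv2, hv⟩ := hpr.exists_residue (h := h) b u
  have hpos := Nat.mul_pos hW (hpr.configNat_pos u)
  by_cases hl : ∃ j, u j = some l
  · obtain ⟨j, hj⟩ := hl
    rw [prod_eq_zero (mem_univ j) (by rw [hj, sum_locProb'_mul_locInd_some, if_pos rfl]),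
      mul_zero, sub_zero, sum_eq_zero, abs_zero]
    · positivity
    · intro p hp
      have hpp := (mem_filter.mp hp).2
      by_cases h1 : (p : ℝ) ≤ X
      · rw [primeWeight_eq_zero hψ hpp.pos h1, ite_self, zero_mul]
      · rw [configInd_divState hs]
        refine mul_eq_zero_of_right _ (if_neg fun h2 ↦ ?_)
        have h3 := h2 j l hj
        have h4 : h l ≤ p := by
          have : (h l : ℝ) ≤ p := by linarith
          exact_mod_cast this
        rw [Nat.sub_add_cancel h4, Nat.prime_dvd_prime_iff_eq (hpr.prime j) hpp] at h3
        have h5 : (p : ℝ) ≤ R := by exact_mod_cast h3 ▸ hpr.le j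
        linarith
  · push Not at hl
    have h1 : (v + h l).Coprime (W * configNat pr u) := by
      refine Nat.Coprime.mul_right ?_ (Nat.Coprime.prod_right fun j hj ↦ ?_)
      · rw [Nat.Coprime, ((hv1.add_right (h l)).gcd_eq)]
        exact hb
      · refine (((hpr.prime j).coprime_iff_not_dvd).mpr fun h2 ↦ ?_).symm
        obtain ⟨i, hi⟩ := Option.ne_none_iff_exists'.mp (mem_filter.mp hj).2
        have h3 := (Nat.modEq_zero_iff_dvd.mpr h2).trans (Nat.modEq_zero_iff_dvd.mpr
          (hv2 j i hi)).symm
        rw [hs j l i (Nat.ModEq.add_left_cancel' v h3)] at hl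
        exact hl j hi
    have h2 : ∑ p ∈ windowPrimes κ X, (if p ≡ b + h l [MOD W] then primeWeight ψ X p else 0) *
        configInd u (divState pr h (p - h l)) = ∑ p ∈ windowPrimes κ X,
        (if p ≡ v + h l [MOD W * configNat pr u] then primeWeight ψ X p else 0) := by
      refine sum_congr rfl fun p hp ↦ ?_
      have hpp := (mem_filter.mp hp).2
      by_cases h1 : (p : ℝ) ≤ X
      · simp_rw [primeWeight_eq_zero hψ hpp.pos h1, ite_self, zero_mul]
      · have h4 : h l ≤ p := by
          have : (h l : ℝ) ≤ p := by linarith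
          exact_mod_cast this
        obtain ⟨m, rfl⟩ := Nat.exists_eq_add_of_le' h4
        rw [configInd_divState hs, Nat.add_sub_cancel]
        have h5 := hv m
        have h6 : ∀ a N, m + h l ≡ a + h l [MOD N] ↔ m ≡ a [MOD N] := fun a N ↦
          ⟨Nat.ModEq.add_right_cancel' _, fun h ↦ h.add_right _⟩
        simp_rw [h6, ← h5, ite_and, mul_ite, mul_one, mul_zero]
        by_cases h7 : m ≡ b [MOD W] <;> simp [h7]
    have h3 : (∑ p ∈ windowPrimes κ X, primeWeight ψ X p) / W.totient *
        ∏ j, ∑ c, locProb' l (pr j : ℝ) c * locInd (u j) c =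
        ((W * configNat pr u).totient : ℝ)⁻¹ * ∑ p ∈ windowPrimes κ X, primeWeight ψ X p := by
      rw [Nat.totient_mul (hpr.coprime_configNat u), hpr.totient_configNat, Nat.cast_mul, mul_inv,
        Nat.cast_prod, ← prod_inv_distrib, Config.supp, prod_filter, div_eq_inv_mul,
        mul_right_comm]
      congr 2
      refine prod_congr rfl fun j _ ↦ ?_
      cases hj : u j with
      | none =>
        rw [sum_locProb'_mul_locInd_none]
        simp
      | some i =>
        rw [sum_locProb'_mul_locInd_some, if_neg fun h7 ↦ hl j (by rw [hj, h7]), if_pos (by simp),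
          Nat.cast_sub (hpr.prime j).one_le, one_div, Nat.cast_one]
    rw [h2, h3]
    exact abs_sum_modEq_primeWeight_sub_le hψ hpos hu h1

theorem PrimeEnum.le_sum_primeWeight_mul_sieveSum_sq (hpr : PrimeEnum W R pr) (hW : 0 < W)
    (hs : Separated pr h) (hk : ∀ j, k ≤ pr j) (hψ : ∀ u ≤ 0, ψ u = 0) (hψ0 : ∀ u, 0 ≤ ψ u)
    (l : Fin k) {b : ℕ} (hb : (b + h l).Coprime W) (hRX : (R : ℝ) ≤ X) (hhX : (h l : ℝ) ≤ X)
    {y : Config n k → ℝ} {F S : ℝ} (hS : 0 ≤ S) (hSX : W * (S * S) ≤ X)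
    (hF : 0 ≤ F) (hy : ∀ r, |y r| ≤ F * (configNorm (fun j ↦ (pr j : ℝ)) r)⁻¹)
    (hy' : ∀ r, S < configNorm (fun j ↦ (pr j : ℝ)) r → y r = 0) :
    (∑ p ∈ windowPrimes κ X, primeWeight ψ X p) / W.totient *
      ∑ c, primeTerm (fun j ↦ (pr j : ℝ)) l y c ≤
    ∑ p ∈ windowPrimes κ X, (if p ≡ b + h l [MOD W] then primeWeight ψ X p else 0) *
      sieveSum (fun j ↦ (pr j : ℝ)) y (divState pr h (p - h l)) ^ 2 +
    (F * ∏ j, (1 + k / (pr j : ℝ))) ^ 2 *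
      ∑ u : Config n k with configNorm (fun j ↦ (pr j : ℝ)) u ≤ S * S, 4 ^ #u.supp *
        (((W * configNat pr u).totient : ℝ)⁻¹ * ∑ x ∈ primitiveFamily (W * configNat pr u),
          ‖primeSum (fun u ↦ (ψ u : ℂ)) κ X x.ev‖) := by
  have hp : ∀ j, (2 : ℝ) ≤ pr j := fun j ↦ by exact_mod_cast (hpr.prime j).two_le
  have h1 := abs_sum_mul_sieveSum_sq_sub_le_of_join hp hS hF hy hy' (windowPrimes κ X)
    (fun p ↦ if p ≡ b + h l [MOD W] then primeWeight ψ X p else 0)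
    (fun p ↦ divState pr h (p - h l)) (fun j ↦ locProb' l (pr j))
    ((∑ p ∈ windowPrimes κ X, primeWeight ψ X p) / W.totient)
    (fun u ↦ ((W * configNat pr u).totient : ℝ)⁻¹ *
      ∑ x ∈ primitiveFamily (W * configNat pr u),
        ‖primeSum (fun u ↦ (ψ u : ℂ)) κ X x.ev‖) (fun u ↦ by positivity) fun u hu ↦
    hpr.abs_sum_primeWeight_mul_configInd_sub_le hW hs hψ l hb hRX hhX ?_
  · have h2 : 0 ≤ (∑ p ∈ windowPrimes κ X, primeWeight ψ X p) / W.totient :=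
      div_nonneg (sum_nonneg fun p _ ↦ mul_nonneg (Real.log_natCast_nonneg p) (hψ0 _))
        (Nat.cast_nonneg _)
    have h4 := (abs_le.mp h1).1
    have h5 := mul_le_mul_of_nonneg_left (le_sum_prob'_mul_sieveSum_sq l hp
      (fun j ↦ by exact_mod_cast hk j) y) h2
    simp only [primeTerm]
    linarith
  · rw [Nat.cast_mul, configNat_cast]
    exact (mul_le_mul_of_nonneg_left hu (Nat.cast_nonneg _)).trans hSX

end Progressions

end

section

open Finset

open scoped ContDiff

section Weight

theorem half_le_theta {Y : ℝ} (hY : 200 ^ 4 ≤ Y) : Y / 2 ≤ Chebyshev.theta Y := by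
  obtain ⟨s, hs⟩ : ∃ s, s = √(√Y) := ⟨_, rfl⟩
  have hY0 : 0 ≤ Y := le_trans (by norm_num) hY
  have h2 : s ^ 2 = √Y := by rw [hs, Real.sq_sqrt (Real.sqrt_nonneg _)]
  have h4 : s ^ 4 = Y := by
    rw [show s ^ 4 = (s ^ 2) ^ 2 by ring, h2, Real.sq_sqrt hY0]
  have hs0 : 0 ≤ s := hs ▸ Real.sqrt_nonneg _
  have hs1 : 200 ≤ s := le_of_pow_le_pow_left₀ (n := 4) (by norm_num) hs0 (by rw [h4]; exact hY)
  have hlog : Real.log Y ≤ 4 * s := by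
    rw [← h4, Real.log_pow]
    have := Real.log_le_sub_one_of_pos (by linarith : 0 < s)
    push_cast
    linarith
  have hlog' : Real.log (Y + 2) ≤ 8 * s := by
    have h5 : Real.log (Y + 2) ≤ Real.log (Y ^ 2) :=
      Real.log_le_log (by linarith) (by nlinarith)
    rw [Real.log_pow] at h5
    push_cast at h5
    linarith
  have h6 := Chebyshev.theta_ge' (x := Y) (le_trans (by norm_num) hY)
  have h7 := mul_le_mul_of_nonneg_left hlog (by positivity : 0 ≤ 2 * √Y)
  rw [← h2] at h6 h7
  have h8 := mul_le_mul_of_nonneg_left Real.log_two_gt_d9.le (by linarith : 0 ≤ Y - 1)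
  have h9 : 8 * s ^ 3 ≤ Y / 25 := by
    rw [← h4]
    have := mul_le_mul_of_nonneg_left hs1 (pow_nonneg hs0 3)
    nlinarith
  have h10 : 8 * s ≤ s ^ 3 := by nlinarith
  nlinarith

theorem exists_weight : ∃ ψ : ℝ → ℝ, ContDiff ℝ ∞ (fun u ↦ (ψ u : ℂ)) ∧
    HasCompactSupport (fun u ↦ (ψ u : ℂ)) ∧ (∃ P, IsWeight (fun u ↦ (ψ u : ℂ)) P 4) ∧
    (∀ u ≤ 0, ψ u = 0) ∧ (∀ u, 0 ≤ ψ u) ∧ (∀ u, ψ u ≤ 1) ∧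
    ∃ X₀, ∀ X ≥ X₀, X ≤ ∑ p ∈ windowPrimes 4 X, primeWeight ψ X p := by
  obtain ⟨ψ, hψ⟩ : ∃ ψ : ℝ → ℝ, ∀ u, ψ u =
    Real.smoothTransition u * Real.smoothTransition (4 - u) := ⟨_, fun _ ↦ rfl⟩
  have h0 : ∀ u, 0 ≤ ψ u := fun u ↦ by
    rw [hψ]
    exact mul_nonneg (Real.smoothTransition.nonneg _) (Real.smoothTransition.nonneg _)
  have h1 : ∀ u, ψ u ≤ 1 := fun u ↦ by
    rw [hψ]
    exact mul_le_one₀ (Real.smoothTransition.le_one _) (Real.smoothTransition.nonneg _)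
      (Real.smoothTransition.le_one _)
  have hl : ∀ u ≤ 0, ψ u = 0 := fun u hu ↦ by
    rw [hψ, Real.smoothTransition.zero_of_nonpos hu, zero_mul]
  have hr : ∀ u, 4 ≤ u → ψ u = 0 := fun u hu ↦ by
    rw [hψ, Real.smoothTransition.zero_of_nonpos (by linarith : 4 - u ≤ 0), mul_zero]
  have hm : ∀ u, 1 ≤ u → u ≤ 3 → ψ u = 1 := fun u hu hu' ↦ by
    rw [hψ, Real.smoothTransition.one_of_one_le hu, Real.smoothTransition.one_of_one_le
      (by linarith), mul_one]
  have hc' : ContDiff ℝ ∞ ψ := by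
    rw [funext hψ]
    exact Real.smoothTransition.contDiff.mul
      (Real.smoothTransition.contDiff.comp (contDiff_const.sub contDiff_id))
  have hc : ContDiff ℝ ∞ (fun u ↦ (ψ u : ℂ)) := Complex.ofRealCLM.contDiff.comp hc'
  have hcs : HasCompactSupport (fun u ↦ (ψ u : ℂ)) := by
    refine HasCompactSupport.intro (isCompact_Icc (a := (0 : ℝ)) (b := 4)) fun u hu ↦ ?_
    rw [Set.mem_Icc, not_and_or, not_le, not_le] at hu
    rcases hu with hu | hu
    · rw [hl u hu.le, Complex.ofReal_zero]
    · rw [hr u hu.le, Complex.ofReal_zero]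
  refine ⟨ψ, hc, hcs, ?_, hl, h0, h1, 200 ^ 4, fun X hX ↦ ?_⟩
  · obtain ⟨C, hC⟩ := hc.lipschitzWith_of_hasCompactSupport hcs (by simp)
    refine ⟨max 1 C, by norm_num, fun u ↦ ?_, fun u v ↦ ?_, fun u hu ↦ by simp [hl u hu],
      fun u hu ↦ by simp [hr u hu]⟩
    · rw [Complex.norm_real, Real.norm_of_nonneg (h0 u)]
      exact (h1 u).trans (le_max_left _ _)
    · have := hC.dist_le_mul u v
      rw [dist_eq_norm, Real.dist_eq] at this
      exact this.trans (mul_le_mul_of_nonneg_right (le_max_right _ _) (abs_nonneg _))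
  · have hX0 : 0 < X := lt_of_lt_of_le (by norm_num) hX
    have he1 := Real.exp_one_lt_d9
    have he2 := Real.exp_one_gt_d9
    have he3 : (20 : ℝ) ≤ Real.exp 3 := by
      have : Real.exp 3 = Real.exp 1 ^ 3 := by rw [← Real.exp_nat_mul]; norm_num
      rw [this]
      calc (20 : ℝ) ≤ 2.7182818283 ^ 3 := by norm_num
        _ ≤ _ := by gcongr
    have h2 := half_le_theta (Y := Real.exp 3 * X) (by nlinarith)
    have h3 := Chebyshev.theta_le_log4_mul_x (x := Real.exp 1 * X) (by positivity)
    have h4 : Real.log 4 ≤ 1.4 := by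
      rw [show (4 : ℝ) = 2 ^ 2 by norm_num, Real.log_pow]
      have := Real.log_two_lt_d9
      push_cast
      linarith
    have h5 : Real.log 4 * (Real.exp 1 * X) ≤ 1.4 * (2.72 * X) := by
      gcongr
      linarith
    have h6 : Chebyshev.theta (Real.exp 3 * X) - Chebyshev.theta (Real.exp 1 * X) =
        ∑ p ∈ Ioc ⌊Real.exp 1 * X⌋₊ ⌊Real.exp 3 * X⌋₊ with Nat.Prime p, Real.log p := by
      rw [Chebyshev.theta, Chebyshev.theta, sub_eq_iff_eq_add', ← sum_union]
      · rw [← filter_union, Ioc_union_Ioc_eq_Ioc (Nat.zero_le _)]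
        refine Nat.floor_le_floor ?_
        gcongr
        norm_num
      · exact disjoint_filter_filter (Ioc_disjoint_Ioc_of_le le_rfl)
    have h7 : ∑ p ∈ Ioc ⌊Real.exp 1 * X⌋₊ ⌊Real.exp 3 * X⌋₊ with Nat.Prime p, Real.log p ≤
        ∑ p ∈ windowPrimes 4 X, primeWeight ψ X p := by
      calc _ = ∑ p ∈ Ioc ⌊Real.exp 1 * X⌋₊ ⌊Real.exp 3 * X⌋₊ with Nat.Prime p,
            primeWeight ψ X p := by
            refine sum_congr rfl fun p hp ↦ ?_
            rw [mem_filter, mem_Ioc, Nat.floor_lt (by positivity), Nat.le_floor_iff (by positivity)]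
              at hp
            have hp0 : (0 : ℝ) < p := by exact_mod_cast hp.2.pos
            have h8 := Real.log_le_log (by positivity) hp.1.1.le
            have h9 := Real.log_le_log hp0 hp.1.2
            rw [Real.log_mul (Real.exp_ne_zero _) hX0.ne', Real.log_exp] at h8 h9
            rw [primeWeight, hm _ (by linarith) (by linarith), mul_one]
        _ ≤ _ := by
            refine sum_le_sum_of_subset_of_nonneg (filter_subset_filter _ fun p hp ↦ ?_)
              fun p _ _ ↦ mul_nonneg (Real.log_natCast_nonneg p) (h0 _)
            rw [mem_Ioc] at hp
            rw [mem_Ico, windowEnd]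
            refine ⟨by omega, Nat.lt_succ_of_le (hp.2.trans (Nat.floor_le_floor ?_))⟩
            gcongr
            norm_num
    nlinarith

end Weight

end

section

open Finset

section Assembly

variable {n k W R : ℕ} {pr : Fin n → ℕ} {h : Fin k → ℕ} {g : Finset (Fin n) → ℝ}

theorem abs_sieveParam_le {P : Fin n → ℝ} (hP : ∀ j, 0 < P j) (hg : ∀ t, 0 ≤ g t)
    (hg2 : ∀ t, g t ≤ 2) (R : ℝ) (r : Config n k) :
    |sieveParam P g R r| ≤ 2 ^ k * (configNorm P r)⁻¹ := by
  have h1 := inv_pos.mpr (configNorm_pos hP r)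
  rw [abs_of_nonneg (sieveParam_nonneg hP hg r), sieveParam]
  split_ifs
  · rw [mul_comm]
    refine mul_le_mul_of_nonneg_right ?_ h1.le
    refine (prod_le_prod (fun i _ ↦ hg _) fun i _ ↦ hg2 _).trans_eq ?_
    simp
  · positivity

theorem PrimeEnum.prod_one_add_div_sq_le (hpr : PrimeEnum W R pr) (hk : 0 < k)
    (hD : ∀ j, 64 * k ^ 2 < pr j) : ∏ j, (1 + k / (pr j : ℝ) ^ 2) ≤ 3 := by
  have hk1 : (1 : ℝ) ≤ k := by exact_mod_cast hk
  have h1 := hpr.sum_inv_sq_le hD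
  push_cast at h1
  have h2 : k * (2 / (64 * (k : ℝ) ^ 2 + 1)) ≤ 1 := by
    rw [mul_div_assoc', div_le_one (by positivity)]
    nlinarith
  calc ∏ j, (1 + k / (pr j : ℝ) ^ 2) ≤ ∏ j, Real.exp (k / (pr j : ℝ) ^ 2) :=
        prod_le_prod (fun _ _ ↦ by positivity) fun j _ ↦ by
          rw [add_comm]; exact Real.add_one_le_exp _
    _ = Real.exp (k * ∑ j, (pr j : ℝ)⁻¹ ^ 2) := by
        rw [← Real.exp_sum, mul_sum]
        simp_rw [inv_pow, div_eq_mul_inv]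
    _ ≤ Real.exp 1 := Real.exp_le_exp.mpr
        ((mul_le_mul_of_nonneg_left h1 (Nat.cast_nonneg k)).trans h2)
    _ ≤ 3 := by linarith [Real.exp_one_lt_d9]

theorem PrimeEnum.sum_modEq_mul_sieveParam_sq_le (hpr : PrimeEnum W R pr) (hW : 0 < W)
    (hs : Separated pr h) (hk : 0 < k) (hD : ∀ j, 64 * k ^ 2 < pr j) (hg : ∀ t, 0 ≤ g t)
    (hg2 : ∀ t, g t ≤ 2) (b N : ℕ) :
    ∑ m ∈ range N, (if m ≡ b [MOD W] then 1 else 0) *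
      sieveSum (fun j ↦ (pr j : ℝ)) (sieveParam (fun j ↦ (pr j : ℝ)) g R) (divState pr h m) ^ 2 ≤
    N / W * (3 * (∑ t, g t ^ 2 * (setNorm (fun j ↦ (pr j : ℝ)) t)⁻¹) ^ k) +
    4 ^ k * (∏ j, (1 + 8 * k * (pr j : ℝ)⁻¹)) ^ 3 * R ^ 2 := by
  have hp : ∀ j, (0 : ℝ) < pr j := fun j ↦ by exact_mod_cast (hpr.prime j).pos
  have hkp : ∀ j, k ≤ pr j := fun j ↦ by nlinarith [hD j]
  have h1 := hpr.sum_modEq_mul_sieveSum_sq_le hW hs hkp (S := R) (Nat.cast_nonneg R)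
    (show (0 : ℝ) ≤ 2 ^ k by positivity) (abs_sieveParam_le hp hg hg2 R)
    (fun r hr ↦ if_neg (not_le.mpr hr)) b N
  refine h1.trans (add_le_add ?_ ?_)
  · refine mul_le_mul_of_nonneg_left (mul_le_mul (hpr.prod_one_add_div_sq_le hk hD)
      (sum_configNorm_mul_sieveParam_sq_le hp g R) ?_ (by norm_num)) (by positivity)
    exact sum_nonneg fun c _ ↦ mul_nonneg (configNorm_pos hp c).le (sq_nonneg _)
  · have h2 : ∏ j, (1 + k / (pr j : ℝ)) ≤ ∏ j, (1 + 8 * k * (pr j : ℝ)⁻¹) :=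
      prod_le_prod (fun j _ ↦ by positivity) fun j _ ↦ by
        rw [div_eq_mul_inv]; gcongr; linarith [Nat.cast_nonneg (α := ℝ) k]
    have h3 : ∏ j, (1 + 4 * k * (pr j : ℝ)⁻¹) ≤ ∏ j, (1 + 8 * k * (pr j : ℝ)⁻¹) :=
      prod_le_prod (fun j _ ↦ by positivity) fun j _ ↦ by gcongr; norm_num
    have h4 : (4 : ℝ) ^ k = (2 ^ k) ^ 2 := by rw [← pow_mul, mul_comm, pow_mul]; norm_num
    calc _ ≤ (2 ^ k * ∏ j, (1 + 8 * k * (pr j : ℝ)⁻¹)) ^ 2 *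
          ((R : ℝ) * R * ∏ j, (1 + 8 * k * (pr j : ℝ)⁻¹)) := by gcongr
      _ = _ := by rw [h4]; ring

theorem PrimeEnum.exists_family_le_sum_primeWeight (hpr : PrimeEnum W R pr) (hW : 0 < W)
    (hs : Separated pr h) (hk : 0 < k) (hD : ∀ j, 64 * k ^ 2 < pr j) (hg : ∀ t, 0 ≤ g t)
    (hg2 : ∀ t, g t ≤ 2) (hg' : ∀ s t, s ⊆ t → g t ≤ g s)
    (hgS : ∀ t, √R < setNorm (fun j ↦ (pr j : ℝ)) t → g t = 0) (hR : 1 < R) {μ : ℝ} (hμ : 0 ≤ μ)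
    (hμS : 4 * k * μ ≤ Real.log √R)
    (hgμ : ∑ t, g t ^ 2 * (setNorm (fun j ↦ (pr j : ℝ)) t)⁻¹ *
      Real.log (setNorm (fun j ↦ (pr j : ℝ)) t) ≤
      μ * ∑ t, g t ^ 2 * (setNorm (fun j ↦ (pr j : ℝ)) t)⁻¹)
    {ψ : ℝ → ℝ} {κ X : ℝ} (hψ : ∀ u ≤ 0, ψ u = 0) (hψ0 : ∀ u, 0 ≤ ψ u)
    {b : ℕ} (hb : ∀ l, (b + h l).Coprime W) (hRX : (R : ℝ) ≤ X) (hhX : ∀ l, (h l : ℝ) ≤ X)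
    (hWX : (W * R ^ 2 : ℝ) ≤ X) (hX : X ≤ ∑ p ∈ windowPrimes κ X, primeWeight ψ X p) :
    ∃ T, DChar.Family (W * R ^ 2) T ∧ ∀ l, X / W.totient * (1 / 2 *
      (∑ t, g t * (setNorm (fun j ↦ (pr j : ℝ)) t)⁻¹) ^ 2 *
      (∑ t, g t ^ 2 * (setNorm (fun j ↦ (pr j : ℝ)) t)⁻¹) ^ (k - 1)) ≤
      ∑ p ∈ windowPrimes κ X, (if p ≡ b + h l [MOD W] then primeWeight ψ X p else 0) *
        sieveSum (fun j ↦ (pr j : ℝ)) (sieveParam (fun j ↦ (pr j : ℝ)) g R)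
          (divState pr h (p - h l)) ^ 2 +
      4 ^ k * (∏ j, (1 + 8 * k * (pr j : ℝ)⁻¹)) ^ 3 * (√W / W.totient) *
        ∑ x ∈ T, ‖primeSum (fun u ↦ (ψ u : ℂ)) κ X x.ev‖ * (√x.1)⁻¹ := by
  have hp1 : ∀ j, (1 : ℝ) ≤ pr j := fun j ↦ by exact_mod_cast (hpr.prime j).one_le
  have hp : ∀ j, (0 : ℝ) < pr j := fun j ↦ zero_lt_one.trans_le (hp1 j)
  have hkp : ∀ j, k ≤ pr j := fun j ↦ by nlinarith [hD j]
  have hk1 : (1 : ℝ) ≤ k := by exact_mod_cast hk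
  have hR1 : (1 : ℝ) < R := by exact_mod_cast hR
  have hX0 : 0 < X := by linarith
  have hPsq : (2 * (k : ℝ) ^ 2 + 2 * k) * ∑ j, (pr j : ℝ)⁻¹ ^ 2 ≤ 1 / 4 := by
    have h1 := hpr.sum_inv_sq_le hD
    push_cast at h1
    refine (mul_le_mul_of_nonneg_left h1 (by positivity)).trans ?_
    rw [mul_div_assoc', div_le_iff₀ (by positivity)]
    nlinarith
  obtain ⟨T, hT, hTF⟩ := hpr.exists_family hW (fun j ↦ (hD j).le) (Q := W * R ^ 2)
    (univ.filter fun u : Config n k ↦ configNorm (fun j ↦ (pr j : ℝ)) u ≤ (R : ℝ) * R) fun u hu ↦ by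
      have h1 := (mem_filter.mp hu).2
      rw [← configNat_cast] at h1
      rw [pow_two]
      exact Nat.mul_le_mul_left _ (by exact_mod_cast h1)
  refine ⟨T, hT, fun l ↦ ?_⟩
  have h1 := le_sum_primeTerm hp1 (fun j ↦ by exact_mod_cast hkp j) hg hg' hgS
    ((Real.lt_sqrt zero_le_one).mpr (by simpa using hR1)) (R := R) (Real.mul_self_sqrt (Nat.cast_nonneg R)).le hμ hμS hgμ
    hPsq l
  have h2 := hpr.le_sum_primeWeight_mul_sieveSum_sq hW hs hkp hψ hψ0 l (κ := κ) (hb l) hRX (hhX l)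
    (S := R) (Nat.cast_nonneg R) (by rwa [← pow_two]) (show (0 : ℝ) ≤ 2 ^ k by positivity)
    (abs_sieveParam_le hp hg hg2 R) (fun r hr ↦ if_neg (not_le.mpr hr))
  have h3 := hTF (fun x ↦ ‖primeSum (fun u ↦ (ψ u : ℂ)) κ X x.ev‖) fun x ↦ norm_nonneg _
  have hB : 0 ≤ ∑ x ∈ T, ‖primeSum (fun u ↦ (ψ u : ℂ)) κ X x.ev‖ * (√x.1)⁻¹ :=
    sum_nonneg fun x _ ↦ by positivity
  refine (mul_le_mul (div_le_div_of_nonneg_right hX (Nat.cast_nonneg _)) h1 ?_ ?_).trans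
    (h2.trans (add_le_add le_rfl ((mul_le_mul_of_nonneg_left h3 (sq_nonneg _)).trans ?_)))
  · have := fun t ↦ setNorm_pos hp t
    have h4 : 0 ≤ ∑ t, g t ^ 2 * (setNorm (fun j ↦ (pr j : ℝ)) t)⁻¹ :=
      sum_nonneg fun t _ ↦ mul_nonneg (sq_nonneg _) (inv_nonneg.mpr (this t).le)
    positivity
  · exact div_nonneg (hX0.le.trans hX) (Nat.cast_nonneg _)
  · have h2 : ∏ j, (1 + k / (pr j : ℝ)) ≤ ∏ j, (1 + 8 * k * (pr j : ℝ)⁻¹) :=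
      prod_le_prod (fun j _ ↦ by positivity) fun j _ ↦ by
        rw [div_eq_mul_inv]; gcongr; linarith
    have h4 : (4 : ℝ) ^ k = (2 ^ k) ^ 2 := by rw [← pow_mul, mul_comm, pow_mul]; norm_num
    calc _ ≤ (2 ^ k * ∏ j, (1 + 8 * k * (pr j : ℝ)⁻¹)) ^ 2 *
          (√W / W.totient * (∏ j, (1 + 8 * k * (pr j : ℝ)⁻¹)) *
          ∑ x ∈ T, ‖primeSum (fun u ↦ (ψ u : ℂ)) κ X x.ev‖ * (√x.1)⁻¹) := by gcongr
      _ = _ := by rw [h4]; ring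

theorem sum_primeWeight_shift_le {ψ : ℝ → ℝ} {κ X : ℝ} (hψ : ∀ u ≤ 0, ψ u = 0)
    (hψ1 : ∀ u, ψ u ≤ 1) {m b Y : ℕ}
    (hm : ∀ n ≥ Y, n ≡ b [MOD W] → #{i | (n + h i).Prime} ≤ m)
    (hX : ∀ l, (h l + Y : ℝ) ≤ X) {v : ℕ → ℝ} (hv : ∀ n, 0 ≤ v n) :
    ∑ l, ∑ p ∈ windowPrimes κ X, (if p ≡ b + h l [MOD W] then primeWeight ψ X p else 0) *
      v (p - h l) ≤
    m * Real.log (windowEnd κ X) *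
      ∑ n ∈ range (windowEnd κ X), (if n ≡ b [MOD W] then 1 else 0) * v n := by
  classical
  obtain ⟨L, hL⟩ : ∃ L, L = Real.log (windowEnd κ X) := ⟨_, rfl⟩
  have hL0 : 0 ≤ L := hL ▸ Real.log_natCast_nonneg _
  obtain ⟨φ, hφ⟩ : ∃ φ : Fin k → ℕ → ℝ, ∀ l n, φ l n =
    if Y ≤ n ∧ n ≡ b [MOD W] ∧ (n + h l).Prime then L * v n else 0 := ⟨_, fun _ _ ↦ rfl⟩
  have hφ0 : ∀ l n, 0 ≤ φ l n := fun l n ↦ by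
    rw [hφ]
    split_ifs
    exacts [mul_nonneg hL0 (hv n), le_rfl]
  have key : ∀ l, ∑ p ∈ windowPrimes κ X,
      (if p ≡ b + h l [MOD W] then primeWeight ψ X p else 0) * v (p - h l) ≤
      ∑ n ∈ range (windowEnd κ X), φ l n := fun l ↦ by
    calc _ ≤ ∑ p ∈ windowPrimes κ X with h l + Y ≤ p, φ l (p - h l) := by
          rw [sum_filter]
          refine sum_le_sum fun p hp ↦ ?_
          simp only [windowPrimes, mem_filter, mem_Ico] at hp
          split_ifs with h1 h2 h2
          · obtain ⟨q, rfl⟩ := Nat.exists_eq_add_of_le h2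
            have h3 : h l + Y + q - h l = Y + q := by omega
            have h4 : Y + q + h l = h l + Y + q := by omega
            have h6 : Y + q ≡ b [MOD W] := by
              rw [← h4] at h1
              exact Nat.ModEq.add_right_cancel' _ h1
            rw [h3, hφ, if_pos ⟨by omega, h6, by rw [h4]; exact hp.2⟩]
            · refine mul_le_mul_of_nonneg_right ?_ (hv _)
              have h5 : Real.log (h l + Y + q : ℕ) ≤ L := hL ▸ Real.log_le_log
                (by exact_mod_cast hp.2.pos) (by exact_mod_cast hp.1.2.le)
              calc _ ≤ Real.log (h l + Y + q : ℕ) * 1 :=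
                    mul_le_mul_of_nonneg_left (hψ1 _) (Real.log_natCast_nonneg _)
                _ ≤ L := by rwa [mul_one]
          · rw [primeWeight_eq_zero hψ hp.2.pos, zero_mul]
            refine le_trans ?_ (hX l)
            exact_mod_cast (not_le.mp h2).le
          · rw [zero_mul]; exact hφ0 _ _
          · rw [zero_mul]
      _ = ∑ n ∈
            ((windowPrimes κ X).filter fun p ↦ h l + Y ≤ p).image (· - h l), φ l n := by
          rw [sum_image]
          · intro p hp q hq hpq
            simp only [coe_filter, Set.mem_ofPred_eq] at hp hq hpq
            omega
      _ ≤ _ := by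
          refine sum_le_sum_of_subset_of_nonneg (fun n hn ↦ ?_) fun _ _ _ ↦ hφ0 _ _
          simp only [mem_image, mem_filter,
            windowPrimes, mem_Ico] at hn
          obtain ⟨p, hp, rfl⟩ := hn
          rw [mem_range]
          omega
  refine (sum_le_sum fun l _ ↦ key l).trans ?_
  rw [sum_comm, mul_sum, ← hL]
  refine sum_le_sum fun n _ ↦ ?_
  simp_rw [hφ]
  split_ifs with h1
  · by_cases h2 : Y ≤ n
    · simp only [h1, h2, true_and]
      rw [← sum_filter, sum_const, nsmul_eq_mul, one_mul, ← mul_assoc]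
      have : (#{i | (n + h i).Prime} : ℝ) ≤ m := by exact_mod_cast hm n h2 h1
      have h3 := hv n
      gcongr
    · simp only [h2, false_and, if_false, sum_const_zero]
      have h3 := hv n
      positivity
  · simp [h1]

end Assembly

end

section

open Finset

open scoped ContDiff

section ManyPrimes

open Filter in
theorem eventually_log_pow_le (D : ℕ) (a : ℝ) :
    ∀ᶠ R : ℕ in atTop, a < Real.log R ∧ a * Real.log R ^ D ≤ R := by
  have h1 : ∀ᶠ x : ℝ in atTop, a < Real.log x := Real.tendsto_log_atTop.eventually_gt_atTop a
  have h2 := (Real.isLittleO_pow_log_id_atTop (n := D)).bound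
    (show (0 : ℝ) < (|a| + 1)⁻¹ by positivity)
  filter_upwards [tendsto_natCast_atTop_atTop.eventually h1,
    tendsto_natCast_atTop_atTop.eventually h2] with R h1 h2
  refine ⟨h1, ?_⟩
  rw [id, Real.norm_natCast, Real.norm_eq_abs, inv_mul_eq_div, le_div_iff₀ (by positivity)] at h2
  have h3 : a * Real.log R ^ D ≤ |a| * |Real.log R ^ D| := by
    rw [← abs_mul]; exact le_abs_self _
  nlinarith [abs_nonneg (Real.log R ^ D)]

theorem main_comparison {m k J D : ℕ} (hk : 0 < k) (hJ : 10 ^ 10 * (m + 1) ≤ J)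
    {W φ X R ℓ Z G M C C₁ N L B S₁ : ℝ} {S : Fin k → ℝ} (hW : 0 < W) (hφ : 0 < φ) (hX : 0 < X)
    (hℓ : 1 ≤ ℓ) (hZ : 1 ≤ Z) (hM : 0 ≤ M) (hC₁ : 0 ≤ C₁) (hB : 0 ≤ B)
    (hMC : M ≤ C₁ * ℓ ^ D) (hN : N ≤ 56 * X) (hL0 : 0 ≤ L) (hL : L ≤ 501 * ℓ)
    (h₁ : ∑ l, S l ≤ m * L * S₁)
    (h₂ : S₁ ≤ N / W * (3 * Z ^ k) + 4 ^ k * M ^ 3 * R ^ 2)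
    (h₃ : ∀ l, X / φ * (1 / 2 * G ^ 2 * Z ^ (k - 1)) ≤ S l + 4 ^ k * M ^ 3 * (√W / φ) * B)
    (h₄ : ℓ ^ (3 * D) * B ≤ C * X) (h₅ : φ / W * ℓ * (J + 1) * Z ≤ 50000 * k * G ^ 2)
    (h₆ : 4 ^ k * C₁ ^ 3 * W * ℓ ^ (3 * D) * R ^ 2 ≤ X)
    (h₇ : k * (4 ^ k * C₁ ^ 3 * (√W / φ) * C) * W < ℓ) : False := by
  obtain ⟨V, hV⟩ : ∃ V, V = X / W * ℓ * Z ^ k := ⟨_, rfl⟩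
  have hZk : 1 ≤ Z ^ k := one_le_pow₀ hZ
  have hXW : 0 < X / W := div_pos hX hW
  have hV0 : 0 < V := by rw [hV]; positivity
  have hM3 : M ^ 3 ≤ C₁ ^ 3 * ℓ ^ (3 * D) := by
    rw [mul_comm 3 D, pow_mul, ← mul_pow]; exact pow_le_pow_left₀ hM hMC 3
  have a1 : 4 ^ k * M ^ 3 * R ^ 2 ≤ X / W * Z ^ k := by
    calc _ ≤ 4 ^ k * (C₁ ^ 3 * ℓ ^ (3 * D)) * R ^ 2 := by gcongr
      _ ≤ X / W * 1 := by rw [mul_one, le_div_iff₀ hW]; linarith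
      _ ≤ _ := by gcongr
  have a2 : m * L * S₁ ≤ 84669 * m * V := by
    calc m * L * S₁ ≤ m * L * (169 * (X / W * Z ^ k)) := by
          refine mul_le_mul_of_nonneg_left (h₂.trans ?_) (by positivity)
          have : N / W * (3 * Z ^ k) ≤ 56 * X / W * (3 * Z ^ k) := by gcongr
          have h : 56 * X / W * (3 * Z ^ k) = 168 * (X / W * Z ^ k) := by ring
          linarith
      _ ≤ m * (501 * ℓ) * (169 * (X / W * Z ^ k)) := by gcongr
      _ = _ := by rw [hV]; ring
  have a3 : k * (4 ^ k * M ^ 3 * (√W / φ) * B) ≤ V := by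
    calc _ ≤ k * (4 ^ k * (C₁ ^ 3 * ℓ ^ (3 * D)) * (√W / φ) * B) := by gcongr
      _ = k * (4 ^ k * C₁ ^ 3 * (√W / φ)) * (ℓ ^ (3 * D) * B) := by ring
      _ ≤ k * (4 ^ k * C₁ ^ 3 * (√W / φ)) * (C * X) := by gcongr
      _ = (k * (4 ^ k * C₁ ^ 3 * (√W / φ) * C) * W) * (X / W) * 1 := by field_simp
      _ ≤ ℓ * (X / W) * Z ^ k := by gcongr
      _ = V := by rw [hV]; ring
  have a4 : k * (X / φ * (1 / 2 * G ^ 2 * Z ^ (k - 1))) ≤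
      ∑ l, S l + k * (4 ^ k * M ^ 3 * (√W / φ) * B) := by
    have := sum_le_sum fun l (_ : l ∈ univ) ↦ h₃ l
    rwa [sum_add_distrib, sum_const, sum_const, card_univ, Fintype.card_fin, nsmul_eq_mul,
      nsmul_eq_mul] at this
  have a5 : V * (J + 1) / 100000 ≤ k * (X / φ * (1 / 2 * G ^ 2 * Z ^ (k - 1))) := by
    calc V * (J + 1) / 100000 = X / φ * Z ^ (k - 1) / 100000 * (φ / W * ℓ * (J + 1) * Z) := by
          rw [hV, ← Nat.succ_pred_eq_of_pos hk]
          simp only [Nat.pred_eq_sub_one, Nat.succ_eq_add_one, Nat.add_sub_cancel]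
          rw [pow_succ]
          field_simp
      _ ≤ X / φ * Z ^ (k - 1) / 100000 * (50000 * k * G ^ 2) := by gcongr
      _ = _ := by ring
  have hJ' : (10 : ℝ) ^ 10 * (m + 1) ≤ J := by exact_mod_cast hJ
  have a6 : V * (10 ^ 10 * (m + 1) + 1) / 100000 ≤ V * (J + 1) / 100000 := by gcongr
  have a7 : 0 ≤ V * m := by positivity
  linarith

theorem exists_many_primes (m : ℕ) : ∃ k, 0 < k ∧ ∀ (W b : ℕ) (h : Fin k → ℕ), 0 < W →
    (∀ p, p.Prime → p ≤ 64 * k ^ 2 → p ∣ W) →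
    (∀ p, p.Prime → ¬ p ∣ W → ∀ i i', h i ≡ h i' [MOD p] → i = i') →
    (∀ l, (b + h l).Coprime W) →
    ∀ Y, ∃ n ≥ Y, n ≡ b [MOD W] ∧ m < #{i | (n + h i).Prime} := by
  obtain ⟨J, hJ⟩ : ∃ J, J = 10 ^ 10 * (m + 1) := ⟨_, rfl⟩
  obtain ⟨k, hkJ⟩ : ∃ k, k = 2 ^ J := ⟨_, rfl⟩
  have hk : 0 < k := hkJ ▸ Nat.two_pow_pos J
  refine ⟨k, hk, fun W b h hW hpW hsep hb Y ↦ ?_⟩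
  by_contra! hm
  obtain ⟨ψ, hψs, hψc, ⟨P, hw⟩, hψ, hψ0, hψ1, X₀, hX₀⟩ := exists_weight
  obtain ⟨C₁, hC₁, D, hprod⟩ := PrimeEnum.exists_prod_le (8 * k)
  obtain ⟨C, hC, hBV⟩ := hw.sum_primeSum_le hψs hψc (3 * D)
  obtain ⟨R₀, hR₀⟩ := PrimeEnum.exists_sieveFun hW hkJ.ge
  obtain ⟨R, ⟨⟨he1, -⟩, ⟨he2, -⟩, -, he3⟩, hRR⟩ :=
    (((eventually_log_pow_le 0 1).and ((eventually_log_pow_le 0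
      (k * (4 ^ k * C₁ ^ 3 * (√W / W.totient) * C) * W)).and
      (eventually_log_pow_le (3 * D) (4 ^ k * C₁ ^ 3 * W)))).and
      (Filter.eventually_ge_atTop (R₀ + W + 3 + Y + ∑ l, h l + ⌈X₀⌉₊))).exists
  obtain ⟨n, pr, hpr⟩ := PrimeEnum.exists W R
  obtain ⟨g, hg, hg2, hg', hgS, ⟨μ, hμ, hμS, hgμ⟩, hZ, hGZ⟩ := hR₀ R (by omega) n pr hpr
  have hR3 : (3 : ℝ) ≤ R := by exact_mod_cast (show 3 ≤ R by omega)
  have hWR : (W : ℝ) ≤ R := by exact_mod_cast (show W ≤ R by omega)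
  have hD : ∀ j, 64 * k ^ 2 < pr j := fun j ↦ by
    by_contra! h1
    exact hpr.not_dvd j (hpW _ (hpr.prime j) h1)
  have hs : Separated pr h := fun j ↦ hsep _ (hpr.prime j) (hpr.not_dvd j)
  obtain ⟨X, hX⟩ : ∃ X : ℝ, X = R ^ 100 := ⟨_, rfl⟩
  have hR1 : (1 : ℝ) ≤ R := by linarith
  have hRX : (R : ℝ) ≤ X := hX ▸ le_self_pow₀ hR1 (by norm_num)
  have hRX' : ∀ a ≤ 100, (R : ℝ) ^ a ≤ X := fun a ha ↦ hX ▸ pow_le_pow_right₀ hR1 ha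
  have hlX : Real.log X = 100 * Real.log R := by rw [hX, Real.log_pow]; norm_num
  have hhX : ∀ l, (h l + Y : ℝ) ≤ X := fun l ↦ by
    have h1 := single_le_sum (f := h) (fun _ _ ↦ Nat.zero_le _) (mem_univ l)
    exact le_trans (by exact_mod_cast (show h l + Y ≤ R by omega)) hRX
  have hWX : (W * R ^ 2 : ℝ) ≤ X := by
    calc (W * R ^ 2 : ℝ) ≤ R * R ^ 2 := by gcongr
      _ = R ^ 3 := by ring
      _ ≤ X := hRX' _ (by norm_num)
  have hX₀X : X₀ ≤ X := (Nat.le_ceil X₀).trans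
    (le_trans (by exact_mod_cast (show ⌈X₀⌉₊ ≤ R by omega)) hRX)
  obtain ⟨T, hT, hST⟩ := hpr.exists_family_le_sum_primeWeight hW hs hk hD hg hg2 hg' hgS (by omega)
    hμ hμS hgμ hψ hψ0 (κ := 4) hb hRX (fun l ↦ by linarith [hhX l, Nat.cast_nonneg (α := ℝ) Y]) hWX
    (hX₀ X hX₀X)
  have hB := hBV X (by linarith) (W * R ^ 2) (Nat.mul_pos hW (pow_pos (by omega) 2)) (by
    push_cast
    calc ((W : ℝ) * R ^ 2) ^ 32 ≤ (R * R ^ 2) ^ 32 := by gcongr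
      _ = (R : ℝ) ^ 96 := by ring
      _ ≤ X := hRX' _ (by norm_num)) T hT
  have hS1 := hpr.sum_modEq_mul_sieveParam_sq_le hW hs hk hD hg hg2 b (windowEnd 4 X)
  have hcount := sum_primeWeight_shift_le (κ := 4) hψ hψ1 hm hhX (v := fun n ↦
    sieveSum (fun j ↦ (pr j : ℝ)) (sieveParam (fun j ↦ (pr j : ℝ)) g R) (divState pr h n) ^ 2)
    fun _ ↦ sq_nonneg _
  have hMC := hprod W R n pr hpr (by omega)
  push_cast at hMC
  have hWlog := hw.log_windowEnd_le (X := X) (by linarith)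
  have hexp : Real.exp 4 ≤ 55 := by
    have h1 : Real.exp 4 = Real.exp 1 ^ 4 := by rw [← Real.exp_nat_mul]; norm_num
    rw [h1]
    refine (pow_le_pow_left₀ (Real.exp_pos _).le Real.exp_one_lt_d9.le 4).trans (by norm_num)
  refine main_comparison hk hJ.ge (Nat.cast_pos.mpr hW) (Nat.cast_pos.mpr (W.totient_pos.mpr hW))
    (by linarith) he1.le hZ
    (prod_nonneg fun j _ ↦ by positivity) (zero_le_one.trans hC₁)
    (sum_nonneg fun x _ ↦ by positivity) hMC ?_ (Real.log_natCast_nonneg (windowEnd 4 X))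
    (by linarith) hcount hS1 hST ?_ hGZ ?_ he2
  · have h1 := Nat.floor_le (show 0 ≤ Real.exp 4 * X by
      exact mul_nonneg (Real.exp_pos 4).le (by linarith))
    have h2 : Real.exp 4 * X ≤ 55 * X := mul_le_mul_of_nonneg_right hexp (by linarith)
    rw [windowEnd]
    push_cast
    linarith
  · refine le_trans (mul_le_mul_of_nonneg_right (pow_le_pow_left₀ (by linarith) ?_ _)
      (sum_nonneg fun x _ ↦ by positivity)) hB
    linarith
  · calc _ ≤ (R : ℝ) * R ^ 2 := by gcongr
      _ = R ^ 3 := by ring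
      _ ≤ X := hRX' _ (by norm_num)

end ManyPrimes

end

section

open Finset

section Gaps

theorem exists_concave_shifts (k : ℕ) : ∃ (h : Fin k → ℕ) (H : ℕ), StrictMono h ∧
    (∀ l, h l < H) ∧ (∀ i j l, i < j → j < l → h i + h l < 2 * h j) ∧
    ∀ p, p.Prime → p ≤ k → ∀ l, p ∣ h l := by
  have hM : 0 < k.factorial := k.factorial_pos
  have ha : ∀ i : Fin k, (2 ^ k - 2 ^ (k - 1 - i)) * k.factorial + 2 ^ (k - 1 - i) * k.factorial =
      2 ^ k * k.factorial := fun i ↦ by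
    rw [← add_mul, Nat.sub_add_cancel (Nat.pow_le_pow_right two_pos (by omega))]
  have hlt : ∀ i j : Fin k, i < j →
      2 * (2 ^ (k - 1 - j) * k.factorial) ≤ 2 ^ (k - 1 - i) * k.factorial := fun i j hij ↦ by
    rw [← mul_assoc, ← pow_succ']
    exact Nat.mul_le_mul_right _ (Nat.pow_le_pow_right two_pos (by omega))
  have hpos : ∀ i : Fin k, 0 < 2 ^ (k - 1 - i) * k.factorial := fun i ↦ by positivity
  refine ⟨fun i ↦ (2 ^ k - 2 ^ (k - 1 - i)) * k.factorial, 2 ^ k * k.factorial, fun i j hij ↦ ?_,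
    fun l ↦ ?_, fun i j l hij hjl ↦ ?_, fun p hp hpk l ↦ ?_⟩
  · have h1 := hlt i j hij
    have h2 := hpos j
    have h3 := ha i
    have h4 := ha j
    dsimp only
    omega
  · have h2 := hpos l
    have h3 := ha l
    dsimp only
    omega
  · have h1 := hlt i j hij
    have h2 := hpos l
    have h3 := ha i
    have h4 := ha j
    have h5 := ha l
    dsimp only
    omega
  · exact Dvd.dvd.mul_left ((hp.dvd_factorial).mpr hpk) _

theorem exists_residue {k : ℕ} {h : Fin k → ℕ} {H : ℕ} (hH : ∀ l, h l < H)
    (hk : ∀ p, p.Prime → p ≤ k → ∀ l, p ∣ h l) {q : ℕ → ℕ} (hq : ∀ u, H ≤ q u)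
    (hqi : Function.Injective q) {p : ℕ} (hp : p.Prime) :
    ∃ a, (∀ l, ¬ p ∣ a + h l) ∧ ∀ u < H, p = q u → (∀ l, h l ≠ u) → p ∣ a + u := by
  by_cases h1 : ∃ u < H, p = q u ∧ ∀ l, h l ≠ u
  · obtain ⟨u, hu, rfl, hlu⟩ := h1
    have h2 := hq u
    refine ⟨q u - u, fun l hl ↦ hlu l ?_, fun v _ hv _ ↦ ?_⟩
    · have h3 : q u ∣ q u - u + u := by rw [Nat.sub_add_cancel (by omega)]
      have h4 := Nat.ModEq.add_left_cancel' _ ((Nat.modEq_zero_iff_dvd.mpr hl).trans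
        (Nat.modEq_zero_iff_dvd.mpr h3).symm)
      exact h4.eq_of_lt_of_lt ((hH l).trans_le h2) (hu.trans_le h2)
    · rw [← hqi hv, Nat.sub_add_cancel (by omega)]
  · have h2 : ∀ u < H, p = q u → (∀ l, h l ≠ u) → False := fun u hu hpu hlu ↦ h1 ⟨u, hu, hpu, hlu⟩
    suffices ∃ a, ∀ l, ¬ p ∣ a + h l from this.imp fun a ha ↦
      ⟨ha, fun u hu hpu hlu ↦ (h2 u hu hpu hlu).elim⟩
    rcases le_or_gt p k with hpk | hpk
    · exact ⟨1, fun l hl ↦ hp.one_lt.ne' (Nat.dvd_one.mp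
        ((Nat.dvd_add_left (hk p hp hpk l)).mp hl))⟩
    · have : Fact p.Prime := ⟨hp⟩
      have h3 : #(univ.image fun l ↦ -(h l : ZMod p)) < #(univ : Finset (ZMod p)) := by
        rw [card_univ, ZMod.card]
        exact card_image_le.trans_lt (by simpa using hpk)
      obtain ⟨x, -, hx⟩ := exists_mem_notMem_of_card_lt_card h3
      refine ⟨x.val, fun l hl ↦ hx (mem_image.mpr ⟨l, mem_univ _, ?_⟩)⟩
      rw [← ZMod.natCast_eq_zero_iff, Nat.cast_add, ZMod.natCast_zmod_val] at hl
      exact (eq_neg_of_add_eq_zero_left hl).symm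

theorem exists_modulus {k : ℕ} {h : Fin k → ℕ} {H : ℕ} (hi : Function.Injective h)
    (hH : ∀ l, h l < H) (hk : ∀ p, p.Prime → p ≤ k → ∀ l, p ∣ h l) (K : ℕ) :
    ∃ W b Y : ℕ, 0 < W ∧ (∀ p, p.Prime → p ≤ K → p ∣ W) ∧
    (∀ p, p.Prime → ¬ p ∣ W → ∀ i i', h i ≡ h i' [MOD p] → i = i') ∧
    (∀ l, (b + h l).Coprime W) ∧
    ∀ n ≥ Y, n ≡ b [MOD W] → ∀ u < H, (n + u).Prime → ∃ l, h l = u := by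
  obtain ⟨q, hq⟩ : ∃ q : ℕ → ℕ, ∀ u, q u = Nat.nth Nat.Prime (H + u) := ⟨_, fun _ ↦ rfl⟩
  have hqH : ∀ u, H ≤ q u := fun u ↦ by
    have := Nat.add_two_le_nth_prime (H + u)
    rw [hq]
    omega
  have hqi : Function.Injective q := fun u v huv ↦ by
    rw [hq, hq] at huv
    have := Nat.nth_injective Nat.infinite_setOfPred_prime huv
    omega
  have hqp : ∀ u, (q u).Prime := fun u ↦ hq u ▸ Nat.prime_nth_prime _
  obtain ⟨D, hD⟩ : ∃ D, D = K + H + q H := ⟨_, rfl⟩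
  have hqD : ∀ u < H, q u ≤ D := fun u hu ↦ by
    have : q u ≤ q H := by
      rw [hq, hq]
      exact Nat.nth_monotone Nat.infinite_setOfPred_prime (by omega)
    omega
  choose a ha using fun p : ℕ ↦ fun hp : p.Prime ↦ exists_residue hH hk hqH hqi hp
  obtain ⟨b, hb⟩ := Nat.chineseRemainderOfFinset
    (fun p ↦ if hp : p.Prime then a p hp else 0) id ((range (D + 1)).filter Nat.Prime)
    (fun p hp ↦ (mem_filter.mp hp).2.ne_zero) fun p hp p' hp' hne ↦
      (Nat.coprime_primes (mem_filter.mp hp).2 (mem_filter.mp hp').2).mpr hne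
  have hb' : ∀ p (hp : p.Prime), p ≤ D → b ≡ a p hp [MOD p] := fun p hp hpD ↦ by
    have := hb p (mem_filter.mpr ⟨mem_range.mpr (by omega), hp⟩)
    simpa [hp] using this
  refine ⟨primorial D, b, D + 1, primorial_pos D,
    fun p hp hpK ↦ hp.dvd_primorial_iff.mpr (by omega), fun p hp hpW i i' hii ↦ hi ?_,
    fun l ↦ Nat.coprime_of_dvd fun p hp h1 h2 ↦ ?_, fun n hn hnb u hu hp ↦ ?_⟩
  · rw [hp.dvd_primorial_iff] at hpW
    have h1 := hH i
    have h2 := hH i'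
    exact hii.eq_of_lt_of_lt (by omega) (by omega)
  · refine (ha p hp).1 l ((Nat.ModEq.dvd_iff ?_ dvd_rfl).mp h1)
    exact (hb' p hp (hp.dvd_primorial_iff.mp h2)).add_right _
  · by_contra! hl
    have h1 := (ha _ (hqp u)).2 u hu rfl hl
    have h2 := hnb.of_dvd ((hqp u).dvd_primorial_iff.mpr (hqD u hu))
    have h3 := (h2.trans (hb' _ (hqp u) (hqD u hu))).add_right u
    have h4 := (Nat.prime_dvd_prime_iff_eq (hqp u) hp).mp ((h3.dvd_iff dvd_rfl).mpr h1)
    have h5 := hqD u hu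
    omega

theorem exists_decreasing_run (m r₀ : ℕ) :
    ∃ r, (∀ j : ℕ, 1 ≤ j → j < m → primeGap r j > primeGap r (j + 1)) ∧ r₀ < r := by
  obtain ⟨k, hk, hmany⟩ := exists_many_primes m
  obtain ⟨h, H, hmono, hH, hconc, hdvd⟩ := exists_concave_shifts k
  obtain ⟨W, b, Y, hW, hpW, hsep, hb, hY⟩ := exists_modulus hmono.injective hH hdvd (64 * k ^ 2)
  obtain ⟨n, hn, hnb, hcard⟩ := hmany W b h hW hpW hsep hb (Y + Nat.nth Nat.Prime (r₀ + 1))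
  obtain ⟨c, hc⟩ : ∃ c, c = Nat.count Nat.Prime n := ⟨_, rfl⟩
  have hcount : c + m + 1 ≤ Nat.count Nat.Prime (n + H) := by
    rw [Nat.count_add, ← hc, add_assoc, Nat.count_eq_card_filter_range]
    refine Nat.add_le_add_left (Nat.succ_le_of_lt (hcard.trans_le ?_)) _
    rw [← card_image_of_injective _ hmono.injective]
    refine card_le_card fun u hu ↦ ?_
    obtain ⟨l, hl, rfl⟩ := mem_image.mp hu
    exact mem_filter.mpr ⟨mem_range.mpr (hH l), (mem_filter.mp hl).2⟩
  have key : ∀ t ≤ m, ∃ l, Nat.nth Nat.Prime (c + t) = n + h l := fun t ht ↦ by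
    have h1 : n ≤ Nat.nth Nat.Prime (c + t) :=
      (Nat.count_le_iff_le_nth Nat.infinite_setOfPred_prime).mp (hc ▸ Nat.le_add_right c t)
    have h2 : Nat.nth Nat.Prime (c + t) < n + H := Nat.nth_lt_of_lt_count (by omega)
    obtain ⟨u, hu⟩ := Nat.exists_eq_add_of_le h1
    obtain ⟨l, rfl⟩ := hY n (by omega) hnb u (by omega) (hu ▸ Nat.prime_nth_prime _)
    exact ⟨l, hu⟩
  refine ⟨c, fun j hj hjm ↦ ?_, ?_⟩
  · obtain ⟨t, rfl⟩ := Nat.exists_eq_add_of_le' hj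
    obtain ⟨i₀, h₀⟩ := key t (by omega)
    obtain ⟨i₁, h₁⟩ := key (t + 1) (by omega)
    obtain ⟨i₂, h₂⟩ := key (t + 2) (by omega)
    have hlt : ∀ t, Nat.nth Nat.Prime (c + t) < Nat.nth Nat.Prime (c + (t + 1)) := fun t ↦
      Nat.nth_strictMono Nat.infinite_setOfPred_prime (by omega)
    have h3 := hlt t
    have h4 : Nat.nth Nat.Prime (c + (t + 1)) < Nat.nth Nat.Prime (c + (t + 2)) := hlt (t + 1)
    have h5 := hconc i₀ i₁ i₂ (hmono.lt_iff_lt.mp (by omega)) (hmono.lt_iff_lt.mp (by omega))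
    simp only [primeGap, nthPrime]
    rw [show c + (t + 1) + 1 - 1 = c + (t + 1) by omega, show c + (t + 1) - 1 = c + t by omega,
      show c + (t + 1 + 1) + 1 - 1 = c + (t + 2) by omega,
      show c + (t + 1 + 1) - 1 = c + (t + 1) by omega, h₀, h₁, h₂]
    omega
  · have h1 := Nat.count_monotone Nat.Prime (show Nat.nth Nat.Prime (r₀ + 1) ≤ n by omega)
    rw [Nat.count_nth_of_infinite Nat.infinite_setOfPred_prime] at h1
    omega

end Gaps

end

/-- For every `m ≥ 2` there are infinitely many `r` such that the run of
consecutive prime gaps `δ j = primeGap r j` for `1 ≤ j ≤ m` is strictly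
decreasing: `δ 1 > δ 2 > ⋯ > δ m`. -/
theorem decreasing_prime_gap_runs (m : ℕ) (hm : 2 ≤ m) :
    {r : ℕ | ∀ j : ℕ, 1 ≤ j → j < m → primeGap r j > primeGap r (j + 1)}.Infinite := by
  exact Set.infinite_of_forall_exists_gt (exists_decreasing_run m)
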